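/- There exists a universal constant C'' > 0 such that for every dimension n ≥ 1, every isotropic log-concave random vector X in ℝⁿ, every ε > 0, and every y ∈ ℝⁿ, one has ℙ(‖X − y‖₂² ≤ ε²·n) ≤ (C''·ε)ⁿ. -/

import Mathlib

open MeasureTheory ProbabilityTheory

noncomputable section

/-- A nonnegative function is log-concave if it satisfies
`f(t x + (1-t) y) ≥ f(x)^t f(y)^(1-t)`; this is equivalent to `f = e^{-V}`
for some convex function `V : ℝⁿ → ℝ ∪ {+∞}`. -/
def IsLogConcaveFun {E : Type*} [AddCommGroup E] [Module ℝ E] (f : E → ℝ) : Prop :=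
  (∀ x, 0 ≤ f x) ∧
  ∀ x y : E, ∀ t : ℝ, 0 ≤ t → t ≤ 1 →
    f x ^ t * f y ^ (1 - t) ≤ f (t • x + (1 - t) • y)

/-- A measure on `ℝⁿ` is log-concave (with density) if it has a log-concave
density with respect to the Lebesgue measure. -/
def IsLogConcaveMeasure {n : ℕ} (μ : Measure (EuclideanSpace ℝ (Fin n))) : Prop :=
  ∃ f : EuclideanSpace ℝ (Fin n) → ℝ, IsLogConcaveFun f ∧
    μ = volume.withDensity fun x => ENNReal.ofReal (f x)

/-- A measure on `ℝⁿ` is isotropic if it has mean `0` and covariance matrix `Iₙ`. -/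
def IsIsotropicMeasure {n : ℕ} (μ : Measure (EuclideanSpace ℝ (Fin n))) : Prop :=
  (∀ i, ∫ x, x i ∂μ = 0) ∧
  (∀ i j, ∫ x, x i * x j ∂μ = if i = j then 1 else 0)

namespace SmallBall

open scoped ENNReal NNReal Topology

/-- Log-concavity of an extended nonnegative function on a real vector space. -/
def LC {V : Type*} [AddCommGroup V] [Module ℝ V] (F : V → ℝ≥0∞) : Prop :=
  ∀ x y : V, ∀ a b : ℝ, 0 < a → 0 < b → a + b = 1 → F x ^ a * F y ^ b ≤ F (a • x + b • y)

/-- Quasi-concavity on the real line. -/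
def QC (F : ℝ → ℝ≥0∞) : Prop := ∀ c, Set.OrdConnected {x | c < F x}

theorem QC.measurable {F : ℝ → ℝ≥0∞} (h : QC F) : Measurable F :=
  measurable_of_Ioi fun c => (h c).measurableSet

theorem brunn_minkowski_line {A B C : Set ℝ} (hA : A.Nonempty) (hB : B.Nonempty)
    (hAo : A.OrdConnected) (hBo : B.OrdConnected) {a b : ℝ} (ha : 0 < a) (hb : 0 < b)
    (h : ∀ x ∈ A, ∀ y ∈ B, a * x + b * y ∈ C) :
    ENNReal.ofReal a * volume A + ENNReal.ofReal b * volume B ≤ volume C := by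
  have key : ∀ x₁ ∈ A, ∀ x₂ ∈ A, ∀ y₁ ∈ B, ∀ y₂ ∈ B, x₁ ≤ x₂ → y₁ ≤ y₂ →
      ENNReal.ofReal a * ENNReal.ofReal (x₂ - x₁) + ENNReal.ofReal b * ENNReal.ofReal (y₂ - y₁)
        ≤ volume C := by
    intro x₁ hx₁ x₂ hx₂ y₁ hy₁ y₂ hy₂ hx hy
    have hsub : Set.Icc (a * x₁ + b * y₁) (a * x₂ + b * y₂) ⊆ C := by
      intro z hz
      by_cases hd : a * x₂ + b * y₂ ≤ a * x₁ + b * y₁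
      · have : z = a * x₁ + b * y₁ := le_antisymm (hz.2.trans hd) hz.1
        rw [this]; exact h _ hx₁ _ hy₁
      · push Not at hd
        set s := (z - (a * x₁ + b * y₁)) / (a * x₂ + b * y₂ - (a * x₁ + b * y₁)) with hs
        have hs0 : 0 ≤ s := div_nonneg (by linarith [hz.1]) (by linarith)
        have hs1 : s ≤ 1 := (div_le_one (by linarith)).2 (by linarith [hz.2])
        have hse : s * (a * x₂ + b * y₂ - (a * x₁ + b * y₁)) = z - (a * x₁ + b * y₁) :=
          div_mul_cancel₀ _ (by linarith)
        have hz' : z = a * (x₁ + s * (x₂ - x₁)) + b * (y₁ + s * (y₂ - y₁)) := by linarith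
        rw [hz']
        refine h _ (hAo.out hx₁ hx₂ ⟨?_, ?_⟩) _ (hBo.out hy₁ hy₂ ⟨?_, ?_⟩) <;> nlinarith
    calc _ = ENNReal.ofReal (a * x₂ + b * y₂ - (a * x₁ + b * y₁)) := by
          rw [← ENNReal.ofReal_mul ha.le, ← ENNReal.ofReal_mul hb.le, ← ENNReal.ofReal_add]
          · congr 1; ring
          · exact mul_nonneg ha.le (by linarith)
          · exact mul_nonneg hb.le (by linarith)
      _ = volume (Set.Icc (a * x₁ + b * y₁) (a * x₂ + b * y₂)) := by rw [Real.volume_Icc]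
      _ ≤ _ := measure_mono hsub
  have key2 : ∀ p : A × A, ∀ q : B × B,
      ENNReal.ofReal a * edist p.1 p.2 + ENNReal.ofReal b * edist q.1 q.2 ≤ volume C := by
    rintro ⟨⟨x, hx⟩, ⟨x', hx'⟩⟩ ⟨⟨y, hy⟩, ⟨y', hy'⟩⟩
    simp only [edist_dist]
    change ENNReal.ofReal a * ENNReal.ofReal |x - x'| + ENNReal.ofReal b * ENNReal.ofReal |y - y'| ≤ _
    have e : ∀ u v : ℝ, |u - v| = max u v - min u v := by
      intro u v; rw [max_sub_min_eq_abs]; exact abs_sub_comm _ _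
    rw [e, e]
    refine key _ ?_ _ ?_ _ ?_ _ ?_ (min_le_max) min_le_max
    · rcases min_choice x x' with h | h <;> rw [h] <;> assumption
    · rcases max_choice x x' with h | h <;> rw [h] <;> assumption
    · rcases min_choice y y' with h | h <;> rw [h] <;> assumption
    · rcases max_choice y y' with h | h <;> rw [h] <;> assumption
  have := hA.to_subtype
  have := hB.to_subtype
  have ed : ∀ S : Set ℝ, volume S ≤ ⨆ p : S × S, edist p.1 p.2 := by
    intro S
    refine (Real.volume_le_diam S).trans ?_
    refine Metric.ediam_le fun x hx y hy => ?_
    exact le_iSup (fun p : S × S => edist p.1 p.2) (⟨⟨x, hx⟩, ⟨y, hy⟩⟩ : S × S)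
  calc _ ≤ ENNReal.ofReal a * (⨆ p : A × A, edist p.1 p.2)
        + ENNReal.ofReal b * (⨆ p : B × B, edist p.1 p.2) := by
        gcongr <;> exact ed _
    _ ≤ _ := by
        rw [ENNReal.mul_iSup, ENNReal.mul_iSup, ENNReal.iSup_add]
        refine iSup_le fun p => ?_
        rw [ENNReal.add_iSup]
        exact iSup_le fun q => key2 p q

theorem ennreal_geom_mean_le (u v : ℝ≥0∞) {a b : ℝ} (ha : 0 < a) (hb : 0 < b) (hab : a + b = 1) :
    u ^ a * v ^ b ≤ ENNReal.ofReal a * u + ENNReal.ofReal b * v := by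
  have ha' : ENNReal.ofReal a ≠ 0 := by simpa using ha
  have hb' : ENNReal.ofReal b ≠ 0 := by simpa using hb
  by_cases hu : u = ∞
  · simp [hu, ENNReal.mul_top ha']
  by_cases hv : v = ∞
  · simp [hv, ENNReal.mul_top hb']
  lift u to ℝ≥0 using hu
  lift v to ℝ≥0 using hv
  have := NNReal.geom_mean_le_arith_mean2_weighted ⟨a, ha.le⟩ ⟨b, hb.le⟩ u v
    (NNReal.coe_injective (by push_cast; exact hab))
  have h2 := ENNReal.coe_le_coe.2 this
  rw [ENNReal.ofReal_eq_coe_nnreal ha.le, ENNReal.ofReal_eq_coe_nnreal hb.le]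
  push_cast at h2
  rw [← ENNReal.coe_rpow_of_nonneg _ ha.le, ← ENNReal.coe_rpow_of_nonneg _ hb.le]
  exact_mod_cast h2

theorem lintegral_eq_levels {F : ℝ → ℝ≥0∞} (hF : Measurable F) (h1 : ∀ x, F x ≤ 1) :
    ∫⁻ x, F x = ∫⁻ t in Set.Ioo (0 : ℝ) 1, volume {x | ENNReal.ofReal t < F x} := by
  have hfin : ∀ x, F x ≠ ∞ := fun x => ((h1 x).trans_lt ENNReal.one_lt_top).ne
  have e1 : ∫⁻ x, F x = ∫⁻ x, ENNReal.ofReal ((F x).toReal) :=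
    lintegral_congr fun x => (ENNReal.ofReal_toReal (hfin x)).symm
  rw [e1, lintegral_eq_lintegral_meas_lt volume (Filter.Eventually.of_forall fun x => by simp)
    hF.ennreal_toReal.aemeasurable]
  have e2 : Set.Ioi (0 : ℝ) = Set.Ioo 0 1 ∪ Set.Ici 1 := (Set.Ioo_union_Ici_eq_Ioi one_pos).symm
  rw [e2, lintegral_union measurableSet_Ici]
  · have : ∫⁻ t in Set.Ici (1 : ℝ), volume {x | t < (F x).toReal} = 0 := by
      rw [setLIntegral_congr_fun (g := fun _ => 0) measurableSet_Ici]
      · simp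
      · intro t ht
        have : {x | t < (F x).toReal} = ∅ := by
          ext x
          simp only [Set.mem_ofPred_eq, Set.mem_empty_iff_false, iff_false, not_lt]
          exact (ENNReal.toReal_mono ENNReal.one_ne_top (h1 x)).trans (by simpa using ht)
        simp [this]
    rw [this, add_zero]
    refine setLIntegral_congr_fun measurableSet_Ioo fun t ht => ?_
    congr 1
    ext x
    simp only [Set.mem_ofPred_eq]
    rw [ENNReal.ofReal_lt_iff_lt_toReal ht.1.le (hfin x)]
  · exact Set.disjoint_left.2 fun x hx hx' => absurd hx.2 (not_lt.2 hx')

theorem prekopa_leindler_unit {F G H : ℝ → ℝ≥0∞} (hF : QC F) (hG : QC G) (hH : QC H)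
    (hF1 : ⨆ x, F x = 1) (hG1 : ⨆ x, G x = 1)
    {a b : ℝ} (ha : 0 < a) (hb : 0 < b) (hab : a + b = 1)
    (h : ∀ x y, F x ^ a * G y ^ b ≤ H (a * x + b * y)) :
    (∫⁻ x, F x) ^ a * (∫⁻ x, G x) ^ b ≤ ∫⁻ x, H x := by
  have hF' : ∀ x, F x ≤ 1 := fun x => hF1 ▸ le_iSup F x
  have hG' : ∀ x, G x ≤ 1 := fun x => hG1 ▸ le_iSup G x
  refine (ennreal_geom_mean_le _ _ ha hb hab).trans ?_
  have hmin : QC fun x => min (H x) 1 := by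
    intro c
    by_cases hc : c < 1
    · simpa [lt_min_iff, hc] using hH c
    · simp [lt_min_iff, hc, Set.ordConnected_empty]
  refine le_trans ?_ (lintegral_mono fun x => min_le_left (H x) 1)
  rw [lintegral_eq_levels hF.measurable hF', lintegral_eq_levels hG.measurable hG',
    lintegral_eq_levels hmin.measurable fun x => min_le_right _ _]
  rw [← lintegral_const_mul', ← lintegral_const_mul' _ _ ENNReal.ofReal_ne_top]
  rotate_left
  · exact ENNReal.ofReal_ne_top
  have anti : ∀ F : ℝ → ℝ≥0∞, Measurable fun t : ℝ => volume {x | ENNReal.ofReal t < F x} := by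
    intro F
    refine Antitone.measurable fun s t hst => measure_mono fun x hx => ?_
    exact lt_of_le_of_lt (ENNReal.ofReal_le_ofReal hst) hx
  rw [← lintegral_add_left ((anti F).const_mul _)]
  refine setLIntegral_mono (anti _) fun t ht => ?_
  have ht1 : ENNReal.ofReal t < 1 := by
    rw [← ENNReal.ofReal_one]; exact (ENNReal.ofReal_lt_ofReal_iff one_pos).2 ht.2
  have ht0 : ENNReal.ofReal t ≠ 0 := by simpa using ht.1
  refine brunn_minkowski_line ?_ ?_ (hF _) (hG _) ha hb fun x hx y hy => ?_
  · exact lt_iSup_iff.1 (hF1 ▸ ht1)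
  · exact lt_iSup_iff.1 (hG1 ▸ ht1)
  · simp only [Set.mem_ofPred_eq, lt_min_iff] at hx hy ⊢
    refine ⟨lt_of_lt_of_le ?_ (h x y), ht1⟩
    calc ENNReal.ofReal t = ENNReal.ofReal t ^ a * ENNReal.ofReal t ^ b := by
          rw [← ENNReal.rpow_add _ _ ht0 ENNReal.ofReal_ne_top, hab, ENNReal.rpow_one]
      _ < F x ^ a * G y ^ b := by
          exact ENNReal.mul_lt_mul (ENNReal.rpow_lt_rpow hx ha) (ENNReal.rpow_lt_rpow hy hb)

theorem prekopa_leindler_bdd {F G H : ℝ → ℝ≥0∞} (hF : QC F) (hG : QC G) (hH : QC H)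
    (hF1 : ⨆ x, F x ≠ ∞) (hG1 : ⨆ x, G x ≠ ∞)
    {a b : ℝ} (ha : 0 < a) (hb : 0 < b) (hab : a + b = 1)
    (h : ∀ x y, F x ^ a * G y ^ b ≤ H (a * x + b * y)) :
    (∫⁻ x, F x) ^ a * (∫⁻ x, G x) ^ b ≤ ∫⁻ x, H x := by
  by_cases hF0 : ⨆ x, F x = 0
  · have : ∀ x, F x = 0 := fun x => by simpa using (le_iSup F x).trans hF0.le
    simp [this, ENNReal.zero_rpow_of_pos ha]
  by_cases hG0 : ⨆ x, G x = 0
  · have : ∀ x, G x = 0 := fun x => by simpa using (le_iSup G x).trans hG0.le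
    simp [this, ENNReal.zero_rpow_of_pos hb]
  set s := ⨆ x, F x with hs
  set t := ⨆ x, G x with ht
  have hsa : s ^ a ≠ 0 := by simp [hF0, hF1, ha.le]
  have hsa' : s ^ a ≠ ∞ := by simp [hF0, hF1, ha.le]
  have htb : t ^ b ≠ 0 := by simp [hG0, hG1, hb.le]
  have htb' : t ^ b ≠ ∞ := by simp [hG0, hG1, hb.le]
  have qc : ∀ {F : ℝ → ℝ≥0∞} {c : ℝ≥0∞}, QC F → c ≠ 0 → c ≠ ∞ → QC fun x => c⁻¹ * F x := by
    intro F c hF hc hc' d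
    have : {x | d < c⁻¹ * F x} = {x | c * d < F x} := by
      ext x
      simp only [Set.mem_ofPred_eq]
      rw [mul_comm c⁻¹, ← div_eq_mul_inv, ENNReal.lt_div_iff_mul_lt (Or.inl hc) (Or.inl hc'),
        mul_comm]
    rw [this]; exact hF _
  have := prekopa_leindler_unit (qc hF hF0 hF1) (qc hG hG0 hG1)
    (qc hH (mul_ne_zero hsa htb) (ENNReal.mul_ne_top hsa' htb'))
    (by rw [← ENNReal.mul_iSup, ← hs, ENNReal.inv_mul_cancel hF0 hF1])
    (by rw [← ENNReal.mul_iSup, ← ht, ENNReal.inv_mul_cancel hG0 hG1]) ha hb hab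
    (fun x y => by
      rw [ENNReal.mul_rpow_of_nonneg _ _ ha.le, ENNReal.mul_rpow_of_nonneg _ _ hb.le,
        ENNReal.inv_rpow, ENNReal.inv_rpow, ENNReal.mul_inv (Or.inl hsa) (Or.inl hsa')]
      calc _ = ((s ^ a)⁻¹ * (t ^ b)⁻¹) * (F x ^ a * G y ^ b) := by ring
        _ ≤ _ := by gcongr; exact h x y)
  rw [lintegral_const_mul' _ _ (by simpa using hF0), lintegral_const_mul' _ _ (by simpa using hG0),
    lintegral_const_mul' _ _ (by simp [hsa, htb]),
    ENNReal.mul_rpow_of_nonneg _ _ ha.le, ENNReal.mul_rpow_of_nonneg _ _ hb.le,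
        ENNReal.inv_rpow, ENNReal.inv_rpow, ENNReal.mul_inv (Or.inl hsa) (Or.inl hsa')] at this
  have e : (s ^ a)⁻¹ * (∫⁻ x, F x) ^ a * ((t ^ b)⁻¹ * (∫⁻ x, G x) ^ b)
      = ((s ^ a)⁻¹ * (t ^ b)⁻¹) * ((∫⁻ x, F x) ^ a * (∫⁻ x, G x) ^ b) := by ring
  rw [e] at this
  have hne : (s ^ a)⁻¹ * (t ^ b)⁻¹ ≠ 0 := by simp [hsa', htb']
  have hnt : (s ^ a)⁻¹ * (t ^ b)⁻¹ ≠ ∞ := ENNReal.mul_ne_top (by simp [hsa]) (by simp [htb])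
  exact (ENNReal.mul_le_mul_iff_right hne hnt).1 this

theorem rpow_iSup_nat (u : ℕ → ℝ≥0∞) {a : ℝ} (ha : 0 < a) : (⨆ k, u k) ^ a = ⨆ k, u k ^ a :=
  (ENNReal.orderIsoRpow a ha).map_iSup u

theorem prekopa_leindler_line {F G H : ℝ → ℝ≥0∞} (hF : QC F) (hG : QC G) (hH : QC H)
    {a b : ℝ} (ha : 0 < a) (hb : 0 < b) (hab : a + b = 1)
    (h : ∀ x y, F x ^ a * G y ^ b ≤ H (a * x + b * y)) :
    (∫⁻ x, F x) ^ a * (∫⁻ x, G x) ^ b ≤ ∫⁻ x, H x := by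
  have qc : ∀ {F : ℝ → ℝ≥0∞} (c : ℝ≥0∞), QC F → QC fun x => min (F x) c := by
    intro F c hF d
    by_cases hc : d < c
    · simpa [lt_min_iff, hc] using hF d
    · simp [lt_min_iff, hc, Set.ordConnected_empty]
  have sup : ∀ {F : ℝ → ℝ≥0∞}, QC F → ∫⁻ x, F x = ⨆ k : ℕ, ∫⁻ x, min (F x) k := by
    intro F hF
    rw [← lintegral_iSup (fun k => (qc _ hF).measurable)
      (fun i j hij x => min_le_min le_rfl (by exact_mod_cast hij))]
    refine lintegral_congr fun x => ?_
    rw [← inf_iSup_eq, ENNReal.iSup_natCast, inf_top_eq]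
  rw [sup hF, sup hG, rpow_iSup_nat _ ha, rpow_iSup_nat _ hb, ENNReal.iSup_mul]
  refine iSup_le fun k => ?_
  rw [ENNReal.mul_iSup]
  refine iSup_le fun l => ?_
  have fin : ∀ (F : ℝ → ℝ≥0∞) (k : ℕ), ⨆ x, min (F x) k ≠ ∞ := fun F k =>
    (lt_of_le_of_lt (iSup_le fun x => min_le_right _ _) (ENNReal.natCast_lt_top k)).ne
  refine prekopa_leindler_bdd (qc _ hF) (qc _ hG) hH (fin F k) (fin G l) ha hb hab fun x y => ?_
  refine le_trans ?_ (h x y)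
  gcongr <;> exact min_le_left _ _

section LCBasic

variable {V W : Type*} [AddCommGroup V] [Module ℝ V] [AddCommGroup W] [Module ℝ W]

theorem LC.convex_level {F : V → ℝ≥0∞} (hF : LC F) (c : ℝ≥0∞) : Convex ℝ {x | c < F x} := by
  rw [convex_iff_forall_pos]
  intro x hx y hy a b ha hb hab
  have hc : c ≠ ∞ := (lt_of_lt_of_le hx le_top).ne
  refine lt_of_lt_of_le ?_ (hF x y a b ha hb hab)
  by_cases hc0 : c = 0
  · rw [hc0]
    exact ENNReal.mul_pos (by
      have : 0 < F x ^ a := ENNReal.rpow_pos_of_nonneg (lt_of_le_of_lt (zero_le) hx) ha.le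
      exact this.ne') (by
      have : 0 < F y ^ b := ENNReal.rpow_pos_of_nonneg (lt_of_le_of_lt (zero_le) hy) hb.le
      exact this.ne')
  calc c = c ^ a * c ^ b := by rw [← ENNReal.rpow_add _ _ hc0 hc, hab, ENNReal.rpow_one]
    _ < _ := ENNReal.mul_lt_mul (ENNReal.rpow_lt_rpow hx ha) (ENNReal.rpow_lt_rpow hy hb)

theorem LC.convex_level_le {F : V → ℝ≥0∞} (hF : LC F) (c : ℝ≥0∞) : Convex ℝ {x | c ≤ F x} := by
  have : {x | c ≤ F x} = ⋂ d : Set.Iio c, {x | (d : ℝ≥0∞) < F x} := by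
    ext x
    simp only [Set.mem_ofPred_eq, Set.mem_iInter, Subtype.forall, Set.mem_Iio]
    exact ⟨fun h d hd => hd.trans_le h, fun h => le_of_forall_lt h⟩
  rw [this]
  exact convex_iInter fun d => hF.convex_level d

theorem LC.qc {F : ℝ → ℝ≥0∞} (hF : LC F) : QC F := fun c => (hF.convex_level c).ordConnected

theorem LC.comp_affine {F : W → ℝ≥0∞} (hF : LC F) (L : V → W)
    (hL : ∀ x y : V, ∀ a b : ℝ, a + b = 1 → L (a • x + b • y) = a • L x + b • L y) :
    LC fun x => F (L x) := by
  intro x y a b ha hb hab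
  simp only
  rw [hL x y a b hab]
  exact hF _ _ a b ha hb hab

theorem LC.comp_linear {F : W → ℝ≥0∞} (hF : LC F) (L : V →ₗ[ℝ] W) : LC fun x => F (L x) :=
  hF.comp_affine L fun x y a b _ => by simp

theorem LC.mul {F G : V → ℝ≥0∞} (hF : LC F) (hG : LC G) : LC fun x => F x * G x := by
  intro x y a b ha hb hab
  simp only
  rw [ENNReal.mul_rpow_of_nonneg _ _ ha.le, ENNReal.mul_rpow_of_nonneg _ _ hb.le]
  calc _ = (F x ^ a * F y ^ b) * (G x ^ a * G y ^ b) := by ring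
    _ ≤ _ := mul_le_mul' (hF x y a b ha hb hab) (hG x y a b ha hb hab)

theorem LC.exp_neg {φ : V → ℝ} (h : ∀ x y : V, ∀ a b : ℝ, 0 < a → 0 < b → a + b = 1 →
    φ (a • x + b • y) ≤ a * φ x + b * φ y) : LC fun x => ENNReal.ofReal (Real.exp (-φ x)) := by
  intro x y a b ha hb hab
  simp only
  rw [ENNReal.ofReal_rpow_of_pos (Real.exp_pos _), ENNReal.ofReal_rpow_of_pos (Real.exp_pos _),
    ← ENNReal.ofReal_mul (by positivity)]
  refine ENNReal.ofReal_le_ofReal ?_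
  rw [← Real.exp_mul, ← Real.exp_mul, ← Real.exp_add]
  exact Real.exp_le_exp.2 (by linarith [h x y a b ha hb hab])

theorem LC.indicator {K : Set V} (hK : Convex ℝ K) : LC (K.indicator fun _ => (1 : ℝ≥0∞)) := by
  intro x y a b ha hb hab
  by_cases hx : x ∈ K
  · by_cases hy : y ∈ K
    · simp [hx, hy, hK hx hy ha.le hb.le hab]
    · simp [hy, ENNReal.zero_rpow_of_pos hb]
  · simp [hx, ENNReal.zero_rpow_of_pos ha]

/-- One-dimensional marginals preserve log-concavity. -/
theorem LC.marginal_line {F : V × ℝ → ℝ≥0∞} (hF : LC F) : LC fun v => ∫⁻ y, F (v, y) := by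
  intro v w a b ha hb hab
  have sec : ∀ v, QC fun y => F (v, y) := fun v =>
    (hF.comp_affine (fun y : ℝ => (v, y)) fun x y a b hab => by
      ext <;> simp [← add_smul, hab]).qc
  refine prekopa_leindler_line (sec v) (sec w) (sec _) ha hb hab fun x y => ?_
  simpa using hF (v, x) (w, y) a b ha hb hab

end LCBasic

theorem LC.aemeasurable {E : Type*} [NormedAddCommGroup E] [NormedSpace ℝ E] [MeasurableSpace E]
    [BorelSpace E] [FiniteDimensional ℝ E] (μ : Measure E) [μ.IsAddHaarMeasure]
    {F : E → ℝ≥0∞} (hF : LC F) : AEMeasurable F μ := by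
  apply NullMeasurable.aemeasurable
  exact @measurable_of_Ioi ℝ≥0∞ (NullMeasurableSpace E μ) _ _ _ _ _ _ inferInstance F
    fun c => (hF.convex_level c).nullMeasurableSet μ

theorem LC.marginal_pi {V : Type*} [AddCommGroup V] [Module ℝ V] (n : ℕ) :
    ∀ {F : V × (Fin n → ℝ) → ℝ≥0∞}, LC F → LC fun v => ∫⁻ y, F (v, y) := by
  induction n generalizing V with
  | zero =>
    intro F hF
    have : (fun v => ∫⁻ y : Fin 0 → ℝ, F (v, y)) = fun v => F (v, fun i => Fin.elim0 i) := by
      funext v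
      rw [Measure.volume_pi_eq_dirac (fun i => Fin.elim0 i)]
      simp
    rw [this]
    exact hF.comp_affine _ fun x y a b hab => by ext i <;> [simp; exact Fin.elim0 i]
  | succ n ih =>
    intro F hF
    let F' : (V × ℝ) × (Fin n → ℝ) → ℝ≥0∞ := fun p => F (p.1.1, Fin.cons p.1.2 p.2)
    have hF' : LC F' := hF.comp_affine (fun p : (V × ℝ) × (Fin n → ℝ) =>
        (p.1.1, (Fin.cons p.1.2 p.2 : Fin (n + 1) → ℝ))) fun x y a b hab => by
      ext i
      · simp
      · refine Fin.cases ?_ (fun j => ?_) i <;> simp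
    have := (ih hF').marginal_line
    convert this using 2 with v
    have e := (volume_preserving_piFinSuccAbove (fun _ : Fin (n + 1) => ℝ) 0).symm
    rw [← e.lintegral_comp_emb (MeasurableEquiv.measurableEmbedding _), Measure.volume_eq_prod,
      lintegral_prod]
    · refine lintegral_congr fun y => lintegral_congr fun z => ?_
      simp [F', MeasurableEquiv.piFinSuccAbove, Fin.insertNthEquiv, Fin.insertNth_zero]
    · refine LC.aemeasurable ((volume : Measure ℝ).prod (volume : Measure (Fin n → ℝ)))
        (F := fun p => F (v, (MeasurableEquiv.piFinSuccAbove (fun _ : Fin (n + 1) => ℝ) 0).symm p)) ?_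
      refine hF.comp_affine (fun p : ℝ × (Fin n → ℝ) =>
        (v, (MeasurableEquiv.piFinSuccAbove (fun _ : Fin (n + 1) => ℝ) 0).symm p))
        fun x y a b hab => ?_
      ext i
      · simp [← add_smul, hab]
      · refine Fin.cases ?_ (fun j => ?_) i <;>
          simp [MeasurableEquiv.piFinSuccAbove, Fin.insertNthEquiv, Fin.insertNth_zero]

theorem LC.const_mul {V : Type*} [AddCommGroup V] [Module ℝ V] {F : V → ℝ≥0∞} (hF : LC F)
    (c : ℝ≥0∞) : LC fun x => c * F x := by
  refine LC.mul (F := fun _ => c) ?_ hF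
  intro x y a b ha hb hab
  rw [← ENNReal.rpow_add_of_nonneg _ _ ha.le hb.le, hab, ENNReal.rpow_one]

/-- Prékopa's theorem: marginals of log-concave functions are log-concave. -/
theorem LC.marginal {V W : Type*} [AddCommGroup V] [Module ℝ V] [NormedAddCommGroup W]
    [NormedSpace ℝ W] [FiniteDimensional ℝ W] [MeasurableSpace W] [BorelSpace W]
    (μ : Measure W) [μ.IsAddHaarMeasure] {F : V × W → ℝ≥0∞} (hF : LC F) :
    LC fun v => ∫⁻ w, F (v, w) ∂μ := by
  let e : W ≃L[ℝ] (Fin (Module.finrank ℝ W) → ℝ) := ContinuousLinearEquiv.ofFinrankEq (by simp)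
  have h1 : LC fun v => ∫⁻ y : Fin (Module.finrank ℝ W) → ℝ, F (v, e.symm y) :=
    LC.marginal_pi _ (F := fun p => F (p.1, e.symm p.2))
      (hF.comp_affine (fun p : V × (Fin (Module.finrank ℝ W) → ℝ) => (p.1, e.symm p.2))
        fun x y a b hab => by simp)
  have : (μ.map e).IsAddHaarMeasure := e.isAddHaarMeasure_map μ
  obtain ⟨c, hc⟩ : ∃ c : ℝ≥0, μ.map e = c • volume :=
    ⟨_, Measure.isAddLeftInvariant_eq_smul (μ.map e) volume⟩
  have h2 : (fun v => ∫⁻ w, F (v, w) ∂μ)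
      = fun v => c * ∫⁻ y : Fin (Module.finrank ℝ W) → ℝ, F (v, e.symm y) := by
    funext v
    rw [← smul_eq_mul, ← lintegral_smul_measure]
    change _ = ∫⁻ y, F (v, e.symm y) ∂(c • volume)
    rw [← hc]
    have := (e.toHomeomorph.measurableEmbedding).lintegral_map (μ := μ)
      (fun y => F (v, e.symm y))
    simpa using this.symm
  rw [h2]
  exact h1.const_mul c

end SmallBall

namespace SmallBall

open scoped ENNReal NNReal Topology

abbrev E (n : ℕ) := EuclideanSpace ℝ (Fin n)

section Tame

variable {n : ℕ}

/-- `F'` is the gradient of `F`, in coordinates. -/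
def HasGrad (F : E n → ℝ) (F' : Fin n → E n → ℝ) : Prop :=
  ∀ x, HasFDerivAt F (∑ i, F' i x • (EuclideanSpace.proj i : E n →L[ℝ] ℝ)) x

/-- Continuous functions of at most exponential growth. -/
def Tame (F : E n → ℝ) : Prop :=
  Continuous F ∧ ∃ C c : ℝ, 0 ≤ C ∧ 0 ≤ c ∧ ∀ x, |F x| ≤ C * Real.exp (c * ‖x‖)

theorem Tame.const (a : ℝ) : Tame fun _ : E n => a :=
  ⟨continuous_const, |a|, 0, abs_nonneg _, le_rfl, fun x => by simp⟩

theorem Tame.of_bdd {F : E n → ℝ} (hc : Continuous F) (C : ℝ) (h : ∀ x, |F x| ≤ C) : Tame F :=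
  ⟨hc, C, 0, (abs_nonneg _).trans (h 0), le_rfl, fun x => by simpa using h x⟩

theorem Tame.add {F G : E n → ℝ} (hF : Tame F) (hG : Tame G) : Tame fun x => F x + G x := by
  obtain ⟨hF, C, c, hC, hc, h⟩ := hF
  obtain ⟨hG, D, d, hD, hd, k⟩ := hG
  refine ⟨hF.add hG, C + D, c + d, by positivity, by positivity, fun x => ?_⟩
  calc _ ≤ |F x| + |G x| := abs_add_le _ _
    _ ≤ C * Real.exp (c * ‖x‖) + D * Real.exp (d * ‖x‖) := add_le_add (h x) (k x)
    _ ≤ C * Real.exp ((c + d) * ‖x‖) + D * Real.exp ((c + d) * ‖x‖) := by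
        gcongr <;> nlinarith [norm_nonneg x]
    _ = _ := by ring

theorem Tame.mul {F G : E n → ℝ} (hF : Tame F) (hG : Tame G) : Tame fun x => F x * G x := by
  obtain ⟨hF, C, c, hC, hc, h⟩ := hF
  obtain ⟨hG, D, d, hD, hd, k⟩ := hG
  refine ⟨hF.mul hG, C * D, c + d, by positivity, by positivity, fun x => ?_⟩
  rw [abs_mul, add_mul, Real.exp_add]
  calc _ ≤ (C * Real.exp (c * ‖x‖)) * (D * Real.exp (d * ‖x‖)) :=
        mul_le_mul (h x) (k x) (abs_nonneg _) (by positivity)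
    _ = _ := by ring

theorem Tame.neg {F : E n → ℝ} (hF : Tame F) : Tame fun x => - F x := by
  simpa using (Tame.const (-1)).mul hF

theorem Tame.sub {F G : E n → ℝ} (hF : Tame F) (hG : Tame G) : Tame fun x => F x - G x := by
  simpa [sub_eq_add_neg] using hF.add hG.neg

theorem Tame.pow {F : E n → ℝ} (hF : Tame F) (k : ℕ) : Tame fun x => F x ^ k := by
  induction k with
  | zero => simpa using Tame.const 1
  | succ k ih => simpa [pow_succ] using ih.mul hF

theorem Tame.sum {ι : Type*} (s : Finset ι) {F : ι → E n → ℝ} (h : ∀ i ∈ s, Tame (F i)) :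
    Tame fun x => ∑ i ∈ s, F i x := by
  classical
  induction s using Finset.induction_on with
  | empty => simpa using Tame.const 0
  | insert i s hi ih =>
    simp only [Finset.sum_insert hi]
    exact (h i (by simp)).add (ih fun j hj => h j (by simp [hj]))

theorem Tame.coord (i : Fin n) : Tame fun x : E n => x i := by
  refine ⟨by fun_prop, 1, 1, zero_le_one, zero_le_one, fun x => ?_⟩
  have h1 : |x i| ≤ ‖x‖ := by simpa using PiLp.norm_apply_le x i
  have h2 := Real.add_one_le_exp ‖x‖
  simp only [one_mul]; linarith

theorem HasGrad.continuous {F : E n → ℝ} {F'} (h : HasGrad F F') : Continuous F :=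
  continuous_iff_continuousAt.2 fun x => (h x).continuousAt

theorem HasGrad.fderiv_single {F : E n → ℝ} {F'} (h : HasGrad F F') (x : E n) (i : Fin n) :
    fderiv ℝ F x (EuclideanSpace.single i 1) = F' i x := by
  rw [(h x).fderiv]
  simp [ContinuousLinearMap.sum_apply, Pi.single_apply]

theorem HasGrad.const (a : ℝ) : HasGrad (fun _ : E n => a) fun _ _ => 0 := fun x => by
  simpa using hasFDerivAt_const a x

theorem HasGrad.add {F G : E n → ℝ} {F' G'} (hF : HasGrad F F') (hG : HasGrad G G') :
    HasGrad (fun x => F x + G x) fun i x => F' i x + G' i x := fun x => by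
  have e : (∑ i, (F' i x + G' i x) • (EuclideanSpace.proj i : E n →L[ℝ] ℝ))
      = (∑ i, F' i x • (EuclideanSpace.proj i : E n →L[ℝ] ℝ))
        + ∑ i, G' i x • (EuclideanSpace.proj i : E n →L[ℝ] ℝ) := by
    simp only [add_smul, Finset.sum_add_distrib]
  rw [e]
  exact (hF x).add (hG x)

theorem HasGrad.mul {F G : E n → ℝ} {F' G'} (hF : HasGrad F F') (hG : HasGrad G G') :
    HasGrad (fun x => F x * G x) fun i x => F x * G' i x + F' i x * G x := fun x => by
  have e : (∑ i, (F x * G' i x + F' i x * G x) • (EuclideanSpace.proj i : E n →L[ℝ] ℝ))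
      = F x • (∑ i, G' i x • (EuclideanSpace.proj i : E n →L[ℝ] ℝ))
        + G x • ∑ i, F' i x • (EuclideanSpace.proj i : E n →L[ℝ] ℝ) := by
    simp only [add_smul, Finset.sum_add_distrib, Finset.smul_sum, smul_smul, mul_comm (G x)]
  rw [e]
  exact (hF x).mul (hG x)

theorem HasGrad.const_mul {G : E n → ℝ} {G'} (a : ℝ) (hG : HasGrad G G') :
    HasGrad (fun x => a * G x) fun i x => a * G' i x := by
  simpa using (HasGrad.const a).mul hG

theorem HasGrad.neg {G : E n → ℝ} {G'} (hG : HasGrad G G') :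
    HasGrad (fun x => - G x) fun i x => - G' i x := by
  simpa using HasGrad.const_mul (-1) hG

theorem HasGrad.sub {F G : E n → ℝ} {F' G'} (hF : HasGrad F F') (hG : HasGrad G G') :
    HasGrad (fun x => F x - G x) fun i x => F' i x - G' i x := by
  simpa [sub_eq_add_neg] using hF.add hG.neg

theorem HasGrad.coord (j : Fin n) :
    HasGrad (fun x : E n => x j) fun i _ => if i = j then 1 else 0 := fun x => by
  simpa using (EuclideanSpace.proj j : E n →L[ℝ] ℝ).hasFDerivAt (x := x)

theorem HasGrad.exp {F : E n → ℝ} {F'} (hF : HasGrad F F') :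
    HasGrad (fun x => Real.exp (F x)) fun i x => Real.exp (F x) * F' i x := fun x => by
  have := (hF x).exp
  simpa [Finset.smul_sum, smul_smul] using this

theorem norm_sq_coord (x : E n) : ‖x‖ ^ 2 = ∑ i, x i * x i := by
  rw [EuclideanSpace.norm_sq_eq]
  simp [sq]

theorem HasGrad.sum {ι : Type*} (s : Finset ι) {F : ι → E n → ℝ} {F' : ι → Fin n → E n → ℝ}
    (h : ∀ k ∈ s, HasGrad (F k) (F' k)) :
    HasGrad (fun x => ∑ k ∈ s, F k x) fun i x => ∑ k ∈ s, F' k i x := by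
  classical
  induction s using Finset.induction_on with
  | empty => simpa using HasGrad.const 0
  | insert i s hi ih =>
    simp only [Finset.sum_insert hi]
    exact (h i (by simp)).add (ih fun j hj => h j (by simp [hj]))

theorem HasGrad.norm_sq : HasGrad (fun x : E n => ‖x‖ ^ 2) fun i x => 2 * x i := by
  simp_rw [norm_sq_coord]
  have := HasGrad.sum Finset.univ fun k _ => (HasGrad.coord (n := n) k).mul (HasGrad.coord k)
  convert this using 2 with i
  funext x
  simp [Finset.sum_add_distrib]
  ring

theorem integrable_exp_neg_sq {b : ℝ} (hb : 0 < b) :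
    Integrable fun x : E n => Real.exp (-b * ‖x‖ ^ 2) := by
  by_contra h
  have := GaussianFourier.integral_rexp_neg_mul_sq_norm (V := E n) hb
  rw [integral_undef h] at this
  have : (0 : ℝ) < (Real.pi / b) ^ (Module.finrank ℝ (E n) / 2 : ℝ) := by positivity
  linarith

theorem Tame.integrable_gauss {F : E n → ℝ} (hF : Tame F) {b : ℝ} (hb : 0 < b) :
    Integrable fun x => F x * Real.exp (-b * ‖x‖ ^ 2) := by
  obtain ⟨hF, C, c, hC, hc, h⟩ := hF
  refine Integrable.mono' (g := fun x => (C * Real.exp (c ^ 2 / (2 * b))) *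
    Real.exp (-(b / 2) * ‖x‖ ^ 2)) ((integrable_exp_neg_sq (half_pos hb)).const_mul _)
    (by fun_prop) (Filter.Eventually.of_forall fun x => ?_)
  rw [norm_mul, Real.norm_eq_abs, Real.norm_eq_abs, Real.abs_exp]
  calc _ ≤ C * Real.exp (c * ‖x‖) * Real.exp (-b * ‖x‖ ^ 2) := by gcongr; exact h x
    _ = C * (Real.exp (c * ‖x‖ + -b * ‖x‖ ^ 2)) := by rw [Real.exp_add]; ring
    _ ≤ C * Real.exp (c ^ 2 / (2 * b) + -(b / 2) * ‖x‖ ^ 2) := by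
        refine mul_le_mul_of_nonneg_left (Real.exp_le_exp.2 ?_) hC
        have : 0 ≤ (b * ‖x‖ - c) ^ 2 / (2 * b) := by positivity
        have e : (b * ‖x‖ - c) ^ 2 / (2 * b) = b / 2 * ‖x‖ ^ 2 - c * ‖x‖ + c ^ 2 / (2 * b) := by
          field_simp
          ring
        nlinarith
    _ = _ := by rw [Real.exp_add]; ring

end Tame

/-- A smooth log-concave weight `exp (W - s |x|² / 2)` of total mass one. -/
structure Nice {n : ℕ} (s : ℝ) (W : E n → ℝ) (b : Fin n → E n → ℝ)
    (h : Fin n → Fin n → E n → ℝ) (l : ℝ) : Prop where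
  s_pos : 0 < s
  gradW : HasGrad W b
  gradb : ∀ i, HasGrad (b i) (h i)
  cont_h : ∀ i j, Continuous (h i j)
  W_le : ∀ x, W x ≤ l
  b_le : ∀ i x, |b i x| ≤ l
  h_le : ∀ i j x, |h i j x| ≤ l
  concave : ∀ x (v : Fin n → ℝ), ∑ i, ∑ j, v i * v j * h i j x ≤ 0
  mass : ∫ x, Real.exp (W x - s / 2 * ‖x‖ ^ 2) = 1

section NiceBasic

variable {n : ℕ} {s : ℝ} {W : E n → ℝ} {b : Fin n → E n → ℝ}
    {h : Fin n → Fin n → E n → ℝ} {l : ℝ}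

/-- Integral against the weight. -/
def wInt (W : E n → ℝ) (s : ℝ) (F : E n → ℝ) : ℝ :=
  ∫ x, F x * Real.exp (W x - s / 2 * ‖x‖ ^ 2)

theorem Nice.integrable (N : Nice s W b h l) {F : E n → ℝ} (hF : Tame F) :
    Integrable fun x => F x * Real.exp (W x - s / 2 * ‖x‖ ^ 2) := by
  have h1 := hF.integrable_gauss (half_pos N.s_pos)
  have h2 := h1.bdd_mul (c := Real.exp l) (f := fun x => Real.exp (W x))
    ((Real.continuous_exp.comp N.gradW.continuous).aestronglyMeasurable)
    (Filter.Eventually.of_forall fun x => by simpa using N.W_le x)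
  refine h2.congr (Filter.Eventually.of_forall fun x => ?_)
  simp only
  rw [sub_eq_add_neg, Real.exp_add, neg_mul]
  ring

theorem Nice.tame_b (N : Nice s W b h l) (i) : Tame (b i) :=
  Tame.of_bdd (N.gradb i).continuous l (N.b_le i)

theorem Nice.tame_h (N : Nice s W b h l) (i j) : Tame (h i j) :=
  Tame.of_bdd (N.cont_h i j) l (N.h_le i j)

theorem Nice.wInt_add (N : Nice s W b h l) {F G : E n → ℝ} (hF : Tame F) (hG : Tame G) :
    wInt W s (fun x => F x + G x) = wInt W s F + wInt W s G := by
  unfold wInt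
  rw [← integral_add (N.integrable hF) (N.integrable hG)]
  simp only [add_mul]

theorem Nice.wInt_sub (N : Nice s W b h l) {F G : E n → ℝ} (hF : Tame F) (hG : Tame G) :
    wInt W s (fun x => F x - G x) = wInt W s F - wInt W s G := by
  unfold wInt
  rw [← integral_sub (N.integrable hF) (N.integrable hG)]
  simp only [sub_mul]

theorem wInt_const_mul (a : ℝ) (F : E n → ℝ) :
    wInt W s (fun x => a * F x) = a * wInt W s F := by
  unfold wInt
  rw [← integral_const_mul]
  simp only [mul_assoc]

theorem Nice.wInt_sum (N : Nice s W b h l) {ι : Type*} (t : Finset ι) {F : ι → E n → ℝ}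
    (hF : ∀ k ∈ t, Tame (F k)) :
    wInt W s (fun x => ∑ k ∈ t, F k x) = ∑ k ∈ t, wInt W s (F k) := by
  unfold wInt
  rw [← integral_finsetSum _ fun k hk => N.integrable (hF k hk)]
  simp only [Finset.sum_mul]

theorem wInt_nonneg {F : E n → ℝ} (hF : ∀ x, 0 ≤ F x) : 0 ≤ wInt W s F :=
  integral_nonneg fun x => mul_nonneg (hF x) (Real.exp_pos _).le

theorem Nice.wInt_mono (N : Nice s W b h l) {F G : E n → ℝ} (hF : Tame F) (hG : Tame G)
    (hFG : ∀ x, F x ≤ G x) : wInt W s F ≤ wInt W s G :=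
  integral_mono (N.integrable hF) (N.integrable hG) fun x =>
    mul_le_mul_of_nonneg_right (hFG x) (Real.exp_pos _).le

theorem Nice.wInt_const (N : Nice s W b h l) (a : ℝ) : wInt W s (fun _ => a) = a := by
  unfold wInt
  rw [integral_const_mul, N.mass, mul_one]

/-- Integration by parts: `D_i^* G = (s x_i - b_i) G - ∂_i G`. -/
theorem Nice.ibp (N : Nice s W b h l) {F G : E n → ℝ} {F' G' : Fin n → E n → ℝ}
    (hF : HasGrad F F') (hG : HasGrad G G') (tF : Tame F) (tG : Tame G) (i : Fin n)
    (tF' : Tame (F' i)) (tG' : Tame (G' i)) :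
    wInt W s (fun x => F' i x * G x)
      = wInt W s (fun x => F x * ((s * x i - b i x) * G x - G' i x)) := by
  have hρ : HasGrad (fun x => Real.exp (W x - s / 2 * ‖x‖ ^ 2)) _ :=
    (N.gradW.sub (HasGrad.norm_sq.const_mul (s / 2))).exp
  have hGρ := hG.mul hρ
  have hd := hGρ.fderiv_single
  have key := integral_mul_fderiv_eq_neg_fderiv_mul_of_integrable (μ := (volume : Measure (E n)))
    (f := F) (g := fun x => G x * Real.exp (W x - s / 2 * ‖x‖ ^ 2))
    (v := EuclideanSpace.single i 1) ?_ ?_ ?_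
    (fun x _ => (hF x).differentiableAt) (fun x _ => (hGρ x).differentiableAt)
  · simp only [hF.fderiv_single, hd] at key
    unfold wInt
    rw [← neg_eq_iff_eq_neg] at key
    rw [show (∫ x, F' i x * G x * Real.exp (W x - s / 2 * ‖x‖ ^ 2))
      = ∫ x, F' i x * (G x * Real.exp (W x - s / 2 * ‖x‖ ^ 2)) by simp only [mul_assoc], ← key,
      ← integral_neg]
    congr 1
    funext x
    ring
  · simp only [hF.fderiv_single, ← mul_assoc]
    exact N.integrable (tF'.mul tG)
  · simp only [hd]
    have : Tame fun x => F x * (G x * (b i x - s / 2 * (2 * x i)) + G' i x) :=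
      tF.mul ((tG.mul ((N.tame_b i).sub ((Tame.const _).mul
        ((Tame.const _).mul (Tame.coord i))))).add tG')
    refine (N.integrable this).congr (Filter.Eventually.of_forall fun x => ?_)
    simp only
    ring
  · simp only [← mul_assoc]
    exact N.integrable (tF.mul tG)

end NiceBasic

end SmallBall

namespace SmallBall

open scoped ENNReal NNReal Topology

abbrev Poly (n : ℕ) := MvPolynomial (Fin n) ℝ

/-- Evaluation of a polynomial at a point of Euclidean space. -/
def pv {n : ℕ} (p : Poly n) (x : E n) : ℝ := MvPolynomial.eval (fun i => x i) p

/-- Partial derivatives of polynomials. -/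
abbrev pd {n : ℕ} (i : Fin n) (p : Poly n) : Poly n := MvPolynomial.pderiv i p

section

variable {n : ℕ}

@[simp] theorem pv_add (p q : Poly n) (x : E n) : pv (p + q) x = pv p x + pv q x := by simp [pv]
@[simp] theorem pv_sub (p q : Poly n) (x : E n) : pv (p - q) x = pv p x - pv q x := by simp [pv]
@[simp] theorem pv_mul (p q : Poly n) (x : E n) : pv (p * q) x = pv p x * pv q x := by simp [pv]
@[simp] theorem pv_zero (x : E n) : pv (0 : Poly n) x = 0 := by simp [pv]
@[simp] theorem pv_one (x : E n) : pv (1 : Poly n) x = 1 := by simp [pv]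
@[simp] theorem pv_C (a : ℝ) (x : E n) : pv (MvPolynomial.C a : Poly n) x = a := by simp [pv]
@[simp] theorem pv_X (i : Fin n) (x : E n) : pv (MvPolynomial.X i : Poly n) x = x i := by simp [pv]
@[simp] theorem pv_smul (a : ℝ) (p : Poly n) (x : E n) : pv (a • p) x = a * pv p x := by
  simp [pv, MvPolynomial.smul_eval]
@[simp] theorem pv_sum {ι : Type*} (t : Finset ι) (p : ι → Poly n) (x : E n) :
    pv (∑ k ∈ t, p k) x = ∑ k ∈ t, pv (p k) x := by simp [pv]

theorem pv_C_eq (a : ℝ) : pv (MvPolynomial.C a : Poly n) = fun _ => a := funext (pv_C a)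
theorem pv_add_eq (p q : Poly n) : pv (p + q) = fun x => pv p x + pv q x := funext (pv_add p q)
theorem pv_mul_eq (p q : Poly n) : pv (p * q) = fun x => pv p x * pv q x := funext (pv_mul p q)
theorem pv_X_eq (i : Fin n) : pv (MvPolynomial.X i : Poly n) = fun x => x i := funext (pv_X i)

theorem tame_pv (p : Poly n) : Tame (pv p) := by
  induction p using MvPolynomial.induction_on with
  | C a => rw [pv_C_eq]; exact Tame.const a
  | add p q hp hq => rw [pv_add_eq]; exact hp.add hq
  | mul_X p i hp => rw [pv_mul_eq, pv_X_eq]; exact hp.mul (Tame.coord i)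

theorem hasGrad_pv (p : Poly n) : HasGrad (pv p) fun i => pv (pd i p) := by
  induction p using MvPolynomial.induction_on with
  | C a =>
    have e : (fun i => pv (pd i (MvPolynomial.C a : Poly n))) = fun _ _ => 0 := by
      funext i x; simp [pd]
    rw [pv_C_eq, e]; exact HasGrad.const a
  | add p q hp hq =>
    have e : (fun i => pv (pd i (p + q))) = fun i x => pv (pd i p) x + pv (pd i q) x := by
      funext i x; simp [pd]
    rw [pv_add_eq, e]; exact hp.add hq
  | mul_X p i hp =>
    have e : (fun j => pv (pd j (p * MvPolynomial.X i)))
        = fun j x => pv p x * (if j = i then 1 else 0) + pv (pd j p) x * x i := by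
      funext j x
      simp only [pd, MvPolynomial.pderiv_mul, MvPolynomial.pderiv_X, pv_add, pv_mul, pv_X]
      rcases eq_or_ne j i with h | h
      · subst h; simp; ring
      · simp [h, Ne.symm h]
    rw [pv_mul_eq, pv_X_eq, e]; exact hp.mul (HasGrad.coord i)

theorem pd_comm (i j : Fin n) (p : Poly n) : pd i (pd j p) = pd j (pd i p) := by
  induction p using MvPolynomial.induction_on with
  | C a => simp [pd]
  | add p q hp hq => simp only [pd, map_add] at *; rw [hp, hq]
  | mul_X p k hp =>
    have e : ∀ a b : Fin n, pd a (Pi.single (M := fun _ => Poly n) b 1 k) = 0 := by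
      intro a b
      rcases eq_or_ne k b with h | h
      · subst h; simp [pd]
      · simp [pd, Pi.single_eq_of_ne h]
    simp only [pd] at hp e
    simp only [pd, MvPolynomial.pderiv_mul, MvPolynomial.pderiv_X, map_add, e, hp]
    ring

end

section Gen

variable {n : ℕ} {s : ℝ} {W : E n → ℝ} {b : Fin n → E n → ℝ}
    {h : Fin n → Fin n → E n → ℝ} {l : ℝ}

/-- The `i`-th adjoint derivative of `∂_i p`. -/
def dstar (s : ℝ) (b : Fin n → E n → ℝ) (i : Fin n) (p : Poly n) (x : E n) : ℝ :=
  (s * x i - b i x) * pv p x - pv (pd i p) x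

/-- Minus the generator associated with the weight. -/
def gen (s : ℝ) (b : Fin n → E n → ℝ) (p : Poly n) (x : E n) : ℝ :=
  ∑ i, dstar s b i (pd i p) x

/-- The Dirichlet energy. -/
def energy (W : E n → ℝ) (s : ℝ) (p q : Poly n) : ℝ :=
  ∑ i, wInt W s fun x => pv (pd i p) x * pv (pd i q) x

theorem Nice.tame_dstar (N : Nice s W b h l) (i : Fin n) (p : Poly n) : Tame (dstar s b i p) :=
  ((((Tame.const s).mul (Tame.coord i)).sub (N.tame_b i)).mul (tame_pv p)).sub (tame_pv _)

theorem Nice.tame_gen (N : Nice s W b h l) (p : Poly n) : Tame (gen s b p) :=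
  Tame.sum _ fun i _ => N.tame_dstar i _

theorem Nice.ibp_dstar (N : Nice s W b h l) {F : E n → ℝ} {F' : Fin n → E n → ℝ}
    (hF : HasGrad F F') (tF : Tame F) (i : Fin n) (tF' : Tame (F' i)) (p : Poly n) :
    wInt W s (fun x => F x * dstar s b i p x) = wInt W s fun x => F' i x * pv p x :=
  (N.ibp hF (hasGrad_pv p) tF (tame_pv p) i tF' (tame_pv _)).symm

theorem Nice.gen_pair (N : Nice s W b h l) (p q : Poly n) :
    wInt W s (fun x => gen s b p x * pv q x) = energy W s p q := by
  have : (fun x => gen s b p x * pv q x) = fun x => ∑ i, pv q x * dstar s b i (pd i p) x := by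
    funext x
    simp only [gen]
    rw [mul_comm, Finset.mul_sum]
  rw [this, N.wInt_sum _ fun i _ => (tame_pv q).mul (N.tame_dstar i _)]
  refine Finset.sum_congr rfl fun i _ => ?_
  rw [N.ibp_dstar (hasGrad_pv q) (tame_pv q) i (tame_pv _)]
  simp only [mul_comm]

theorem Nice.hasGrad_dstar (N : Nice s W b h l) (j : Fin n) (p : Poly n) :
    HasGrad (dstar s b j p) fun i x =>
      ((if i = j then s else 0) - h j i x) * pv p x + dstar s b j (pd i p) x := by
  have := ((((HasGrad.coord j).const_mul s).sub (N.gradb j)).mul (hasGrad_pv p)).sub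
    (hasGrad_pv (pd j p))
  have e : (fun i x => ((if i = j then s else 0) - h j i x) * pv p x + dstar s b j (pd i p) x)
      = fun i (x : E n) => (s * x j - b j x) * pv (pd i p) x
        + (s * (if i = j then 1 else 0) - h j i x) * pv p x - pv (pd i (pd j p)) x := by
    funext i x
    simp only [dstar, pd_comm i j, mul_ite, mul_one, mul_zero]
    ring
  rw [e]; exact this

theorem Nice.bochner (N : Nice s W b h l) (p : Poly n) :
    (∑ i, ∑ j, wInt W s fun x => pv (pd i (pd j p)) x ^ 2)
      + s * energy W s p p ≤ wInt W s fun x => gen s b p x ^ 2 := by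
  have e1 : (fun x => gen s b p x ^ 2)
      = fun x => ∑ i, ∑ j, dstar s b j (pd j p) x * dstar s b i (pd i p) x := by
    funext x
    simp only [gen, sq, Finset.sum_mul, Finset.mul_sum, mul_comm]
  have t1 : ∀ i j : Fin n, Tame fun x => dstar s b j (pd j p) x * dstar s b i (pd i p) x :=
    fun i j => (N.tame_dstar j _).mul (N.tame_dstar i _)
  rw [e1, N.wInt_sum _ fun i _ => Tame.sum _ fun j _ => t1 i j]
  have td : ∀ i j : Fin n, Tame fun x => (if i = j then s else 0) - h j i x := fun i j =>
    (Tame.const _).sub (N.tame_h j i)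
  have e2 : ∀ i j, wInt W s (fun x => dstar s b j (pd j p) x * dstar s b i (pd i p) x)
      = wInt W s (fun x => ((if i = j then s else 0) - h j i x) * pv (pd j p) x * pv (pd i p) x)
        + wInt W s fun x => pv (pd i (pd j p)) x ^ 2 := by
    intro i j
    have ht := ((td i j).mul (tame_pv (pd j p)))
    rw [N.ibp_dstar (N.hasGrad_dstar j _) (N.tame_dstar j _) i (ht.add (N.tame_dstar j _))]
    simp only [add_mul]
    rw [N.wInt_add (ht.mul (tame_pv _)) ((N.tame_dstar j _).mul (tame_pv _))]
    congr 1
    have := N.ibp_dstar (hasGrad_pv (pd i p)) (tame_pv _) j (tame_pv _) (pd i (pd j p))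
    rw [pd_comm j i p] at this
    simp only [sq, mul_comm (dstar s b j _ _)]
    exact this
  have t2 : ∀ i j : Fin n, Tame fun x =>
      ((if i = j then s else 0) - h j i x) * pv (pd j p) x * pv (pd i p) x :=
    fun i j => ((td i j).mul (tame_pv _)).mul (tame_pv _)
  have e3 : s * energy W s p p ≤ ∑ i, ∑ j, wInt W s (fun x =>
      ((if i = j then s else 0) - h j i x) * pv (pd j p) x * pv (pd i p) x) := by
    unfold energy
    simp only [← N.wInt_sum _ fun j _ => t2 _ j]
    rw [← N.wInt_sum _ fun i _ => Tame.sum _ fun j _ => t2 i j,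
      ← N.wInt_sum _ fun i _ => (tame_pv _).mul (tame_pv _), ← wInt_const_mul]
    refine N.wInt_mono ((Tame.const _).mul (Tame.sum _ fun i _ => (tame_pv _).mul (tame_pv _)))
      (Tame.sum _ fun i _ => Tame.sum _ fun j _ => t2 i j) fun x => ?_
    have := N.concave x fun i => pv (pd i p) x
    have e : ∑ i, ∑ j, ((if i = j then s else 0) - h j i x) * pv (pd j p) x * pv (pd i p) x
        = s * ∑ i, pv (pd i p) x * pv (pd i p) x
          - ∑ i, ∑ j, pv (pd i p) x * pv (pd j p) x * h i j x := by
      rw [Finset.sum_comm (f := fun i j => pv (pd i p) x * pv (pd j p) x * h i j x),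
        Finset.mul_sum, ← Finset.sum_sub_distrib]
      refine Finset.sum_congr rfl fun i _ => ?_
      simp only [sub_mul, Finset.sum_sub_distrib, ite_mul, zero_mul, Finset.sum_ite_eq,
        Finset.mem_univ, if_true]
      congr 1
      · ring
      · exact Finset.sum_congr rfl fun j _ => by ring
    rw [e]; linarith
  simp only [N.wInt_sum _ fun j _ => t1 _ j, e2, Finset.sum_add_distrib]
  linarith

end Gen

end SmallBall

namespace SmallBall

open scoped ENNReal NNReal Topology

section Alg

variable {n : ℕ}

/-- The Ornstein-Uhlenbeck operator (with a minus sign) acting on polynomials. -/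
def ouP (s : ℝ) (p : Poly n) : Poly n :=
  ∑ i, (s • (MvPolynomial.X i * pd i p) - pd i (pd i p))

theorem ouP_add (s : ℝ) (p q : Poly n) : ouP s (p + q) = ouP s p + ouP s q := by
  simp only [ouP, pd, map_add, mul_add, smul_add, ← Finset.sum_add_distrib]
  exact Finset.sum_congr rfl fun i _ => by abel

theorem ouP_smul (s a : ℝ) (p : Poly n) : ouP s (a • p) = a • ouP s p := by
  simp only [ouP, pd, Derivation.map_smul, Finset.smul_sum, smul_sub, mul_smul_comm, smul_comm s a]

theorem exists_ouP (s z : ℝ) (hs : 0 < s) (hz : 0 ≤ z) (p : Poly n) :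
    ∃ (u : Poly n) (c : ℝ), p = z • u + ouP s u + MvPolynomial.C c := by
  let R : Submodule ℝ (Poly n) :=
    { carrier := {p | ∃ (u : Poly n) (c : ℝ), p = z • u + ouP s u + MvPolynomial.C c}
      add_mem' := by
        rintro p q ⟨u, c, rfl⟩ ⟨v, d, rfl⟩
        refine ⟨u + v, c + d, ?_⟩
        rw [ouP_add, map_add, smul_add]; abel
      zero_mem' := ⟨0, 0, by simp [ouP]⟩
      smul_mem' := by
        rintro a p ⟨u, c, rfl⟩
        refine ⟨a • u, a * c, ?_⟩
        rw [ouP_smul, smul_add, smul_add, smul_comm z a, map_mul,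
          ← MvPolynomial.smul_eq_C_mul (MvPolynomial.C c) a] }
  have key : ∀ d : ℕ, ∀ α : Fin n →₀ ℕ, α.degree ≤ d → ∀ a : ℝ,
      MvPolynomial.monomial α a ∈ R := by
    intro d
    induction d with
    | zero =>
      intro α hα a
      have : α = 0 := (Finsupp.degree_eq_zero_iff α).1 (Nat.le_zero.1 hα)
      subst this
      exact ⟨0, a, by simp [ouP]⟩
    | succ d ih =>
      intro α hα a
      rcases Nat.lt_or_ge d α.degree with hd | hd
      swap
      · exact ih α hd a
      have hdeg : α.degree = d + 1 := le_antisymm hα hd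
      set m : Poly n := MvPolynomial.monomial α a with hm
      have h1 : ∑ i, MvPolynomial.X i * pd i m = ((d + 1 : ℕ) : ℝ) • m := by
        have := (MvPolynomial.isHomogeneous_monomial a hdeg).sum_X_mul_pderiv
        rw [Nat.cast_smul_eq_nsmul]
        exact this
      have h2 : ∑ i, pd i (pd i m) ∈ R := by
        refine R.sum_mem fun i _ => ?_
        simp only [pd, hm, MvPolynomial.pderiv_monomial]
        rcases Nat.eq_zero_or_pos (α i) with h0 | h0
        · simp [h0]
        · refine ih _ ?_ _
          have hle : Finsupp.single i 1 ≤ α := by simpa [Nat.one_le_iff_ne_zero, Nat.pos_iff_ne_zero] using h0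
          have e : (α - Finsupp.single i 1).degree + 1 = α.degree := by
            conv_rhs => rw [← tsub_add_cancel_of_le hle]
            simp
          have e2 : (α - Finsupp.single i 1 - Finsupp.single i 1).degree
              ≤ (α - Finsupp.single i 1).degree :=
            Finsupp.degree_mono tsub_le_self
          omega
      have h3 : ouP s m = (s * ((d + 1 : ℕ) : ℝ)) • m - ∑ i, pd i (pd i m) := by
        rw [ouP, Finset.sum_sub_distrib, ← Finset.smul_sum, h1, smul_smul]
      have h4 : z • m + ouP s m ∈ R := ⟨m, 0, by simp⟩
      have hpos : 0 < z + s * ((d + 1 : ℕ) : ℝ) := by positivity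
      have h5 : (z + s * ((d + 1 : ℕ) : ℝ)) • m ∈ R := by
        have := R.add_mem h4 h2
        rw [h3] at this
        convert this using 1
        rw [add_smul]; abel
      have h6 := R.smul_mem (z + s * ((d + 1 : ℕ) : ℝ))⁻¹ h5
      rwa [smul_smul, inv_mul_cancel₀ hpos.ne', one_smul] at h6
  have : p ∈ R := by
    rw [MvPolynomial.as_sum p]
    exact R.sum_mem fun α _ => key _ α le_rfl _
  exact this

theorem exists_ouP_of_pos (s z : ℝ) (hs : 0 < s) (hz : 0 < z) (p : Poly n) :
    ∃ u : Poly n, p = z • u + ouP s u := by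
  obtain ⟨u, c, h⟩ := exists_ouP s z hs hz.le p
  refine ⟨u + MvPolynomial.C (c / z), ?_⟩
  have : ouP s (MvPolynomial.C (c / z) : Poly n) = 0 := by simp [ouP, pd]
  rw [ouP_add, this, smul_add, MvPolynomial.smul_eq_C_mul (MvPolynomial.C _) z,
    ← map_mul, mul_div_cancel₀ _ hz.ne', add_zero, add_right_comm, ← h]

end Alg

section Gauss

variable {n : ℕ}

theorem exists_gauss_const (s : ℝ) (hs : 0 < s) :
    ∃ c : ℝ, Nice (n := n) s (fun _ => c) (fun _ _ => 0) (fun _ _ _ => 0) |c| := by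
  have hI := integrable_exp_neg_sq (n := n) (half_pos hs)
  have hp : 0 < ∫ x : E n, Real.exp (-(s / 2) * ‖x‖ ^ 2) := by
    rw [GaussianFourier.integral_rexp_neg_mul_sq_norm (half_pos hs)]
    positivity
  refine ⟨-Real.log (∫ x : E n, Real.exp (-(s / 2) * ‖x‖ ^ 2)), hs, HasGrad.const _,
    fun i => HasGrad.const _, fun _ _ => continuous_const, fun _ => le_abs_self _,
    fun _ _ => by simp, fun _ _ _ => by simp, fun _ _ => by simp, ?_⟩
  simp only [sub_eq_add_neg, Real.exp_add, ← neg_mul]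
  rw [integral_const_mul, Real.exp_neg, Real.exp_log hp, inv_mul_cancel₀ hp.ne']

theorem gen_zero_eq (s : ℝ) (p : Poly n) : gen s (fun _ _ => 0) p = pv (ouP s p) := by
  funext x
  simp only [gen, dstar, ouP, pv_sum, pv_sub, pv_smul, pv_mul, pv_X, sub_zero, mul_assoc]

end Gauss

section Op

variable {n : ℕ} {s : ℝ} {W : E n → ℝ} {b : Fin n → E n → ℝ}
    {h : Fin n → Fin n → E n → ℝ} {l : ℝ}

theorem gen_add (p q : Poly n) (x : E n) : gen s b (p + q) x = gen s b p x + gen s b q x := by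
  simp only [gen, dstar, pd, map_add, pv_add, ← Finset.sum_add_distrib]
  exact Finset.sum_congr rfl fun i _ => by ring

theorem gen_C (a : ℝ) (x : E n) : gen s b (MvPolynomial.C a : Poly n) x = 0 := by
  simp [gen, dstar, pd]

theorem Nice.wInt_gen (N : Nice s W b h l) (p : Poly n) : wInt W s (gen s b p) = 0 := by
  have := N.gen_pair p 1
  simp only [pv_one, mul_one] at this
  rw [show wInt W s (gen s b p) = wInt W s (fun x => gen s b p x) from rfl, this]
  simp [energy, pd, wInt]

theorem energy_nonneg (p : Poly n) : 0 ≤ energy W s p p :=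
  Finset.sum_nonneg fun _ _ => wInt_nonneg fun _ => mul_self_nonneg _

theorem Nice.tame_op (N : Nice s W b h l) (z : ℝ) (p : Poly n) :
    Tame fun x => z * pv p x + gen s b p x :=
  ((Tame.const z).mul (tame_pv p)).add (N.tame_gen p)

theorem Nice.sq_op (N : Nice s W b h l) (z : ℝ) (p : Poly n) :
    wInt W s (fun x => (z * pv p x + gen s b p x) ^ 2)
      = z ^ 2 * wInt W s (fun x => pv p x ^ 2) + 2 * z * energy W s p p
        + wInt W s fun x => gen s b p x ^ 2 := by
  have e : (fun x => (z * pv p x + gen s b p x) ^ 2) = fun x =>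
      (z ^ 2 * pv p x ^ 2 + 2 * z * (gen s b p x * pv p x)) + gen s b p x ^ 2 := by
    funext x; ring
  have t := tame_pv p
  have g := N.tame_gen p
  rw [e, N.wInt_add (((Tame.const _).mul (t.pow 2)).add ((Tame.const _).mul (g.mul t))) (g.pow 2),
    N.wInt_add ((Tame.const _).mul (t.pow 2)) ((Tame.const _).mul (g.mul t)), wInt_const_mul,
    wInt_const_mul, N.gen_pair]

/-- Cauchy-Schwarz against the constant function. -/
theorem Nice.sq_wInt_le (N : Nice s W b h l) {F : E n → ℝ} (hF : Tame F) :
    wInt W s F ^ 2 ≤ wInt W s fun x => F x ^ 2 := by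
  set a := wInt W s F with ha
  have h0 : 0 ≤ wInt W s fun x => (F x - a) ^ 2 := wInt_nonneg fun x => sq_nonneg _
  have e : (fun x => (F x - a) ^ 2) = fun x => (F x ^ 2 - 2 * a * F x) + a ^ 2 := by
    funext x; ring
  rw [e, N.wInt_add ((hF.pow 2).sub ((Tame.const _).mul hF)) (Tame.const _),
    N.wInt_sub (hF.pow 2) ((Tame.const _).mul hF), wInt_const_mul, N.wInt_const, ← ha] at h0
  linarith

theorem Nice.sq_add_le (N : Nice s W b h l) {F G : E n → ℝ} (hF : Tame F) (hG : Tame G) {t : ℝ}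
    (ht : 0 < t) : wInt W s (fun x => (F x + G x) ^ 2)
      ≤ (1 + t) * wInt W s (fun x => F x ^ 2) + (1 + t⁻¹) * wInt W s fun x => G x ^ 2 := by
  rw [← wInt_const_mul, ← wInt_const_mul,
    ← N.wInt_add ((Tame.const _).mul (hF.pow 2)) ((Tame.const _).mul (hG.pow 2))]
  refine N.wInt_mono ((hF.add hG).pow 2)
    (((Tame.const _).mul (hF.pow 2)).add ((Tame.const _).mul (hG.pow 2))) fun x => ?_
  have : (1 + t) * F x ^ 2 + (1 + t⁻¹) * G x ^ 2 - (F x + G x) ^ 2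
      = (t * F x - G x) ^ 2 * t⁻¹ := by field_simp; ring
  have h2 : 0 ≤ (t * F x - G x) ^ 2 * t⁻¹ := by positivity
  linarith

/-- If each residual can be reduced by a fixed factor, it can be made arbitrarily small. -/
theorem iterate_residual (z θ : ℝ) (h0 : 0 ≤ θ) (h1 : θ < 1)
    (Good : (E n → ℝ) → Prop)
    (hG : ∀ F p, Good F → Good fun x => F x - (z * pv p x + gen s b p x))
    (step : ∀ F, Good F → ∀ η > 0, ∃ p : Poly n,
      wInt W s (fun x => (F x - (z * pv p x + gen s b p x)) ^ 2)
        ≤ θ * wInt W s (fun x => F x ^ 2) + η)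
    (F : E n → ℝ) (hF : Good F) (η : ℝ) (hη : 0 < η) :
    ∃ p : Poly n, wInt W s (fun x => (F x - (z * pv p x + gen s b p x)) ^ 2) ≤ η := by
  have hθ : 0 < 1 - θ := by linarith
  have key : ∀ k : ℕ, ∃ p : Poly n,
      wInt W s (fun x => (F x - (z * pv p x + gen s b p x)) ^ 2)
        ≤ θ ^ k * wInt W s (fun x => F x ^ 2) + η / 2 := by
    intro k
    induction k with
    | zero =>
      refine ⟨0, ?_⟩
      have : ∀ x, gen s b (0 : Poly n) x = 0 := fun x => by
        simpa using gen_C (s := s) (b := b) 0 x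
      simp [this]; positivity
    | succ k ih =>
      obtain ⟨p, hp⟩ := ih
      obtain ⟨q, hq⟩ := step _ (hG F p hF) ((1 - θ) * (η / 2)) (by positivity)
      refine ⟨p + q, ?_⟩
      have e : (fun x => (F x - (z * pv (p + q) x + gen s b (p + q) x)) ^ 2)
          = fun x => (F x - (z * pv p x + gen s b p x) - (z * pv q x + gen s b q x)) ^ 2 := by
        funext x; rw [gen_add, pv_add]; ring
      rw [e]
      have := mul_le_mul_of_nonneg_left hp h0
      rw [pow_succ]
      linarith
  have hlim := (tendsto_pow_atTop_nhds_zero_of_lt_one h0 h1).mul_const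
    (wInt W s (fun x => F x ^ 2))
  rw [zero_mul] at hlim
  obtain ⟨k, hk⟩ := (hlim.eventually (gt_mem_nhds (half_pos hη))).exists
  obtain ⟨p, hp⟩ := key k
  exact ⟨p, by linarith⟩

end Op

end SmallBall

namespace SmallBall

open scoped ENNReal NNReal Topology

section Density

variable {n : ℕ}

theorem ae_zero_of_moments {k : E n → ℝ} (hk : ∀ c : ℝ, Integrable fun x => k x * Real.exp (c * ‖x‖))
    (h0 : ∀ p : Poly n, ∫ x, k x * pv p x = 0) : k =ᵐ[volume] 0 := by
  have hInt : Integrable k := by simpa using hk 0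
  have hch : ∀ t : E n, ∫ x, (k x : ℂ) * Complex.exp (inner ℝ x t * Complex.I) = 0 := by
    intro t
    have hs := hasSum_integral_of_dominated_convergence (μ := (volume : Measure (E n)))
      (F := fun (m : ℕ) (x : E n) => (k x : ℂ) *
        ((m.factorial : ℂ)⁻¹ * ((inner ℝ x t : ℝ) * Complex.I) ^ m))
      (f := fun x => (k x : ℂ) * Complex.exp (inner ℝ x t * Complex.I))
      (bound := fun m x => |k x| * ((m.factorial : ℝ)⁻¹ * (‖t‖ * ‖x‖) ^ m))
      (fun m => by
        refine (Complex.continuous_ofReal.comp_aestronglyMeasurable hInt.1).mul ?_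
        exact Continuous.aestronglyMeasurable (by fun_prop))
      (fun m => Filter.Eventually.of_forall fun x => by
        simp only [norm_mul, norm_inv, norm_pow, Complex.norm_real, Complex.norm_natCast,
          Complex.norm_I, mul_one, Real.norm_eq_abs]
        gcongr
        rw [mul_comm]
        exact abs_real_inner_le_norm x t)
      (Filter.Eventually.of_forall fun x => by
        refine Summable.mul_left _ ?_
        have := Real.summable_pow_div_factorial (‖t‖ * ‖x‖)
        simpa [div_eq_inv_mul] using this)
      (by
        refine (hk ‖t‖).norm.congr (Filter.Eventually.of_forall fun x => ?_)
        simp only [norm_mul, Real.norm_eq_abs, Real.abs_exp]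
        rw [tsum_mul_left]
        congr 1
        rw [Real.exp_eq_exp_ℝ, NormedSpace.exp_eq_tsum_div]
        simp only [div_eq_inv_mul])
      (Filter.Eventually.of_forall fun x => by
        refine HasSum.mul_left _ ?_
        have := NormedSpace.expSeries_div_hasSum_exp ((inner ℝ x t : ℝ) * Complex.I)
        rw [← Complex.exp_eq_exp_ℂ] at this
        simpa [div_eq_inv_mul] using this)
    have hz : ∀ m : ℕ, ∫ x, (k x : ℂ) *
        ((m.factorial : ℂ)⁻¹ * ((inner ℝ x t : ℝ) * Complex.I) ^ m) = 0 := by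
      intro m
      have h1 := h0 ((∑ i, t i • MvPolynomial.X i) ^ m)
      have h2 : ∀ x, pv ((∑ i, t i • (MvPolynomial.X i : Poly n)) ^ m) x = (inner ℝ x t) ^ m := by
        intro x
        have : pv (∑ i, t i • (MvPolynomial.X i : Poly n)) x = inner ℝ x t := by
          simp [PiLp.inner_apply]
        rw [← this]; simp [pv]
      simp only [h2] at h1
      have h3 : ∀ x, (k x : ℂ) * ((m.factorial : ℂ)⁻¹ * ((inner ℝ x t : ℝ) * Complex.I) ^ m)
          = ((m.factorial : ℂ)⁻¹ * Complex.I ^ m) * ((k x * (inner ℝ x t) ^ m : ℝ) : ℂ) := by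
        intro x; push_cast; ring
      simp only [h3]
      rw [integral_const_mul, integral_complex_ofReal, h1]
      simp
    simp only [hz] at hs
    exact hs.unique hasSum_zero
  set μ₁ : Measure (E n) := volume.withDensity fun x => ENNReal.ofReal (k x) with hμ₁
  set μ₂ : Measure (E n) := volume.withDensity fun x => ENNReal.ofReal (- k x) with hμ₂
  have m1 : AEMeasurable (fun x => ENNReal.ofReal (k x)) (volume : Measure (E n)) :=
    hInt.1.aemeasurable.ennreal_ofReal
  have m2 : AEMeasurable (fun x => ENNReal.ofReal (- k x)) (volume : Measure (E n)) :=
    hInt.1.aemeasurable.neg.ennreal_ofReal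
  have f1 : IsFiniteMeasure μ₁ := isFiniteMeasure_withDensity_ofReal hInt.2
  have f2 : IsFiniteMeasure μ₂ := isFiniteMeasure_withDensity_ofReal hInt.neg.2
  have heq : μ₁ = μ₂ := by
    apply Measure.ext_of_charFun
    funext t
    rw [charFun_apply, charFun_apply, hμ₁, hμ₂,
      integral_withDensity_eq_integral_toReal_smul₀ m1 (by simp),
      integral_withDensity_eq_integral_toReal_smul₀ m2 (by simp), ← sub_eq_zero]
    have hb : ∀ f : E n → ℝ, Integrable f → Integrable fun x =>
        f x • Complex.exp (inner ℝ x t * Complex.I) := by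
      intro f hf
      refine Integrable.mono' hf.norm (hf.1.smul (Continuous.aestronglyMeasurable (by fun_prop)))
        (Filter.Eventually.of_forall fun x => ?_)
      rw [norm_smul, Complex.norm_exp_ofReal_mul_I, mul_one]
    rw [← integral_sub (hb _ ?_) (hb _ ?_), ← hch t]
    · congr 1
      funext x
      rw [← sub_smul, ENNReal.toReal_ofReal', ENNReal.toReal_ofReal']
      have : max (k x) 0 - max (-k x) 0 = k x := by
        rcases le_total 0 (k x) with h | h
        · rw [max_eq_left h, max_eq_right (by linarith)]; ring
        · rw [max_eq_right h, max_eq_left (by linarith)]; ring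
      rw [this, Complex.real_smul]
    · simpa [ENNReal.toReal_ofReal'] using hInt.pos_part
    · simpa [ENNReal.toReal_ofReal'] using hInt.neg_part
  have := (withDensity_eq_iff_of_sigmaFinite m1 m2).1 heq
  filter_upwards [this] with x hx
  have h1 := congrArg ENNReal.toReal hx
  rw [ENNReal.toReal_ofReal', ENNReal.toReal_ofReal'] at h1
  rcases le_total 0 (k x) with h | h
  · rw [max_eq_left h, max_eq_right (by linarith)] at h1; exact h1
  · rw [max_eq_right h, max_eq_left (by linarith)] at h1; simp; linarith

theorem dense_of_orthogonal {α : Type*} [MeasurableSpace α] {μ : Measure α}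
    (S : Submodule ℝ (α → ℝ)) (hS : ∀ f ∈ S, MemLp f 2 μ)
    (h : ∀ g : α → ℝ, MemLp g 2 μ → (∀ f ∈ S, ∫ x, g x * f x ∂μ = 0) → g =ᵐ[μ] 0)
    {F : α → ℝ} (hF : MemLp F 2 μ) {η : ℝ} (hη : 0 < η) :
    ∃ f ∈ S, ∫ x, (F x - f x) ^ 2 ∂μ ≤ η := by
  let Φ : S →ₗ[ℝ] Lp ℝ 2 μ :=
    { toFun := fun f => (hS f f.2).toLp f
      map_add' := fun _ _ => rfl
      map_smul' := fun _ _ => rfl }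
  let K := LinearMap.range Φ
  have hK : K.topologicalClosure = ⊤ := by
    rw [Submodule.topologicalClosure_eq_top_iff, Submodule.eq_bot_iff]
    intro g hg
    rw [Lp.eq_zero_iff_ae_eq_zero]
    refine h g (Lp.memLp g) fun f hf => ?_
    have h1 := (Submodule.mem_orthogonal' K g).1 hg _ ⟨⟨f, hf⟩, rfl⟩
    rw [L2.inner_def] at h1
    rw [← h1]
    refine integral_congr_ae ?_
    filter_upwards [(hS f hf).coeFn_toLp] with x hx
    change _ = inner ℝ (g x) ((hS f hf).toLp f x)
    rw [hx]
    simp only [RCLike.inner_apply, conj_trivial]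
    ring
  have hmem : hF.toLp F ∈ closure (K : Set (Lp ℝ 2 μ)) := by
    have : hF.toLp F ∈ K.topologicalClosure := by rw [hK]; trivial
    exact this
  obtain ⟨_, ⟨q, rfl⟩, hq⟩ := Metric.mem_closure_iff.1 hmem (Real.sqrt η) (Real.sqrt_pos.2 hη)
  refine ⟨q, q.2, ?_⟩
  have h2 : hF.toLp F - Φ q = (hF.sub (hS q q.2)).toLp (F - (q : α → ℝ)) := rfl
  rw [dist_eq_norm, h2] at hq
  have h1 : ‖(hF.sub (hS q q.2)).toLp (F - (q : α → ℝ))‖ ^ 2 = ∫ x, (F x - (q : α → ℝ) x) ^ 2 ∂μ := by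
    rw [← real_inner_self_eq_norm_sq, L2.inner_def]
    refine integral_congr_ae ?_
    filter_upwards [(hF.sub (hS q q.2)).coeFn_toLp] with x hx
    rw [hx]
    simp only [RCLike.inner_apply, conj_trivial, Pi.sub_apply]
    ring
  rw [← h1, ← Real.sq_sqrt hη.le]
  exact pow_le_pow_left₀ (norm_nonneg _) hq.le 2

theorem gauss_dense {s c : ℝ} (hs : 0 < s) {F : E n → ℝ} (hF : Tame F) {η : ℝ} (hη : 0 < η) :
    ∃ q : Poly n, wInt (fun _ : E n => c) s (fun x => (F x - pv q x) ^ 2) ≤ η := by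
  let σ : E n → ℝ := fun x => Real.exp ((c - s / 2 * ‖x‖ ^ 2) / 2)
  have hσ : ∀ x, σ x ^ 2 = Real.exp (c - s / 2 * ‖x‖ ^ 2) := fun x => by
    simp only [σ, sq]; rw [← Real.exp_add]; congr 1; ring
  have σc : Continuous σ := by fun_prop
  have hL : ∀ {G : E n → ℝ}, Tame G → MemLp (fun x => G x * σ x) 2 (volume : Measure (E n)) := by
    intro G hG
    refine (memLp_two_iff_integrable_sq (hG.1.mul σc).aestronglyMeasurable).2 ?_
    refine (((hG.pow 2).integrable_gauss (half_pos hs)).const_mul (Real.exp c)).congr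
      (Filter.Eventually.of_forall fun x => ?_)
    simp only [Pi.mul_apply]
    rw [mul_pow, hσ, sub_eq_add_neg, Real.exp_add, neg_mul]; ring
  let S : Submodule ℝ (E n → ℝ) :=
    { carrier := {g | ∃ p : Poly n, g = fun x => pv p x * σ x}
      add_mem' := by
        rintro _ _ ⟨p, rfl⟩ ⟨q, rfl⟩
        exact ⟨p + q, by funext x; simp [add_mul]⟩
      zero_mem' := ⟨0, by funext x; simp⟩
      smul_mem' := by
        rintro a _ ⟨p, rfl⟩
        exact ⟨a • p, by funext x; simp [mul_assoc]⟩ }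
  obtain ⟨_, ⟨q, rfl⟩, hq⟩ := dense_of_orthogonal S (by rintro _ ⟨p, rfl⟩; exact hL (tame_pv p))
    (fun g gL h0 => by
      have h2 := ae_zero_of_moments (k := fun x => g x * σ x) (fun a => by
        have tm : Tame fun x : E n => Real.exp (a * ‖x‖) :=
          ⟨by fun_prop, 1, |a|, zero_le_one, abs_nonneg _, fun x => by
            rw [Real.abs_exp, one_mul]; gcongr; exact le_abs_self a⟩
        have := gL.integrable_mul (hL tm)
        refine this.congr (Filter.Eventually.of_forall fun x => ?_)
        simp only [Pi.mul_apply]; ring) (fun p => by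
          rw [← h0 _ ⟨p, rfl⟩]
          congr 1; funext x; ring)
      filter_upwards [h2] with x hx
      have hp : σ x ≠ 0 := (Real.exp_pos _).ne'
      simpa [hp] using hx) (hL hF) hη
  refine ⟨q, le_of_eq_of_le ?_ hq⟩
  unfold wInt
  congr 1
  funext x
  rw [← hσ]; ring

end Density

end SmallBall

namespace SmallBall

open scoped ENNReal NNReal Topology

section Solve

variable {n : ℕ} {s : ℝ} {W : E n → ℝ} {b : Fin n → E n → ℝ}
    {h : Fin n → Fin n → E n → ℝ} {l : ℝ}

theorem Nice.two_energy_le (N : Nice s W b h l) (u p : Poly n) {t : ℝ} (ht : 0 < t) :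
    2 * energy W s u p ≤ t * energy W s u u + t⁻¹ * energy W s p p := by
  simp only [energy, Finset.mul_sum, ← Finset.sum_add_distrib]
  refine Finset.sum_le_sum fun i _ => ?_
  have tu := tame_pv (pd i u)
  have tp := tame_pv (pd i p)
  rw [← wInt_const_mul, ← wInt_const_mul, ← wInt_const_mul,
    ← N.wInt_add ((Tame.const _).mul (tu.mul tu)) ((Tame.const _).mul (tp.mul tp))]
  refine N.wInt_mono ((Tame.const _).mul (tu.mul tp))
    (((Tame.const _).mul (tu.mul tu)).add ((Tame.const _).mul (tp.mul tp))) fun x => ?_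
  have : t * (pv (pd i u) x * pv (pd i u) x) + t⁻¹ * (pv (pd i p) x * pv (pd i p) x)
      - 2 * (pv (pd i u) x * pv (pd i p) x)
      = (t * pv (pd i u) x - pv (pd i p) x) ^ 2 * t⁻¹ := by field_simp; ring
  have h2 : 0 ≤ (t * pv (pd i u) x - pv (pd i p) x) ^ 2 * t⁻¹ := by positivity
  linarith

theorem energy_sub_C (u p : Poly n) (c : ℝ) :
    energy W s u (p - MvPolynomial.C c) = energy W s u p := by
  simp [energy, pd]

theorem energy_sub_C_self (p : Poly n) (c : ℝ) :
    energy W s (p - MvPolynomial.C c) (p - MvPolynomial.C c) = energy W s p p := by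
  simp [energy, pd]

theorem Nice.bochner_le (N : Nice s W b h l) (p : Poly n) :
    s * energy W s p p ≤ wInt W s fun x => gen s b p x ^ 2 := by
  have h1 := N.bochner p
  have h2 : 0 ≤ ∑ i, ∑ j, wInt W s fun x => pv (pd i (pd j p)) x ^ 2 :=
    Finset.sum_nonneg fun i _ => Finset.sum_nonneg fun j _ => wInt_nonneg fun x => sq_nonneg _
  linarith

theorem gauss_poincare {c : ℝ} (N : Nice (n := n) s (fun _ => c) (fun _ _ => 0) (fun _ _ _ => 0) l)
    (p : Poly n) :
    wInt (fun _ => c) s (fun x => (pv p x - wInt (fun _ => c) s (pv p)) ^ 2)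
      ≤ energy (fun _ => c) s p p / s := by
  have hs := N.s_pos
  obtain ⟨u, m, hu⟩ := exists_ouP s 0 hs le_rfl p
  have e1 : pv p = fun x => gen s (fun _ _ => 0) u x + m := by
    rw [gen_zero_eq]
    funext x
    rw [hu]; simp
  have e2 : wInt (fun _ => c) s (pv p) = m := by
    rw [e1, N.wInt_add (N.tame_gen u) (Tame.const m), N.wInt_const]
    have := N.wInt_gen u
    rw [show wInt (fun _ => c) s (fun x => gen s (fun _ _ => 0) u x) = 0 from this, zero_add]
  have e3 : (fun x => (pv p x - wInt (fun _ => c) s (pv p)) ^ 2)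
      = fun x => gen s (fun _ _ => 0) u x ^ 2 := by
    rw [e2]; funext x; rw [e1]; ring
  have e4 : (fun x => gen s (fun _ _ => 0) u x ^ 2)
      = fun x => gen s (fun _ _ => 0) u x * pv (p - MvPolynomial.C m) x := by
    funext x; rw [pv_sub, pv_C, e1]; ring
  have h1 := N.bochner_le u
  have h2 := N.gen_pair u (p - MvPolynomial.C m)
  rw [← e4, energy_sub_C] at h2
  have h3 := N.two_energy_le u p hs
  rw [e3, div_eq_inv_mul]
  linarith

theorem Nice.wInt_le_of_le (N : Nice s W b h l) {W' : E n → ℝ} {s' : ℝ} {b' h' l'}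
    (N' : Nice s' W' b' h' l') {M : ℝ}
    (hM : ∀ x, Real.exp (W x - s / 2 * ‖x‖ ^ 2) ≤ M * Real.exp (W' x - s' / 2 * ‖x‖ ^ 2))
    {F : E n → ℝ} (hF : Tame F) (h0 : ∀ x, 0 ≤ F x) :
    wInt W s F ≤ M * wInt W' s' F := by
  unfold wInt
  rw [← integral_const_mul]
  refine integral_mono (N.integrable hF) ((N'.integrable hF).const_mul M) fun x => ?_
  have := mul_le_mul_of_nonneg_left (hM x) (h0 x)
  simp only
  linarith

theorem gen_eq_sub (p : Poly n) (x : E n) :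
    gen s b p x = gen s (fun _ _ => 0) p x - ∑ i, b i x * pv (pd i p) x := by
  simp only [gen, dstar, ← Finset.sum_sub_distrib]
  exact Finset.sum_congr rfl fun i _ => by ring

theorem Nice.dense_op (N : Nice s W b h l) : ∃ z > 0, ∀ F : E n → ℝ, Tame F → ∀ η > 0,
    ∃ p : Poly n, wInt W s (fun x => (F x - (z * pv p x + gen s b p x)) ^ 2) ≤ η := by
  have hs := N.s_pos
  obtain ⟨c, N0⟩ := exists_gauss_const (n := n) s hs
  set z : ℝ := 8 * (n * l ^ 2) + 1 with hz
  have hz0 : 0 < z := by positivity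
  refine ⟨z, hz0, fun F hF η hη => ?_⟩
  have hM : ∀ x, Real.exp (W x - s / 2 * ‖x‖ ^ 2)
      ≤ Real.exp (l - c) * Real.exp (c - s / 2 * ‖x‖ ^ 2) := fun x => by
    rw [← Real.exp_add]; apply Real.exp_le_exp.2; linarith [N.W_le x]
  obtain ⟨p, hp⟩ := iterate_residual (W := fun _ : E n => c) (s := s) (b := b) z (1 / 2)
    (by norm_num) (by norm_num) Tame (fun F p hF => hF.sub (N.tame_op z p)) (by
      intro F hF η hη
      obtain ⟨q, hq⟩ := gauss_dense (c := c) hs hF (η := η / 3) (by positivity)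
      obtain ⟨v, hv⟩ := exists_ouP_of_pos s z hs hz0 q
      refine ⟨v, ?_⟩
      have tq := tame_pv q
      have tB : Tame fun x => ∑ i, b i x * pv (pd i v) x :=
        Tame.sum _ fun i _ => (N.tame_b i).mul (tame_pv _)
      have eq1 : ∀ x, pv q x = z * pv v x + gen s (fun _ _ => 0) v x := by
        intro x; rw [hv, gen_zero_eq]; simp
      have e1 : (fun x => (F x - (z * pv v x + gen s b v x)) ^ 2)
          = fun x => ((F x - pv q x) + ∑ i, b i x * pv (pd i v) x) ^ 2 := by
        funext x; rw [gen_eq_sub, eq1]; ring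
      have h1 := N0.sq_add_le (hF.sub tq) tB one_pos
      have h2 : wInt (fun _ => c) s (fun x => (∑ i, b i x * pv (pd i v) x) ^ 2)
          ≤ (n * l ^ 2) * energy (fun _ => c) s v v := by
        unfold energy
        have td : ∀ i ∈ Finset.univ, Tame fun x => pv (pd i v) x * pv (pd i v) x :=
          fun i _ => (tame_pv _).mul (tame_pv _)
        rw [← N0.wInt_sum _ td, ← wInt_const_mul]
        refine N0.wInt_mono (tB.pow 2) ((Tame.const _).mul (Tame.sum _ td)) fun x => ?_
        refine (Finset.sum_mul_sq_le_sq_mul_sq _ _ _).trans ?_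
        simp only [← sq]
        refine mul_le_mul_of_nonneg_right ?_ (Finset.sum_nonneg fun i _ => sq_nonneg _)
        calc ∑ i, b i x ^ 2 ≤ ∑ i : Fin n, l ^ 2 := Finset.sum_le_sum fun i _ => by
              rw [← sq_abs]; exact pow_le_pow_left₀ (abs_nonneg _) (N.b_le i x) 2
          _ = n * l ^ 2 := by simp
      have h3 := N0.sq_op z v
      simp only [← eq1] at h3
      have h4 : 0 ≤ wInt (fun _ => c) s (fun x => pv v x ^ 2) := wInt_nonneg fun x => sq_nonneg _
      have h5 : 0 ≤ wInt (fun _ => c) s (fun x => gen s (fun _ _ => 0) v x ^ 2) :=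
        wInt_nonneg fun x => sq_nonneg _
      have h6 := N0.sq_add_le hF (tq.sub hF) one_pos
      have e6 : (fun x => (F x + (pv q x - F x)) ^ 2) = fun x => pv q x ^ 2 := by
        funext x; ring
      have e7 : (fun x => (pv q x - F x) ^ 2) = fun x => (F x - pv q x) ^ 2 := by
        funext x; ring
      rw [e6, e7] at h6
      rw [e1]
      set e := energy (fun _ => c) s v v with he
      have he0 : 0 ≤ e := energy_nonneg v
      have h8 : 0 ≤ z ^ 2 * wInt (fun _ => c) s (fun x => pv v x ^ 2) := by positivity
      have h9 : 16 * ((n * l ^ 2) * e) ≤ wInt (fun _ => c) s (fun x => pv q x ^ 2) := by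
        have : 2 * z * e = 16 * ((n * l ^ 2) * e) + 2 * e := by rw [hz]; ring
        linarith
      have h10 : 0 ≤ wInt (fun _ => c) s (fun x => F x ^ 2) := wInt_nonneg fun x => sq_nonneg _
      norm_num at h1 h6
      linarith) F hF (η / Real.exp (l - c)) (by positivity)
  refine ⟨p, ?_⟩
  have := N.wInt_le_of_le N0 hM ((hF.sub (N.tame_op z p)).pow 2) fun x => sq_nonneg _
  refine this.trans ?_
  rwa [le_div_iff₀ (Real.exp_pos _), mul_comm] at hp

theorem Nice.var_eq (N : Nice s W b h l) {F : E n → ℝ} (hF : Tame F) (a : ℝ) :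
    wInt W s (fun x => (F x - a) ^ 2)
      = wInt W s (fun x => F x ^ 2) - 2 * a * wInt W s F + a ^ 2 := by
  have e : (fun x => (F x - a) ^ 2) = fun x => (F x ^ 2 - 2 * a * F x) + a ^ 2 := by
    funext x; ring
  rw [e, N.wInt_add ((hF.pow 2).sub ((Tame.const _).mul hF)) (Tame.const _),
    N.wInt_sub (hF.pow 2) ((Tame.const _).mul hF), wInt_const_mul, N.wInt_const]

theorem Nice.moment_le (N : Nice s W b h l) : ∃ A > 0, ∀ p : Poly n,
    wInt W s (fun x => ‖x‖ ^ 2 * pv p x ^ 2)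
      ≤ A * (wInt W s (fun x => pv p x ^ 2) + energy W s p p) := by
  have hs := N.s_pos
  refine ⟨2 / s * (n * (l ^ 2 / s + 1) + 4 / s), by positivity, fun p => ?_⟩
  have tp := tame_pv p
  have hi : ∀ i : Fin n, s / 2 * wInt W s (fun x => x i * x i * pv p x ^ 2)
      ≤ (l ^ 2 / s + 1) * wInt W s (fun x => pv p x ^ 2)
        + 4 / s * wInt W s (fun x => pv (pd i p) x * pv (pd i p) x) := by
    intro i
    have tx := Tame.coord (n := n) i
    have td := tame_pv (pd i p)
    have hg := (HasGrad.coord i).mul (hasGrad_pv p)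
    have tg : Tame fun x => x i * pv (pd i p) x + (if i = i then (1 : ℝ) else 0) * pv p x := by
      simpa using (tx.mul td).add tp
    have h1 := N.ibp_dstar hg (tx.mul tp) i tg p
    have t1 : Tame fun x => x i * pv p x * dstar s b i p x := (tx.mul tp).mul (N.tame_dstar i p)
    have h2 := N.wInt_sub t1 (tg.mul tp)
    rw [h1, sub_self] at h2
    have t2 : Tame fun x => x i * x i * pv p x ^ 2 := (tx.mul tx).mul (tp.pow 2)
    have t3 : Tame fun x => pv (pd i p) x * pv (pd i p) x := td.mul td
    have h3 : wInt W s (fun x => s / 2 * (x i * x i * pv p x ^ 2))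
        ≤ wInt W s (fun x => (x i * pv p x * dstar s b i p x
            - (x i * pv (pd i p) x + (if i = i then (1 : ℝ) else 0) * pv p x) * pv p x)
          + ((l ^ 2 / s + 1) * pv p x ^ 2 + 4 / s * (pv (pd i p) x * pv (pd i p) x))) := by
      refine N.wInt_mono ((Tame.const _).mul t2) ((t1.sub (tg.mul tp)).add
        (((Tame.const _).mul (tp.pow 2)).add ((Tame.const _).mul t3))) fun x => ?_
      simp only [dstar, if_true, one_mul]
      set y := x i
      set q := pv p x
      set d := pv (pd i p) x
      set β := b i x
      have hβ : β ^ 2 ≤ l ^ 2 := by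
        rw [← sq_abs]; exact pow_le_pow_left₀ (abs_nonneg _) (N.b_le i x) 2
      have k1 : 0 ≤ (s * y / 2 - β) ^ 2 * q ^ 2 / s := by positivity
      have k2 : 0 ≤ (s * y * q / 2 - 2 * d) ^ 2 / s := by positivity
      have k3 : 0 ≤ (l ^ 2 - β ^ 2) * q ^ 2 / s := by
        have : 0 ≤ l ^ 2 - β ^ 2 := by linarith
        positivity
      have e1 : (s * y / 2 - β) ^ 2 * q ^ 2 / s
          = s * y ^ 2 * q ^ 2 / 4 - y * β * q ^ 2 + β ^ 2 * q ^ 2 / s := by field_simp; ring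
      have e2 : (s * y * q / 2 - 2 * d) ^ 2 / s
          = s * y ^ 2 * q ^ 2 / 4 - 2 * y * q * d + 4 * d ^ 2 / s := by field_simp; ring
      have e3 : (l ^ 2 - β ^ 2) * q ^ 2 / s = l ^ 2 / s * q ^ 2 - β ^ 2 * q ^ 2 / s := by ring
      have e4 : 4 / s * (d * d) = 4 * d ^ 2 / s := by ring
      rw [e4]
      nlinarith [k1, k2, k3, e1, e2, e3]
    rw [N.wInt_add (t1.sub (tg.mul tp)) (((Tame.const _).mul (tp.pow 2)).add
      ((Tame.const _).mul t3)), h2, N.wInt_add ((Tame.const _).mul (tp.pow 2))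
      ((Tame.const _).mul t3), wInt_const_mul, wInt_const_mul, wInt_const_mul, zero_add] at h3
    exact h3
  have e : (fun x : E n => ‖x‖ ^ 2 * pv p x ^ 2) = fun x => ∑ i, x i * x i * pv p x ^ 2 := by
    funext x; rw [norm_sq_coord, Finset.sum_mul]
  rw [e, N.wInt_sum _ fun i _ => ((Tame.coord i).mul (Tame.coord i)).mul (tp.pow 2)]
  have hsum := Finset.sum_le_sum fun i (_ : i ∈ Finset.univ) => hi i
  rw [← Finset.mul_sum, Finset.sum_add_distrib, ← Finset.mul_sum, ← Finset.mul_sum] at hsum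
  simp only [Finset.sum_const, Finset.card_univ, Fintype.card_fin, nsmul_eq_mul] at hsum
  change _ ≤ _ + 4 / s * energy W s p p at hsum
  set S := ∑ i, wInt W s (fun x => x i * x i * pv p x ^ 2)
  set P := wInt W s (fun x => pv p x ^ 2)
  set e := energy W s p p
  have hP : 0 ≤ P := wInt_nonneg fun x => sq_nonneg _
  have he : 0 ≤ e := energy_nonneg p
  have k1 : 0 ≤ 4 / s * P := by positivity
  have k2 : 0 ≤ (n * (l ^ 2 / s + 1)) * e := by positivity
  have k3 : s / 2 * S ≤ (n * (l ^ 2 / s + 1) + 4 / s) * (P + e) := by linarith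
  calc S = 2 / s * (s / 2 * S) := by field_simp
    _ ≤ 2 / s * ((n * (l ^ 2 / s + 1) + 4 / s) * (P + e)) := by gcongr
    _ = _ := by ring

theorem Nice.W_ge (N : Nice s W b h l) (x : E n) : W 0 - n * l * ‖x‖ ≤ W x := by
  have hb : ∀ y ∈ (Set.univ : Set (E n)),
      ‖∑ i, b i y • (EuclideanSpace.proj i : E n →L[ℝ] ℝ)‖ ≤ n * l := by
    intro y _
    refine (norm_sum_le _ _).trans ?_
    calc _ ≤ ∑ _i : Fin n, l := Finset.sum_le_sum fun i _ => by
          rw [norm_smul, Real.norm_eq_abs]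
          have : ‖(EuclideanSpace.proj i : E n →L[ℝ] ℝ)‖ ≤ 1 :=
            ContinuousLinearMap.opNorm_le_bound _ zero_le_one fun v => by
              rw [one_mul]; exact PiLp.norm_apply_le v i
          calc _ ≤ l * 1 := mul_le_mul (N.b_le i y) this (norm_nonneg _)
                ((abs_nonneg _).trans (N.b_le i y))
            _ = l := mul_one l
      _ = n * l := by simp
  have := Convex.norm_image_sub_le_of_norm_hasFDerivWithin_le (𝕜 := ℝ) (f := W) (C := n * l)
    (fun y _ => (N.gradW y).hasFDerivWithinAt) hb convex_univ (Set.mem_univ 0) (Set.mem_univ x)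
  rw [sub_zero, Real.norm_eq_abs] at this
  linarith [neg_abs_le (W x - W 0)]

theorem Nice.crude_poincare (N : Nice s W b h l) : ∃ C > 0, ∀ p : Poly n,
    wInt W s (fun x => (pv p x - wInt W s (pv p)) ^ 2) ≤ C * energy W s p p := by
  have hs := N.s_pos
  obtain ⟨A, hA, hmom⟩ := N.moment_le
  obtain ⟨c, N0⟩ := exists_gauss_const (n := n) (s + 2) (by linarith)
  set D : ℝ := Real.exp (c - W 0 + (n * l) ^ 2 / 4) with hD
  set R : ℝ := Real.exp (l - c + (s + 2) * A) with hR
  have hD' : ∀ x, Real.exp (c - (s + 2) / 2 * ‖x‖ ^ 2)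
      ≤ D * Real.exp (W x - s / 2 * ‖x‖ ^ 2) := fun x => by
    rw [hD, ← Real.exp_add]; apply Real.exp_le_exp.2
    nlinarith [N.W_ge x, sq_nonneg (n * l / 2 - ‖x‖)]
  refine ⟨1 + 2 * (R * (D / (s + 2))), by positivity, fun p => ?_⟩
  set q := p - MvPolynomial.C (wInt (fun _ => c) (s + 2) (pv p)) with hq
  have tq := tame_pv q
  have h1 : wInt W s (fun x => (pv p x - wInt W s (pv p)) ^ 2)
      ≤ wInt W s fun x => pv q x ^ 2 := by
    simp only [hq, pv_sub, pv_C]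
    rw [N.var_eq (tame_pv p), N.var_eq (tame_pv p)]
    nlinarith [sq_nonneg (wInt W s (pv p) - wInt (fun _ => c) (s + 2) (pv p))]
  have h2 := hmom q
  rw [hq, energy_sub_C_self, ← hq] at h2
  have h3 : wInt W s (fun x => pv q x ^ 2) ≤ (2 * A)⁻¹ * wInt W s (fun x => ‖x‖ ^ 2 * pv q x ^ 2)
      + R * wInt (fun _ => c) (s + 2) (fun x => pv q x ^ 2) := by
    have tn : Tame fun x : E n => ‖x‖ ^ 2 := by
      simp_rw [norm_sq_coord]; exact Tame.sum _ fun i _ => (Tame.coord i).mul (Tame.coord i)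
    unfold wInt
    rw [← integral_const_mul, ← integral_const_mul, ← integral_add
      ((N.integrable (tn.mul (tq.pow 2))).const_mul _) ((N0.integrable (tq.pow 2)).const_mul _)]
    refine integral_mono (N.integrable (tq.pow 2)) (((N.integrable (tn.mul
      (tq.pow 2))).const_mul _).add ((N0.integrable (tq.pow 2)).const_mul _)) fun x => ?_
    simp only
    rcases le_total (2 * A) (‖x‖ ^ 2) with hx | hx
    · have k1 : 1 ≤ (2 * A)⁻¹ * ‖x‖ ^ 2 := by
        rw [← div_eq_inv_mul, le_div_iff₀ (by positivity)]; linarith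
      have k2 := mul_le_mul_of_nonneg_right k1 (show 0 ≤ pv q x ^ 2 *
        Real.exp (W x - s / 2 * ‖x‖ ^ 2) by positivity)
      have k3 : 0 ≤ R * (pv q x ^ 2 * Real.exp (c - (s + 2) / 2 * ‖x‖ ^ 2)) := by positivity
      linarith
    · have k1 : Real.exp (W x - s / 2 * ‖x‖ ^ 2) ≤ R * Real.exp (c - (s + 2) / 2 * ‖x‖ ^ 2) := by
        rw [hR, ← Real.exp_add]; apply Real.exp_le_exp.2
        have : 0 ≤ s * ‖x‖ ^ 2 := by positivity
        nlinarith [N.W_le x]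
      have k2 := mul_le_mul_of_nonneg_left k1 (sq_nonneg (pv q x))
      have k3 : 0 ≤ (2 * A)⁻¹ * (‖x‖ ^ 2 * pv q x ^ 2 * Real.exp (W x - s / 2 * ‖x‖ ^ 2)) := by
        positivity
      linarith
  have h4 : wInt (fun _ => c) (s + 2) (fun x => pv q x ^ 2)
      ≤ energy (fun _ => c) (s + 2) p p / (s + 2) := by
    have := gauss_poincare N0 p
    simpa only [hq, pv_sub, pv_C] using this
  have h5 : energy (fun _ => c) (s + 2) p p ≤ D * energy W s p p := by
    unfold energy
    rw [Finset.mul_sum]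
    exact Finset.sum_le_sum fun i _ => N0.wInt_le_of_le N hD' ((tame_pv _).mul (tame_pv _))
      fun x => mul_self_nonneg _
  set e := energy W s p p
  set Q := wInt W s fun x => pv q x ^ 2
  have h6 : (2 * A)⁻¹ * wInt W s (fun x => ‖x‖ ^ 2 * pv q x ^ 2) ≤ (Q + e) / 2 := by
    calc _ ≤ (2 * A)⁻¹ * (A * (Q + e)) := by gcongr
      _ = _ := by field_simp
  have h7 : R * wInt (fun _ => c) (s + 2) (fun x => pv q x ^ 2) ≤ R * (D / (s + 2)) * e := by
    calc _ ≤ R * ((D * e) / (s + 2)) := by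
          gcongr
          exact h4.trans (by gcongr)
      _ = _ := by ring
  have h8 : (1 + 2 * (R * (D / (s + 2)))) * e = e + 2 * (R * (D / (s + 2)) * e) := by ring
  rw [h8]
  linarith

theorem Nice.dense_gen (N : Nice s W b h l) (F : E n → ℝ) (hF : Tame F) (h0 : wInt W s F = 0)
    (η : ℝ) (hη : 0 < η) :
    ∃ p : Poly n, wInt W s (fun x => (F x - gen s b p x) ^ 2) ≤ η := by
  obtain ⟨z, hz, hd⟩ := N.dense_op
  obtain ⟨C, hC, hpc⟩ := N.crude_poincare
  set κ : ℝ := 2 / (z * C) with hκ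
  have hκ0 : 0 < κ := by positivity
  set τ : ℝ := κ / (κ + 3) with hτ
  have hτ0 : 0 < τ := by positivity
  have hτ1 : τ ≤ 1 := by rw [hτ, div_le_one (by positivity)]; linarith
  have hτκ : (1 + τ) ^ 2 < 1 + κ := by
    have : 3 * τ < κ := by
      rw [hτ, ← mul_div_assoc, div_lt_iff₀ (by positivity)]; nlinarith
    nlinarith
  set θ : ℝ := (1 + τ) ^ 2 / (1 + κ) with hθ
  obtain ⟨p, hp⟩ := iterate_residual (W := W) (s := s) (b := b) 0 θ (by positivity)
    (by rw [hθ, div_lt_one (by positivity)]; exact hτκ) (fun G => Tame G ∧ wInt W s G = 0)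
    (by
      rintro G p ⟨tG, hG⟩
      refine ⟨tG.sub (N.tame_op 0 p), ?_⟩
      rw [N.wInt_sub tG (N.tame_op 0 p), hG]
      simpa using N.wInt_gen p) (by
      rintro G ⟨tG, hG⟩ η hη
      set M : ℝ := (1 + τ) * ((1 + τ⁻¹) + κ) + (1 + τ⁻¹) with hM
      have hM0 : 0 < M := by positivity
      obtain ⟨v, hv⟩ := hd G tG (η / M) (by positivity)
      refine ⟨v, ?_⟩
      set ε := η / M with hε
      have tv := tame_pv v
      have top := N.tame_op z v
      have terr := tG.sub top
      have e1 : (fun x => (G x - (0 * pv v x + gen s b v x)) ^ 2)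
          = fun x => (z * pv v x + (G x - (z * pv v x + gen s b v x))) ^ 2 := by
        funext x; ring
      have h1 := N.sq_add_le ((Tame.const z).mul tv) terr hτ0
      rw [← e1] at h1
      have e2 : wInt W s (fun x => (z * pv v x) ^ 2) = z ^ 2 * wInt W s fun x => pv v x ^ 2 := by
        simp only [mul_pow, wInt_const_mul]
      rw [e2] at h1
      have h2 := hpc v
      rw [N.var_eq tv] at h2
      have h3 := N.sq_op z v
      have h4 := N.sq_wInt_le terr
      rw [N.wInt_sub tG top, hG, N.wInt_add ((Tame.const z).mul tv) (N.tame_gen v),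
        wInt_const_mul] at h4
      rw [show wInt W s (fun x => gen s b v x) = 0 from N.wInt_gen v] at h4
      have h5 := N.sq_add_le tG (terr.neg) hτ0
      have e5 : (fun x => (G x + -(G x - (z * pv v x + gen s b v x))) ^ 2)
          = fun x => (z * pv v x + gen s b v x) ^ 2 := by funext x; ring
      rw [e5] at h5
      simp only [neg_sq] at h5
      have h6 : 0 ≤ wInt W s (fun x => gen s b v x ^ 2) := wInt_nonneg fun x => sq_nonneg _
      set V := wInt W s (fun x => pv v x ^ 2)
      set m := wInt W s (fun x => pv v x)
      set e := energy W s v v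
      set O := wInt W s (fun x => (z * pv v x + gen s b v x) ^ 2)
      set g := wInt W s (fun x => G x ^ 2)
      set r := wInt W s (fun x => (G x - (z * pv v x + gen s b v x)) ^ 2)
      have k1 : κ * z ^ 2 * (V - m ^ 2) ≤ 2 * z * e := by
        have : κ * z ^ 2 * (C * e) = 2 * z * e := by rw [hκ]; field_simp
        rw [← this]
        gcongr
        linarith
      have k2 : z ^ 2 * m ^ 2 ≤ ε := by nlinarith
      have k3 : (1 + κ) * (z ^ 2 * V) ≤ (1 + τ) * g + ((1 + τ⁻¹) + κ) * ε := by
        have a1 : (1 + τ⁻¹) * r ≤ (1 + τ⁻¹) * ε := by gcongr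
        have a2 : κ * (z ^ 2 * m ^ 2) ≤ κ * ε := by gcongr
        nlinarith
      have hB : 0 ≤ ((1 + τ⁻¹) + κ) * ε := by positivity
      have k4 : z ^ 2 * V ≤ (1 + τ) / (1 + κ) * g + ((1 + τ⁻¹) + κ) * ε := by
        have a1 : z ^ 2 * V ≤ ((1 + τ) * g + ((1 + τ⁻¹) + κ) * ε) / (1 + κ) := by
          rw [le_div_iff₀ (by positivity)]; linarith
        have a2 : ((1 + τ⁻¹) + κ) * ε / (1 + κ) ≤ ((1 + τ⁻¹) + κ) * ε :=
          div_le_self hB (by linarith)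
        have a3 : ((1 + τ) * g + ((1 + τ⁻¹) + κ) * ε) / (1 + κ)
            = (1 + τ) / (1 + κ) * g + ((1 + τ⁻¹) + κ) * ε / (1 + κ) := by ring
        linarith
      have k5 : M * ε = η := by rw [hε]; field_simp
      have k6 := mul_le_mul_of_nonneg_left k4 (show 0 ≤ 1 + τ by positivity)
      have k7 : (1 + τ⁻¹) * r ≤ (1 + τ⁻¹) * ε := by gcongr
      have k8 : (1 + τ) * ((1 + τ) / (1 + κ) * g) = θ * g := by rw [hθ]; ring
      have k9 : M * ε = (1 + τ) * (((1 + τ⁻¹) + κ) * ε) + (1 + τ⁻¹) * ε := by rw [hM]; ring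
      linarith) F ⟨hF, h0⟩ η hη
  refine ⟨p, ?_⟩
  simpa using hp

end Solve

end SmallBall

namespace SmallBall

open scoped ENNReal NNReal Topology

section Improve

variable {n : ℕ} {s : ℝ} {W : E n → ℝ} {b : Fin n → E n → ℝ}
    {h : Fin n → Fin n → E n → ℝ} {l : ℝ}

/-- The Poincaré inequality with constant `C` on polynomials. -/
def PC (W : E n → ℝ) (s C : ℝ) : Prop :=
  ∀ p : Poly n, wInt W s (fun x => (pv p x - wInt W s (pv p)) ^ 2) ≤ C * energy W s p p

theorem Nice.dual_bound (N : Nice s W b h l) {κ : ℝ} (hκ : 0 < κ) (φ : Poly n)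
    (h0 : wInt W s (pv φ) = 0)
    (H : ∀ u : Poly n, ∃ u' : Poly n, energy W s u φ = energy W s u' φ ∧
      κ * energy W s u' u' ≤ wInt W s fun x => gen s b u x ^ 2) :
    wInt W s (fun x => pv φ x ^ 2) ≤ κ⁻¹ * energy W s φ φ := by
  refine le_of_forall_pos_le_add fun η hη => ?_
  obtain ⟨u, hu⟩ := N.dense_gen (pv φ) (tame_pv φ) h0 η hη
  obtain ⟨u', e1, e2⟩ := H u
  have tφ := tame_pv φ
  have tg := N.tame_gen u
  have e3 : (fun x => (pv φ x - gen s b u x) ^ 2)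
      = fun x => (pv φ x ^ 2 + gen s b u x ^ 2) - 2 * (gen s b u x * pv φ x) := by
    funext x; ring
  rw [e3, N.wInt_sub ((tφ.pow 2).add (tg.pow 2)) ((Tame.const 2).mul (tg.mul tφ)),
    N.wInt_add (tφ.pow 2) (tg.pow 2), wInt_const_mul, N.gen_pair, e1] at hu
  have := N.two_energy_le u' φ hκ
  linarith

/-- The linear polynomial with gradient `m`. -/
def linP (m : Fin n → ℝ) : Poly n := ∑ i, MvPolynomial.C (m i) * MvPolynomial.X i

theorem pd_linP (m : Fin n → ℝ) (i : Fin n) : pd i (linP m) = MvPolynomial.C (m i) := by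
  simp only [linP, pd, map_sum, Derivation.leibniz, MvPolynomial.pderiv_C, MvPolynomial.pderiv_X,
    smul_zero, add_zero, smul_eq_mul]
  rw [Finset.sum_eq_single i]
  · simp
  · intro j _ hj; simp [Pi.single_apply, hj.symm]
  · simp

theorem pv_linP (m : Fin n → ℝ) (x : E n) : pv (linP m) x = ∑ i, m i * x i := by
  simp [linP, pv]

theorem Nice.poincare_start (N : Nice s W b h l) : PC W s s⁻¹ := fun p => by
  have := N.dual_bound N.s_pos (p - MvPolynomial.C (wInt W s (pv p))) (by
    have e : pv (p - MvPolynomial.C (wInt W s (pv p))) = fun x => pv p x - wInt W s (pv p) := by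
      funext x; simp
    rw [e, N.wInt_sub (tame_pv p) (Tame.const _), N.wInt_const, sub_self])
    (fun u => ⟨u, rfl, N.bochner_le u⟩)
  rw [energy_sub_C_self] at this
  simpa only [pv_sub, pv_C] using this

theorem Nice.poincare_orthogonal (N : Nice s W b h l) {C : ℝ} (hC : 0 < C) (hPC : PC W s C)
    (φ : Poly n) (h0 : wInt W s (pv φ) = 0) (h1 : ∀ i, wInt W s (pv (pd i φ)) = 0) :
    wInt W s (fun x => pv φ x ^ 2) ≤ (s + C⁻¹)⁻¹ * energy W s φ φ := by
  have hs := N.s_pos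
  refine N.dual_bound (by positivity) φ h0 fun u => ?_
  set m : Fin n → ℝ := fun i => wInt W s (pv (pd i u)) with hm
  have e : ∀ i x, pv (pd i (u - linP m)) x = pv (pd i u) x - m i := fun i x => by
    rw [show pd i (u - linP m) = pd i u - pd i (linP m) from map_sub _ _ _, pd_linP]; simp
  refine ⟨u - linP m, ?_, ?_⟩
  · unfold energy
    refine Finset.sum_congr rfl fun i _ => ?_
    simp only [e, sub_mul]
    rw [N.wInt_sub ((tame_pv _).mul (tame_pv _)) ((Tame.const _).mul (tame_pv _)),
      wInt_const_mul, show wInt W s (fun x => pv (pd i φ) x) = 0 from h1 i]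
    simp
  · have h2 := N.bochner u
    have h3 : ∀ j, wInt W s (fun x => (pv (pd j u) x - m j) ^ 2)
        ≤ C * ∑ i, wInt W s fun x => pv (pd i (pd j u)) x ^ 2 := fun j => by
      refine (hPC (pd j u)).trans (le_of_eq ?_)
      simp only [energy, sq]
    have h4 : energy W s (u - linP m) (u - linP m)
        = ∑ j, wInt W s (fun x => (pv (pd j u) x - m j) ^ 2) := by
      simp only [energy, e, sq]
    have h5 : energy W s (u - linP m) (u - linP m)
        ≤ C * ∑ i, ∑ j, wInt W s fun x => pv (pd i (pd j u)) x ^ 2 := by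
      rw [h4, Finset.sum_comm, Finset.mul_sum]
      exact Finset.sum_le_sum fun j _ => h3 j
    have h6 : energy W s (u - linP m) (u - linP m) ≤ energy W s u u := by
      rw [h4]; unfold energy
      refine Finset.sum_le_sum fun j _ => ?_
      rw [N.var_eq (tame_pv _)]
      change _ - 2 * m j * m j + _ ≤ _
      simp only [← sq]
      nlinarith [sq_nonneg (m j)]
    have h7 : C⁻¹ * energy W s (u - linP m) (u - linP m)
        ≤ ∑ i, ∑ j, wInt W s fun x => pv (pd i (pd j u)) x ^ 2 := by
      rw [inv_mul_le_iff₀ hC]; exact h5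
    have h8 := mul_le_mul_of_nonneg_left h6 hs.le
    linarith

theorem Nice.poincare_improve (N : Nice s W b h l) {C u : ℝ} (hC : 0 < C) (hu : 0 < u)
    (hmom : ∀ v : Fin n → ℝ, wInt W s (fun x => (∑ i, v i * x i) ^ 2) ≤ u * ∑ i, v i ^ 2)
    (hPC : PC W s C) : PC W s (u + (s + C⁻¹)⁻¹) := fun p => by
  have hs := N.s_pos
  set m : Fin n → ℝ := fun i => wInt W s (pv (pd i p)) with hm
  set L : E n → ℝ := fun x => ∑ i, m i * x i with hL
  have tL : Tame L := Tame.sum _ fun i _ => (Tame.const _).mul (Tame.coord i)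
  set a := wInt W s L with ha
  set c := wInt W s (pv p) with hc
  set φ : Poly n := p - linP m - MvPolynomial.C (c - a) with hφ
  have eφ : ∀ x, pv φ x = pv p x - L x - (c - a) := fun x => by
    rw [hφ, pv_sub, pv_sub, pv_C, pv_linP]
  have e : ∀ i x, pv (pd i φ) x = pv (pd i p) x - m i := fun i x => by
    rw [hφ, show pd i (p - linP m - MvPolynomial.C (c - a)) = pd i p - pd i (linP m)
      - pd i (MvPolynomial.C (c - a)) by rw [pd, map_sub, map_sub], pd_linP]
    simp [pd]
  have tp := tame_pv p
  have h0 : wInt W s (pv φ) = 0 := by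
    rw [show pv φ = fun x => pv p x - L x - (c - a) from funext eφ,
      N.wInt_sub (tp.sub tL) (Tame.const _), N.wInt_sub tp tL, N.wInt_const]
    change c - a - (c - a) = 0
    ring
  have h1 : ∀ i, wInt W s (pv (pd i φ)) = 0 := fun i => by
    rw [show pv (pd i φ) = fun x => pv (pd i p) x - m i from funext (e i),
      N.wInt_sub (tame_pv _) (Tame.const _), N.wInt_const]
    exact sub_self _
  have h2 := N.poincare_orthogonal hC hPC φ h0 h1
  have h3 : energy W s φ φ = energy W s p p - ∑ i, m i ^ 2 := by
    unfold energy
    rw [← Finset.sum_sub_distrib]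
    refine Finset.sum_congr rfl fun i _ => ?_
    simp only [e, ← sq]
    rw [N.var_eq (tame_pv _)]
    change _ - 2 * m i * m i + _ = _
    ring
  set k := (s + C⁻¹)⁻¹ with hk
  have hk0 : 0 < k := by positivity
  have h4 := N.sq_add_le (tL.sub (Tame.const a)) (tame_pv φ) (t := k / u) (by positivity)
  have e4 : (fun x => (L x - a + pv φ x) ^ 2) = fun x => (pv p x - c) ^ 2 := by
    funext x; rw [eφ]; ring
  rw [e4] at h4
  have h5 : wInt W s (fun x => (L x - a) ^ 2) ≤ u * ∑ i, m i ^ 2 := by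
    refine le_trans ?_ (hmom m)
    rw [N.var_eq tL]
    nlinarith [sq_nonneg a]
  refine h4.trans ?_
  rw [h3] at h2
  calc _ ≤ (1 + k / u) * (u * ∑ i, m i ^ 2)
        + (1 + (k / u)⁻¹) * (k * (energy W s p p - ∑ i, m i ^ 2)) := by gcongr
    _ = _ := by field_simp; ring

theorem PC.mono {C C' : ℝ} (hC : C ≤ C') (hPC : PC W s C) : PC W s C' := fun p =>
  (hPC p).trans (mul_le_mul_of_nonneg_right hC (energy_nonneg p))

theorem Nice.poincare (N : Nice s W b h l) {u : ℝ} (hu : 0 < u)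
    (hmom : ∀ v : Fin n → ℝ, wInt W s (fun x => (∑ i, v i * x i) ^ 2) ≤ u * ∑ i, v i ^ 2) :
    PC W s (2 * √(u / s)) := by
  have hs := N.s_pos
  set S : Set ℝ := {C | 0 < C ∧ C ≤ s⁻¹ ∧ PC W s C} with hS
  have hS1 : s⁻¹ ∈ S := ⟨by positivity, le_rfl, N.poincare_start⟩
  have hbdd : BddBelow S := ⟨0, fun C hC => hC.1.le⟩
  set C0 := sInf S with hC0
  have hC00 : 0 ≤ C0 := le_csInf ⟨_, hS1⟩ fun C hC => hC.1.le
  have hC0s : C0 ≤ s⁻¹ := csInf_le hbdd hS1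
  have key : s * C0 ^ 2 ≤ 2 * u := by
    refine le_of_forall_pos_le_add fun δ hδ => ?_
    obtain ⟨C, ⟨hC, hCs, hPC⟩, hCδ⟩ := exists_lt_of_csInf_lt ⟨_, hS1⟩
      (show sInf S < C0 + δ by linarith)
    have hCC : C0 ≤ C := csInf_le hbdd ⟨hC, hCs, hPC⟩
    have h1 := N.poincare_improve hC hu hmom hPC
    have h2 : C0 ≤ u + (s + C⁻¹)⁻¹ := by
      rcases le_total (u + (s + C⁻¹)⁻¹) s⁻¹ with h | h
      · exact csInf_le hbdd ⟨by positivity, h, h1⟩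
      · exact hC0s.trans h
    have h3 : (s + C⁻¹)⁻¹ = C / (1 + s * C) := by field_simp; ring
    have hsC : s * C ≤ 1 := by
      calc s * C ≤ s * s⁻¹ := by gcongr
        _ = 1 := by field_simp
    rw [h3] at h2
    have h4 : (C0 - u) * (1 + s * C) ≤ C := by
      rw [← le_div_iff₀ (by positivity)]; linarith
    have h5 : s * C0 * C0 ≤ s * C0 * C := by gcongr
    nlinarith
  have h1 : C0 < 2 * √(u / s) := by
    refine lt_of_pow_lt_pow_left₀ 2 (by positivity) ?_
    rw [mul_pow, Real.sq_sqrt (by positivity)]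
    have : C0 ^ 2 ≤ 2 * (u / s) := by
      rw [← mul_div_assoc, le_div_iff₀ hs]; linarith
    have : 0 < u / s := by positivity
    linarith
  obtain ⟨C, ⟨_, _, hPC⟩, hC⟩ := exists_lt_of_csInf_lt ⟨_, hS1⟩ h1
  exact hPC.mono hC.le

/-- The polynomial of a quadratic form. -/
def quadP (A : Fin n → Fin n → ℝ) : Poly n :=
  ∑ i, ∑ j, MvPolynomial.C (A i j) * (MvPolynomial.X i * MvPolynomial.X j)

theorem pv_quadP (A : Fin n → Fin n → ℝ) (x : E n) :
    pv (quadP A) x = ∑ i, ∑ j, A i j * (x i * x j) := by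
  simp [quadP, pv]

theorem pd_quadP (A : Fin n → Fin n → ℝ) (k : Fin n) (x : E n) :
    pv (pd k (quadP A)) x = ∑ j, (A k j + A j k) * x j := by
  have e : HasGrad (pv (quadP A)) fun k x => ∑ i, ∑ j, A i j *
      (x i * (if k = j then 1 else 0) + (if k = i then 1 else 0) * x j) := by
    rw [show pv (quadP A) = fun x => ∑ i, ∑ j, A i j * (x i * x j) from funext (pv_quadP A)]
    exact HasGrad.sum _ fun i _ => HasGrad.sum _ fun j _ =>
      ((HasGrad.coord i).mul (HasGrad.coord j)).const_mul _
  rw [← (hasGrad_pv (quadP A)).fderiv_single x k, e.fderiv_single x k]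
  simp only [mul_add, Finset.sum_add_distrib, add_mul, mul_ite, ite_mul, mul_one, one_mul, mul_zero,
    zero_mul]
  rw [add_comm]
  congr 1
  · rw [Finset.sum_comm]; simp
  · simp

theorem Nice.quad_var (N : Nice s W b h l) {u : ℝ} (hu : 0 < u)
    (hmom : ∀ v : Fin n → ℝ, wInt W s (fun x => (∑ i, v i * x i) ^ 2) ≤ u * ∑ i, v i ^ 2)
    (A : Fin n → Fin n → ℝ) :
    wInt W s (fun x => (∑ i, ∑ j, A i j * (x i * x j)) ^ 2)
        - wInt W s (fun x => ∑ i, ∑ j, A i j * (x i * x j)) ^ 2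
      ≤ 8 * u * √(u / s) * ∑ i, ∑ j, A i j ^ 2 := by
  have h1 := N.poincare hu hmom (quadP A)
  rw [N.var_eq (tame_pv _)] at h1
  have e : pv (quadP A) = fun x => ∑ i, ∑ j, A i j * (x i * x j) := funext (pv_quadP A)
  simp only [e] at h1
  have h2 : energy W s (quadP A) (quadP A) ≤ u * (4 * ∑ i, ∑ j, A i j ^ 2) := by
    calc energy W s (quadP A) (quadP A)
        ≤ ∑ k, u * ∑ j, (A k j + A j k) ^ 2 := by
          unfold energy
          refine Finset.sum_le_sum fun k _ => ?_
          simp only [pd_quadP, ← sq]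
          exact hmom fun j => A k j + A j k
      _ ≤ ∑ k, u * ∑ j, (2 * A k j ^ 2 + 2 * A j k ^ 2) := by
          gcongr with k _ j _
          nlinarith [sq_nonneg (A k j - A j k)]
      _ = _ := by
          simp only [← Finset.mul_sum, Finset.sum_add_distrib]
          rw [Finset.sum_comm (f := fun k j => A j k ^ 2)]
          ring
  have h3 := mul_le_mul_of_nonneg_left h2 (show 0 ≤ 2 * √(u / s) by positivity)
  linarith

end Improve

end SmallBall

namespace SmallBall

open scoped ENNReal NNReal Topology

section Kernel

variable {n : ℕ}

theorem HasGrad.comp_real {F : E n → ℝ} {F'} (hF : HasGrad F F') {φ φ' : ℝ → ℝ}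
    (hφ : ∀ x, HasDerivAt φ (φ' (F x)) (F x)) :
    HasGrad (fun x => φ (F x)) fun i x => φ' (F x) * F' i x := fun x => by
  have := (hφ x).comp_hasFDerivAt x (hF x)
  have e : φ' (F x) • (∑ i, F' i x • (EuclideanSpace.proj i : E n →L[ℝ] ℝ))
      = ∑ i, (φ' (F x) * F' i x) • (EuclideanSpace.proj i : E n →L[ℝ] ℝ) := by
    rw [Finset.smul_sum]; simp only [smul_smul]
  rw [← e]; exact this

theorem HasGrad.line {F : E n → ℝ} {F'} (hF : HasGrad F F') (x v : E n) (t : ℝ) :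
    HasDerivAt (fun t : ℝ => F (x + t • v)) (∑ i, F' i (x + t • v) * v i) t := by
  have h1 : HasDerivAt (fun t : ℝ => x + t • v) v t := by
    have := ((hasDerivAt_id t).smul_const v).const_add x
    rwa [one_smul] at this
  have := (hF (x + t • v)).comp_hasDerivAt t h1
  have e : (∑ i, F' i (x + t • v) • (EuclideanSpace.proj i : E n →L[ℝ] ℝ)) v
      = ∑ i, F' i (x + t • v) * v i := by
    simp [ContinuousLinearMap.sum_apply]
  rw [← e]; exact this

/-- A smooth log-concave kernel at scale `1 / R`. -/
def ker (R : ℝ) (x : E n) : ℝ := Real.exp (-√(1 + R ^ 2 * ‖x‖ ^ 2))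

def kerX (w : ℝ) : ℝ := -Real.exp (-√w) / √w

def kerY (w : ℝ) : ℝ := Real.exp (-√w) / (2 * w) + Real.exp (-√w) / (2 * (w * √w))

def ker1 (R : ℝ) (i : Fin n) (x : E n) : ℝ := R ^ 2 * (x i * kerX (1 + R ^ 2 * ‖x‖ ^ 2))

def ker2 (R : ℝ) (i j : Fin n) (x : E n) : ℝ :=
  R ^ 2 * (x i * (kerY (1 + R ^ 2 * ‖x‖ ^ 2) * (R ^ 2 * (2 * x j)))
    + (if j = i then 1 else 0) * kerX (1 + R ^ 2 * ‖x‖ ^ 2))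

theorem hasDerivAt_exp_neg_sqrt {w : ℝ} (hw : 0 < w) :
    HasDerivAt (fun w => Real.exp (-√w)) (kerX w / 2) w := by
  have := ((Real.hasDerivAt_sqrt hw.ne').neg).exp
  have e : Real.exp (-√w) * (-(1 / (2 * √w))) = kerX w / 2 := by unfold kerX; ring
  rw [← e]; exact this

theorem hasDerivAt_kerX {w : ℝ} (hw : 0 < w) : HasDerivAt kerX (kerY w) w := by
  have hs : √w ≠ 0 := (Real.sqrt_pos.2 hw).ne'
  have := ((hasDerivAt_exp_neg_sqrt hw).neg).div (Real.hasDerivAt_sqrt hw.ne') hs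
  have e : (-(kerX w / 2) * √w - -Real.exp (-√w) * (1 / (2 * √w))) / √w ^ 2 = kerY w := by
    unfold kerX kerY
    have h2 : √w ^ 2 = w := Real.sq_sqrt hw.le
    set q := √w
    rw [← h2]
    field_simp
    ring
  rw [← e]; exact this

theorem ker_arg_pos (R : ℝ) (x : E n) : 0 < 1 + R ^ 2 * ‖x‖ ^ 2 := by positivity

theorem hasGrad_ker_arg (R : ℝ) :
    HasGrad (fun x : E n => 1 + R ^ 2 * ‖x‖ ^ 2) fun i x => R ^ 2 * (2 * x i) := by
  have := (HasGrad.const 1).add (HasGrad.norm_sq (n := n).const_mul (R ^ 2))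
  simpa only [zero_add] using this

theorem hasGrad_ker (R : ℝ) : HasGrad (ker (n := n) R) (ker1 R) := by
  have := (hasGrad_ker_arg (n := n) R).comp_real
    (φ := fun w => Real.exp (-√w)) (φ' := fun w => kerX w / 2)
    fun x => hasDerivAt_exp_neg_sqrt (ker_arg_pos R x)
  have e : (fun i (x : E n) => kerX (1 + R ^ 2 * ‖x‖ ^ 2) / 2 * (R ^ 2 * (2 * x i))) = ker1 R := by
    funext i x; unfold ker1; ring
  rw [← e]; exact this

theorem hasGrad_ker1 (R : ℝ) (i : Fin n) : HasGrad (ker1 R i) (ker2 R i) :=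
  ((HasGrad.coord i).mul ((hasGrad_ker_arg (n := n) R).comp_real
    (φ := kerX) (φ' := kerY) fun x => hasDerivAt_kerX (ker_arg_pos R x))).const_mul _

theorem ker_pos (R : ℝ) (x : E n) : 0 < ker R x := Real.exp_pos _

theorem ker_le_one (R : ℝ) (x : E n) : ker R x ≤ 1 :=
  Real.exp_le_one_iff.2 (neg_nonpos.2 (Real.sqrt_nonneg _))

theorem abs_coord_le_sqrt {R : ℝ} (hR : 0 ≤ R) (x : E n) (i : Fin n) :
    R * |x i| ≤ √(1 + R ^ 2 * ‖x‖ ^ 2) := by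
  refine Real.le_sqrt_of_sq_le ?_
  have : |x i| ≤ ‖x‖ := PiLp.norm_apply_le x i
  have h2 : (R * |x i|) ^ 2 ≤ (R * ‖x‖) ^ 2 := by gcongr
  nlinarith

theorem ker1_le {R : ℝ} (hR : 0 ≤ R) (i : Fin n) (x : E n) : |ker1 R i x| ≤ R * ker R x := by
  have h1 := abs_coord_le_sqrt hR x i
  have hw := Real.sqrt_pos.2 (ker_arg_pos R x)
  unfold ker1 ker kerX
  set q := √(1 + R ^ 2 * ‖x‖ ^ 2)
  have e : |R ^ 2 * (x i * (-Real.exp (-q) / q))| = R * (R * |x i|) * Real.exp (-q) / q := by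
    rw [abs_mul, abs_mul, abs_div, abs_neg, abs_of_pos hw, abs_of_pos (Real.exp_pos _),
      abs_of_nonneg (sq_nonneg R)]
    ring
  rw [e, div_le_iff₀ hw]
  calc R * (R * |x i|) * Real.exp (-q) ≤ R * q * Real.exp (-q) := by gcongr
    _ = _ := by ring

theorem ker2_le {R : ℝ} (hR : 0 ≤ R) (i j : Fin n) (x : E n) :
    |ker2 R i j x| ≤ 3 * R ^ 2 * ker R x := by
  have h1 := abs_coord_le_sqrt hR x i
  have h2 := abs_coord_le_sqrt hR x j
  have hw := ker_arg_pos R x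
  have hw1 : 1 ≤ 1 + R ^ 2 * ‖x‖ ^ 2 := by nlinarith [sq_nonneg (R * ‖x‖)]
  have hq1 : 1 ≤ √(1 + R ^ 2 * ‖x‖ ^ 2) := Real.one_le_sqrt.2 hw1
  have hq2 : √(1 + R ^ 2 * ‖x‖ ^ 2) ^ 2 = 1 + R ^ 2 * ‖x‖ ^ 2 := Real.sq_sqrt hw.le
  unfold ker2 ker kerY kerX
  set q := √(1 + R ^ 2 * ‖x‖ ^ 2)
  rw [← hq2]
  have he := Real.exp_pos (-q)
  have k1 : |x i * ((Real.exp (-q) / (2 * q ^ 2) + Real.exp (-q) / (2 * (q ^ 2 * q)))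
      * (R ^ 2 * (2 * x j)))| ≤ 2 * Real.exp (-q) := by
    have e : |x i * ((Real.exp (-q) / (2 * q ^ 2) + Real.exp (-q) / (2 * (q ^ 2 * q)))
      * (R ^ 2 * (2 * x j)))| = (R * |x i|) * (R * |x j|) * Real.exp (-q) * (1 / q ^ 2)
        * (1 + 1 / q) := by
      rw [abs_mul, abs_mul, abs_mul, abs_mul, abs_of_pos (by positivity : 0 < Real.exp (-q) /
        (2 * q ^ 2) + Real.exp (-q) / (2 * (q ^ 2 * q))), abs_of_nonneg (sq_nonneg R),
        abs_of_pos (two_pos : (0 : ℝ) < 2)]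
      field_simp
    rw [e]
    calc _ ≤ q * q * Real.exp (-q) * (1 / q ^ 2) * (1 + 1 / 1) := by gcongr
      _ = _ := by field_simp; norm_num
  have k2 : |(if j = i then (1 : ℝ) else 0) * (-Real.exp (-q) / q)| ≤ Real.exp (-q) := by
    rw [abs_mul, abs_div, abs_neg, abs_of_pos he, abs_of_pos (by linarith : 0 < q)]
    have a1 : |if j = i then (1 : ℝ) else 0| ≤ 1 := by split_ifs <;> simp
    have a2 : Real.exp (-q) / q ≤ Real.exp (-q) := div_le_self he.le hq1
    calc _ ≤ 1 * Real.exp (-q) := by gcongr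
      _ = _ := one_mul _
  rw [abs_mul, abs_of_nonneg (sq_nonneg R)]
  have k3 := abs_add_le (x i * ((Real.exp (-q) / (2 * q ^ 2) + Real.exp (-q) / (2 * (q ^ 2 * q)))
      * (R ^ 2 * (2 * x j)))) ((if j = i then (1 : ℝ) else 0) * (-Real.exp (-q) / q))
  calc _ ≤ R ^ 2 * (2 * Real.exp (-q) + Real.exp (-q)) := by gcongr; linarith
    _ = _ := by ring

theorem continuous_ker2 (R : ℝ) (i j : Fin n) : Continuous (ker2 R i j) := by
  have hw : ∀ x : E n, √(1 + R ^ 2 * ‖x‖ ^ 2) ≠ 0 := fun x =>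
    (Real.sqrt_pos.2 (ker_arg_pos R x)).ne'
  have hc : ∀ i : Fin n, Continuous fun x : E n => x i := fun i => (HasGrad.coord i).continuous
  have h1 : Continuous fun x : E n => kerX (1 + R ^ 2 * ‖x‖ ^ 2) := by
    unfold kerX
    exact Continuous.div (by fun_prop) (by fun_prop) hw
  have h2 : Continuous fun x : E n => kerY (1 + R ^ 2 * ‖x‖ ^ 2) := by
    unfold kerY
    refine (Continuous.div (by fun_prop) (by fun_prop) fun x => ?_).add
      (Continuous.div (by fun_prop) (by fun_prop) fun x => ?_)
    · have := ker_arg_pos R x; positivity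
    · have := ker_arg_pos R x
      have := Real.sqrt_pos.2 this; positivity
  unfold ker2
  exact continuous_const.mul (((hc i).mul (h2.mul (continuous_const.mul
    (continuous_const.mul (hc j))))).add (continuous_const.mul h1))

theorem lc_ker (R : ℝ) : LC fun x : E n => ENNReal.ofReal (ker R x) := by
  refine LC.exp_neg fun x y a b ha hb hab => ?_
  have hn : ‖a • x + b • y‖ ≤ a * ‖x‖ + b * ‖y‖ := by
    refine (norm_add_le _ _).trans ?_
    rw [norm_smul, norm_smul, Real.norm_of_nonneg ha.le, Real.norm_of_nonneg hb.le]
  have h1 : (‖a • x + b • y‖) ^ 2 ≤ (a * ‖x‖ + b * ‖y‖) ^ 2 := by gcongr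
  set X := ‖x‖
  set Y := ‖y‖
  have p1 := Real.sqrt_pos.2 (ker_arg_pos R x)
  have p2 := Real.sqrt_pos.2 (ker_arg_pos R y)
  have q1 : √(1 + R ^ 2 * X ^ 2) ^ 2 = _ := Real.sq_sqrt (ker_arg_pos R x).le
  have q2 : √(1 + R ^ 2 * Y ^ 2) ^ 2 = _ := Real.sq_sqrt (ker_arg_pos R y).le
  set P := √(1 + R ^ 2 * X ^ 2)
  set Q := √(1 + R ^ 2 * Y ^ 2)
  refine Real.sqrt_le_iff.2 ⟨by positivity, ?_⟩
  have h2 : 1 + R ^ 2 * X * Y ≤ P * Q := by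
    refine le_of_sq_le_sq ?_ (by positivity)
    rw [mul_pow, q1, q2]
    nlinarith [sq_nonneg (R * (X - Y))]
  have h3 : R ^ 2 * ‖a • x + b • y‖ ^ 2 ≤ R ^ 2 * (a * X + b * Y) ^ 2 := by gcongr
  have h4 : a * b * (1 + R ^ 2 * X * Y) ≤ a * b * (P * Q) := by gcongr
  have h5 : b = 1 - a := by linarith
  have : (a * P + b * Q) ^ 2 = a ^ 2 * (1 + R ^ 2 * X ^ 2) + 2 * (a * b * (P * Q))
      + b ^ 2 * (1 + R ^ 2 * Y ^ 2) := by rw [← q1, ← q2]; ring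
  rw [this]
  have e : (1 : ℝ) = a ^ 2 + 2 * (a * b) + b ^ 2 := by rw [h5]; ring
  nlinarith

end Kernel

section Smooth

variable {n : ℕ}

/-- Convolution against a fixed integrable function. -/
def conv (f k : E n → ℝ) (x : E n) : ℝ := ∫ y, f y * k (x - y)

theorem integrable_conv {f k : E n → ℝ} (hf : Integrable f) (hk : Continuous k) {M : ℝ}
    (hM : ∀ x, |k x| ≤ M) (x : E n) : Integrable fun y => f y * k (x - y) :=
  hf.mul_bdd (c := M) (hk.comp (continuous_const.sub continuous_id)).aestronglyMeasurable
    (Filter.Eventually.of_forall fun y => hM _)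

theorem continuous_conv {f k : E n → ℝ} (hf : Integrable f) (hk : Continuous k) {M : ℝ}
    (hM : ∀ x, |k x| ≤ M) : Continuous (conv f k) := by
  refine continuous_of_dominated (bound := fun y => |f y| * M)
    (fun x => (integrable_conv hf hk hM x).aestronglyMeasurable) (fun x => ?_)
    (hf.abs.mul_const M) (Filter.Eventually.of_forall fun y => ?_)
  · refine Filter.Eventually.of_forall fun y => ?_
    rw [Real.norm_eq_abs, abs_mul]
    exact mul_le_mul_of_nonneg_left (hM _) (abs_nonneg _)
  · exact continuous_const.mul (hk.comp (continuous_id.sub continuous_const))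

theorem hasGrad_conv {f k : E n → ℝ} {k' : Fin n → E n → ℝ} (hf : Integrable f)
    (hk : HasGrad k k') (hk' : ∀ i, Continuous (k' i)) {M : ℝ}
    (hM : ∀ x, |k x| ≤ M) (hM' : ∀ i x, |k' i x| ≤ M) :
    HasGrad (conv f k) fun i => conv f (k' i) := fun x => by
  set D : E n → E n → (E n →L[ℝ] ℝ) := fun x y =>
    f y • ∑ i, k' i (x - y) • (EuclideanSpace.proj i : E n →L[ℝ] ℝ) with hD
  have hpr : ∀ i : Fin n, ‖(EuclideanSpace.proj i : E n →L[ℝ] ℝ)‖ ≤ 1 := fun i =>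
    ContinuousLinearMap.opNorm_le_bound _ zero_le_one fun v => by
      rw [one_mul]; exact PiLp.norm_apply_le v i
  have hM0 : 0 ≤ M := (abs_nonneg _).trans (hM 0)
  have key := hasFDerivAt_integral_of_dominated_of_fderiv_le (𝕜 := ℝ) (μ := volume)
    (F := fun x y => f y * k (x - y)) (F' := D) (x₀ := x) (s := Set.univ)
    (bound := fun y => |f y| * (n * M)) Filter.univ_mem
    (Filter.Eventually.of_forall fun z =>
      (integrable_conv hf hk.continuous hM z).aestronglyMeasurable)
    (integrable_conv hf hk.continuous hM x)
    (by
      refine hf.aestronglyMeasurable.smul (Continuous.aestronglyMeasurable ?_)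
      exact continuous_finsetSum _ fun i _ => ((hk' i).comp
        (continuous_const.sub continuous_id)).smul continuous_const)
    (Filter.Eventually.of_forall fun y z _ => by
      rw [hD]
      simp only
      rw [norm_smul, Real.norm_eq_abs]
      refine mul_le_mul_of_nonneg_left ?_ (abs_nonneg _)
      refine (norm_sum_le _ _).trans ?_
      calc _ ≤ ∑ _i : Fin n, M := Finset.sum_le_sum fun i _ => by
            rw [norm_smul, Real.norm_eq_abs]
            calc _ ≤ M * 1 := mul_le_mul (hM' i _) (hpr i) (norm_nonneg _) hM0
              _ = M := mul_one M
        _ = n * M := by simp)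
    (hf.abs.mul_const _)
    (Filter.Eventually.of_forall fun y z _ => by
      have h1 : HasFDerivAt (fun z : E n => z - y) (ContinuousLinearMap.id ℝ (E n)) z :=
        (hasFDerivAt_id z).sub_const y
      have := ((hk (z - y)).comp z h1).const_mul (f y)
      rw [ContinuousLinearMap.comp_id] at this
      exact this)
  have e : ∫ y, D x y = ∑ i, conv f (k' i) x • (EuclideanSpace.proj i : E n →L[ℝ] ℝ) := by
    have : ∀ y, D x y = ∑ i, (f y * k' i (x - y)) • (EuclideanSpace.proj i : E n →L[ℝ] ℝ) :=
      fun y => by simp only [hD, Finset.smul_sum, smul_smul]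
    simp only [this]
    rw [integral_finsetSum _ fun i _ => (integrable_conv hf (hk' i) (hM' i) x).smul_const _]
    exact Finset.sum_congr rfl fun i _ => integral_smul_const _ _
  rw [← e]; exact key

end Smooth

end SmallBall

namespace SmallBall

open scoped ENNReal NNReal Topology

section Smoothing

variable {n : ℕ}

theorem second_deriv_nonpos {φ φ' : ℝ → ℝ} {c : ℝ}
    (hc : ∀ x y a b : ℝ, 0 < a → 0 < b → a + b = 1 → a * φ x + b * φ y ≤ φ (a * x + b * y))
    (h1 : ∀ t, HasDerivAt φ (φ' t) t) (h2 : HasDerivAt φ' c 0) : c ≤ 0 := by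
  have hconc : ConcaveOn ℝ Set.univ φ := by
    refine ⟨convex_univ, fun x _ y _ a b ha hb hab => ?_⟩
    rcases ha.eq_or_lt with h | ha
    · subst h; simp at hab; subst hab; simp
    rcases hb.eq_or_lt with h | hb
    · subst h; simp at hab; subst hab; simp
    exact hc x y a b ha hb hab
  have hanti : Antitone φ' := by
    have : Antitone (deriv φ) := by
      rw [← antitoneOn_univ]
      have := hconc.antitoneOn_derivWithin fun x _ => (h1 x).differentiableAt.differentiableWithinAt
      simpa only [derivWithin_univ] using this
    rwa [show deriv φ = φ' from funext fun t => (h1 t).deriv] at this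
  rw [← h2.deriv]
  exact hanti.deriv_nonpos

theorem lc_conv {f k : E n → ℝ} (hf0 : ∀ x, 0 ≤ f x) (hk0 : ∀ x, 0 ≤ k x)
    (hf : LC fun x => ENNReal.ofReal (f x)) (hk : LC fun x => ENNReal.ofReal (k x))
    (hi : ∀ x, Integrable fun y => f y * k (x - y)) :
    LC fun x => ENNReal.ofReal (conv f k x) := by
  have h1 : LC fun p : E n × E n => ENNReal.ofReal (f p.2) * ENNReal.ofReal (k (p.1 - p.2)) :=
    (hf.comp_linear (LinearMap.snd ℝ _ _)).mul
      (hk.comp_linear (LinearMap.fst ℝ _ _ - LinearMap.snd ℝ _ _))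
  have h2 := h1.marginal (volume : Measure (E n))
  refine cast ?_ h2
  congr 1
  funext x
  rw [conv, ofReal_integral_eq_lintegral_ofReal (hi x)
    (Filter.Eventually.of_forall fun y => mul_nonneg (hf0 y) (hk0 _))]
  simp only [ENNReal.ofReal_mul (hf0 _)]

theorem concave_log_of_LC {g : E n → ℝ} (hg : ∀ x, 0 < g x)
    (h : LC fun x => ENNReal.ofReal (g x)) (x y : E n) (a b : ℝ) (ha : 0 < a) (hb : 0 < b)
    (hab : a + b = 1) : a * Real.log (g x) + b * Real.log (g y) ≤ Real.log (g (a • x + b • y)) := by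
  have := h x y a b ha hb hab
  rw [ENNReal.ofReal_rpow_of_pos (hg x), ENNReal.ofReal_rpow_of_pos (hg y),
    ← ENNReal.ofReal_mul (by have := hg x; positivity),
    ENNReal.ofReal_le_ofReal_iff (hg _).le] at this
  have h2 := Real.log_le_log (by have := hg x; have := hg y; positivity) this
  rwa [Real.log_mul (Real.rpow_pos_of_pos (hg x) _).ne' (Real.rpow_pos_of_pos (hg y) _).ne',
    Real.log_rpow (hg x), Real.log_rpow (hg y)] at h2

theorem conv_pos {f k : E n → ℝ} (hf0 : ∀ x, 0 ≤ f x) (hk0 : ∀ x, 0 < k x)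
    (hi : ∀ x, Integrable fun y => f y * k (x - y)) (hf : Integrable f) (hpos : 0 < ∫ x, f x)
    (x : E n) : 0 < conv f k x := by
  rw [integral_pos_iff_support_of_nonneg hf0 hf] at hpos
  refine (integral_pos_iff_support_of_nonneg (fun y => mul_nonneg (hf0 y) (hk0 _).le) (hi x)).2 ?_
  refine lt_of_lt_of_le hpos (measure_mono fun y hy => ?_)
  exact mul_ne_zero hy (hk0 _).ne'

theorem abs_conv_le {f k k' : E n → ℝ} (hf0 : ∀ x, 0 ≤ f x) {M : ℝ}
    (hi : ∀ x, Integrable fun y => f y * k (x - y)) (h : ∀ x, |k' x| ≤ M * k x) (x : E n) :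
    |conv f k' x| ≤ M * conv f k x := by
  unfold conv
  rw [← integral_const_mul]
  refine (abs_integral_le_integral_abs).trans ?_
  refine integral_mono_of_nonneg (Filter.Eventually.of_forall fun y => abs_nonneg _)
    ((hi x).const_mul M) (Filter.Eventually.of_forall fun y => ?_)
  simp only [abs_mul, abs_of_nonneg (hf0 y)]
  nlinarith [mul_le_mul_of_nonneg_left (h (x - y)) (hf0 y)]

theorem HasGrad.log_div {g : E n → ℝ} {g1} (h : HasGrad g g1) (gpos : ∀ x, 0 < g x) {Z : ℝ}
    (Zpos : 0 < Z) : HasGrad (fun x => Real.log (g x / Z)) fun i x => g1 i x / g x := by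
  have hd : ∀ x, HasDerivAt (fun t => Real.log (t / Z)) (1 / g x) (g x) := fun x => by
    have h1 := ((hasDerivAt_id (g x)).div_const Z).log (by
      have := gpos x; simp only [id]; positivity)
    have e : 1 / Z / (id (g x) / Z) = 1 / g x := by
      have := (gpos x).ne'; simp only [id]; field_simp
    rw [← e]; exact h1
  have := h.comp_real (φ := fun t => Real.log (t / Z)) (φ' := fun t => 1 / t) hd
  have e : (fun i x => g1 i x / g x) = fun i x => 1 / g x * g1 i x := by
    funext i x; ring
  rw [e]; exact this

theorem HasGrad.quot {f g : E n → ℝ} {f1 g1} (hf : HasGrad f f1) (h : HasGrad g g1)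
    (gpos : ∀ x, 0 < g x) : HasGrad (fun x => f x / g x)
      fun j x => f1 j x / g x - f x * g1 j x / g x ^ 2 := by
  have hd : ∀ x, HasDerivAt (fun t : ℝ => t⁻¹) (-(g x ^ 2)⁻¹) (g x) := fun x =>
    hasDerivAt_inv (gpos x).ne'
  have h1 := h.comp_real (φ := fun t => t⁻¹) (φ' := fun t => -(t ^ 2)⁻¹) hd
  have h2 := hf.mul h1
  have e : (fun j x => f1 j x / g x - f x * g1 j x / g x ^ 2)
      = fun j x => f x * (-(g x ^ 2)⁻¹ * g1 j x) + f1 j x * (g x)⁻¹ := by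
    funext j x; ring
  rw [e]
  exact h2

theorem hess_log_nonpos {W : E n → ℝ} {b : Fin n → E n → ℝ} {h : Fin n → Fin n → E n → ℝ}
    (hW : HasGrad W b) (hb : ∀ i, HasGrad (b i) (h i))
    (hc : ∀ (x y : E n) (a b : ℝ), 0 < a → 0 < b → a + b = 1 →
      a * W x + b * W y ≤ W (a • x + b • y)) (x : E n) (v : Fin n → ℝ) :
    ∑ i, ∑ j, v i * v j * h i j x ≤ 0 := by
  set v' : E n := WithLp.toLp 2 v with hv'
  have hW' := fun t => hW.line x v' t
  have hb2 := HasDerivAt.fun_sum fun i (_ : i ∈ Finset.univ) =>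
    ((hb i).line x v' 0).mul_const (v' i)
  have := second_deriv_nonpos (φ := fun t : ℝ => W (x + t • v')) ?_ hW' hb2
  · refine le_trans (le_of_eq ?_) this
    simp only [zero_smul, add_zero]
    refine Finset.sum_congr rfl fun i _ => ?_
    rw [Finset.sum_mul]
    exact Finset.sum_congr rfl fun j _ => by
      change _ = _ * v j * v i
      ring
  · intro p q a b ha hb hab
    have h1 := hc (x + p • v') (x + q • v') a b ha hb hab
    have e : a • (x + p • v') + b • (x + q • v') = x + (a * p + b * q) • v' := by
      have : b = 1 - a := by linarith
      subst this; module
    rwa [e] at h1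

theorem nice_of_bounds {g : E n → ℝ} {g1 : Fin n → E n → ℝ} {g2 : Fin n → Fin n → E n → ℝ}
    {s R H : ℝ} (hs : 0 < s) (hR : 0 ≤ R) (G1 : HasGrad g g1) (G2 : ∀ i, HasGrad (g1 i) (g2 i))
    (cg2 : ∀ i j, Continuous (g2 i j)) (gpos : ∀ x, 0 < g x) (gle : ∀ x, g x ≤ H)
    (b1 : ∀ i x, |g1 i x| ≤ R * g x) (b2 : ∀ i j x, |g2 i j x| ≤ 3 * R ^ 2 * g x)
    (gLC : LC fun x => ENNReal.ofReal (g x)) :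
    ∃ W b h l, Nice (n := n) s W b h l ∧ ∃ Z > 0, ∀ x, Real.exp (W x) = Z * g x := by
  have tg : Tame g := Tame.of_bdd G1.continuous H fun x => by
    rw [abs_of_pos (gpos x)]; exact gle x
  obtain ⟨Z, hZ⟩ : ∃ Z : ℝ, Z = ∫ x, g x * Real.exp (-(s / 2) * ‖x‖ ^ 2) := ⟨_, rfl⟩
  have hgi := tg.integrable_gauss (b := s / 2) (by positivity)
  have Zpos : 0 < Z := by
    rw [hZ]
    refine (integral_pos_iff_support_of_nonneg (fun y => by have := gpos y; positivity) hgi).2 ?_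
    have : (Function.support fun x => g x * Real.exp (-(s / 2) * ‖x‖ ^ 2)) = Set.univ := by
      ext x; have := gpos x; simp [this.ne']
    rw [this]
    exact Measure.measure_univ_pos.2 (NeZero.ne _)
  obtain ⟨l, hl⟩ : ∃ l : ℝ, l = |Real.log (H / Z)| + R + 4 * R ^ 2 := ⟨_, rfl⟩
  have hl0 := abs_nonneg (Real.log (H / Z))
  have hR2 : 0 ≤ R ^ 2 := sq_nonneg R
  have hWg := G1.log_div gpos Zpos
  have hbg : ∀ i, HasGrad (fun x => g1 i x / g x)
      fun j x => g2 i j x / g x - g1 i x * g1 j x / g x ^ 2 := fun i => (G2 i).quot G1 gpos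
  refine ⟨fun x => Real.log (g x / Z), fun i x => g1 i x / g x,
    fun i j x => g2 i j x / g x - g1 i x * g1 j x / g x ^ 2, l,
    ⟨hs, hWg, hbg, ?_, ?_, ?_, ?_, ?_, ?_⟩, Z⁻¹, by positivity, fun x => ?_⟩
  · intro i j
    exact ((cg2 i j).div G1.continuous fun x => (gpos x).ne').sub
      (((G2 i).continuous.mul (G2 j).continuous).div (G1.continuous.pow 2)
        fun x => (pow_pos (gpos x) 2).ne')
  · intro x
    have h1 : Real.log (g x / Z) ≤ Real.log (H / Z) :=
      Real.log_le_log (div_pos (gpos x) Zpos) (by gcongr; exact gle x)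
    have h2 := le_abs_self (Real.log (H / Z))
    linarith
  · intro i x
    rw [abs_div, abs_of_pos (gpos x), div_le_iff₀ (gpos x)]
    refine (b1 i x).trans (mul_le_mul_of_nonneg_right ?_ (gpos x).le)
    linarith
  · intro i j x
    have h1 : |g2 i j x / g x| ≤ 3 * R ^ 2 := by
      rw [abs_div, abs_of_pos (gpos x), div_le_iff₀ (gpos x)]; exact b2 i j x
    have h2 : |g1 i x * g1 j x / g x ^ 2| ≤ R ^ 2 := by
      rw [abs_div, abs_mul, abs_of_pos (pow_pos (gpos x) 2), div_le_iff₀ (pow_pos (gpos x) 2)]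
      have := gpos x
      calc _ ≤ (R * g x) * (R * g x) := mul_le_mul (b1 i x) (b1 j x) (abs_nonneg _) (by positivity)
        _ = _ := by ring
    have h3 := abs_sub (g2 i j x / g x) (g1 i x * g1 j x / g x ^ 2)
    linarith
  · refine hess_log_nonpos hWg hbg fun x y a b ha hb hab => ?_
    have h1 := concave_log_of_LC gpos gLC x y a b ha hb hab
    simp only [Real.log_div (gpos _).ne' Zpos.ne']
    have : (a + b) * Real.log Z = Real.log Z := by rw [hab, one_mul]
    linarith
  · have e : ∀ x, Real.exp (Real.log (g x / Z) - s / 2 * ‖x‖ ^ 2)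
        = Z⁻¹ * (g x * Real.exp (-(s / 2) * ‖x‖ ^ 2)) := fun x => by
      rw [sub_eq_add_neg, Real.exp_add, Real.exp_log (div_pos (gpos x) Zpos)]
      rw [neg_mul]; ring
    simp only [e]
    rw [integral_const_mul, ← hZ, inv_mul_cancel₀ Zpos.ne']
  · change Real.exp (Real.log (g x / Z)) = _
    rw [Real.exp_log (div_pos (gpos x) Zpos)]; ring

/-- Gaussian-weighted log-concave densities are approximated by nice ones. -/
theorem exists_nice {f : E n → ℝ} (hf0 : ∀ x, 0 ≤ f x) (hf : Integrable f)
    (hLC : LC fun x => ENNReal.ofReal (f x)) (hpos : 0 < ∫ x, f x) {s : ℝ} (hs : 0 < s)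
    {R : ℝ} (hR : 0 ≤ R) :
    ∃ W b h l, Nice (n := n) s W b h l ∧ ∃ Z > 0, ∀ x, Real.exp (W x) = Z * conv f (ker R) x := by
  have bk : ∀ x : E n, |ker R x| ≤ 1 + R + 3 * R ^ 2 := fun x => by
    rw [abs_of_pos (ker_pos R x)]; nlinarith [ker_le_one R x]
  have bk1 : ∀ i (x : E n), |ker1 R i x| ≤ 1 + R + 3 * R ^ 2 := fun i x => by
    refine (ker1_le hR i x).trans ?_
    nlinarith [ker_le_one R x]
  have bk2 : ∀ i j (x : E n), |ker2 R i j x| ≤ 1 + R + 3 * R ^ 2 := fun i j x => by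
    refine (ker2_le hR i j x).trans ?_
    nlinarith [ker_le_one R x, sq_nonneg R]
  have ck : Continuous (ker (n := n) R) := (hasGrad_ker R).continuous
  have ck1 : ∀ i, Continuous (ker1 (n := n) R i) := fun i => (hasGrad_ker1 R i).continuous
  have hi := fun x => integrable_conv hf ck bk x
  set g := conv f (ker R) with hg
  set g1 : Fin n → E n → ℝ := fun i => conv f (ker1 R i) with hg1
  set g2 : Fin n → Fin n → E n → ℝ := fun i j => conv f (ker2 R i j) with hg2
  have G1 : HasGrad g g1 := hasGrad_conv hf (hasGrad_ker R) ck1 bk bk1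
  have G2 : ∀ i, HasGrad (g1 i) (g2 i) := fun i =>
    hasGrad_conv hf (hasGrad_ker1 R i) (continuous_ker2 R i) (bk1 i) (bk2 i)
  have cg2 : ∀ i j, Continuous (g2 i j) := fun i j =>
    continuous_conv hf (continuous_ker2 R i j) (bk2 i j)
  have gpos : ∀ x, 0 < g x := conv_pos hf0 (ker_pos R) hi hf hpos
  have gle : ∀ x, g x ≤ ∫ x, f x := fun x => by
    refine integral_mono (hi x) hf fun y => ?_
    exact mul_le_of_le_one_right (hf0 y) (ker_le_one R _)
  have b1 : ∀ i x, |g1 i x| ≤ R * g x := fun i => abs_conv_le hf0 hi (ker1_le hR i)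
  have b2 : ∀ i j x, |g2 i j x| ≤ 3 * R ^ 2 * g x := fun i j => abs_conv_le hf0 hi (ker2_le hR i j)
  have gLC : LC fun x => ENNReal.ofReal (g x) :=
    lc_conv hf0 (fun x => (ker_pos R x).le) hLC (lc_ker R) hi
  exact nice_of_bounds hs hR G1 G2 cg2 gpos gle b1 b2 gLC

end Smoothing

end SmallBall

namespace SmallBall

open scoped ENNReal NNReal Topology

section Limit

variable {n : ℕ}

theorem ker_smul (R : ℝ) (x : E n) : ker 1 (R • x) = ker R x := by
  simp [ker, norm_smul, mul_pow]

theorem integrable_ker_one : Integrable (ker (n := n) 1) := by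
  have h1 := (integrable_one_add_norm (E := E n) (μ := volume) (r := n + 1) (by simp)).const_mul
    (((n + 1).factorial : ℝ) * Real.exp 1)
  refine h1.mono' (hasGrad_ker 1).continuous.aestronglyMeasurable
    (Filter.Eventually.of_forall fun x => ?_)
  rw [Real.norm_of_nonneg (ker_pos 1 x).le]
  have hx : 0 ≤ 1 + ‖x‖ := by positivity
  have h2 : (1 + ‖x‖) ^ (n + 1) / (n + 1).factorial ≤ Real.exp (1 + ‖x‖) :=
    Real.pow_div_factorial_le_exp _ hx _
  have h3 : ker 1 x ≤ Real.exp (-‖x‖) := by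
    refine Real.exp_le_exp.2 (neg_le_neg ?_)
    exact Real.le_sqrt_of_sq_le (by linarith)
  rw [Real.rpow_neg hx, show ((n : ℝ) + 1) = ((n + 1 : ℕ) : ℝ) by push_cast; ring,
    Real.rpow_natCast]
  refine h3.trans ?_
  have hf : (0 : ℝ) < (n + 1).factorial := by positivity
  rw [div_le_iff₀ hf] at h2
  rw [← div_eq_mul_inv, le_div_iff₀ (by positivity)]
  calc Real.exp (-‖x‖) * (1 + ‖x‖) ^ (n + 1)
      ≤ Real.exp (-‖x‖) * (Real.exp (1 + ‖x‖) * (n + 1).factorial) := by gcongr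
    _ = (n + 1).factorial * (Real.exp (-‖x‖) * Real.exp (1 + ‖x‖)) := by ring
    _ = _ := by rw [← Real.exp_add]; ring_nf

theorem Tame.gauss_bdd {F : E n → ℝ} (hF : Tame F) {b : ℝ} (hb : 0 < b) :
    ∃ C, ∀ x, |F x * Real.exp (-b * ‖x‖ ^ 2)| ≤ C := by
  obtain ⟨_, C, c, hC, hc, h⟩ := hF
  refine ⟨C * Real.exp (c ^ 2 / (4 * b)), fun x => ?_⟩
  rw [abs_mul, abs_of_pos (Real.exp_pos _)]
  calc _ ≤ C * Real.exp (c * ‖x‖) * Real.exp (-b * ‖x‖ ^ 2) := by gcongr; exact h x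
    _ = C * Real.exp (c * ‖x‖ + -b * ‖x‖ ^ 2) := by rw [Real.exp_add]; ring
    _ ≤ _ := by
      gcongr
      rw [le_div_iff₀ (by positivity)]
      nlinarith [sq_nonneg (c - 2 * b * ‖x‖)]

/-- Averages of `Φ` against `f` smoothed at scale `ε`. -/
def smoothAvg (f Φ : E n → ℝ) (ε : ℝ) : ℝ := ∫ y, f y * ∫ z, Φ (y + ε • z) * ker 1 z

theorem integral_conv_ker {f Φ : E n → ℝ} (hf : Integrable f) (hΦ : Integrable Φ)
    {R : ℝ} (hR : 0 < R) :
    ∫ x, Φ x * conv f (ker R) x = (R ^ n)⁻¹ * smoothAvg f Φ R⁻¹ := by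
  have e1 : ∀ y, ∫ x, Φ x * (f y * ker R (x - y))
      = (R ^ n)⁻¹ * (f y * ∫ z, Φ (y + R⁻¹ • z) * ker 1 z) := fun y => by
    have h1 : ∫ x, Φ x * (f y * ker R (x - y)) = f y * ∫ x, Φ x * ker R (x - y) := by
      rw [← integral_const_mul]; congr 1; funext x; ring
    have h2 : ∫ x, Φ x * ker R (x - y) = ∫ x, Φ (x + y) * ker R x := by
      rw [← integral_add_right_eq_self (fun x => Φ x * ker R (x - y)) y]
      simp
    have h3 := Measure.integral_comp_smul (volume : Measure (E n))
      (fun z => Φ (y + R⁻¹ • z) * ker 1 z) R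
    simp only [smul_smul, inv_mul_cancel₀ hR.ne', one_smul, ker_smul] at h3
    rw [h1, h2]
    have h4 : ∫ x, Φ (x + y) * ker R x = ∫ x, Φ (y + x) * ker R x := by simp only [add_comm]
    rw [h4, h3]
    simp only [finrank_euclideanSpace, Fintype.card_fin, smul_eq_mul]
    rw [abs_of_pos (by positivity)]
    ring
  unfold conv smoothAvg
  rw [← integral_const_mul]
  simp only [← e1]
  simp only [← integral_const_mul]
  refine integral_integral_swap (μ := volume) (ν := volume)
    (f := fun x y => Φ x * (f y * ker R (x - y))) ?_
  have hp : Integrable (fun p : E n × E n => Φ p.1 * f p.2) (volume.prod volume) := hΦ.mul_prod hf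
  have := hp.mul_bdd (c := 1) (g := fun p : E n × E n => ker R (p.1 - p.2))
    ((hasGrad_ker R).continuous.comp (continuous_fst.sub continuous_snd)).aestronglyMeasurable
    (Filter.Eventually.of_forall fun p => by
      rw [Real.norm_of_nonneg (ker_pos R _).le]; exact ker_le_one R _)
  refine this.congr (Filter.Eventually.of_forall fun p => ?_)
  simp only [Function.uncurry]; ring

theorem tendsto_smoothAvg {f Φ : E n → ℝ} (hf : Integrable f) (hc : Continuous Φ) {C : ℝ}
    (hb : ∀ x, |Φ x| ≤ C) {ε : ℕ → ℝ} (hε : Filter.Tendsto ε Filter.atTop (𝓝 0)) :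
    Filter.Tendsto (fun k => smoothAvg f Φ (ε k)) Filter.atTop
      (𝓝 ((∫ z : E n, ker 1 z) * ∫ y, f y * Φ y)) := by
  have hbz : ∀ (t : ℝ) (y z : E n), ‖Φ (y + t • z) * ker 1 z‖ ≤ C * ker 1 z := fun t y z => by
    rw [norm_mul, Real.norm_of_nonneg (ker_pos 1 z).le]
    exact mul_le_mul_of_nonneg_right (hb _) (ker_pos 1 z).le
  have hcz : ∀ t : ℝ, Continuous fun y : E n => ∫ z, Φ (y + t • z) * ker 1 z := fun t => by
    refine continuous_of_dominated (bound := fun z => C * ker 1 z) (fun y => ?_)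
      (fun y => Filter.Eventually.of_forall (hbz t y)) (integrable_ker_one.const_mul C)
      (Filter.Eventually.of_forall fun z => ?_)
    · exact ((hc.comp (by fun_prop)).mul (hasGrad_ker 1).continuous).aestronglyMeasurable
    · exact (hc.comp (by fun_prop)).mul continuous_const
  have key : ∀ y, Filter.Tendsto (fun k => ∫ z, Φ (y + ε k • z) * ker 1 z) Filter.atTop
      (𝓝 (∫ z, Φ y * ker 1 z)) := fun y => by
    refine tendsto_integral_of_dominated_convergence (fun z => C * ker 1 z) (fun k => ?_)
      (integrable_ker_one.const_mul C) (fun k => Filter.Eventually.of_forall (hbz _ y))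
      (Filter.Eventually.of_forall fun z => ?_)
    · exact ((hc.comp (by fun_prop)).mul (hasGrad_ker 1).continuous).aestronglyMeasurable
    · refine Filter.Tendsto.mul_const _ ?_
      have h1 : Filter.Tendsto (fun k => y + ε k • z) Filter.atTop (𝓝 (y + (0 : ℝ) • z)) :=
        (hε.smul_const z).const_add y
      rw [zero_smul, add_zero] at h1
      exact (hc.tendsto y).comp h1
  have e : (∫ z : E n, ker 1 z) * ∫ y, f y * Φ y = ∫ y : E n, f y * ∫ z : E n, Φ y * ker 1 z := by
    rw [← integral_const_mul]; congr 1; funext y; rw [integral_const_mul]; ring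
  rw [e]
  refine tendsto_integral_of_dominated_convergence (fun y => |f y| * (C * ∫ z : E n, ker 1 z))
    (fun k => hf.aestronglyMeasurable.mul (hcz _).aestronglyMeasurable)
    (hf.abs.mul_const _) (fun k => Filter.Eventually.of_forall fun y => ?_)
    (Filter.Eventually.of_forall fun y => (key y).const_mul _)
  rw [norm_mul, Real.norm_eq_abs]
  refine mul_le_mul_of_nonneg_left ?_ (abs_nonneg _)
  rw [← integral_const_mul]
  exact norm_integral_le_of_norm_le (integrable_ker_one.const_mul C)
    (Filter.Eventually.of_forall (hbz _ y))

/-- Normalised Gaussian-weighted average. -/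
def gAvg (f : E n → ℝ) (s : ℝ) (F : E n → ℝ) : ℝ :=
  (∫ x, F x * (f x * Real.exp (-(s / 2) * ‖x‖ ^ 2))) / ∫ x, f x * Real.exp (-(s / 2) * ‖x‖ ^ 2)

theorem exists_nice_tendsto {f : E n → ℝ} (hf0 : ∀ x, 0 ≤ f x) (hf : Integrable f)
    (hLC : LC fun x => ENNReal.ofReal (f x)) (hpos : 0 < ∫ x, f x) {s : ℝ} (hs : 0 < s) :
    ∃ W : ℕ → E n → ℝ, (∀ k, ∃ b h l, Nice (n := n) s (W k) b h l) ∧ ∀ F, Tame F →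
      Filter.Tendsto (fun k => wInt (W k) s F) Filter.atTop (𝓝 (gAvg f s F)) := by
  have hex := fun k : ℕ => exists_nice hf0 hf hLC hpos hs (R := (k : ℝ) + 1) (by positivity)
  choose W b h l N Z hZ hW using hex
  refine ⟨W, fun k => ⟨b k, h k, l k, N k⟩, fun F hF => ?_⟩
  have hs2 : 0 < s / 2 := by positivity
  set Φ : (E n → ℝ) → E n → ℝ := fun F x => F x * Real.exp (-(s / 2) * ‖x‖ ^ 2) with hΦ
  have hw : ∀ G, Tame G → ∀ k, wInt (W k) s G
      = Z k * ((((k : ℝ) + 1) ^ n)⁻¹ * smoothAvg f (Φ G) ((k : ℝ) + 1)⁻¹) := fun G hG k => by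
    rw [← integral_conv_ker hf (hG.integrable_gauss hs2) (by positivity), ← integral_const_mul]
    unfold wInt
    congr 1; funext x
    rw [sub_eq_add_neg, Real.exp_add, hW, ← neg_mul]
    ring
  have hε : Filter.Tendsto (fun k : ℕ => ((k : ℝ) + 1)⁻¹) Filter.atTop (𝓝 0) := by
    simpa only [one_div] using tendsto_one_div_add_atTop_nhds_zero_nat (𝕜 := ℝ)
  have hlim : ∀ G, Tame G → Filter.Tendsto (fun k : ℕ => smoothAvg f (Φ G) ((k : ℝ) + 1)⁻¹)
      Filter.atTop (𝓝 ((∫ z : E n, ker 1 z) * ∫ y, f y * Φ G y)) := fun G hG => by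
    obtain ⟨C, hC⟩ := hG.gauss_bdd hs2
    exact tendsto_smoothAvg hf (hG.1.mul (by fun_prop)) hC hε
  have t1 : Tame fun _ : E n => (1 : ℝ) := Tame.const 1
  have hk0 : 0 < ∫ z : E n, ker 1 z := by
    refine (integral_pos_iff_support_of_nonneg (fun y => (ker_pos 1 y).le) integrable_ker_one).2 ?_
    rw [show Function.support (ker (n := n) 1) = Set.univ from
      Set.eq_univ_of_forall fun x => (ker_pos 1 x).ne']
    exact Measure.measure_univ_pos.2 (NeZero.ne _)
  have hm0 : 0 < ∫ y, f y * Φ (fun _ => 1) y := by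
    have hi : Integrable fun y => f y * Φ (fun _ => 1) y := by
      obtain ⟨C, hC⟩ := t1.gauss_bdd hs2
      exact hf.mul_bdd (c := C) (t1.1.mul (by fun_prop)).aestronglyMeasurable
        (Filter.Eventually.of_forall hC)
    rw [integral_pos_iff_support_of_nonneg (fun y => by have := hf0 y; simp only [hΦ]; positivity) hi]
    rw [integral_pos_iff_support_of_nonneg hf0 hf] at hpos
    refine hpos.trans_le (measure_mono fun y hy => ?_)
    exact mul_ne_zero hy (by simp only [hΦ]; positivity)
  have h1 : ∀ k, wInt (W k) s F
      = smoothAvg f (Φ F) ((k : ℝ) + 1)⁻¹ / smoothAvg f (Φ fun _ => 1) ((k : ℝ) + 1)⁻¹ :=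
      fun k => by
    have a1 := hw F hF k
    have a2 := hw _ t1 k
    rw [(N k).wInt_const] at a2
    have : smoothAvg f (Φ fun _ => 1) ((k : ℝ) + 1)⁻¹ ≠ 0 := fun h => by
      rw [h] at a2; simp at a2
    rw [eq_div_iff this, a1]
    linear_combination (-smoothAvg f (Φ F) ((k : ℝ) + 1)⁻¹) * a2
  simp only [h1]
  have h2 := (hlim F hF).div (hlim _ t1) (by positivity)
  rw [mul_div_mul_left _ _ hk0.ne'] at h2
  have e : (∫ y, f y * Φ F y) / (∫ y, f y * Φ (fun _ => 1) y) = gAvg f s F := by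
    unfold gAvg
    simp only [hΦ, one_mul]
    congr 2
    funext x; ring
  rwa [e] at h2

theorem quad_var_gAvg {f : E n → ℝ} (hf0 : ∀ x, 0 ≤ f x) (hf : Integrable f)
    (hLC : LC fun x => ENNReal.ofReal (f x)) (hpos : 0 < ∫ x, f x) {s : ℝ} (hs : 0 < s)
    {u : ℝ} (hu : 0 ≤ u)
    (hmom : ∀ v : Fin n → ℝ, ∑ i, ∑ j, v i * v j * gAvg f s (fun x => x i * x j)
      ≤ u * ∑ i, v i ^ 2) (A : Fin n → Fin n → ℝ) :
    gAvg f s (fun x => (∑ i, ∑ j, A i j * (x i * x j)) ^ 2)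
        - gAvg f s (fun x => ∑ i, ∑ j, A i j * (x i * x j)) ^ 2
      ≤ 8 * u * √(u / s) * ∑ i, ∑ j, A i j ^ 2 := by
  obtain ⟨W, hN, hlim⟩ := exists_nice_tendsto hf0 hf hLC hpos hs
  choose b h l N using hN
  have tc := Tame.coord (n := n)
  have tQ : Tame fun x : E n => ∑ i, ∑ j, A i j * (x i * x j) :=
    Tame.sum _ fun i _ => Tame.sum _ fun j _ => (Tame.const _).mul ((tc i).mul (tc j))
  have hL := ((hlim _ (tQ.pow 2)).sub ((hlim _ tQ).pow 2))
  have hδ : ∀ δ > 0, gAvg f s (fun x => (∑ i, ∑ j, A i j * (x i * x j)) ^ 2)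
        - gAvg f s (fun x => ∑ i, ∑ j, A i j * (x i * x j)) ^ 2
      ≤ 8 * (u + δ) * √((u + δ) / s) * ∑ i, ∑ j, A i j ^ 2 := by
    intro δ hδ
    refine le_of_tendsto hL ?_
    have herr : Filter.Tendsto (fun k => ∑ i, ∑ j, |wInt (W k) s (fun x => x i * x j)
        - gAvg f s (fun x => x i * x j)|) Filter.atTop (𝓝 0) := by
      have : (0 : ℝ) = ∑ i : Fin n, ∑ j : Fin n, |gAvg f s (fun x => x i * x j)
        - gAvg f s (fun x => x i * x j)| := by simp
      rw [this]
      exact tendsto_finsetSum _ fun i _ => tendsto_finsetSum _ fun j _ =>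
        ((hlim _ ((tc i).mul (tc j))).sub_const _).abs
    filter_upwards [herr.eventually (gt_mem_nhds hδ)] with k hk
    refine (N k).quad_var (by positivity) (fun v => ?_) A
    have e1 : (fun x : E n => (∑ i, v i * x i) ^ 2)
        = fun x => ∑ i, ∑ j, v i * v j * (x i * x j) := by
      funext x
      rw [sq, Finset.sum_mul_sum]
      exact Finset.sum_congr rfl fun i _ => Finset.sum_congr rfl fun j _ => by ring
    have e2 : wInt (W k) s (fun x => (∑ i, v i * x i) ^ 2)
        = ∑ i, ∑ j, v i * v j * wInt (W k) s (fun x => x i * x j) := by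
      rw [e1, (N k).wInt_sum _ fun i _ => Tame.sum _ fun j _ =>
        (Tame.const _).mul ((tc i).mul (tc j))]
      refine Finset.sum_congr rfl fun i _ => ?_
      rw [(N k).wInt_sum _ fun j _ => (Tame.const _).mul ((tc i).mul (tc j))]
      exact Finset.sum_congr rfl fun j _ => wInt_const_mul _ _
    have h2 : ∀ i j, v i * v j * wInt (W k) s (fun x => x i * x j)
        ≤ v i * v j * gAvg f s (fun x => x i * x j)
          + |wInt (W k) s (fun x => x i * x j) - gAvg f s (fun x => x i * x j)|
            * ∑ i, v i ^ 2 := fun i j => by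
      have a1 : |v i * v j| ≤ ∑ i, v i ^ 2 := by
        have b1 := Finset.single_le_sum (f := fun i => v i ^ 2) (fun i _ => sq_nonneg _)
          (Finset.mem_univ i)
        have b2 := Finset.single_le_sum (f := fun i => v i ^ 2) (fun i _ => sq_nonneg _)
          (Finset.mem_univ j)
        rw [abs_le]
        constructor <;> nlinarith [sq_nonneg (v i - v j), sq_nonneg (v i + v j)]
      set d := wInt (W k) s (fun x => x i * x j) - gAvg f s (fun x => x i * x j) with hd
      have a2 : v i * v j * d ≤ |d| * ∑ i, v i ^ 2 := by
        calc v i * v j * d ≤ |v i * v j * d| := le_abs_self _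
          _ = |d| * |v i * v j| := by rw [abs_mul, mul_comm]
          _ ≤ _ := by gcongr
      have : v i * v j * d = v i * v j * wInt (W k) s (fun x => x i * x j)
        - v i * v j * gAvg f s (fun x => x i * x j) := by rw [hd]; ring
      linarith
    rw [e2]
    refine (Finset.sum_le_sum fun i _ => Finset.sum_le_sum fun j _ => h2 i j).trans ?_
    simp only [Finset.sum_add_distrib, ← Finset.sum_mul]
    have h3 : 0 ≤ ∑ i, v i ^ 2 := Finset.sum_nonneg fun i _ => sq_nonneg _
    have h4 := mul_le_mul_of_nonneg_right hk.le h3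
    have := hmom v
    linarith
  have hc : Continuous fun δ : ℝ => 8 * (u + δ) * √((u + δ) / s) * ∑ i, ∑ j, A i j ^ 2 := by
    fun_prop
  have h0 := (hc.tendsto 0).mono_left (nhdsWithin_le_nhds (s := Set.Ioi 0))
  rw [add_zero u] at h0
  exact ge_of_tendsto h0 (Filter.eventually_of_mem self_mem_nhdsWithin fun δ h => hδ δ h)

end Limit

end SmallBall

namespace SmallBall

open scoped ENNReal NNReal Topology

section Ito

variable {n : ℕ} {M : Type*} [NormedRing M] [NormedAlgebra ℝ M]

/-- Continuous functions of space-time with at most exponential growth. -/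
def Grow (F : ℝ × E n → M) : Prop :=
  Continuous F ∧ ∃ C c : ℝ, 0 ≤ C ∧ 0 ≤ c ∧ ∀ p, ‖F p‖ ≤ C * Real.exp (c * ‖p‖)

theorem Grow.of_bdd {F : ℝ × E n → M} (hc : Continuous F) (C : ℝ) (h : ∀ p, ‖F p‖ ≤ C) :
    Grow F :=
  ⟨hc, C, 0, (norm_nonneg _).trans (h 0), le_rfl, fun p => by simpa using h p⟩

theorem Grow.const (a : M) : Grow fun _ : ℝ × E n => a :=
  Grow.of_bdd continuous_const ‖a‖ fun _ => le_rfl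

theorem Grow.add {F G : ℝ × E n → M} (hF : Grow F) (hG : Grow G) : Grow fun p => F p + G p := by
  obtain ⟨hF, C, c, hC, hc, h⟩ := hF
  obtain ⟨hG, D, d, hD, hd, k⟩ := hG
  refine ⟨hF.add hG, C + D, c + d, by positivity, by positivity, fun x => ?_⟩
  calc _ ≤ ‖F x‖ + ‖G x‖ := norm_add_le _ _
    _ ≤ C * Real.exp (c * ‖x‖) + D * Real.exp (d * ‖x‖) := add_le_add (h x) (k x)
    _ ≤ C * Real.exp ((c + d) * ‖x‖) + D * Real.exp ((c + d) * ‖x‖) := by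
        gcongr <;> nlinarith [norm_nonneg x]
    _ = _ := by ring

theorem Grow.mul {F G : ℝ × E n → M} (hF : Grow F) (hG : Grow G) : Grow fun p => F p * G p := by
  obtain ⟨hF, C, c, hC, hc, h⟩ := hF
  obtain ⟨hG, D, d, hD, hd, k⟩ := hG
  refine ⟨hF.mul hG, C * D, c + d, by positivity, by positivity, fun x => ?_⟩
  rw [add_mul, Real.exp_add]
  calc _ ≤ ‖F x‖ * ‖G x‖ := norm_mul_le _ _
    _ ≤ (C * Real.exp (c * ‖x‖)) * (D * Real.exp (d * ‖x‖)) :=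
        mul_le_mul (h x) (k x) (norm_nonneg _) (by positivity)
    _ = _ := by ring

theorem Grow.map {N : Type*} [NormedRing N] [NormedAlgebra ℝ N] {F : ℝ × E n → M} (hF : Grow F)
    (L : M →L[ℝ] N) : Grow fun p => L (F p) := by
  obtain ⟨hF, C, c, hC, hc, h⟩ := hF
  refine ⟨L.continuous.comp hF, ‖L‖ * C, c, by positivity, hc, fun p => ?_⟩
  calc _ ≤ ‖L‖ * ‖F p‖ := L.le_opNorm _
    _ ≤ ‖L‖ * (C * Real.exp (c * ‖p‖)) := by gcongr; exact h p
    _ = _ := by ring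

theorem Grow.neg {F : ℝ × E n → M} (hF : Grow F) : Grow fun p => - F p := by
  simpa using (Grow.const (-1)).mul hF

theorem Grow.sub {F G : ℝ × E n → M} (hF : Grow F) (hG : Grow G) : Grow fun p => F p - G p := by
  simpa [sub_eq_add_neg] using hF.add hG.neg

theorem Grow.smul {F : ℝ × E n → M} (hF : Grow F) (a : ℝ) : Grow fun p => a • F p :=
  hF.map (a • ContinuousLinearMap.id ℝ M)

theorem Grow.sum {ι : Type*} (s : Finset ι) {F : ι → ℝ × E n → M} (h : ∀ i ∈ s, Grow (F i)) :
    Grow fun p => ∑ i ∈ s, F i p := by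
  induction s using Finset.cons_induction with
  | empty => simpa using Grow.const 0
  | cons a s ha ih =>
    simp only [Finset.sum_cons]
    exact (h a (by simp)).add (ih fun i hi => h i (by simp [hi]))

/-- `Ft` is the time derivative, `F1` the spatial gradient and `F2` the pure second spatial
derivatives of `F`. -/
structure Ito (F Ft : ℝ × E n → M) (F1 F2 : Fin n → ℝ × E n → M) : Prop where
  g0 : Grow F
  gt : Grow Ft
  g1 : ∀ k, Grow (F1 k)
  g2 : ∀ k, Grow (F2 k)
  hF : ∀ (γ : ℝ → ℝ × E n) (γ' : ℝ × E n) (s : ℝ), HasDerivAt γ γ' s →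
    HasDerivAt (fun s => F (γ s)) (γ'.1 • Ft (γ s) + ∑ k, γ'.2 k • F1 k (γ s)) s
  h1 : ∀ k p, HasDerivAt (fun s : ℝ => F1 k (p + s • (0, EuclideanSpace.single k 1))) (F2 k p) 0

variable {F Ft G Gt : ℝ × E n → M} {F1 F2 G1 G2 : Fin n → ℝ × E n → M}

theorem Ito.congr {Ft' : ℝ × E n → M} {F1' F2' : Fin n → ℝ × E n → M} (h : Ito F Ft F1 F2)
    (ht : ∀ p, Ft p = Ft' p) (h1 : ∀ k p, F1 k p = F1' k p) (h2 : ∀ k p, F2 k p = F2' k p) :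
    Ito F Ft' F1' F2' := by
  obtain rfl : Ft = Ft' := funext ht
  obtain rfl : F1 = F1' := funext fun k => funext (h1 k)
  obtain rfl : F2 = F2' := funext fun k => funext (h2 k)
  exact h

theorem hasDerivAt_axis (k : Fin n) (p : ℝ × E n) (s : ℝ) :
    HasDerivAt (fun s : ℝ => p + s • ((0, EuclideanSpace.single k 1) : ℝ × E n))
      (0, EuclideanSpace.single k 1) s := by
  simpa using ((hasDerivAt_id s).smul_const ((0, EuclideanSpace.single k 1) : ℝ × E n)).const_add p

theorem Ito.axis (h : Ito F Ft F1 F2) (k : Fin n) (p : ℝ × E n) :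
    HasDerivAt (fun s : ℝ => F (p + s • (0, EuclideanSpace.single k 1))) (F1 k p) 0 := by
  have := h.hF _ _ 0 (hasDerivAt_axis k p 0)
  simp only [zero_smul, add_zero, zero_add] at this
  rwa [Finset.sum_eq_single k (fun b _ hb => by simp [hb]) (by simp),
    EuclideanSpace.single_apply, if_pos rfl, one_smul] at this

theorem Ito.const (a : M) : Ito (n := n) (fun _ => a) (fun _ => 0) (fun _ _ => 0) fun _ _ => 0 :=
  ⟨Grow.const a, Grow.const 0, fun _ => Grow.const 0, fun _ => Grow.const 0,
    fun γ γ' s _ => by simpa using hasDerivAt_const s a, fun k p => hasDerivAt_const _ _⟩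

theorem Ito.add (hF : Ito F Ft F1 F2) (hG : Ito G Gt G1 G2) :
    Ito (fun p => F p + G p) (fun p => Ft p + Gt p) (fun k p => F1 k p + G1 k p)
      fun k p => F2 k p + G2 k p :=
  ⟨hF.g0.add hG.g0, hF.gt.add hG.gt, fun k => (hF.g1 k).add (hG.g1 k),
    fun k => (hF.g2 k).add (hG.g2 k), fun γ γ' s h => by
      have e : γ'.1 • (Ft (γ s) + Gt (γ s)) + ∑ k, γ'.2 k • (F1 k (γ s) + G1 k (γ s))
        = (γ'.1 • Ft (γ s) + ∑ k, γ'.2 k • F1 k (γ s))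
          + (γ'.1 • Gt (γ s) + ∑ k, γ'.2 k • G1 k (γ s)) := by
        simp only [smul_add, Finset.sum_add_distrib]; abel
      rw [e]
      exact (hF.hF γ γ' s h).add (hG.hF γ γ' s h),
    fun k p => (hF.h1 k p).add (hG.h1 k p)⟩

theorem Ito.map {N : Type*} [NormedRing N] [NormedAlgebra ℝ N] (hF : Ito F Ft F1 F2)
    (L : M →L[ℝ] N) : Ito (fun p => L (F p)) (fun p => L (Ft p)) (fun k p => L (F1 k p))
      fun k p => L (F2 k p) :=
  ⟨hF.g0.map L, hF.gt.map L, fun k => (hF.g1 k).map L, fun k => (hF.g2 k).map L,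
    fun γ γ' s h => by
      have := L.hasFDerivAt.comp_hasDerivAt s (hF.hF γ γ' s h)
      simp only [map_add, map_smul, map_sum] at this
      exact this,
    fun k p => L.hasFDerivAt.comp_hasDerivAt 0 (hF.h1 k p)⟩

theorem Ito.mul (hF : Ito F Ft F1 F2) (hG : Ito G Gt G1 G2) :
    Ito (fun p => F p * G p) (fun p => Ft p * G p + F p * Gt p)
      (fun k p => F1 k p * G p + F p * G1 k p)
      fun k p => F2 k p * G p + (2 : ℝ) • (F1 k p * G1 k p) + F p * G2 k p :=
  ⟨hF.g0.mul hG.g0, (hF.gt.mul hG.g0).add (hF.g0.mul hG.gt),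
    fun k => ((hF.g1 k).mul hG.g0).add (hF.g0.mul (hG.g1 k)),
    fun k => (((hF.g2 k).mul hG.g0).add (((hF.g1 k).mul (hG.g1 k)).smul 2)).add
      (hF.g0.mul (hG.g2 k)), fun γ γ' s h => by
      have := (hF.hF γ γ' s h).mul (hG.hF γ γ' s h)
      have e : γ'.1 • (Ft (γ s) * G (γ s) + F (γ s) * Gt (γ s))
          + ∑ k, γ'.2 k • (F1 k (γ s) * G (γ s) + F (γ s) * G1 k (γ s))
        = (γ'.1 • Ft (γ s) + ∑ k, γ'.2 k • F1 k (γ s)) * G (γ s)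
          + F (γ s) * (γ'.1 • Gt (γ s) + ∑ k, γ'.2 k • G1 k (γ s)) := by
        simp only [smul_add, Finset.sum_add_distrib, add_mul, mul_add, Finset.sum_mul,
          Finset.mul_sum, smul_mul_assoc, mul_smul_comm]
        abel
      rw [e]
      exact this,
    fun k p => by
      have := ((hF.h1 k p).mul (hG.axis k p)).add ((hF.axis k p).mul (hG.h1 k p))
      simp only [zero_smul, add_zero] at this
      have e : F2 k p * G p + (2 : ℝ) • (F1 k p * G1 k p) + F p * G2 k p
        = F2 k p * G p + F1 k p * G1 k p + (F1 k p * G1 k p + F p * G2 k p) := by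
        rw [two_smul]; abel
      rw [e]
      exact this⟩

theorem hasDerivAt_inverse [CompleteSpace M] {f r : ℝ → M} {f' : M} {s : ℝ}
    (hf : HasDerivAt f f' s)
    (h1 : ∀ s, f s * r s = 1) (h2 : ∀ s, r s * f s = 1) :
    HasDerivAt r (-(r s * f' * r s)) s := by
  have hr : r = fun s => Ring.inverse (f s) := by
    funext s
    exact (Ring.inverse_unit ⟨f s, r s, h1 s, h2 s⟩).symm
  have := (hasFDerivAt_ringInverse (𝕜 := ℝ) (⟨f s, r s, h1 s, h2 s⟩ : Mˣ)).comp_hasDerivAt s hf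
  have e : -(r s * f' * r s) = (-ContinuousLinearMap.mulLeftRight ℝ M
      ↑(⟨f s, r s, h1 s, h2 s⟩ : Mˣ)⁻¹ ↑(⟨f s, r s, h1 s, h2 s⟩ : Mˣ)⁻¹) f' := by simp
  rw [e]
  nth_rewrite 1 [hr]
  exact this

theorem Ito.inv [CompleteSpace M] (hF : Ito F Ft F1 F2) {R : ℝ × E n → M} (hR : Grow R)
    (h1 : ∀ p, F p * R p = 1) (h2 : ∀ p, R p * F p = 1) :
    Ito R (fun p => -(R p * Ft p * R p)) (fun k p => -(R p * F1 k p * R p))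
      fun k p => (2 : ℝ) • (R p * F1 k p * R p * F1 k p * R p) - R p * F2 k p * R p := by
  have hd : ∀ (γ : ℝ → ℝ × E n) (γ' : ℝ × E n) (s : ℝ), HasDerivAt γ γ' s →
      HasDerivAt (fun s => R (γ s))
        (-(R (γ s) * (γ'.1 • Ft (γ s) + ∑ k, γ'.2 k • F1 k (γ s)) * R (γ s))) s :=
    fun γ γ' s h => hasDerivAt_inverse (hF.hF γ γ' s h) (fun s => h1 _) fun s => h2 _
  refine ⟨hR, ((hR.mul hF.gt).mul hR).neg, fun k => ((hR.mul (hF.g1 k)).mul hR).neg, fun k =>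
    (((((hR.mul (hF.g1 k)).mul hR).mul (hF.g1 k)).mul hR).smul 2).sub
      ((hR.mul (hF.g2 k)).mul hR), fun γ γ' s h => ?_, fun k p => ?_⟩
  · have := hd γ γ' s h
    have e : γ'.1 • -(R (γ s) * Ft (γ s) * R (γ s))
          + ∑ k, γ'.2 k • -(R (γ s) * F1 k (γ s) * R (γ s))
        = -(R (γ s) * (γ'.1 • Ft (γ s) + ∑ k, γ'.2 k • F1 k (γ s)) * R (γ s)) := by
      simp only [add_mul, mul_add, Finset.sum_mul, Finset.mul_sum, smul_mul_assoc, mul_smul_comm,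
        neg_add, smul_neg, Finset.sum_neg_distrib]
    rw [e]
    exact this
  · have a : HasDerivAt (fun s : ℝ => R (p + s • (0, EuclideanSpace.single k 1)))
        (-(R p * F1 k p * R p)) 0 := by
      have := hasDerivAt_inverse (hF.axis k p) (r := fun s : ℝ =>
        R (p + s • (0, EuclideanSpace.single k 1))) (fun s => h1 _) fun s => h2 _
      simpa only [zero_smul, add_zero] using this
    have := ((a.mul (hF.h1 k p)).mul a).neg
    simp only [zero_smul, add_zero, Pi.mul_apply] at this
    have e : (2 : ℝ) • (R p * F1 k p * R p * F1 k p * R p) - R p * F2 k p * R p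
      = -((-(R p * F1 k p * R p) * F1 k p + R p * F2 k p) * R p
        + R p * F1 k p * -(R p * F1 k p * R p)) := by
      rw [two_smul]; noncomm_ring
    rw [e]
    exact this

end Ito

end SmallBall

namespace SmallBall

open scoped ENNReal NNReal Topology

section Heat

variable {n : ℕ}

/-- The unnormalised standard Gaussian density. -/
def gw (g : E n) : ℝ := Real.exp (-(1 / 2) * ‖g‖ ^ 2)

theorem gw_pos (g : E n) : 0 < gw g := Real.exp_pos _

theorem integrable_gw : Integrable (gw (n := n)) := integrable_exp_neg_sq (by norm_num)

theorem integral_gw_pos : 0 < ∫ g : E n, gw g := by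
  refine (integral_pos_iff_support_of_nonneg (fun y => (gw_pos y).le) integrable_gw).2 ?_
  rw [show Function.support (gw (n := n)) = Set.univ from
    Set.eq_univ_of_forall fun x => (gw_pos x).ne']
  exact Measure.measure_univ_pos.2 (NeZero.ne _)

theorem Tame.integrable_gw {F : E n → ℝ} (hF : Tame F) : Integrable fun x => F x * gw x :=
  hF.integrable_gauss (by norm_num)

/-- The Gaussian average of `F (t, √t g)`. -/
def heat (F : ℝ × E n → ℝ) (t : ℝ) : ℝ := (∫ g, F (t, √t • g) * gw g) / ∫ g : E n, gw g

theorem Grow.dom {F : ℝ × E n → ℝ} (hF : Grow F) (T : ℝ) :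
    ∃ C c, 0 ≤ C ∧ 0 ≤ c ∧ ∀ t, |t| ≤ T → ∀ g : E n, |F (t, √t • g)| ≤ C * Real.exp (c * ‖g‖) := by
  obtain ⟨_, C, c, hC, hc, h⟩ := hF
  refine ⟨C * Real.exp (c * T), c * √T, by positivity, by positivity, fun t ht g => ?_⟩
  refine (h _).trans ?_
  rw [mul_assoc, ← Real.exp_add]
  gcongr
  have h1 : ‖((t, √t • g) : ℝ × E n)‖ ≤ T + √T * ‖g‖ := by
    rw [Prod.norm_def]
    have hT : 0 ≤ T := (abs_nonneg t).trans ht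
    refine max_le ?_ ?_
    · rw [Real.norm_eq_abs]; have : 0 ≤ √T * ‖g‖ := by positivity
      linarith
    · rw [norm_smul, Real.norm_of_nonneg (Real.sqrt_nonneg _)]
      have : √t ≤ √T := Real.sqrt_le_sqrt ((le_abs_self t).trans ht)
      have := mul_le_mul_of_nonneg_right this (norm_nonneg g)
      linarith
  nlinarith

theorem tame_exp_norm (C c : ℝ) (hC : 0 ≤ C) (hc : 0 ≤ c) :
    Tame fun g : E n => C * Real.exp (c * ‖g‖) :=
  ⟨by fun_prop, C, c, hC, hc, fun x => by rw [abs_of_nonneg (by positivity)]⟩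

theorem Grow.tame {F : ℝ × E n → ℝ} (hF : Grow F) (t : ℝ) : Tame fun g : E n => F (t, √t • g) := by
  obtain ⟨C, c, hC, hc, h⟩ := hF.dom |t|
  exact ⟨hF.1.comp (by fun_prop), C, c, hC, hc, fun g => h t le_rfl g⟩

theorem Grow.continuous_heat {F : ℝ × E n → ℝ} (hF : Grow F) : Continuous (heat F) := by
  refine Continuous.div_const ?_ _
  refine continuous_iff_continuousAt.2 fun t₀ => ?_
  obtain ⟨C, c, hC, hc, h⟩ := hF.dom (|t₀| + 1)
  refine continuousAt_of_dominated (bound := fun g => C * Real.exp (c * ‖g‖) * gw g)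
    (Filter.Eventually.of_forall fun t => (hF.tame t).integrable_gw.aestronglyMeasurable) ?_
    (tame_exp_norm C c hC hc).integrable_gw (Filter.Eventually.of_forall fun g => ?_)
  · have : {t : ℝ | |t| < |t₀| + 1} ∈ 𝓝 t₀ :=
      (isOpen_lt continuous_abs continuous_const).mem_nhds (by simp)
    filter_upwards [this] with t ht
    refine Filter.Eventually.of_forall fun g => ?_
    rw [norm_mul, Real.norm_of_nonneg (gw_pos g).le]
    exact mul_le_mul_of_nonneg_right (h t (le_of_lt ht) g) (gw_pos g).le
  · exact ((hF.1.comp (by fun_prop)).mul continuous_const).continuousAt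

theorem heat_add {F G : ℝ × E n → ℝ} (hF : Grow F) (hG : Grow G) (t : ℝ) :
    heat (fun p => F p + G p) t = heat F t + heat G t := by
  unfold heat
  rw [← add_div, ← integral_add (hF.tame t).integrable_gw (hG.tame t).integrable_gw]
  simp only [add_mul]

theorem heat_const_mul (F : ℝ × E n → ℝ) (a t : ℝ) :
    heat (fun p => a * F p) t = a * heat F t := by
  unfold heat
  simp only [mul_assoc, integral_const_mul, mul_div_assoc]

theorem heat_mono {F G : ℝ × E n → ℝ} (hF : Grow F) (hG : Grow G) {t : ℝ}
    (h : ∀ θ, F (t, θ) ≤ G (t, θ)) : heat F t ≤ heat G t := by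
  unfold heat
  refine div_le_div_of_nonneg_right ?_ integral_gw_pos.le
  exact integral_mono (hF.tame t).integrable_gw (hG.tame t).integrable_gw fun g =>
    mul_le_mul_of_nonneg_right (h _) (gw_pos g).le

theorem heat_const (a t : ℝ) : heat (fun _ : ℝ × E n => a) t = a := by
  unfold heat
  rw [integral_const_mul, mul_div_assoc, div_self integral_gw_pos.ne', mul_one]

theorem heat_sum {ι : Type*} (s : Finset ι) {F : ι → ℝ × E n → ℝ} (h : ∀ i ∈ s, Grow (F i))
    (t : ℝ) : heat (fun p => ∑ i ∈ s, F i p) t = ∑ i ∈ s, heat (F i) t := by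
  induction s using Finset.cons_induction with
  | empty => simpa using heat_const 0 t
  | cons a s ha ih =>
    simp only [Finset.sum_cons]
    rw [heat_add (h a (by simp)) (Grow.sum s fun i hi => h i (by simp [hi])),
      ih fun i hi => h i (by simp [hi])]

theorem hasLineDerivAt_gw (k : Fin n) (g : E n) :
    HasLineDerivAt ℝ gw (-(g k) * gw g) g (EuclideanSpace.single k 1) := by
  have h := ((HasGrad.norm_sq (n := n)).const_mul (-(1 / 2))).exp
  have := (h g).hasLineDerivAt (EuclideanSpace.single k 1)
  have e : (∑ i, (Real.exp (-(1 / 2) * ‖g‖ ^ 2) * (-(1 / 2) * (2 * g i))) •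
      (EuclideanSpace.proj i : E n →L[ℝ] ℝ)) (EuclideanSpace.single k 1) = -(g k) * gw g := by
    rw [ContinuousLinearMap.sum_apply, Finset.sum_eq_single k (fun b _ hb => by simp [hb])
      (by simp)]
    simp [gw]; ring
  rw [e] at this
  exact this

/-- Gaussian integration by parts. -/
theorem gauss_ibp {F F' : E n → ℝ} (hF : Tame F) (hF' : Tame F') (k : Fin n)
    (hd : ∀ g, HasDerivAt (fun s : ℝ => F (g + s • EuclideanSpace.single k 1)) (F' g) 0) :
    ∫ g, g k * F g * gw g = ∫ g, F' g * gw g := by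
  have key := integral_bilinear_hasLineDerivAt_right_eq_neg_left_of_integrable
    (μ := (volume : Measure (E n))) (f := F) (f' := F') (g := gw)
    (g' := fun g => -(g k) * gw g) (v := EuclideanSpace.single k 1)
    (B := ContinuousLinearMap.mul ℝ ℝ) ?_ ?_ ?_ (fun x _ => hd x)
    (fun x _ => hasLineDerivAt_gw k x)
  · simp only [ContinuousLinearMap.mul_apply'] at key
    rw [← neg_eq_iff_eq_neg, ← integral_neg] at key
    rw [← key]
    congr 1; funext g; ring
  · exact hF'.integrable_gw
  · refine ((hF.mul (Tame.coord k)).integrable_gw.neg).congr (Filter.Eventually.of_forall fun g => ?_)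
    simp
    ring
  · exact hF.integrable_gw

theorem heat_ibp {F F' : ℝ × E n → ℝ} (hF : Grow F) (hF' : Grow F') (k : Fin n)
    (hd : ∀ p, HasDerivAt (fun s : ℝ => F (p + s • (0, EuclideanSpace.single k 1))) (F' p) 0)
    (t : ℝ) : ∫ g, g k * F (t, √t • g) * gw g = √t * ∫ g, F' (t, √t • g) * gw g := by
  rw [gauss_ibp (hF.tame t) (F' := fun g => √t * F' (t, √t • g))
    ((Tame.const _).mul (hF'.tame t)) k fun g => ?_]
  · simp only [mul_assoc, integral_const_mul]
  · have h1 : HasDerivAt (fun s : ℝ => √t * s) √t 0 := by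
      simpa using (hasDerivAt_id (0 : ℝ)).const_mul √t
    have h2 := hd (t, √t • g)
    rw [show (0 : ℝ) = √t * 0 by simp] at h2
    have h3 := HasDerivAt.scomp (0 : ℝ) h2 h1
    refine HasDerivAt.congr_deriv (h3.congr_of_eventuallyEq
      (Filter.Eventually.of_forall fun s => ?_)) (by simp)
    simp [smul_add, mul_smul]

/-- Evolution of Gaussian averages. -/
theorem Ito.heat_deriv {F Ft : ℝ × E n → ℝ} {F1 F2 : Fin n → ℝ × E n → ℝ}
    (h : Ito F Ft F1 F2) {t : ℝ} (ht : 0 < t) :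
    HasDerivAt (heat F) (heat (fun p => Ft p + 1 / 2 * ∑ k, F2 k p) t) t := by
  have hγ : ∀ (g : E n) (s : ℝ), 0 < s → HasDerivAt (fun s : ℝ => ((s, √s • g) : ℝ × E n))
      (1, (1 / (2 * √s)) • g) s := fun g s hs =>
    (hasDerivAt_id s).prodMk ((Real.hasDerivAt_sqrt hs.ne').smul_const g)
  set D : ℝ → E n → ℝ := fun s g => (Ft (s, √s • g)
    + ∑ k, 1 / (2 * √s) * (g k * F1 k (s, √s • g))) with hD
  have hd : ∀ (g : E n) (s : ℝ), 0 < s → HasDerivAt (fun s : ℝ => F (s, √s • g) * gw g)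
      (D s g * gw g) s := fun g s hs => by
    have := (h.hF _ _ s (hγ g s hs)).mul_const (gw g)
    refine this.congr_deriv ?_
    simp [hD, mul_assoc]
  have tD : ∀ s, Tame (D s) := fun s => (h.gt.tame s).add (Tame.sum _ fun k _ =>
    (Tame.const _).mul ((Tame.coord k).mul ((h.g1 k).tame s)))
  obtain ⟨B, hB, hBD⟩ : ∃ B : E n → ℝ, Tame B ∧ ∀ s ∈ Set.Ioo (t / 2) (2 * t), ∀ g,
      |D s g| ≤ B g := by
    obtain ⟨C, c, hC, hc, hb⟩ := h.gt.dom (2 * t)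
    choose C1 c1 hC1 hc1 hb1 using fun k => (h.g1 k).dom (2 * t)
    refine ⟨fun g => C * Real.exp (c * ‖g‖) + ∑ k, 1 / (2 * √(t / 2)) * (‖g‖ *
      (C1 k * Real.exp (c1 k * ‖g‖))), (tame_exp_norm C c hC hc).add (Tame.sum _ fun k _ =>
        (Tame.const _).mul (Tame.mul ?_ (tame_exp_norm _ _ (hC1 k) (hc1 k)))), fun s hs g => ?_⟩
    · exact ⟨continuous_norm, 1, 1, by norm_num, by norm_num, fun x => by
        have := Real.add_one_le_exp ‖x‖
        rw [abs_norm, one_mul, one_mul]; linarith⟩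
    · have hs0 : 0 < s := lt_trans (by positivity) hs.1
      have hst : |s| ≤ 2 * t := by rw [abs_of_pos hs0]; exact hs.2.le
      refine (abs_add_le _ _).trans (add_le_add (hb s hst g) ?_)
      refine (Finset.abs_sum_le_sum_abs _ _).trans (Finset.sum_le_sum fun k _ => ?_)
      rw [abs_mul, abs_mul, abs_of_pos (by positivity)]
      gcongr
      · exact hs.1.le
      · rw [← Real.norm_eq_abs]; exact PiLp.norm_apply_le g k
      · exact hb1 k s hst g
  have key := (hasDerivAt_integral_of_dominated_loc_of_deriv_le (μ := (volume : Measure (E n)))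
    (F := fun s g => F (s, √s • g) * gw g) (F' := fun s g => D s g * gw g)
    (bound := fun g => B g * gw g) (x₀ := t)
    (Ioo_mem_nhds (by linarith : t / 2 < t) (by linarith : t < 2 * t))
    (Filter.Eventually.of_forall fun s => (h.g0.tame s).integrable_gw.aestronglyMeasurable)
    (h.g0.tame t).integrable_gw (tD t).integrable_gw.aestronglyMeasurable
    (Filter.Eventually.of_forall fun g s hs => by
      rw [norm_mul, Real.norm_of_nonneg (gw_pos g).le]
      exact mul_le_mul_of_nonneg_right (hBD s hs g) (gw_pos g).le)
    hB.integrable_gw (Filter.Eventually.of_forall fun g s hs =>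
      hd g s (lt_trans (by positivity) hs.1))).2
  refine (key.div_const _).congr_deriv ?_
  unfold heat
  congr 1
  have i0 := (h.gt.tame t).integrable_gw
  have i1 : ∀ k, Integrable fun g : E n => g k * F1 k (t, √t • g) * gw g := fun k =>
    ((Tame.coord k).mul ((h.g1 k).tame t)).integrable_gw
  have i2 : ∀ k, Integrable fun g : E n => F2 k (t, √t • g) * gw g := fun k =>
    ((h.g2 k).tame t).integrable_gw
  simp only [hD, add_mul, Finset.sum_mul, mul_assoc (1 / (2 * √t)), mul_assoc (1 / 2 : ℝ)]
  rw [integral_add i0 (integrable_finsetSum _ fun k _ => (i1 k).const_mul _),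
    integral_add i0 ((integrable_finsetSum _ fun k _ => i2 k).const_mul _),
    integral_finsetSum _ fun k _ => (i1 k).const_mul _, integral_const_mul,
    integral_finsetSum _ fun k _ => i2 k, Finset.mul_sum]
  congr 1
  refine Finset.sum_congr rfl fun k _ => ?_
  rw [integral_const_mul, heat_ibp (h.g1 k) (h.g2 k) k (h.h1 k) t, ← mul_assoc]
  congr 1
  have : √t ≠ 0 := by positivity
  field_simp

end Heat

end SmallBall

namespace SmallBall

open scoped ENNReal NNReal Topology

section Tilt

variable {n : ℕ}

/-- Exponent of the Gaussian tilt. -/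
def tl (p : ℝ × E n) (x : E n) : ℝ := inner ℝ p.2 x - p.1 / 2 * ‖x‖ ^ 2

/-- Unnormalised moments of the tilted density. -/
def U (f : E n → ℝ) (q : E n → ℝ) (p : ℝ × E n) : ℝ := ∫ x, q x * (f x * Real.exp (tl p x))

/-- Integrable nonnegative densities supported in a ball. -/
structure Cpt (f : E n → ℝ) (r : ℝ) : Prop where
  nonneg : ∀ x, 0 ≤ f x
  int : Integrable f
  supp : ∀ x, r < ‖x‖ → f x = 0
  r0 : 0 ≤ r

variable {f : E n → ℝ} {r : ℝ}

theorem continuous_tl (p : ℝ × E n) : Continuous (tl p) := by unfold tl; fun_prop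

theorem tl_le (hr : 0 ≤ r) {x : E n} (hx : ‖x‖ ≤ r) (p : ℝ × E n) :
    |tl p x| ≤ (r + r ^ 2) * ‖p‖ := by
  have h1 := abs_real_inner_le_norm p.2 x
  have h2 : ‖p.2‖ ≤ ‖p‖ := norm_snd_le p
  have h3 : |p.1| ≤ ‖p‖ := norm_fst_le p
  have h4 : ‖x‖ ^ 2 ≤ r ^ 2 := by gcongr
  unfold tl
  calc _ ≤ |inner ℝ p.2 x| + |p.1 / 2 * ‖x‖ ^ 2| := abs_sub _ _
    _ ≤ ‖p‖ * r + ‖p‖ * r ^ 2 := by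
      refine add_le_add (h1.trans (by gcongr)) ?_
      rw [abs_mul, abs_of_nonneg (sq_nonneg ‖x‖), abs_div, abs_two]
      have : |p.1| / 2 ≤ ‖p‖ := by linarith [abs_nonneg p.1]
      gcongr
    _ = _ := by ring

theorem Cpt.bdd (hf : Cpt f r) {q : E n → ℝ} (hq : Continuous q) :
    ∃ C, 0 ≤ C ∧ ∀ x, ‖x‖ ≤ r → |q x| ≤ C := by
  obtain ⟨C, hC⟩ := (isCompact_closedBall (0 : E n) r).exists_bound_of_continuousOn hq.continuousOn
  refine ⟨C, (norm_nonneg _).trans (hC 0 (by simpa using hf.r0)), fun x hx => hC x (by simpa using hx)⟩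

theorem Cpt.mul_le (hf : Cpt f r) {q : E n → ℝ} {C : ℝ} (h : ∀ x, ‖x‖ ≤ r → |q x| ≤ C) (x : E n) :
    |q x * f x| ≤ C * f x := by
  rcases le_or_gt ‖x‖ r with hx | hx
  · rw [abs_mul, abs_of_nonneg (hf.nonneg x)]
    exact mul_le_mul_of_nonneg_right (h x hx) (hf.nonneg x)
  · simp [hf.supp x hx]

theorem Cpt.integrable_mul (hf : Cpt f r) {q : E n → ℝ} (hq : Continuous q) :
    Integrable fun x => q x * f x := by
  obtain ⟨C, _, h⟩ := hf.bdd hq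
  exact (hf.int.const_mul C).mono' (hq.aestronglyMeasurable.mul hf.int.aestronglyMeasurable)
    (Filter.Eventually.of_forall (hf.mul_le h))

theorem Cpt.integrable_U (hf : Cpt f r) {q : E n → ℝ} (hq : Continuous q) (p : ℝ × E n) :
    Integrable fun x => q x * (f x * Real.exp (tl p x)) := by
  refine (hf.integrable_mul (hq.mul (continuous_tl p).rexp)).congr
    (Filter.Eventually.of_forall fun x => ?_)
  simp only [Pi.mul_apply]; ring

/-- The differential of the exponent. -/
def dtl (x : E n) : ℝ × E n →L[ℝ] ℝ :=
  (innerSL ℝ x).comp (ContinuousLinearMap.snd ℝ ℝ (E n))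
    - (‖x‖ ^ 2 / 2) • ContinuousLinearMap.fst ℝ ℝ (E n)

theorem dtl_apply (x : E n) (v : ℝ × E n) :
    dtl x v = inner ℝ v.2 x - v.1 / 2 * ‖x‖ ^ 2 := by
  simp [dtl, real_inner_comm]; ring

theorem continuous_dtl : Continuous (dtl (n := n)) := by
  unfold dtl
  fun_prop

theorem hasFDerivAt_tl (x : E n) (p : ℝ × E n) : HasFDerivAt (fun p => tl p x) (dtl x) p := by
  have : (fun p => tl p x) = dtl x := by
    funext p; rw [dtl_apply]; rfl
  rw [this]
  exact (dtl x).hasFDerivAt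

theorem norm_dtl_le (hr : 0 ≤ r) {x : E n} (hx : ‖x‖ ≤ r) : ‖dtl x‖ ≤ r + r ^ 2 := by
  refine ContinuousLinearMap.opNorm_le_bound _ (by positivity) fun v => ?_
  rw [dtl_apply]
  exact tl_le hr hx v

theorem Cpt.hasFDerivAt_U (hf : Cpt f r) {q : E n → ℝ} (hq : Continuous q) (p₀ : ℝ × E n) :
    HasFDerivAt (U f q) (∫ x, (q x * (f x * Real.exp (tl p₀ x))) • dtl x) p₀ := by
  obtain ⟨C, hC, h⟩ := hf.bdd hq
  have hr := hf.r0
  refine hasFDerivAt_integral_of_dominated_of_fderiv_le (μ := (volume : Measure (E n)))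
    (F := fun p x => q x * (f x * Real.exp (tl p x)))
    (F' := fun p x => (q x * (f x * Real.exp (tl p x))) • dtl x)
    (bound := fun x => C * Real.exp ((r + r ^ 2) * (‖p₀‖ + 1)) * (r + r ^ 2) * f x)
    (Metric.ball_mem_nhds p₀ one_pos)
    (Filter.Eventually.of_forall fun p => (hf.integrable_U hq p).aestronglyMeasurable)
    (hf.integrable_U hq p₀)
    ((hf.integrable_U hq p₀).aestronglyMeasurable.smul continuous_dtl.aestronglyMeasurable)
    (Filter.Eventually.of_forall fun x p hp => ?_) (hf.int.const_mul _)
    (Filter.Eventually.of_forall fun x p _ => ?_)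
  · rcases le_or_gt ‖x‖ r with hx | hx
    · rw [norm_smul, norm_mul, norm_mul, Real.norm_of_nonneg (hf.nonneg x), Real.norm_eq_abs,
        Real.norm_of_nonneg (Real.exp_pos _).le]
      have h1 : ‖p‖ ≤ ‖p₀‖ + 1 := by
        have := norm_le_norm_add_norm_sub p₀ p
        rw [Metric.mem_ball, dist_eq_norm, norm_sub_rev] at hp
        linarith
      have h2 : tl p x ≤ (r + r ^ 2) * (‖p₀‖ + 1) :=
        (le_abs_self _).trans ((tl_le hr hx p).trans (by gcongr))
      calc |q x| * (f x * Real.exp (tl p x)) * ‖dtl x‖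
          ≤ C * (f x * Real.exp ((r + r ^ 2) * (‖p₀‖ + 1))) * (r + r ^ 2) := by
            have := hf.nonneg x
            gcongr
            · exact h x hx
            · exact norm_dtl_le hr hx
        _ = _ := by ring
    · simp [hf.supp x hx]
  · have := ((hasFDerivAt_tl x p).exp.const_mul (q x * f x))
    refine (this.congr_of_eventuallyEq (Filter.Eventually.of_forall fun p => by ring)).congr_fderiv ?_
    rw [smul_smul]; congr 1; ring

theorem Cpt.U_add (hf : Cpt f r) {q q' : E n → ℝ} (hq : Continuous q) (hq' : Continuous q')
    (p : ℝ × E n) : U f (fun x => q x + q' x) p = U f q p + U f q' p := by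
  unfold U
  rw [← integral_add (hf.integrable_U hq p) (hf.integrable_U hq' p)]
  simp only [add_mul]

theorem U_const_mul (q : E n → ℝ) (a : ℝ) (p : ℝ × E n) :
    U f (fun x => a * q x) p = a * U f q p := by
  unfold U
  simp only [mul_assoc, integral_const_mul]

theorem Cpt.U_sub (hf : Cpt f r) {q q' : E n → ℝ} (hq : Continuous q) (hq' : Continuous q')
    (p : ℝ × E n) : U f (fun x => q x - q' x) p = U f q p - U f q' p := by
  unfold U
  rw [← integral_sub (hf.integrable_U hq p) (hf.integrable_U hq' p)]
  simp only [sub_mul]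

theorem Cpt.U_sum (hf : Cpt f r) {ι : Type*} (s : Finset ι) {q : ι → E n → ℝ}
    (hq : ∀ i ∈ s, Continuous (q i)) (p : ℝ × E n) :
    U f (fun x => ∑ i ∈ s, q i x) p = ∑ i ∈ s, U f (q i) p := by
  unfold U
  rw [← integral_finsetSum _ fun i hi => hf.integrable_U (hq i hi) p]
  simp only [Finset.sum_mul]

theorem Cpt.U_mono (hf : Cpt f r) {q q' : E n → ℝ} (hq : Continuous q) (hq' : Continuous q')
    (h : ∀ x, ‖x‖ ≤ r → q x ≤ q' x) (p : ℝ × E n) : U f q p ≤ U f q' p := by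
  refine integral_mono (hf.integrable_U hq p) (hf.integrable_U hq' p) fun x => ?_
  rcases le_or_gt ‖x‖ r with hx | hx
  · exact mul_le_mul_of_nonneg_right (h x hx) (mul_nonneg (hf.nonneg x) (Real.exp_pos _).le)
  · simp [hf.supp x hx]

theorem Cpt.hasDerivAt_U (hf : Cpt f r) {q : E n → ℝ} (hq : Continuous q)
    (γ : ℝ → ℝ × E n) (γ' : ℝ × E n) (s : ℝ) (hγ : HasDerivAt γ γ' s) :
    HasDerivAt (fun s => U f q (γ s)) (γ'.1 • U f (fun x => -(1 / 2) * ‖x‖ ^ 2 * q x) (γ s)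
      + ∑ k, γ'.2 k • U f (fun x => x k * q x) (γ s)) s := by
  have := (hf.hasFDerivAt_U hq (γ s)).comp_hasDerivAt s hγ
  refine this.congr_deriv ?_
  have hi : Integrable fun x => (q x * (f x * Real.exp (tl (γ s) x))) • dtl x := by
    obtain ⟨C, hC, h⟩ := hf.bdd (q := fun x => ‖q x * Real.exp (tl (γ s) x)‖ * ‖dtl x‖)
      (((hq.mul (continuous_tl _).rexp).norm).mul continuous_dtl.norm)
    refine (hf.int.const_mul C).mono' ((hf.integrable_U hq _).aestronglyMeasurable.smul
      continuous_dtl.aestronglyMeasurable) (Filter.Eventually.of_forall fun x => ?_)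
    refine le_trans (le_of_eq ?_) (hf.mul_le h x)
    rw [norm_smul, abs_mul, abs_of_nonneg (by positivity), norm_mul, norm_mul, norm_mul,
      Real.norm_eq_abs (f x)]
    ring
  rw [ContinuousLinearMap.integral_apply hi]
  have e : ∀ x : E n, ((q x * (f x * Real.exp (tl (γ s) x))) • dtl x) γ'
      = (γ'.1 * (-(1 / 2) * ‖x‖ ^ 2 * q x) + ∑ k, γ'.2 k * (x k * q x))
        * (f x * Real.exp (tl (γ s) x)) := fun x => by
    rw [ContinuousLinearMap.smul_apply, dtl_apply, smul_eq_mul]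
    have : inner ℝ γ'.2 x = ∑ k, γ'.2 k * x k := by
      simp [PiLp.inner_apply, mul_comm]
    rw [this]
    simp only [← mul_assoc, ← Finset.sum_mul]
    ring
  simp only [e]
  have h1 := hf.U_add (q := fun x => γ'.1 * (-(1 / 2) * ‖x‖ ^ 2 * q x))
    (q' := fun x => ∑ k, γ'.2 k * (x k * q x)) (by fun_prop) (by fun_prop) (γ s)
  rw [U_const_mul, hf.U_sum _ fun k _ => by fun_prop] at h1
  simp only [U_const_mul] at h1
  exact h1

theorem Cpt.grow_U (hf : Cpt f r) {q : E n → ℝ} (hq : Continuous q) : Grow (U f q) := by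
  obtain ⟨C, hC, h⟩ := hf.bdd hq
  have hr := hf.r0
  have hI : 0 ≤ ∫ x, f x := integral_nonneg hf.nonneg
  refine ⟨continuous_iff_continuousAt.2 fun p => (hf.hasFDerivAt_U hq p).continuousAt,
    C * ∫ x, f x, r + r ^ 2, by positivity, by positivity, fun p => ?_⟩
  rw [mul_right_comm, ← integral_const_mul]
  refine norm_integral_le_of_norm_le (hf.int.const_mul _) (Filter.Eventually.of_forall fun x => ?_)
  rw [show q x * (f x * Real.exp (tl p x)) = (q x * Real.exp (tl p x)) * f x by ring]
  refine hf.mul_le (q := fun x => q x * Real.exp (tl p x)) (fun x hx => ?_) x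
  rw [abs_mul, abs_of_pos (Real.exp_pos _)]
  gcongr
  · exact h x hx
  · exact (le_abs_self _).trans (tl_le hr hx p)

theorem Cpt.ito_U (hf : Cpt f r) {q : E n → ℝ} (hq : Continuous q) :
    Ito (U f q) (U f fun x => -(1 / 2) * ‖x‖ ^ 2 * q x) (fun k => U f fun x => x k * q x)
      fun k => U f fun x => x k * (x k * q x) := by
  refine ⟨hf.grow_U hq, hf.grow_U (by fun_prop), fun k => hf.grow_U (by fun_prop),
    fun k => hf.grow_U (by fun_prop), fun γ γ' s h => hf.hasDerivAt_U hq γ γ' s h, fun k p => ?_⟩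
  have := hf.hasDerivAt_U (q := fun x => x k * q x) (by fun_prop) _ _ 0 (hasDerivAt_axis k p 0)
  refine this.congr_deriv ?_
  simp only [zero_smul, add_zero, zero_add]
  rw [Finset.sum_eq_single k (fun b _ hb => by simp [hb]) (by simp),
    EuclideanSpace.single_apply, if_pos rfl, one_smul]

/-- Moments evolve by the backward heat equation. -/
theorem Cpt.heat_U (hf : Cpt f r) {q : E n → ℝ} (hq : Continuous q) (p : ℝ × E n) :
    U f (fun x => -(1 / 2) * ‖x‖ ^ 2 * q x) p + 1 / 2 * ∑ k, U f (fun x => x k * (x k * q x)) p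
      = 0 := by
  rw [← hf.U_sum _ fun k _ => by fun_prop, ← U_const_mul, ← hf.U_add (by fun_prop) (by fun_prop)]
  unfold U
  rw [← integral_zero (E n) ℝ]
  congr 1; funext x
  have : ∑ k, x k * (x k * q x) = ‖x‖ ^ 2 * q x := by
    rw [norm_sq_coord, Finset.sum_mul]
    exact Finset.sum_congr rfl fun k _ => by ring
  simp only [this]; ring

end Tilt

end SmallBall

namespace SmallBall

open scoped ENNReal NNReal Topology

section Gen

variable {n : ℕ} {f : E n → ℝ} {r : ℝ}

/-- The partition function of the tilts of `f`. -/
def Zf (f : E n → ℝ) : ℝ × E n → ℝ := U f fun _ => 1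

/-- Expectation under the tilts of `f`. -/
def Ev (f : E n → ℝ) (q : E n → ℝ) (p : ℝ × E n) : ℝ := U f q p * (Zf f p)⁻¹

/-- Barycentre of the tilts of `f`. -/
def mn (f : E n → ℝ) (k : Fin n) : ℝ × E n → ℝ := Ev f fun x => x k

theorem Cpt.le_Zf (hf : Cpt f r) (p : ℝ × E n) :
    (∫ x, f x) * Real.exp (-((r + r ^ 2) * ‖p‖)) ≤ Zf f p := by
  rw [← integral_mul_const]
  refine integral_mono (hf.int.mul_const _) (hf.integrable_U continuous_const p) fun x => ?_
  rcases le_or_gt ‖x‖ r with hx | hx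
  · simp only [one_mul]
    refine mul_le_mul_of_nonneg_left (Real.exp_le_exp.2 ?_) (hf.nonneg x)
    linarith [neg_abs_le (tl p x), tl_le hf.r0 hx p]
  · simp [hf.supp x hx]

theorem Cpt.Zf_pos (hf : Cpt f r) (h0 : 0 < ∫ x, f x) (p : ℝ × E n) : 0 < Zf f p :=
  (mul_pos h0 (Real.exp_pos _)).trans_le (hf.le_Zf p)

theorem Cpt.grow_inv (hf : Cpt f r) (h0 : 0 < ∫ x, f x) : Grow fun p => (Zf f p)⁻¹ := by
  have hr := hf.r0
  refine ⟨(hf.grow_U continuous_const).1.inv₀ fun p => (hf.Zf_pos h0 p).ne',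
    (∫ x, f x)⁻¹, r + r ^ 2, by positivity, by positivity, fun p => ?_⟩
  rw [Real.norm_of_nonneg (inv_pos.2 (hf.Zf_pos h0 p)).le, ← neg_neg ((r + r ^ 2) * ‖p‖),
    Real.exp_neg, ← mul_inv]
  exact inv_anti₀ (by positivity) (hf.le_Zf p)

section
variable (hf : Cpt f r) (h0 : 0 < ∫ x, f x)
include hf

theorem Cpt.Ev_add {q q' : E n → ℝ} (hq : Continuous q) (hq' : Continuous q')
    (p : ℝ × E n) : Ev f (fun x => q x + q' x) p = Ev f q p + Ev f q' p := by
  unfold Ev; rw [hf.U_add hq hq', add_mul]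

omit hf in
theorem Ev_const_mul (q : E n → ℝ) (a : ℝ) (p : ℝ × E n) :
    Ev f (fun x => a * q x) p = a * Ev f q p := by
  unfold Ev; rw [U_const_mul, mul_assoc]

theorem Cpt.Ev_sub {q q' : E n → ℝ} (hq : Continuous q) (hq' : Continuous q')
    (p : ℝ × E n) : Ev f (fun x => q x - q' x) p = Ev f q p - Ev f q' p := by
  unfold Ev; rw [hf.U_sub hq hq', sub_mul]

theorem Cpt.Ev_sum {ι : Type*} (s : Finset ι) {q : ι → E n → ℝ}
    (hq : ∀ i ∈ s, Continuous (q i)) (p : ℝ × E n) :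
    Ev f (fun x => ∑ i ∈ s, q i x) p = ∑ i ∈ s, Ev f (q i) p := by
  unfold Ev; rw [hf.U_sum s hq, Finset.sum_mul]

include h0

theorem Cpt.Ev_const (a : ℝ) (p : ℝ × E n) : Ev f (fun _ => a) p = a := by
  have := Ev_const_mul (f := f) (fun _ => 1) a p
  simp only [mul_one] at this
  rw [this]
  show a * (Zf f p * (Zf f p)⁻¹) = a
  rw [mul_inv_cancel₀ (hf.Zf_pos h0 p).ne', mul_one]

theorem Cpt.Ev_mono {q q' : E n → ℝ} (hq : Continuous q) (hq' : Continuous q')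
    (h : ∀ x, ‖x‖ ≤ r → q x ≤ q' x) (p : ℝ × E n) : Ev f q p ≤ Ev f q' p :=
  mul_le_mul_of_nonneg_right (hf.U_mono hq hq' h p) (inv_pos.2 (hf.Zf_pos h0 p)).le

theorem Cpt.Ev_nonneg {q : E n → ℝ} (hq : Continuous q) (h : ∀ x, 0 ≤ q x) (p : ℝ × E n) :
    0 ≤ Ev f q p := by
  have := hf.Ev_mono h0 continuous_const hq (fun x _ => h x) p
  rwa [hf.Ev_const h0] at this

end

variable {M : Type*} [NormedRing M] [NormedAlgebra ℝ M]

/-- `F1` is the spatial gradient of `F`, and `G` the drift of `F` along the localisation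
process. -/
def IG (f : E n → ℝ) (F : ℝ × E n → M) (F1 : Fin n → ℝ × E n → M) (G : ℝ × E n → M) : Prop :=
  ∃ Ft F2, Ito F Ft F1 F2 ∧
    ∀ p, G p = Ft p + (1 / 2 : ℝ) • ∑ k, F2 k p + ∑ k, mn f k p • F1 k p

variable {F G dF dG : ℝ × E n → M} {F1 G1 : Fin n → ℝ × E n → M}

theorem IG.grow (h : IG f F F1 dF) : Grow F := by
  obtain ⟨_, _, h, _⟩ := h; exact h.g0

theorem IG.congr {dF' : ℝ × E n → M} {F1' : Fin n → ℝ × E n → M} (h : IG f F F1 dF)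
    (h1 : ∀ k p, F1 k p = F1' k p) (h2 : ∀ p, dF p = dF' p) : IG f F F1' dF' := by
  obtain rfl : dF = dF' := funext h2
  obtain rfl : F1 = F1' := funext fun k => funext (h1 k)
  exact h

theorem IG.const (a : M) : IG f (fun _ => a) (fun _ _ => 0) fun _ => 0 :=
  ⟨_, _, Ito.const a, fun p => by simp⟩

theorem IG.add (hF : IG f F F1 dF) (hG : IG f G G1 dG) :
    IG f (fun p => F p + G p) (fun k p => F1 k p + G1 k p) fun p => dF p + dG p := by
  obtain ⟨Ft, F2, hF, eF⟩ := hF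
  obtain ⟨Gt, G2, hG, eG⟩ := hG
  refine ⟨_, _, hF.add hG, fun p => ?_⟩
  simp only [eF, eG, smul_add, Finset.sum_add_distrib]
  abel

theorem IG.map {N : Type*} [NormedRing N] [NormedAlgebra ℝ N] (hF : IG f F F1 dF)
    (L : M →L[ℝ] N) :
    IG f (fun p => L (F p)) (fun k p => L (F1 k p)) fun p => L (dF p) := by
  obtain ⟨Ft, F2, hF, eF⟩ := hF
  refine ⟨_, _, hF.map L, fun p => ?_⟩
  simp only [eF, map_add, map_smul, map_sum]

theorem IG.smul (hF : IG f F F1 dF) (a : ℝ) :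
    IG f (fun p => a • F p) (fun k p => a • F1 k p) fun p => a • dF p :=
  hF.map (a • ContinuousLinearMap.id ℝ M)

theorem IG.sub (hF : IG f F F1 dF) (hG : IG f G G1 dG) :
    IG f (fun p => F p - G p) (fun k p => F1 k p - G1 k p) fun p => dF p - dG p := by
  simpa [sub_eq_add_neg] using hF.add (hG.smul (-1))

theorem IG.sum {ι : Type*} (s : Finset ι) {F dF : ι → ℝ × E n → M}
    {F1 : ι → Fin n → ℝ × E n → M} (h : ∀ i ∈ s, IG f (F i) (F1 i) (dF i)) :
    IG f (fun p => ∑ i ∈ s, F i p) (fun k p => ∑ i ∈ s, F1 i k p) fun p => ∑ i ∈ s, dF i p := by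
  induction s using Finset.cons_induction with
  | empty => simpa using IG.const 0
  | cons a s ha ih =>
    simp only [Finset.sum_cons]
    exact (h a (by simp)).add (ih fun i hi => h i (by simp [hi]))

theorem IG.mul (hF : IG f F F1 dF) (hG : IG f G G1 dG) :
    IG f (fun p => F p * G p) (fun k p => F1 k p * G p + F p * G1 k p)
      fun p => dF p * G p + F p * dG p + ∑ k, F1 k p * G1 k p := by
  obtain ⟨Ft, F2, hF, eF⟩ := hF
  obtain ⟨Gt, G2, hG, eG⟩ := hG
  refine ⟨_, _, hF.mul hG, fun p => ?_⟩
  simp only [eF, eG, smul_add, Finset.sum_add_distrib, add_mul, mul_add, Finset.sum_mul, Finset.mul_sum,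
    smul_mul_assoc, mul_smul_comm, Finset.smul_sum, smul_smul]
  norm_num
  abel

theorem IG.inv [CompleteSpace M] (hF : IG f F F1 dF) {R : ℝ × E n → M} (hR : Grow R)
    (h1 : ∀ p, F p * R p = 1) (h2 : ∀ p, R p * F p = 1) :
    IG f R (fun k p => -(R p * F1 k p * R p))
      fun p => ∑ k, R p * F1 k p * R p * F1 k p * R p - R p * dF p * R p := by
  obtain ⟨Ft, F2, hF, eF⟩ := hF
  refine ⟨_, _, hF.inv hR h1 h2, fun p => ?_⟩
  simp only [eF, smul_sub, Finset.sum_sub_distrib, add_mul, mul_add, Finset.sum_mul, Finset.mul_sum,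
    smul_mul_assoc, mul_smul_comm, Finset.smul_sum, smul_smul, smul_neg, Finset.sum_neg_distrib]
  norm_num
  abel

section
variable (hf : Cpt f r) (h0 : 0 < ∫ x, f x)
include hf h0

theorem Cpt.Zf_mul_Ev (q : E n → ℝ) (p : ℝ × E n) : Zf f p * Ev f q p = U f q p := by
  unfold Ev
  rw [mul_left_comm, mul_inv_cancel₀ (hf.Zf_pos h0 p).ne', mul_one]

theorem Cpt.ig_Ev {q : E n → ℝ} (hq : Continuous q) :
    IG f (Ev f q) (fun k p => Ev f (fun x => x k * q x) p - Ev f q p * mn f k p)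
      fun _ => 0 := by
  have hU := hf.ito_U hq
  have hZ := hf.ito_U (q := fun _ => 1) continuous_const
  have hI := hZ.inv (hf.grow_inv h0) (fun p => mul_inv_cancel₀ (hf.Zf_pos h0 p).ne')
    (fun p => inv_mul_cancel₀ (hf.Zf_pos h0 p).ne')
  have eU := hf.heat_U hq
  have eZ := hf.heat_U (q := fun _ => 1) continuous_const
  refine ⟨_, _, (hU.mul hI).congr (fun p => rfl) (fun k p => ?_) fun k p => rfl, fun p => ?_⟩
  · simp only [Ev, mn, mul_one]; ring
  · have e1 : ∀ k, mn f k p = U f (fun x => x k * 1) p * (Zf f p)⁻¹ := fun k => by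
      simp only [mn, Ev, mul_one]
    simp only [smul_eq_mul, e1, Ev]
    have key : (1 / 2 : ℝ) * ∑ k, (U f (fun x => x k * (x k * q x)) p * (Zf f p)⁻¹
          + 2 * (U f (fun x => x k * q x) p *
            -((Zf f p)⁻¹ * U f (fun x => x k * 1) p * (Zf f p)⁻¹))
          + U f q p * (2 * ((Zf f p)⁻¹ * U f (fun x => x k * 1) p * (Zf f p)⁻¹
            * U f (fun x => x k * 1) p * (Zf f p)⁻¹)
            - (Zf f p)⁻¹ * U f (fun x => x k * (x k * 1)) p * (Zf f p)⁻¹))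
        + ∑ k, U f (fun x => x k * 1) p * (Zf f p)⁻¹ *
          (U f (fun x => x k * q x) p * (Zf f p)⁻¹
            - U f q p * (Zf f p)⁻¹ * (U f (fun x => x k * 1) p * (Zf f p)⁻¹))
        = (Zf f p)⁻¹ * (1 / 2 * ∑ k, U f (fun x => x k * (x k * q x)) p)
          - U f q p * (Zf f p)⁻¹ ^ 2 * (1 / 2 * ∑ k, U f (fun x => x k * (x k * 1)) p) := by
      simp only [Finset.mul_sum]
      rw [← Finset.sum_add_distrib, ← Finset.sum_sub_distrib]
      exact Finset.sum_congr rfl fun k _ => by ring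
    rw [add_assoc, key]
    linear_combination (-(Zf f p)⁻¹) * eU p + U f q p * (Zf f p)⁻¹ ^ 2 * eZ p

theorem IG.heat {F G : ℝ × E n → ℝ} {F1 : Fin n → ℝ × E n → ℝ} (h : IG f F F1 G) {t : ℝ}
    (ht : 0 < t) :
    HasDerivAt (heat fun p => Zf f p * F p) (heat (fun p => Zf f p * G p) t) t := by
  obtain ⟨Ft, F2, h, e⟩ := h
  have hZ := hf.ito_U (q := fun _ => 1) continuous_const
  refine ((hZ.mul h).heat_deriv ht).congr_deriv ?_
  congr 1; funext p
  have eZ := hf.heat_U (q := fun _ => 1) continuous_const p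
  have e1 : ∀ k, U f (fun x => x k * 1) p = Zf f p * mn f k p := fun k => by
    rw [mn, hf.Zf_mul_Ev h0]; simp only [mul_one]
  rw [e]
  have key : (1 / 2 : ℝ) * ∑ k, (U f (fun x => x k * (x k * 1)) p * F p
        + (2 : ℝ) • (U f (fun x => x k * 1) p * F1 k p) + U f (fun _ => 1) p * F2 k p)
      = F p * (1 / 2 * ∑ k, U f (fun x => x k * (x k * 1)) p)
        + Zf f p * (1 / 2 * ∑ k, F2 k p + ∑ k, mn f k p * F1 k p) := by
    simp only [mul_add, Finset.mul_sum, e1, smul_eq_mul, ← Finset.sum_add_distrib]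
    exact Finset.sum_congr rfl fun k _ => by rw [Zf]; ring
  rw [key]
  simp only [smul_eq_mul]
  rw [show U f (fun _ => 1) p = Zf f p from rfl]
  linear_combination F p * eZ

end

end Gen

end SmallBall

namespace SmallBall
open scoped ENNReal NNReal Topology

section Cov
variable {n : ℕ} {f : E n → ℝ} {r : ℝ}

/-- Third central moments along the localisation. -/
def cu (f : E n → ℝ) (k i j : Fin n) (p : ℝ × E n) : ℝ :=
  Ev f (fun x => x k * (x i * x j)) p - Ev f (fun x => x i * x j) p * mn f k p
    - ((Ev f (fun x => x k * x i) p - mn f i p * mn f k p) * mn f j p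
      + mn f i p * (Ev f (fun x => x k * x j) p - mn f j p * mn f k p))

/-- Covariance matrix along the localisation. -/
def co (f : E n → ℝ) (p : ℝ × E n) : Matrix (Fin n) (Fin n) ℝ :=
  Matrix.of fun i j => Ev f (fun x => x i * x j) p - mn f i p * mn f j p

/-- Gradient of the covariance matrix. -/
def cm (f : E n → ℝ) (k : Fin n) (p : ℝ × E n) : Matrix (Fin n) (Fin n) ℝ :=
  Matrix.of fun i j => cu f k i j p

theorem co_symm (p : ℝ × E n) (i j : Fin n) : co f p i j = co f p j i := by
  simp only [co, Matrix.of_apply, mul_comm]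

theorem Cpt.ig_co_apply (hf : Cpt f r) (h0 : 0 < ∫ x, f x) (i j : Fin n) :
    IG f (fun p => co f p i j) (fun k p => cu f k i j p) fun p => -(co f p * co f p) i j := by
  have hc : ∀ k : Fin n, Continuous fun x : E n => x k := fun k => by fun_prop
  refine ((hf.ig_Ev h0 ((hc i).mul (hc j))).sub
    ((hf.ig_Ev h0 (hc i)).mul (hf.ig_Ev h0 (hc j)))).congr (fun k p => rfl) fun p => ?_
  simp only [zero_mul, mul_zero, add_zero, zero_add, zero_sub, Matrix.mul_apply]
  congr 1
  refine Finset.sum_congr rfl fun k _ => ?_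
  rw [co_symm p i k]
  simp only [co, Matrix.of_apply, mn]
  ring

attribute [local instance] Matrix.linftyOpNormedRing Matrix.linftyOpNormedAlgebra

/-- The matrix unit map. -/
def sg (i j : Fin n) : ℝ →L[ℝ] Matrix (Fin n) (Fin n) ℝ :=
  LinearMap.toContinuousLinearMap (Matrix.singleLinearMap ℝ i j)

theorem matrix_eq_sum_sg (A : Matrix (Fin n) (Fin n) ℝ) : A = ∑ i, ∑ j, sg i j (A i j) :=
  Matrix.matrix_eq_sum_single A

theorem grow_matrix {F : ℝ × E n → Matrix (Fin n) (Fin n) ℝ} (h : ∀ i j, Grow fun p => F p i j) :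
    Grow F := by
  have e : F = fun p => ∑ i, ∑ j, sg i j (F p i j) := funext fun p => matrix_eq_sum_sg _
  rw [e]
  exact Grow.sum _ fun i _ => Grow.sum _ fun j _ => (h i j).map _

theorem IG.congr' {M : Type*} [NormedRing M] [NormedAlgebra ℝ M] {F G F' G' : ℝ × E n → M}
    {F1 F1' : Fin n → ℝ × E n → M} (h : IG f F F1 G) (h0 : ∀ p, F p = F' p)
    (h1 : ∀ k p, F1 k p = F1' k p) (h2 : ∀ p, G p = G' p) : IG f F' F1' G' := by
  obtain rfl : F = F' := funext h0
  exact h.congr h1 h2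

theorem Cpt.ig_co (hf : Cpt f r) (h0 : 0 < ∫ x, f x) :
    IG f (co f) (cm f) fun p => -(co f p * co f p) := by
  have h := IG.sum Finset.univ fun i _ => IG.sum Finset.univ fun j _ =>
    (hf.ig_co_apply h0 i j).map (sg i j)
  exact h.congr' (fun p => (matrix_eq_sum_sg (co f p)).symm)
    (fun k p => (matrix_eq_sum_sg (cm f k p)).symm)
    fun p => (matrix_eq_sum_sg (-(co f p * co f p))).symm

/-- The resolvent of the covariance matrix. -/
def rs (f : E n → ℝ) (Λ : ℝ) (p : ℝ × E n) : Matrix (Fin n) (Fin n) ℝ :=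
  (co f p + Λ • (1 : Matrix (Fin n) (Fin n) ℝ))⁻¹

theorem Cpt.co_form (hf : Cpt f r) (h0 : 0 < ∫ x, f x) (p : ℝ × E n) (v w : Fin n → ℝ) :
    ∑ i, ∑ j, v i * w j * co f p i j
      = Ev f (fun x => (∑ i, v i * (x i - mn f i p)) * ∑ i, w i * (x i - mn f i p)) p := by
  have hc : ∀ k : Fin n, Continuous fun x : E n => x k := fun k => by fun_prop
  have e : ∀ x : E n, (∑ i, v i * (x i - mn f i p)) * (∑ i, w i * (x i - mn f i p))
      = ∑ i, ∑ j, v i * w j *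
        (x i * x j - mn f j p * x i - mn f i p * x j + mn f i p * mn f j p) := fun x => by
    rw [Finset.sum_mul_sum]
    exact Finset.sum_congr rfl fun i _ => Finset.sum_congr rfl fun j _ => by ring
  simp only [e]
  rw [hf.Ev_sum _ fun i _ => by fun_prop]
  refine Finset.sum_congr rfl fun i _ => ?_
  rw [hf.Ev_sum _ fun i _ => by fun_prop]
  refine Finset.sum_congr rfl fun j _ => ?_
  rw [Ev_const_mul, hf.Ev_add (by fun_prop) (by fun_prop), hf.Ev_sub (by fun_prop) (by fun_prop),
    hf.Ev_sub (by fun_prop) (by fun_prop), Ev_const_mul, Ev_const_mul, hf.Ev_const h0]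
  simp only [co, Matrix.of_apply, mn]
  ring

theorem Cpt.co_nonneg (hf : Cpt f r) (h0 : 0 < ∫ x, f x) (p : ℝ × E n) (v : Fin n → ℝ) :
    0 ≤ ∑ i, ∑ j, v i * v j * co f p i j := by
  rw [hf.co_form h0]
  exact hf.Ev_nonneg h0 (by fun_prop) (fun x => mul_self_nonneg _) p

theorem Cpt.resolvent_injective (hf : Cpt f r) (h0 : 0 < ∫ x, f x) {Λ : ℝ} (hΛ : 0 < Λ)
    (p : ℝ × E n) (w : Fin n → ℝ) :
    Λ * ∑ i, w i ^ 2 ≤ ∑ i, w i * ((co f p + Λ • (1 : Matrix (Fin n) (Fin n) ℝ)).mulVec w) i := by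
  have h := hf.co_nonneg h0 p w
  have e : ∑ i, w i * ((co f p + Λ • (1 : Matrix (Fin n) (Fin n) ℝ)).mulVec w) i
      = ∑ i, ∑ j, w i * w j * co f p i j + Λ * ∑ i, w i ^ 2 := by
    rw [Finset.mul_sum, ← Finset.sum_add_distrib]
    refine Finset.sum_congr rfl fun i _ => ?_
    rw [Matrix.add_mulVec, Matrix.smul_mulVec, Matrix.one_mulVec, Pi.add_apply, Pi.smul_apply,
      smul_eq_mul, mul_add, Matrix.mulVec, dotProduct, Finset.mul_sum]
    congr 1
    · exact Finset.sum_congr rfl fun j _ => by ring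
    · ring
  rw [e]; linarith

theorem Cpt.resolvent_isUnit (hf : Cpt f r) (h0 : 0 < ∫ x, f x) {Λ : ℝ} (hΛ : 0 < Λ)
    (p : ℝ × E n) : IsUnit (co f p + Λ • (1 : Matrix (Fin n) (Fin n) ℝ)) := by
  rw [← Matrix.mulVec_injective_iff_isUnit]
  have : ∀ w, (co f p + Λ • (1 : Matrix (Fin n) (Fin n) ℝ)).mulVec w = 0 → w = 0 := by
    intro w hw
    have h := hf.resolvent_injective h0 hΛ p w
    rw [hw] at h
    simp only [Pi.zero_apply, mul_zero, Finset.sum_const_zero] at h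
    have h2 : ∑ i, w i ^ 2 = 0 :=
      le_antisymm (by nlinarith) (Finset.sum_nonneg fun i _ => sq_nonneg _)
    rw [Finset.sum_eq_zero_iff_of_nonneg fun i _ => sq_nonneg _] at h2
    funext i
    exact pow_eq_zero_iff two_ne_zero |>.1 (h2 i (Finset.mem_univ i))
  intro a b hab
  have := this (a - b) (by rw [Matrix.mulVec_sub, sub_eq_zero]; exact hab)
  exact sub_eq_zero.1 this

theorem Cpt.mul_rs (hf : Cpt f r) (h0 : 0 < ∫ x, f x) {Λ : ℝ} (hΛ : 0 < Λ) (p : ℝ × E n) :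
    (co f p + Λ • (1 : Matrix (Fin n) (Fin n) ℝ)) * rs f Λ p = 1 :=
  Matrix.mul_nonsing_inv _ ((Matrix.isUnit_iff_isUnit_det _).1 (hf.resolvent_isUnit h0 hΛ p))

theorem Cpt.rs_mul (hf : Cpt f r) (h0 : 0 < ∫ x, f x) {Λ : ℝ} (hΛ : 0 < Λ) (p : ℝ × E n) :
    rs f Λ p * (co f p + Λ • (1 : Matrix (Fin n) (Fin n) ℝ)) = 1 :=
  Matrix.nonsing_inv_mul _ ((Matrix.isUnit_iff_isUnit_det _).1 (hf.resolvent_isUnit h0 hΛ p))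

theorem Cpt.rs_le (hf : Cpt f r) (h0 : 0 < ∫ x, f x) {Λ : ℝ} (hΛ : 0 < Λ) (p : ℝ × E n)
    (i j : Fin n) : |rs f Λ p i j| ≤ Λ⁻¹ := by
  set w : Fin n → ℝ := fun i => rs f Λ p i j with hw
  have h := hf.resolvent_injective h0 hΛ p w
  have e : ∀ i, ((co f p + Λ • (1 : Matrix (Fin n) (Fin n) ℝ)).mulVec w) i
      = (1 : Matrix (Fin n) (Fin n) ℝ) i j := fun i => by
    have := congrFun (congrFun (hf.mul_rs h0 hΛ p) i) j
    rw [Matrix.mul_apply] at this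
    exact this
  simp only [e, Matrix.one_apply, mul_ite, mul_one, mul_zero, Finset.sum_ite_eq',
    Finset.mem_univ, if_true] at h
  have hs : ∀ i, w i ^ 2 ≤ ∑ i, w i ^ 2 := fun i =>
    Finset.single_le_sum (f := fun i => w i ^ 2) (fun i _ => sq_nonneg _) (Finset.mem_univ i)
  have h1 : w j ≤ Λ⁻¹ := by
    rw [← one_div, le_div_iff₀ hΛ]
    by_contra! hc
    nlinarith [hs j, mul_le_mul_of_nonneg_left (hs j) hΛ.le, mul_pos hΛ hΛ]
  have h2 : w i ^ 2 ≤ Λ⁻¹ ^ 2 := by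
    have := hs i
    have h3 : Λ * w i ^ 2 ≤ Λ⁻¹ := by nlinarith
    calc w i ^ 2 = Λ⁻¹ * (Λ * w i ^ 2) := by field_simp
      _ ≤ Λ⁻¹ * Λ⁻¹ := by gcongr
      _ = _ := by ring
  exact abs_le_of_sq_le_sq h2 (inv_nonneg.2 hΛ.le)

theorem Cpt.grow_rs (hf : Cpt f r) (h0 : 0 < ∫ x, f x) {Λ : ℝ} (hΛ : 0 < Λ) :
    Grow (rs f Λ) := by
  have hc : Continuous (co f) := (hf.ig_co h0).grow.1
  have hcr : Continuous (rs f Λ) := by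
    refine continuous_iff_continuousAt.2 fun p => ?_
    have h := NormedRing.inverse_continuousAt (hf.resolvent_isUnit h0 hΛ p).unit
    have e : rs f Λ = fun p => Ring.inverse (co f p + Λ • (1 : Matrix (Fin n) (Fin n) ℝ)) :=
      funext fun p => by rw [rs, Matrix.nonsing_inv_eq_ringInverse]
    rw [e]
    exact ContinuousAt.comp (f := fun p => co f p + Λ • (1 : Matrix (Fin n) (Fin n) ℝ)) h
      (hc.add continuous_const).continuousAt
  refine grow_matrix fun i j => Grow.of_bdd ?_ Λ⁻¹ fun p => hf.rs_le h0 hΛ p i j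
  exact hcr.matrix_elem i j

theorem Cpt.ig_rs (hf : Cpt f r) (h0 : 0 < ∫ x, f x) {Λ : ℝ} (hΛ : 0 < Λ) :
    IG f (rs f Λ) (fun k p => -(rs f Λ p * cm f k p * rs f Λ p))
      fun p => ∑ k, rs f Λ p * cm f k p * rs f Λ p * cm f k p * rs f Λ p
        + rs f Λ p * (co f p * co f p) * rs f Λ p := by
  refine ((((hf.ig_co h0).add (IG.const (Λ • (1 : Matrix (Fin n) (Fin n) ℝ)))).inv
    (hf.grow_rs h0 hΛ) (fun p => hf.mul_rs h0 hΛ p) fun p => hf.rs_mul h0 hΛ p)).congr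
    (fun k p => by simp) fun p => by simp

/-- Trace as a continuous linear map. -/
def trL : Matrix (Fin n) (Fin n) ℝ →L[ℝ] ℝ :=
  LinearMap.toContinuousLinearMap (Matrix.traceLinearMap (Fin n) ℝ ℝ)

/-- The truncated squared trace `tr (A²Λ(A+Λ)⁻¹)` of the covariance. -/
def ph (f : E n → ℝ) (Λ : ℝ) (p : ℝ × E n) : ℝ :=
  Λ * (co f p).trace - Λ ^ 2 * n + Λ ^ 3 * (rs f Λ p).trace

theorem Cpt.ig_ph (hf : Cpt f r) (h0 : 0 < ∫ x, f x) {Λ : ℝ} (hΛ : 0 < Λ) :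
    ∃ F1, IG f (ph f Λ) F1 fun p =>
      Λ ^ 3 * (∑ k, (rs f Λ p * cm f k p * rs f Λ p * cm f k p * rs f Λ p).trace
        + (rs f Λ p * (co f p * co f p) * rs f Λ p).trace) - Λ * (co f p * co f p).trace := by
  have h := ((((hf.ig_co h0).map trL).smul Λ).sub (IG.const (Λ ^ 2 * n))).add
    (((hf.ig_rs h0 hΛ).map trL).smul (Λ ^ 3))
  refine ⟨_, h.congr' (fun p => rfl) (fun k p => rfl) fun p => ?_⟩
  change Λ * (-(co f p * co f p)).trace - 0 + Λ ^ 3 * Matrix.trace (∑ k, rs f Λ p * cm f k p *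
    rs f Λ p * cm f k p * rs f Λ p + rs f Λ p * (co f p * co f p) * rs f Λ p) = _
  rw [Matrix.trace_add, Matrix.trace_sum, Matrix.trace_neg]
  ring

theorem Cpt.ig_tr (hf : Cpt f r) (h0 : 0 < ∫ x, f x) :
    ∃ F1, IG f (fun p => (co f p).trace) F1 fun p => -(co f p * co f p).trace := by
  exact ⟨_, ((hf.ig_co h0).map trL).congr' (fun p => rfl) (fun k p => rfl)
    fun p => Matrix.trace_neg (co f p * co f p)⟩

end Cov
end SmallBall

namespace SmallBall
open scoped ENNReal NNReal Topology

section Third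
variable {n : ℕ} {f : E n → ℝ} {r : ℝ}

theorem exists_integral_comp_affine (e : E n ≃L[ℝ] E n) :
    ∃ c : ℝ, 0 < c ∧ ∀ (m : E n) (G : E n → ℝ), ∫ y, G (m + e y) = c * ∫ x, G x := by
  have hdet : LinearMap.det (e : E n →ₗ[ℝ] E n) ≠ 0 :=
    (LinearEquiv.isUnit_det' e.toLinearEquiv).ne_zero
  refine ⟨|(LinearMap.det (e : E n →ₗ[ℝ] E n))⁻¹|, by positivity, fun m G => ?_⟩
  have h1 : ∫ y, G (m + e y) = ∫ x, G (m + x) ∂(Measure.map e volume) := by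
    exact (e.toHomeomorph.measurableEmbedding.integral_map fun x => G (m + x)).symm
  have h2 : Measure.map e (volume : Measure (E n))
      = ENNReal.ofReal |(LinearMap.det (e : E n →ₗ[ℝ] E n))⁻¹| • volume :=
    Measure.map_linearMap_addHaar_eq_smul_addHaar volume hdet
  rw [h1, h2, integral_smul_measure, integral_add_left_eq_self, smul_eq_mul,
    ENNReal.toReal_ofReal (abs_nonneg _)]

theorem integrable_comp_affine (e : E n ≃L[ℝ] E n) {G : E n → ℝ} (hG : Integrable G) (m : E n) :
    Integrable fun y => G (m + e y) := by
  have hdet : LinearMap.det (e : E n →ₗ[ℝ] E n) ≠ 0 :=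
    (LinearEquiv.isUnit_det' e.toLinearEquiv).ne_zero
  have h2 : Measure.map e (volume : Measure (E n))
      = ENNReal.ofReal |(LinearMap.det (e : E n →ₗ[ℝ] E n))⁻¹| • volume :=
    Measure.map_linearMap_addHaar_eq_smul_addHaar volume hdet
  have h3 : Integrable (fun x => G (m + x)) (Measure.map e (volume : Measure (E n))) := by
    rw [h2]
    exact (hG.comp_add_left m).smul_measure ENNReal.ofReal_ne_top
  exact (e.toHomeomorph.measurableEmbedding.integrable_map_iff).1 h3

theorem norm_sq_convex_comb (z w : E n) {a b : ℝ} (hab : a + b = 1) :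
    ‖a • z + b • w‖ ^ 2 = a * ‖z‖ ^ 2 + b * ‖w‖ ^ 2 - a * b * ‖z - w‖ ^ 2 := by
  rw [norm_add_sq_real, norm_sub_sq_real, norm_smul, norm_smul, inner_smul_left, inner_smul_right,
    mul_pow, mul_pow, Real.norm_eq_abs, Real.norm_eq_abs, sq_abs, sq_abs]
  simp only [conj_trivial]
  obtain rfl : b = 1 - a := by linarith
  ring

/-- The log-concave factor, in new coordinates `y = L (x - m)`, of a tilt of `f`. -/
def hh (f : E n → ℝ) (p : ℝ × E n) (m : E n) (S : E n → E n) (y : E n) : ℝ :=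
  f (m + S y) * Real.exp (tl p (m + S y) + p.1 / 2 * ‖y‖ ^ 2)

theorem lc_hh (hf : Cpt f r) (hLC : LC fun x => ENNReal.ofReal (f x)) (p : ℝ × E n)
    (hp : 0 ≤ p.1) (m : E n) (S : E n →L[ℝ] E n) (hS : ∀ y, ‖y‖ ≤ ‖S y‖) :
    LC fun y => ENNReal.ofReal (hh f p m S y) := by
  have h1 : LC fun y => ENNReal.ofReal (f (m + S y)) :=
    LC.comp_affine (F := fun x => ENNReal.ofReal (f x)) hLC (fun y => m + S y)
      fun x y a b hab => by
        rw [map_add, map_smul, map_smul, smul_add, smul_add, add_add_add_comm, ← add_smul, hab,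
          one_smul]
  have h2 : LC fun y : E n => ENNReal.ofReal
      (Real.exp (-(-(tl p (m + S y) + p.1 / 2 * ‖y‖ ^ 2)))) := by
    refine LC.exp_neg fun x y a b ha hb hab => ?_
    have e : m + S (a • x + b • y) = a • (m + S x) + b • (m + S y) := by
      rw [map_add, map_smul, map_smul, smul_add, smul_add, add_add_add_comm, ← add_smul, hab,
        one_smul]
    rw [e]
    simp only [tl]
    rw [norm_sq_convex_comb _ _ hab, norm_sq_convex_comb x y hab, inner_add_right,
      inner_smul_right, inner_smul_right, add_sub_add_left_eq_sub, ← map_sub]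
    have h3 : ‖x - y‖ ^ 2 ≤ ‖S (x - y)‖ ^ 2 := by gcongr; exact hS _
    have h4 : 0 ≤ p.1 / 2 * (a * b) * (‖S (x - y)‖ ^ 2 - ‖x - y‖ ^ 2) :=
      mul_nonneg (by positivity) (by linarith)
    linarith
  have h3 := h1.mul h2
  refine (funext fun y => ?_ : (fun y => ENNReal.ofReal (hh f p m S y)) = _) ▸ h3
  rw [← ENNReal.ofReal_mul (hf.nonneg _), neg_neg]; rfl

theorem Cpt.quad_var (hf : Cpt f r) (h0 : 0 < ∫ x, f x) (hLC : LC fun x => ENNReal.ofReal (f x))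
    (p : ℝ × E n) (hp : 0 < p.1) (m : E n) (L : E n ≃L[ℝ] E n) (hL : ∀ x, ‖L x‖ ≤ ‖x‖)
    {u : ℝ} (hu : 0 ≤ u)
    (hmom : ∀ v : Fin n → ℝ, ∑ i, ∑ j, v i * v j * Ev f (fun x => L (x - m) i * L (x - m) j) p
      ≤ u * ∑ i, v i ^ 2) (A : Fin n → Fin n → ℝ) :
    Ev f (fun x => (∑ i, ∑ j, A i j * (L (x - m) i * L (x - m) j)) ^ 2) p
        - Ev f (fun x => ∑ i, ∑ j, A i j * (L (x - m) i * L (x - m) j)) p ^ 2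
      ≤ 8 * u * √(u / p.1) * ∑ i, ∑ j, A i j ^ 2 := by
  obtain ⟨c, hc, hcv⟩ := exists_integral_comp_affine L.symm
  set S : E n →L[ℝ] E n := (L.symm : E n →L[ℝ] E n) with hSdef
  have hLS : ∀ y, L (S y) = y := fun y => L.apply_symm_apply y
  have hS : ∀ y, ‖y‖ ≤ ‖S y‖ := fun y => by simpa [hLS] using hL (S y)
  have hcv' : ∀ G : E n → ℝ, ∫ y, G (m + S y) = c * ∫ x, G x := hcv m
  have key : ∀ F : E n → ℝ, gAvg (hh f p m S) p.1 F = Ev f (fun x => F (L (x - m))) p := by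
    intro F
    have e1 : ∀ F : E n → ℝ, ∫ y, F y * (hh f p m S y * Real.exp (-(p.1 / 2) * ‖y‖ ^ 2))
        = c * U f (fun x => F (L (x - m))) p := fun F => by
      rw [U, ← hcv']
      refine integral_congr_ae (ae_of_all _ fun y => ?_)
      simp only [hh, add_sub_cancel_left, hLS]
      rw [mul_assoc (f _), ← Real.exp_add]
      congr 3
      ring
    have e2 := e1 fun _ => 1
    simp only [one_mul] at e2
    rw [gAvg, e1, e2, Ev, Zf, mul_div_mul_left _ _ hc.ne', div_eq_mul_inv]
  have hq : Continuous fun x => Real.exp (tl p x + p.1 / 2 * ‖L (x - m)‖ ^ 2) := by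
    have := continuous_tl p
    fun_prop
  have hInt : Integrable (hh f p m S) := by
    have h := integrable_comp_affine L.symm (hf.integrable_mul hq) m
    refine h.congr (ae_of_all _ fun y => ?_)
    simp only [hh, add_sub_cancel_left, L.apply_symm_apply]
    rw [mul_comm]; rfl
  have hpos : 0 < ∫ y, hh f p m S y := by
    have e : ∫ y, hh f p m S y
        = c * ∫ x, Real.exp (tl p x + p.1 / 2 * ‖L (x - m)‖ ^ 2) * f x := by
      rw [← hcv']
      refine integral_congr_ae (ae_of_all _ fun y => ?_)
      simp only [hh, add_sub_cancel_left, hLS]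
      rw [mul_comm]
    rw [e]
    refine mul_pos hc ((hf.Zf_pos h0 p).trans_le ?_)
    rw [Zf, U]
    refine integral_mono (hf.integrable_U continuous_const p) (hf.integrable_mul hq) fun x => ?_
    simp only [one_mul]
    rw [mul_comm]
    refine mul_le_mul_of_nonneg_right (Real.exp_le_exp.2 ?_) (hf.nonneg x)
    have : 0 ≤ p.1 / 2 * ‖L (x - m)‖ ^ 2 := by positivity
    linarith
  have := quad_var_gAvg (f := hh f p m S) (fun y => mul_nonneg (hf.nonneg _) (Real.exp_pos _).le) hInt
    (lc_hh hf hLC p hp.le m S hS) hpos hp hu (fun v => by simp only [key]; exact hmom v) A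
  simpa only [key] using this

end Third
end SmallBall

namespace SmallBall
open scoped ENNReal NNReal Topology Matrix

section Third
variable {n : ℕ} {f : E n → ℝ} {r : ℝ}

/-- Centred linear functionals `⟨P_i, x - m⟩`. -/
def xi (f : E n → ℝ) (P : Matrix (Fin n) (Fin n) ℝ) (p : ℝ × E n) (i : Fin n) (x : E n) : ℝ :=
  ∑ a, P a i * (x a - mn f a p)

theorem continuous_xi (P : Matrix (Fin n) (Fin n) ℝ) (p : ℝ × E n) (i : Fin n) :
    Continuous (xi f P p i) := by
  unfold xi; fun_prop

theorem norm_sq_transpose {P : Matrix (Fin n) (Fin n) ℝ} (hP : P * Pᵀ = 1) (x : Fin n → ℝ) :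
    ∑ i, (∑ a, P a i * x a) ^ 2 = ∑ a, x a ^ 2 := by
  have h : ∀ a b, ∑ i, P a i * P b i = if a = b then 1 else 0 := fun a b => by
    have := congrFun (congrFun hP a) b
    rw [Matrix.mul_apply, Matrix.one_apply] at this
    exact this
  calc ∑ i, (∑ a, P a i * x a) ^ 2 = ∑ i, ∑ a, ∑ b, x a * x b * (P a i * P b i) := by
        refine Finset.sum_congr rfl fun i _ => ?_
        rw [sq, Finset.sum_mul_sum]
        exact Finset.sum_congr rfl fun a _ => Finset.sum_congr rfl fun b _ => by ring
    _ = ∑ a, ∑ b, x a * x b * ∑ i, P a i * P b i := by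
        rw [Finset.sum_comm]
        refine Finset.sum_congr rfl fun a _ => ?_
        rw [Finset.sum_comm]
        exact Finset.sum_congr rfl fun b _ => by rw [Finset.mul_sum]
    _ = _ := by
        simp only [h, mul_ite, mul_one, mul_zero, Finset.sum_ite_eq, Finset.mem_univ, if_true]
        exact Finset.sum_congr rfl fun a _ => by ring

theorem exists_scaling {P : Matrix (Fin n) (Fin n) ℝ} (hP : P * Pᵀ = 1) {b : Fin n → ℝ}
    (hb : ∀ i, 0 < b i) (hb1 : ∀ i, b i ^ 2 ≤ 1) :
    ∃ L : E n ≃L[ℝ] E n, (∀ x, ‖L x‖ ≤ ‖x‖) ∧ ∀ x i, L x i = b i * ∑ a, P a i * x a := by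
  let L0 : E n →ₗ[ℝ] E n :=
    { toFun := fun x => WithLp.toLp 2 fun i => b i * ∑ a, P a i * x a
      map_add' := fun x y => by
        ext i
        simp only [PiLp.add_apply, mul_add, Finset.sum_add_distrib]
      map_smul' := fun c x => by
        ext i
        simp only [PiLp.smul_apply, smul_eq_mul, RingHom.id_apply, Finset.mul_sum]
        exact Finset.sum_congr rfl fun a _ => by ring }
  have hL0 : ∀ x i, L0 x i = b i * ∑ a, P a i * x a := fun x i => rfl
  have hinj : Function.Injective L0 := by
    rw [injective_iff_map_eq_zero]
    intro x hx
    have h1 : ∀ i, ∑ a, P a i * x a = 0 := fun i => by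
      have : L0 x i = 0 := by rw [hx]; rfl
      rw [hL0] at this
      exact (mul_eq_zero.1 this).resolve_left (hb i).ne'
    have h2 := norm_sq_transpose hP x
    simp only [h1] at h2
    rw [← norm_eq_zero, ← sq_eq_zero_iff, norm_sq_coord]
    simp only [← sq, ← h2]
    simp
  refine ⟨(LinearEquiv.ofInjectiveEndo L0 hinj).toContinuousLinearEquiv, fun x => ?_, fun x i => hL0 x i⟩
  change ‖L0 x‖ ≤ ‖x‖
  refine (sq_le_sq₀ (norm_nonneg _) (norm_nonneg _)).1 ?_
  rw [norm_sq_coord, norm_sq_coord]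
  simp only [hL0, ← sq]
  rw [← norm_sq_transpose hP (fun a => x a)]
  refine Finset.sum_le_sum fun i _ => ?_
  rw [mul_pow]
  exact mul_le_of_le_one_left (sq_nonneg _) (hb1 i)

section
variable (hf : Cpt f r) (h0 : 0 < ∫ x, f x)
include hf h0

theorem Cpt.Ev_cauchy {q w : E n → ℝ} (hq : Continuous q) (hw : Continuous w) (p : ℝ × E n) :
    Ev f (fun x => q x * w x) p ^ 2 ≤ Ev f (fun x => q x ^ 2) p * Ev f (fun x => w x ^ 2) p := by
  have h : ∀ s : ℝ, 0 ≤ Ev f (fun x => w x ^ 2) p * (s * s)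
      + (2 * Ev f (fun x => q x * w x) p) * s + Ev f (fun x => q x ^ 2) p := fun s => by
    have h1 := hf.Ev_nonneg h0 (q := fun x => (q x + s * w x) ^ 2) (by fun_prop)
      (fun x => sq_nonneg _) p
    have e : (fun x => (q x + s * w x) ^ 2)
        = fun x => q x ^ 2 + ((2 * s) * (q x * w x) + (s * s) * w x ^ 2) := by
      funext x; ring
    rw [e, hf.Ev_add (by fun_prop) (by fun_prop), hf.Ev_add (by fun_prop) (by fun_prop),
      Ev_const_mul, Ev_const_mul] at h1
    linarith
  have := discrim_le_zero h
  rw [discrim] at this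
  nlinarith

theorem Cpt.Ev_xi (P : Matrix (Fin n) (Fin n) ℝ) (p : ℝ × E n) (k : Fin n) :
    Ev f (xi f P p k) p = 0 := by
  unfold xi
  rw [hf.Ev_sum _ fun i _ => by fun_prop]
  refine Finset.sum_eq_zero fun a _ => ?_
  rw [Ev_const_mul, hf.Ev_sub (by fun_prop) (by fun_prop), hf.Ev_const h0]
  simp [mn]

theorem Cpt.third (hLC : LC fun x => ENNReal.ofReal (f x)) (p : ℝ × E n) (hp : 0 < p.1)
    {P : Matrix (Fin n) (Fin n) ℝ} (hP : P * Pᵀ = 1) {lam : Fin n → ℝ}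
    (hcov : ∀ i j, Ev f (fun x => xi f P p i x * xi f P p j x) p = if i = j then lam i else 0)
    {b : Fin n → ℝ} (hb : ∀ i, 0 < b i) (hb1 : ∀ i, b i ^ 2 ≤ 1) {u : ℝ} (hu : 0 ≤ u)
    (hbu : ∀ i, b i ^ 2 * lam i ≤ u) (k : Fin n) :
    ∑ i, ∑ j, b i ^ 2 * b j ^ 2
        * Ev f (fun x => xi f P p i x * xi f P p j x * xi f P p k x) p ^ 2
      ≤ 8 * u * √(u / p.1) * lam k := by
  obtain ⟨L, hL, hLe⟩ := exists_scaling hP hb hb1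
  set T : Fin n → Fin n → ℝ :=
    fun i j => Ev f (fun x => xi f P p i x * xi f P p j x * xi f P p k x) p with hT
  have hcx := continuous_xi (f := f) P p
  set m : E n := WithLp.toLp 2 fun a => mn f a p with hm
  have hLx : ∀ x i, L (x - m) i = b i * xi f P p i x := fun x i => by rw [hLe]; rfl
  have hv := hf.quad_var h0 hLC p hp m L hL hu (fun v => ?_) fun i j => b i * b j * T i j
  swap
  · simp only [hLx]
    have e : ∀ i j, Ev f (fun x => b i * xi f P p i x * (b j * xi f P p j x)) p
        = b i * b j * if i = j then lam i else 0 := fun i j => by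
      rw [← hcov, ← Ev_const_mul]
      congr 1; funext x; ring
    simp only [e, mul_ite, mul_zero, Finset.sum_ite_eq, Finset.mem_univ, if_true, Finset.mul_sum]
    refine Finset.sum_le_sum fun i _ => ?_
    calc v i * v i * (b i * b i * lam i) = (b i ^ 2 * lam i) * v i ^ 2 := by ring
      _ ≤ u * v i ^ 2 := by gcongr; exact hbu i
  simp only [hLx] at hv
  set Q : E n → ℝ :=
    fun x => ∑ i, ∑ j, b i * b j * T i j * (b i * xi f P p i x * (b j * xi f P p j x)) with hQ
  have hcQ : Continuous Q := by fun_prop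
  set X := ∑ i, ∑ j, b i ^ 2 * b j ^ 2 * T i j ^ 2 with hX
  have eX : ∑ i, ∑ j, (b i * b j * T i j) ^ 2 = X :=
    Finset.sum_congr rfl fun i _ => Finset.sum_congr rfl fun j _ => by ring
  rw [eX] at hv
  change Ev f (fun x => Q x ^ 2) p - Ev f Q p ^ 2 ≤ 8 * u * √(u / p.1) * X at hv
  have hX0 : 0 ≤ X := Finset.sum_nonneg fun i _ => Finset.sum_nonneg fun j _ => by positivity
  set q := Ev f Q p with hq
  have hlin : Ev f (fun x => (Q x - q) * xi f P p k x) p = X := by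
    have e : (fun x => (Q x - q) * xi f P p k x) = fun x => (∑ i, ∑ j, (b i ^ 2 * b j ^ 2 * T i j)
        * (xi f P p i x * xi f P p j x * xi f P p k x)) - q * xi f P p k x := by
      funext x
      rw [hQ, sub_mul, Finset.sum_mul]
      congr 1
      refine Finset.sum_congr rfl fun i _ => ?_
      rw [Finset.sum_mul]
      exact Finset.sum_congr rfl fun j _ => by ring
    rw [e, hf.Ev_sub (by fun_prop) (by fun_prop), Ev_const_mul, hf.Ev_xi h0, mul_zero, sub_zero,
      hf.Ev_sum _ fun i _ => by fun_prop]
    refine Finset.sum_congr rfl fun i _ => ?_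
    rw [hf.Ev_sum _ fun j _ => by fun_prop]
    refine Finset.sum_congr rfl fun j _ => ?_
    rw [Ev_const_mul]
    change b i ^ 2 * b j ^ 2 * T i j * T i j = _
    ring
  have hvar : Ev f (fun x => (Q x - q) ^ 2) p = Ev f (fun x => Q x ^ 2) p - q ^ 2 := by
    have e : (fun x => (Q x - q) ^ 2) = fun x => Q x ^ 2 - (2 * q) * Q x + q ^ 2 := by
      funext x; ring
    rw [e, hf.Ev_add (by fun_prop) (by fun_prop), hf.Ev_sub (by fun_prop) (by fun_prop),
      Ev_const_mul, hf.Ev_const h0]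
    ring
  have hcs := hf.Ev_cauchy h0 (q := fun x => Q x - q) (w := xi f P p k) (by fun_prop) (hcx k) p
  rw [hlin, hvar] at hcs
  have hk : Ev f (fun x => xi f P p k x ^ 2) p = lam k := by
    have := hcov k k
    rw [if_pos rfl] at this
    simpa only [sq] using this
  have hlam : 0 ≤ lam k := hk ▸ hf.Ev_nonneg h0 (by fun_prop) (fun x => sq_nonneg _) p
  rw [hk] at hcs
  have h1 : X ^ 2 ≤ 8 * u * √(u / p.1) * X * lam k :=
    hcs.trans (mul_le_mul_of_nonneg_right hv hlam)
  rcases hX0.eq_or_lt with h | h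
  · rw [← h]; positivity
  · exact le_of_mul_le_mul_left (by linarith) h

end
end Third
end SmallBall

namespace SmallBall
open scoped ENNReal NNReal Topology Matrix

section Comb
variable {n : ℕ} {lam : Fin n → ℝ} {T : Fin n → Fin n → Fin n → ℝ} {Λ t : ℝ}

theorem third_fiber (hlam : ∀ i, 0 ≤ lam i) (hΛ : 0 < Λ) (ht : 0 < t) (k : Fin n)
    (H : ∀ (b : Fin n → ℝ) (u : ℝ), (∀ i, 0 < b i) → (∀ i, b i ^ 2 ≤ 1) → 0 ≤ u →
      (∀ i, b i ^ 2 * lam i ≤ u) →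
      ∑ i, ∑ j, b i ^ 2 * b j ^ 2 * T i j k ^ 2 ≤ 8 * u * √(u / t) * lam k) :
    ∑ i, ∑ j, (if lam i ≤ lam k then Λ / (lam i + Λ) else 0)
        * (if lam j ≤ lam k then Λ / (lam j + Λ) else 0) * T i j k ^ 2
      ≤ 32 * √(Λ / t) * (lam k ^ 2 * Λ / (lam k + Λ)) := by
  have hw0 : ∀ i, 0 ≤ if lam i ≤ lam k then Λ / (lam i + Λ) else 0 := fun i => by
    have := hlam i
    split_ifs <;> positivity
  rcases (hlam k).eq_or_lt with h | h
  · have h1 := H (fun _ => 1) (∑ i, lam i) (fun _ => one_pos) (fun _ => by norm_num)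
      (Finset.sum_nonneg fun i _ => hlam i) fun i => by
        rw [one_pow, one_mul]
        exact Finset.single_le_sum (fun i _ => hlam i) (Finset.mem_univ i)
    rw [← h, mul_zero] at h1
    simp only [one_pow, one_mul] at h1
    have h2 : ∀ i j, T i j k ^ 2 = 0 := fun i j => by
      refine le_antisymm ?_ (sq_nonneg _)
      calc T i j k ^ 2 ≤ ∑ j, T i j k ^ 2 :=
            Finset.single_le_sum (f := fun j => T i j k ^ 2) (fun j _ => sq_nonneg _)
              (Finset.mem_univ j)
        _ ≤ ∑ i, ∑ j, T i j k ^ 2 :=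
            Finset.single_le_sum (f := fun i => ∑ j, T i j k ^ 2)
              (fun i _ => Finset.sum_nonneg fun j _ => sq_nonneg _) (Finset.mem_univ i)
        _ ≤ 0 := h1
    simp only [h2, mul_zero, Finset.sum_const_zero]
    rw [← h]; positivity
  · set u := lam k * Λ / (lam k + Λ) with hu
    have hu0 : 0 < u := by positivity
    have hpos : ∀ i, 0 < u + lam i := fun i => by linarith [hlam i]
    have hb2 : ∀ i, √(u / (u + lam i)) ^ 2 = u / (u + lam i) := fun i =>
      Real.sq_sqrt (div_pos hu0 (hpos i)).le
    have h1 := H (fun i => √(u / (u + lam i))) u (fun i => Real.sqrt_pos.2 (div_pos hu0 (hpos i)))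
      (fun i => by rw [hb2, div_le_one (hpos i)]; linarith [hlam i]) hu0.le fun i => by
        rw [hb2, div_mul_eq_mul_div, div_le_iff₀ (hpos i)]
        nlinarith [hlam i]
    simp only [hb2] at h1
    have huΛ : u ≤ Λ := by
      rw [hu, div_le_iff₀ (by linarith)]; nlinarith
    have hwb : ∀ i, (if lam i ≤ lam k then Λ / (lam i + Λ) else 0) ≤ 2 * (u / (u + lam i)) := by
      intro i
      split_ifs with hi
      · have := hlam i
        rw [← mul_div_assoc, div_le_div_iff₀ (by linarith) (hpos i)]
        have e : u * (lam k + Λ) = lam k * Λ := by rw [hu]; field_simp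
        have h3 : lam i * Λ ≤ u * (lam i + Λ) + u * lam i := by
          by_contra! hc
          have := mul_lt_mul_of_pos_right hc (show 0 < lam k + Λ by linarith)
          have e2 : (u * (lam i + Λ) + u * lam i) * (lam k + Λ)
              = lam k * Λ * (2 * lam i + Λ) := by rw [← e]; ring
          rw [e2] at this
          nlinarith [mul_le_mul_of_nonneg_left hi (mul_pos hΛ hΛ).le,
            mul_nonneg (mul_nonneg h.le (hlam i)) hΛ.le]
        nlinarith
      · have := hpos i; positivity
    calc _ ≤ ∑ i, ∑ j, 4 * (u / (u + lam i) * (u / (u + lam j)) * T i j k ^ 2) := by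
          refine Finset.sum_le_sum fun i _ => Finset.sum_le_sum fun j _ => ?_
          have h4 := mul_le_mul (hwb i) (hwb j) (hw0 j) ((hw0 i).trans (hwb i))
          have h5 := mul_le_mul_of_nonneg_right h4 (sq_nonneg (T i j k))
          linarith
      _ = 4 * ∑ i, ∑ j, (u / (u + lam i) * (u / (u + lam j)) * T i j k ^ 2) := by
          simp only [Finset.mul_sum]
      _ ≤ 4 * (8 * u * √(u / t) * lam k) := by gcongr
      _ ≤ 4 * (8 * u * √(Λ / t) * lam k) := by gcongr
      _ = _ := by rw [hu]; ring

theorem third_total (hlam : ∀ i, 0 ≤ lam i) (hΛ : 0 < Λ) (ht : 0 < t)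
    (h12 : ∀ a b c, T a b c = T b a c) (h23 : ∀ a b c, T a b c = T a c b)
    (H : ∀ (k : Fin n) (b : Fin n → ℝ) (u : ℝ), (∀ i, 0 < b i) → (∀ i, b i ^ 2 ≤ 1) → 0 ≤ u →
      (∀ i, b i ^ 2 * lam i ≤ u) →
      ∑ i, ∑ j, b i ^ 2 * b j ^ 2 * T i j k ^ 2 ≤ 8 * u * √(u / t) * lam k) :
    ∑ a, ∑ b, ∑ c, (Λ / (lam a + Λ)) ^ 2 * (Λ / (lam b + Λ)) * T a b c ^ 2
      ≤ 96 * √(Λ / t) * ∑ k, lam k ^ 2 * Λ / (lam k + Λ) := by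
  set w : Fin n → Fin n → ℝ := fun i k => if lam i ≤ lam k then Λ / (lam i + Λ) else 0 with hw
  have hρ0 : ∀ i, 0 < Λ / (lam i + Λ) := fun i => div_pos hΛ (by linarith [hlam i])
  have hρ1 : ∀ i, Λ / (lam i + Λ) ≤ 1 := fun i => by
    rw [div_le_one (by linarith [hlam i])]; linarith [hlam i]
  have hw0 : ∀ i k, 0 ≤ w i k := fun i k => by
    simp only [hw]; have := hρ0 i; split_ifs <;> linarith
  have hanti : ∀ i j, lam i ≤ lam j → Λ / (lam j + Λ) ≤ Λ / (lam i + Λ) := fun i j h => by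
    have := hlam i
    gcongr
  have hwt : ∀ i k, lam i ≤ lam k → w i k = Λ / (lam i + Λ) := fun i k h => if_pos h
  have pt : ∀ a b c, (Λ / (lam a + Λ)) ^ 2 * (Λ / (lam b + Λ))
      ≤ w a c * w b c + w b a * w c a + w a b * w c b := by
    intro a b c
    have n1 := mul_nonneg (hw0 a c) (hw0 b c)
    have n2 := mul_nonneg (hw0 b a) (hw0 c a)
    have n3 := mul_nonneg (hw0 a b) (hw0 c b)
    set ra := Λ / (lam a + Λ)
    set rb := Λ / (lam b + Λ)
    set rc := Λ / (lam c + Λ)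
    have hab : 0 ≤ ra * rb := (mul_pos (hρ0 a) (hρ0 b)).le
    have key : ra ^ 2 * rb ≤ ra * rb := by
      have := mul_le_mul_of_nonneg_right (hρ1 a) hab
      linarith
    rcases le_total (lam a) (lam c) with h1 | h1
    · rcases le_total (lam b) (lam c) with h2 | h2
      · rw [hwt a c h1, hwt b c h2]; linarith
      · rw [hwt a b (h1.trans h2), hwt c b h2]
        have := mul_le_mul_of_nonneg_left (hanti c b h2) (hρ0 a).le
        linarith
    · rcases le_total (lam b) (lam a) with h2 | h2
      · rw [hwt b a h2, hwt c a h1]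
        have := mul_le_mul_of_nonneg_left (hanti c a h1) (hρ0 b).le
        linarith
      · rw [hwt a b h2, hwt c b (h1.trans h2)]
        have := mul_le_mul_of_nonneg_left (hanti c b (h1.trans h2)) (hρ0 a).le
        linarith
  have F : ∑ k, ∑ i, ∑ j, w i k * w j k * T i j k ^ 2
      ≤ 32 * √(Λ / t) * ∑ k, lam k ^ 2 * Λ / (lam k + Λ) := by
    rw [Finset.mul_sum]
    exact Finset.sum_le_sum fun k _ => third_fiber hlam hΛ ht k (H k)
  have e1 : ∑ a, ∑ b, ∑ c, w a c * w b c * T a b c ^ 2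
      = ∑ k, ∑ i, ∑ j, w i k * w j k * T i j k ^ 2 := by
    rw [Finset.sum_congr rfl fun a _ => Finset.sum_comm]
    exact Finset.sum_comm
  have e2 : ∑ a, ∑ b, ∑ c, w b a * w c a * T a b c ^ 2
      = ∑ k, ∑ i, ∑ j, w i k * w j k * T i j k ^ 2 :=
    Finset.sum_congr rfl fun a _ => Finset.sum_congr rfl fun b _ =>
      Finset.sum_congr rfl fun c _ => by rw [h12 a b c, h23 b a c]
  have e3 : ∑ a, ∑ b, ∑ c, w a b * w c b * T a b c ^ 2
      = ∑ k, ∑ i, ∑ j, w i k * w j k * T i j k ^ 2 := by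
    rw [Finset.sum_comm]
    exact Finset.sum_congr rfl fun b _ => Finset.sum_congr rfl fun a _ =>
      Finset.sum_congr rfl fun c _ => by rw [h23 a b c]
  calc _ ≤ ∑ a, ∑ b, ∑ c, (w a c * w b c * T a b c ^ 2 + w b a * w c a * T a b c ^ 2
        + w a b * w c b * T a b c ^ 2) := by
        refine Finset.sum_le_sum fun a _ => Finset.sum_le_sum fun b _ =>
          Finset.sum_le_sum fun c _ => ?_
        have := mul_le_mul_of_nonneg_right (pt a b c) (sq_nonneg (T a b c))
        linarith
    _ = 3 * ∑ k, ∑ i, ∑ j, w i k * w j k * T i j k ^ 2 := by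
        simp only [Finset.sum_add_distrib]
        rw [e1, e2, e3]; ring
    _ ≤ _ := by linarith

end Comb
end SmallBall

namespace SmallBall
open scoped ENNReal NNReal Topology Matrix

section Spec
variable {n : ℕ} {f : E n → ℝ} {r : ℝ}

theorem exists_spectral {A : Matrix (Fin n) (Fin n) ℝ} (hA : ∀ i j, A i j = A j i) :
    ∃ (P : Matrix (Fin n) (Fin n) ℝ) (lam : Fin n → ℝ),
      P * Pᵀ = 1 ∧ Pᵀ * P = 1 ∧ A = P * Matrix.diagonal lam * Pᵀ := by
  have hH : A.IsHermitian := by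
    ext i j
    rw [Matrix.conjTranspose_apply, star_trivial, hA]
  refine ⟨hH.eigenvectorUnitary, hH.eigenvalues, ?_, ?_, ?_⟩
  · have := Unitary.mul_star_self_of_mem hH.eigenvectorUnitary.2
    rwa [Matrix.star_eq_conjTranspose, Matrix.conjTranspose_eq_transpose_of_trivial] at this
  · have := Unitary.star_mul_self_of_mem hH.eigenvectorUnitary.2
    rwa [Matrix.star_eq_conjTranspose, Matrix.conjTranspose_eq_transpose_of_trivial] at this
  · have := hH.spectral_theorem
    rw [Unitary.conjStarAlgAut_apply, Matrix.star_eq_conjTranspose,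
      Matrix.conjTranspose_eq_transpose_of_trivial] at this
    exact this

theorem diag_of_spectral {A P : Matrix (Fin n) (Fin n) ℝ} {lam : Fin n → ℝ} (h2 : Pᵀ * P = 1)
    (hA : A = P * Matrix.diagonal lam * Pᵀ) (i j : Fin n) :
    ∑ a, ∑ b, P a i * P b j * A a b = if i = j then lam i else 0 := by
  have e : Pᵀ * A * P = Matrix.diagonal lam := by
    rw [hA]
    calc Pᵀ * (P * Matrix.diagonal lam * Pᵀ) * P = (Pᵀ * P) * Matrix.diagonal lam * (Pᵀ * P) := by
          noncomm_ring
      _ = _ := by rw [h2, one_mul, mul_one]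
  have := congrFun (congrFun e i) j
  rw [Matrix.diagonal_apply, Matrix.mul_apply] at this
  rw [← this, Finset.sum_comm]
  refine Finset.sum_congr rfl fun b _ => ?_
  rw [Matrix.mul_apply, Finset.sum_mul]
  exact Finset.sum_congr rfl fun a _ => by rw [Matrix.transpose_apply]; ring

theorem trace_conj {P D : Matrix (Fin n) (Fin n) ℝ} (h2 : Pᵀ * P = 1) :
    (P * D * Pᵀ).trace = D.trace := by
  rw [Matrix.trace_mul_comm, ← mul_assoc, h2, one_mul]

theorem conj_mul {P D D' : Matrix (Fin n) (Fin n) ℝ} (h2 : Pᵀ * P = 1) :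
    P * D * Pᵀ * (P * D' * Pᵀ) = P * (D * D') * Pᵀ := by
  calc P * D * Pᵀ * (P * D' * Pᵀ) = P * D * (Pᵀ * P) * D' * Pᵀ := by noncomm_ring
    _ = _ := by rw [h2]; noncomm_ring

/-- Trace of `R H R H R` in an eigenbasis of `R`. -/
theorem trace_RHRHR {P H : Matrix (Fin n) (Fin n) ℝ} {d : Fin n → ℝ} (h1 : P * Pᵀ = 1)
    (h2 : Pᵀ * P = 1) (hH : ∀ i j, H i j = H j i) :
    let R := P * Matrix.diagonal d * Pᵀ
    (R * H * R * H * R).trace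
      = ∑ a, ∑ b, d a ^ 2 * d b * (∑ i, ∑ j, P i a * P j b * H i j) ^ 2 := by
  intro R
  set G := Pᵀ * H * P with hG
  have hHG : H = P * G * Pᵀ := by
    rw [hG]
    calc H = (P * Pᵀ) * H * (P * Pᵀ) := by rw [h1, one_mul, mul_one]
      _ = _ := by noncomm_ring
  have hGe : ∀ a b, G a b = ∑ i, ∑ j, P i a * P j b * H i j := fun a b => by
    rw [hG, Matrix.mul_apply, Finset.sum_comm]
    refine Finset.sum_congr rfl fun j _ => ?_
    rw [Matrix.mul_apply, Finset.sum_mul]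
    exact Finset.sum_congr rfl fun i _ => by rw [Matrix.transpose_apply]; ring
  have hGs : ∀ a b, G a b = G b a := fun a b => by
    rw [hGe, hGe, Finset.sum_comm]
    exact Finset.sum_congr rfl fun i _ => Finset.sum_congr rfl fun j _ => by rw [hH]; ring
  have e : R * H * R * H * R
      = P * (Matrix.diagonal d * G * Matrix.diagonal d * G * Matrix.diagonal d) * Pᵀ := by
    rw [hHG, conj_mul h2, conj_mul h2, conj_mul h2, conj_mul h2]
  rw [e, trace_conj h2, Matrix.trace]
  refine Finset.sum_congr rfl fun a _ => ?_
  rw [Matrix.diag_apply, Matrix.mul_diagonal, Matrix.mul_apply, Finset.sum_mul]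
  refine Finset.sum_congr rfl fun b _ => ?_
  rw [Matrix.mul_diagonal, Matrix.diagonal_mul, ← hGe, hGs b a]
  ring

theorem resolvent_spectral {A P R : Matrix (Fin n) (Fin n) ℝ} {lam : Fin n → ℝ} {Λ : ℝ}
    (h1 : P * Pᵀ = 1) (h2 : Pᵀ * P = 1) (hA : A = P * Matrix.diagonal lam * Pᵀ)
    (hlam : ∀ i, 0 ≤ lam i) (hΛ : 0 < Λ)
    (hR : R * (A + Λ • (1 : Matrix (Fin n) (Fin n) ℝ)) = 1) :
    R = P * Matrix.diagonal (fun i => (lam i + Λ)⁻¹) * Pᵀ := by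
  have e : A + Λ • (1 : Matrix (Fin n) (Fin n) ℝ)
      = P * Matrix.diagonal (fun i => lam i + Λ) * Pᵀ := by
    have : Matrix.diagonal (fun i => lam i + Λ) = Matrix.diagonal lam + Λ • 1 := by
      ext i j
      by_cases h : i = j <;> simp [h, Matrix.one_apply]
    rw [this, mul_add, add_mul, ← hA, mul_smul_comm, mul_one, smul_mul_assoc, h1]
  have e2 : (A + Λ • (1 : Matrix (Fin n) (Fin n) ℝ))
      * (P * Matrix.diagonal (fun i => (lam i + Λ)⁻¹) * Pᵀ) = 1 := by
    rw [e, conj_mul h2, Matrix.diagonal_mul_diagonal]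
    have : (fun i => (lam i + Λ) * (lam i + Λ)⁻¹) = fun _ => (1 : ℝ) :=
      funext fun i => mul_inv_cancel₀ (by linarith [hlam i])
    rw [this, Matrix.diagonal_one, mul_one, h1]
  exact left_inv_eq_right_inv hR e2

section
variable (hf : Cpt f r) (h0 : 0 < ∫ x, f x)
include hf h0

theorem Cpt.cu_eq (k i j : Fin n) (p : ℝ × E n) :
    cu f k i j p = Ev f (fun x => (x k - mn f k p) * ((x i - mn f i p) * (x j - mn f j p))) p := by
  have e : (fun x : E n => (x k - mn f k p) * ((x i - mn f i p) * (x j - mn f j p)))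
      = fun x => x k * (x i * x j) - mn f j p * (x k * x i) - mn f i p * (x k * x j)
        - mn f k p * (x i * x j) + mn f i p * mn f j p * x k + mn f k p * mn f j p * x i
        + mn f k p * mn f i p * x j - mn f k p * mn f i p * mn f j p := by
    funext x; ring
  rw [e, hf.Ev_sub (by fun_prop) (by fun_prop), hf.Ev_add (by fun_prop) (by fun_prop),
    hf.Ev_add (by fun_prop) (by fun_prop), hf.Ev_add (by fun_prop) (by fun_prop),
    hf.Ev_sub (by fun_prop) (by fun_prop), hf.Ev_sub (by fun_prop) (by fun_prop),
    hf.Ev_sub (by fun_prop) (by fun_prop), hf.Ev_const h0]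
  simp only [Ev_const_mul]
  simp only [cu, mn]
  ring

theorem Cpt.cu_rot (P : Matrix (Fin n) (Fin n) ℝ) (c a b : Fin n) (p : ℝ × E n) :
    ∑ k, P k c * ∑ i, ∑ j, P i a * P j b * cu f k i j p
      = Ev f (fun x => xi f P p c x * xi f P p a x * xi f P p b x) p := by
  have e : (fun x => xi f P p c x * xi f P p a x * xi f P p b x)
      = fun x => ∑ k, ∑ i, ∑ j, P k c * (P i a * P j b)
        * ((x k - mn f k p) * ((x i - mn f i p) * (x j - mn f j p))) := by
    funext x
    simp only [xi]
    rw [mul_assoc, Finset.sum_mul]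
    refine Finset.sum_congr rfl fun k _ => ?_
    rw [Finset.sum_mul_sum, Finset.mul_sum]
    refine Finset.sum_congr rfl fun i _ => ?_
    rw [Finset.mul_sum]
    exact Finset.sum_congr rfl fun j _ => by ring
  rw [e, hf.Ev_sum _ fun i _ => by fun_prop]
  refine Finset.sum_congr rfl fun k _ => ?_
  rw [hf.Ev_sum _ fun i _ => by fun_prop, Finset.mul_sum]
  refine Finset.sum_congr rfl fun i _ => ?_
  rw [hf.Ev_sum _ fun i _ => by fun_prop, Finset.mul_sum]
  refine Finset.sum_congr rfl fun j _ => ?_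
  rw [Ev_const_mul, hf.cu_eq h0]; ring

/-- Spectral data of the covariance matrix at a point. -/
theorem Cpt.co_spectral (p : ℝ × E n) : ∃ (P : Matrix (Fin n) (Fin n) ℝ) (lam : Fin n → ℝ),
    P * Pᵀ = 1 ∧ Pᵀ * P = 1 ∧ co f p = P * Matrix.diagonal lam * Pᵀ ∧ (∀ i, 0 ≤ lam i) ∧
    ∀ i j, Ev f (fun x => xi f P p i x * xi f P p j x) p = if i = j then lam i else 0 := by
  obtain ⟨P, lam, h1, h2, h3⟩ := exists_spectral (co_symm (f := f) p)
  have h4 : ∀ i j, Ev f (fun x => xi f P p i x * xi f P p j x) p = if i = j then lam i else 0 :=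
    fun i j => by
      rw [← diag_of_spectral h2 h3, hf.co_form h0]; rfl
  refine ⟨P, lam, h1, h2, h3, fun i => ?_, h4⟩
  have := h4 i i
  rw [if_pos rfl] at this
  rw [← this]
  have := continuous_xi (f := f) P p i
  exact hf.Ev_nonneg h0 (by fun_prop) (fun x => mul_self_nonneg _) p

theorem Cpt.spectral_facts {Λ : ℝ} (hΛ : 0 < Λ) (p : ℝ × E n) {P : Matrix (Fin n) (Fin n) ℝ}
    {lam : Fin n → ℝ} (h1 : P * Pᵀ = 1) (h2 : Pᵀ * P = 1)
    (h3 : co f p = P * Matrix.diagonal lam * Pᵀ) (hlam : ∀ i, 0 ≤ lam i) :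
    (co f p).trace = ∑ i, lam i ∧ (co f p * co f p).trace = ∑ i, lam i ^ 2 ∧
    ph f Λ p = ∑ i, lam i ^ 2 * Λ / (lam i + Λ) ∧
    (rs f Λ p * (co f p * co f p) * rs f Λ p).trace = ∑ i, lam i ^ 2 / (lam i + Λ) ^ 2 := by
  have hR := resolvent_spectral h1 h2 h3 hlam hΛ (hf.rs_mul h0 hΛ p)
  have t1 : (co f p).trace = ∑ i, lam i := by
    rw [h3, trace_conj h2, Matrix.trace_diagonal]
  have hpos : ∀ i, 0 < lam i + Λ := fun i => by linarith [hlam i]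
  refine ⟨t1, ?_, ?_, ?_⟩
  · rw [h3, conj_mul h2, trace_conj h2, Matrix.diagonal_mul_diagonal, Matrix.trace_diagonal]
    exact Finset.sum_congr rfl fun i _ => by ring
  · rw [ph, t1, hR, trace_conj h2, Matrix.trace_diagonal, Finset.mul_sum, Finset.mul_sum]
    have : Λ ^ 2 * (n : ℝ) = ∑ i : Fin n, Λ ^ 2 := by
      rw [Finset.sum_const, Finset.card_univ, Fintype.card_fin, nsmul_eq_mul, mul_comm]
    rw [this, ← Finset.sum_sub_distrib, ← Finset.sum_add_distrib]
    refine Finset.sum_congr rfl fun i _ => ?_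
    have := hpos i
    field_simp
    ring
  · rw [hR, h3, conj_mul h2, conj_mul h2, conj_mul h2, trace_conj h2,
      Matrix.diagonal_mul_diagonal, Matrix.diagonal_mul_diagonal, Matrix.diagonal_mul_diagonal,
      Matrix.trace_diagonal]
    refine Finset.sum_congr rfl fun i _ => ?_
    have := hpos i
    field_simp

theorem Cpt.drift_le (hLC : LC fun x => ENNReal.ofReal (f x)) {Λ : ℝ} (hΛ : 0 < Λ) (p : ℝ × E n)
    (hp : 0 < p.1) :
    Λ ^ 3 * (∑ k, (rs f Λ p * cm f k p * rs f Λ p * cm f k p * rs f Λ p).trace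
        + (rs f Λ p * (co f p * co f p) * rs f Λ p).trace) - Λ * (co f p * co f p).trace
      ≤ 96 * √(Λ / p.1) * ph f Λ p := by
  obtain ⟨P, lam, h1, h2, h3, hlam, hcov⟩ := hf.co_spectral h0 p
  obtain ⟨-, t2, t3, t4⟩ := hf.spectral_facts h0 hΛ p h1 h2 h3 hlam
  have hR := resolvent_spectral h1 h2 h3 hlam hΛ (hf.rs_mul h0 hΛ p)
  have hpos : ∀ i, 0 < lam i + Λ := fun i => by linarith [hlam i]
  set T : Fin n → Fin n → Fin n → ℝ :=
    fun a b c => Ev f (fun x => xi f P p a x * xi f P p b x * xi f P p c x) p with hT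
  have h12 : ∀ a b c, T a b c = T b a c := fun a b c => by
    simp only [hT]; congr 1; funext x; ring
  have h23 : ∀ a b c, T a b c = T a c b := fun a b c => by
    simp only [hT]; congr 1; funext x; ring
  have main := third_total hlam hΛ hp h12 h23 fun k b u hb hb1 hu hbu =>
    hf.third h0 hLC p hp h1 hcov hb hb1 hu hbu k
  have hcs : ∀ k i j, cm f k p i j = cm f k p j i := fun k i j => by
    simp only [cm, Matrix.of_apply]
    rw [hf.cu_eq h0, hf.cu_eq h0]
    congr 1; funext x; ring
  have e : Λ ^ 3 * ∑ k, (rs f Λ p * cm f k p * rs f Λ p * cm f k p * rs f Λ p).trace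
      = ∑ a, ∑ b, ∑ c, (Λ / (lam a + Λ)) ^ 2 * (Λ / (lam b + Λ)) * T a b c ^ 2 := by
    have e1 : ∀ k, (rs f Λ p * cm f k p * rs f Λ p * cm f k p * rs f Λ p).trace
        = ∑ a, ∑ b, (lam a + Λ)⁻¹ ^ 2 * (lam b + Λ)⁻¹
          * (∑ i, ∑ j, P i a * P j b * cu f k i j p) ^ 2 := fun k => by
      rw [hR]
      exact trace_RHRHR h1 h2 (hcs k)
    simp only [e1]
    rw [Finset.sum_comm, Finset.mul_sum]
    refine Finset.sum_congr rfl fun a _ => ?_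
    rw [Finset.sum_comm, Finset.mul_sum]
    refine Finset.sum_congr rfl fun b _ => ?_
    rw [← Finset.mul_sum, ← Finset.mul_sum,
      ← norm_sq_transpose h1 fun k => ∑ i, ∑ j, P i a * P j b * cu f k i j p]
    have e2 : ∀ c, ∑ k, P k c * ∑ i, ∑ j, P i a * P j b * cu f k i j p = T a b c := fun c => by
      rw [hf.cu_rot h0, h23, h12 a c b]
    simp only [e2]
    rw [← mul_assoc, div_eq_mul_inv, div_eq_mul_inv]
    ring
  have hA : Λ ^ 3 * (rs f Λ p * (co f p * co f p) * rs f Λ p).trace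
      ≤ Λ * (co f p * co f p).trace := by
    rw [t2, t4, Finset.mul_sum, Finset.mul_sum]
    refine Finset.sum_le_sum fun i _ => ?_
    have := hpos i
    rw [← mul_div_assoc, div_le_iff₀ (by positivity)]
    have h5 : Λ ^ 2 ≤ (lam i + Λ) ^ 2 := by gcongr; linarith [hlam i]
    have h6 : 0 ≤ Λ * lam i ^ 2 := by positivity
    nlinarith [mul_le_mul_of_nonneg_left h5 h6]
  rw [t3, mul_add, e]
  linarith

theorem Cpt.ph_le (Λ : ℝ) (hΛ : 0 < Λ) (p : ℝ × E n) :
    ph f Λ p ≤ (co f p * co f p).trace ∧ 0 ≤ ph f Λ p := by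
  obtain ⟨P, lam, h1, h2, h3, hlam, hcov⟩ := hf.co_spectral h0 p
  obtain ⟨-, t2, t3, -⟩ := hf.spectral_facts h0 hΛ p h1 h2 h3 hlam
  have hpos : ∀ i, 0 < lam i + Λ := fun i => by linarith [hlam i]
  rw [t2, t3]
  refine ⟨Finset.sum_le_sum fun i _ => ?_, Finset.sum_nonneg fun i _ => ?_⟩
  · rw [div_le_iff₀ (hpos i)]
    nlinarith [hlam i, mul_nonneg (sq_nonneg (lam i)) (hlam i)]
  · have := hpos i; positivity

theorem Cpt.tr_sq_le {Λ : ℝ} (hΛ : 0 < Λ) (p : ℝ × E n)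
    (hA : ∀ v : Fin n → ℝ, ∑ i, ∑ j, v i * v j * co f p i j ≤ Λ * ∑ i, v i ^ 2) :
    (co f p * co f p).trace ≤ 2 * ph f Λ p ∧
      (co f p * co f p).trace ≤ Λ * (co f p).trace := by
  obtain ⟨P, lam, h1, h2, h3, hlam, hcov⟩ := hf.co_spectral h0 p
  obtain ⟨t1, t2, t3, -⟩ := hf.spectral_facts h0 hΛ p h1 h2 h3 hlam
  have hpos : ∀ i, 0 < lam i + Λ := fun i => by linarith [hlam i]
  have hle : ∀ i, lam i ≤ Λ := fun i => by
    have h5 := diag_of_spectral h2 h3 i i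
    rw [if_pos rfl] at h5
    have h6 := congrFun (congrFun h2 i) i
    rw [Matrix.mul_apply, Matrix.one_apply_eq] at h6
    have h7 : ∑ a, P a i ^ 2 = 1 := by
      rw [← h6]; exact Finset.sum_congr rfl fun a _ => by rw [Matrix.transpose_apply]; ring
    have h8 := hA fun a => P a i
    rw [h5, h7, mul_one] at h8
    exact h8
  rw [t1, t2, t3, Finset.mul_sum, Finset.mul_sum]
  refine ⟨Finset.sum_le_sum fun i _ => ?_, Finset.sum_le_sum fun i _ => ?_⟩
  · rw [← mul_div_assoc, le_div_iff₀ (hpos i)]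
    nlinarith [hle i, mul_le_mul_of_nonneg_left (hle i) (sq_nonneg (lam i))]
  · nlinarith [hle i, hlam i]

end
end Spec
end SmallBall

namespace SmallBall

open scoped ENNReal NNReal Topology

section Conc
variable {n : ℕ} {f : E n → ℝ} {r : ℝ}

theorem tl_sub_norm_sq {t : ℝ} (ht : 0 < t) (θ x : E n) :
    tl (t, θ) x - ‖θ‖ ^ 2 / (2 * t) = -(t / 2 * ‖x - t⁻¹ • θ‖ ^ 2) := by
  have h := norm_sub_sq_real x (t⁻¹ • θ)
  rw [h, norm_smul, inner_smul_right, real_inner_comm, Real.norm_of_nonneg (inv_pos.2 ht).le]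
  simp only [tl]
  field_simp
  ring

theorem concave_neg_norm_sq {t : ℝ} (ht : 0 < t) (x y : E n) (a b : ℝ) (ha : 0 < a) (hb : 0 < b)
    (hab : a + b = 1) :
    t / 2 * ‖a • x + b • y‖ ^ 2 ≤ a * (t / 2 * ‖x‖ ^ 2) + b * (t / 2 * ‖y‖ ^ 2) := by
  rw [norm_sq_convex_comb _ _ hab]
  have : 0 ≤ t / 2 * (a * b * ‖x - y‖ ^ 2) := by positivity
  linarith

theorem hasDerivAt_norm_sq (θ v : E n) (c s : ℝ) :
    HasDerivAt (fun s : ℝ => ‖θ + s • v‖ ^ 2 / c) (2 * (inner ℝ θ v + s * ‖v‖ ^ 2) / c) s := by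
  have e : (fun s : ℝ => ‖θ + s • v‖ ^ 2 / c)
      = fun s => (‖θ‖ ^ 2 + s * (2 * inner ℝ θ v) + s ^ 2 * ‖v‖ ^ 2) / c := by
    funext s
    rw [norm_add_sq_real, norm_smul, inner_smul_right, mul_pow, Real.norm_eq_abs, sq_abs]
    ring
  rw [e]
  refine HasDerivAt.div_const ?_ c
  refine ((((hasDerivAt_id s).mul_const (2 * inner ℝ θ v)).const_add _).add
    (((hasDerivAt_id s).pow 2).mul_const _)).congr_deriv ?_
  simp; ring

variable (hf : Cpt f r) (h0 : 0 < ∫ x, f x)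
include hf

theorem Cpt.lc_Zf (hLC : LC fun x => ENNReal.ofReal (f x)) {t : ℝ} (ht : 0 < t) :
    LC fun θ : E n => ENNReal.ofReal (Zf f (t, θ) * Real.exp (-(‖θ‖ ^ 2 / (2 * t)))) := by
  have h1 : LC fun q : E n × E n => ENNReal.ofReal (f q.2)
      * ENNReal.ofReal (Real.exp (-(t / 2 * ‖q.2 - t⁻¹ • q.1‖ ^ 2))) :=
    (hLC.comp_linear (LinearMap.snd ℝ _ _)).mul
      ((LC.exp_neg (φ := fun x : E n => t / 2 * ‖x‖ ^ 2) (concave_neg_norm_sq ht)).comp_linear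
        (LinearMap.snd ℝ (E n) (E n) - t⁻¹ • LinearMap.fst ℝ (E n) (E n)))
  have h2 := LC.marginal (volume : Measure (E n)) h1
  refine (funext fun θ => ?_ : (fun θ : E n => ENNReal.ofReal
    (Zf f (t, θ) * Real.exp (-(‖θ‖ ^ 2 / (2 * t))))) = _) ▸ h2
  rw [Zf, U, ← integral_mul_const, ofReal_integral_eq_lintegral_ofReal]
  · refine lintegral_congr fun x => ?_
    rw [← ENNReal.ofReal_mul (hf.nonneg _), ← tl_sub_norm_sq ht, one_mul, mul_assoc,
      ← Real.exp_add]
    rfl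
  · exact (hf.integrable_U continuous_const _).mul_const _
  · exact ae_of_all _ fun x => mul_nonneg (mul_nonneg zero_le_one
      (mul_nonneg (hf.nonneg _) (Real.exp_pos _).le)) (Real.exp_pos _).le

include h0

theorem Cpt.logZ_concave (hLC : LC fun x => ENNReal.ofReal (f x)) {t : ℝ} (ht : 0 < t)
    (x y : E n) (a b : ℝ) (ha : 0 < a) (hb : 0 < b) (hab : a + b = 1) :
    a * (Real.log (Zf f (t, x)) - ‖x‖ ^ 2 / (2 * t))
        + b * (Real.log (Zf f (t, y)) - ‖y‖ ^ 2 / (2 * t))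
      ≤ Real.log (Zf f (t, a • x + b • y)) - ‖a • x + b • y‖ ^ 2 / (2 * t) := by
  have h := concave_log_of_LC
    (g := fun θ : E n => Zf f (t, θ) * Real.exp (-(‖θ‖ ^ 2 / (2 * t))))
    (fun θ => mul_pos (hf.Zf_pos h0 _) (Real.exp_pos _)) (hf.lc_Zf hLC ht) x y a b ha hb hab
  have e : ∀ θ : E n, Real.log (Zf f (t, θ) * Real.exp (-(‖θ‖ ^ 2 / (2 * t))))
      = Real.log (Zf f (t, θ)) - ‖θ‖ ^ 2 / (2 * t) := fun θ => by
    rw [Real.log_mul (hf.Zf_pos h0 _).ne' (Real.exp_pos _).ne', Real.log_exp, sub_eq_add_neg]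
  simpa only [e] using h

theorem Cpt.hasDerivAt_logZ (t : ℝ) (θ v : E n) (s : ℝ) :
    HasDerivAt (fun s : ℝ => Real.log (Zf f (t, θ + s • v)))
      (∑ k, v k * mn f k (t, θ + s • v)) s := by
  have hγ : HasDerivAt (fun s : ℝ => ((t, θ + s • v) : ℝ × E n)) (0, v) s := by
    have h1 : HasDerivAt (fun s : ℝ => θ + s • v) v s := by
      simpa using ((hasDerivAt_id s).smul_const v).const_add θ
    exact (hasDerivAt_const s t).prodMk h1
  have h := (hf.hasDerivAt_U (q := fun _ => 1) continuous_const _ _ s hγ).log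
    (hf.Zf_pos h0 _).ne'
  refine h.congr_deriv ?_
  simp only [zero_smul, zero_mul, zero_add, mul_one, smul_eq_mul, mn, Ev, Zf]
  rw [Finset.sum_div]
  exact Finset.sum_congr rfl fun k _ => by ring

theorem Cpt.hasDerivAt_mn (t : ℝ) (θ v : E n) (k : Fin n) :
    HasDerivAt (fun s : ℝ => mn f k (t, θ + s • v)) (∑ j, v j * co f (t, θ) j k) 0 := by
  have hγ : HasDerivAt (fun s : ℝ => ((t, θ + s • v) : ℝ × E n)) (0, v) 0 := by
    have h1 : HasDerivAt (fun s : ℝ => θ + s • v) v 0 := by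
      simpa using ((hasDerivAt_id (0 : ℝ)).smul_const v).const_add θ
    exact (hasDerivAt_const 0 t).prodMk h1
  obtain ⟨Ft, F2, h, -⟩ := hf.ig_Ev h0 (q := fun x : E n => x k) (by fun_prop)
  have h := h.hF _ _ 0 hγ
  refine h.congr_deriv ?_
  simp only [zero_smul, zero_mul, zero_add, add_zero, smul_eq_mul, co, Matrix.of_apply]
  exact Finset.sum_congr rfl fun j _ => by rw [mul_comm (mn f j _)]; rfl

/-- The tilts are more log-concave than a Gaussian of variance `1 / t`. -/
theorem Cpt.co_le (hLC : LC fun x => ENNReal.ofReal (f x)) (p : ℝ × E n) (hp : 0 < p.1)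
    (v : Fin n → ℝ) : ∑ i, ∑ j, v i * v j * co f p i j ≤ 1 / p.1 * ∑ i, v i ^ 2 := by
  obtain ⟨t, θ⟩ := p
  simp only at hp ⊢
  set w : E n := WithLp.toLp 2 v with hw
  have hwi : ∀ i, w i = v i := fun i => rfl
  have h := second_deriv_nonpos
    (φ := fun s : ℝ => Real.log (Zf f (t, θ + s • w)) - ‖θ + s • w‖ ^ 2 / (2 * t))
    (φ' := fun s => ∑ k, w k * mn f k (t, θ + s • w)
      - 2 * (inner ℝ θ w + s * ‖w‖ ^ 2) / (2 * t))
    (c := ∑ k, w k * ∑ j, w j * co f (t, θ) j k - 2 * (‖w‖ ^ 2) / (2 * t))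
    (fun x y a b ha hb hab => by
      have := hf.logZ_concave h0 hLC hp (θ + x • w) (θ + y • w) a b ha hb hab
      have e : a • (θ + x • w) + b • (θ + y • w) = θ + (a * x + b * y) • w := by
        rw [smul_add, smul_add, add_add_add_comm, ← add_smul, hab, one_smul, smul_smul, smul_smul,
          ← add_smul]
      rwa [e] at this)
    (fun s => (hf.hasDerivAt_logZ h0 t θ w s).sub (hasDerivAt_norm_sq θ w _ s))
    (by
      refine HasDerivAt.sub (HasDerivAt.fun_sum fun k _ =>
        (hf.hasDerivAt_mn h0 t θ w k).const_mul (w k)) ?_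
      refine HasDerivAt.div_const ?_ _
      refine ((((hasDerivAt_id (0 : ℝ)).mul_const (‖w‖ ^ 2)).const_add _).const_mul 2).congr_deriv
        ?_
      simp)
  rw [norm_sq_coord] at h
  have e1 : ∑ k, w k * ∑ j, w j * co f (t, θ) j k = ∑ i, ∑ j, v i * v j * co f (t, θ) i j := by
    refine Finset.sum_congr rfl fun i _ => ?_
    rw [Finset.mul_sum]
    exact Finset.sum_congr rfl fun j _ => by rw [co_symm, hwi, hwi]; ring
  have e2 : ∑ i, w i * w i = ∑ i, v i ^ 2 := Finset.sum_congr rfl fun i _ => by rw [hwi]; ring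
  rw [e1, e2, mul_div_mul_left _ _ two_ne_zero] at h
  rw [one_div_mul_eq_div]
  linarith

/-- The tangent inequality at the tilt `θ` for the concave function `log Z - |θ|² / (2 * t)`. -/
theorem Cpt.logZ_tangent (hLC : LC fun x => ENNReal.ofReal (f x)) {t : ℝ} (ht : 0 < t) (θ : E n) :
    Real.log (Zf f (t, 0)) ≤ Real.log (Zf f (t, θ)) + ‖θ‖ ^ 2 / (2 * t)
      - ∑ k, θ k * mn f k (t, θ) := by
  set φ := fun s : ℝ => Real.log (Zf f (t, θ + s • (-θ))) - ‖θ + s • (-θ)‖ ^ 2 / (2 * t) with hφ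
  have hconc : ConcaveOn ℝ Set.univ φ := by
    refine ⟨convex_univ, fun x _ y _ a b ha hb hab => ?_⟩
    rcases ha.eq_or_lt with h | ha
    · subst h; simp at hab; subst hab; simp
    rcases hb.eq_or_lt with h | hb
    · subst h; simp at hab; subst hab; simp
    have := hf.logZ_concave h0 hLC ht (θ + x • (-θ)) (θ + y • (-θ)) a b ha hb hab
    have e : a • (θ + x • (-θ)) + b • (θ + y • (-θ)) = θ + (a * x + b * y) • (-θ) := by
      rw [smul_add, smul_add, add_add_add_comm, ← add_smul, hab, one_smul, smul_smul, smul_smul,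
        ← add_smul]
    rwa [e] at this
  have hd := (hf.hasDerivAt_logZ h0 t θ (-θ) 0).sub
    (hasDerivAt_norm_sq θ (-θ) (2 * t) 0)
  have h := hconc.slope_le_of_hasDerivAt (Set.mem_univ 0) (Set.mem_univ 1) one_pos hd
  simp only [slope_def_field, hφ, zero_smul, add_zero, one_smul, add_neg_cancel, norm_zero,
    sub_zero, div_one, zero_mul, inner_neg_right, real_inner_self_eq_norm_sq, PiLp.neg_apply,
    neg_mul, Finset.sum_neg_distrib] at h
  have e : 2 * (-‖θ‖ ^ 2) / (2 * t) = - (2 * (‖θ‖ ^ 2 / (2 * t))) := by ring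
  rw [e] at h
  norm_num at h
  linarith

end Conc
end SmallBall

namespace SmallBall

open scoped ENNReal NNReal Topology

section Guan
variable {n : ℕ} {f : E n → ℝ} {r : ℝ}

theorem heat_zero (F : ℝ × E n → ℝ) : heat F 0 = F (0, 0) := by
  simp only [heat, Real.sqrt_zero, zero_smul]
  rw [integral_const_mul, mul_div_assoc, div_self integral_gw_pos.ne', mul_one]

variable (hf : Cpt f r) (h0 : 0 < ∫ x, f x)
include hf

theorem Cpt.grow_Zf : Grow (Zf f) := hf.grow_U continuous_const

/-- The heat flow preserves the moments of the tilts. -/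
theorem Cpt.heat_U_eq {q : E n → ℝ} (hq : Continuous q) {t : ℝ} (ht : 0 ≤ t) :
    heat (U f q) t = U f q (0, 0) := by
  have hd : ∀ s, 0 < s → HasDerivAt (heat (U f q)) 0 s := fun s hs => by
    refine ((hf.ito_U hq).heat_deriv hs).congr_deriv ?_
    simp only [hf.heat_U hq]
    exact heat_const 0 s
  rw [← heat_zero (U f q)]
  rcases ht.eq_or_lt with rfl | ht
  · rfl
  obtain ⟨c, hc, e⟩ := exists_hasDerivAt_eq_slope (heat (U f q)) (fun _ => 0) ht
    (hf.grow_U hq).continuous_heat.continuousOn fun s hs => hd s hs.1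
  have h := sub_ne_zero.2 ht.ne'
  rw [eq_comm, div_eq_zero_iff] at e
  linarith [e.resolve_right h]

include h0

theorem Cpt.grow_mn (k : Fin n) : Grow (mn f k) :=
  (hf.ig_Ev h0 (q := fun x : E n => x k) (by fun_prop)).grow

theorem IG.growD {F G : ℝ × E n → ℝ} {F1 : Fin n → ℝ × E n → ℝ} (h : IG f F F1 G) : Grow G := by
  obtain ⟨Ft, F2, h, e⟩ := h
  rw [show G = fun p => Ft p + (1 / 2 : ℝ) • ∑ k, F2 k p + ∑ k, mn f k p • F1 k p from funext e]
  exact (h.gt.add ((Grow.sum _ fun k _ => h.g2 k).smul _)).add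
    (Grow.sum _ fun k _ => (hf.grow_mn h0 k).mul (h.g1 k))

theorem Cpt.gronwall (hLC : LC fun x => ENNReal.ofReal (f x)) {Λ : ℝ} (hΛ : 0 < Λ) {t : ℝ}
    (ht : 0 ≤ t) :
    heat (fun p => Zf f p * ph f Λ p) t
      ≤ Zf f (0, 0) * ph f Λ (0, 0) * Real.exp (192 * √(Λ * t)) := by
  obtain ⟨F1, hI⟩ := hf.ig_ph h0 hΛ
  set φ := heat fun p => Zf f p * ph f Λ p with hφ
  set G := fun p =>
      Λ ^ 3 * (∑ k, (rs f Λ p * cm f k p * rs f Λ p * cm f k p * rs f Λ p).trace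
        + (rs f Λ p * (co f p * co f p) * rs f Λ p).trace) - Λ * (co f p * co f p).trace with hG
  have hd : ∀ s, 0 < s → HasDerivAt φ (heat (fun p => Zf f p * G p) s) s :=
    fun s hs => IG.heat hf h0 hI hs
  have hle : ∀ s, 0 < s → heat (fun p => Zf f p * G p) s ≤ 96 * √(Λ / s) * φ s := fun s hs => by
    rw [hφ, ← heat_const_mul]
    refine heat_mono (hf.grow_Zf.mul (IG.growD hf h0 hI))
      ((Grow.const _).mul (hf.grow_Zf.mul hI.grow)) fun θ => ?_
    have := mul_le_mul_of_nonneg_left (hf.drift_le h0 hLC hΛ (s, θ) hs) (hf.Zf_pos h0 (s, θ)).le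
    simp only [hG]
    linarith
  have hψ : AntitoneOn (fun s => φ s * Real.exp (-(192 * √(Λ * s)))) (Set.Ici 0) := by
    refine antitoneOn_of_hasDerivWithinAt_nonpos (f' := fun s =>
      (heat (fun p => Zf f p * G p) s - 96 * √(Λ / s) * φ s) * Real.exp (-(192 * √(Λ * s))))
      (convex_Ici 0) ?_ ?_ ?_
    · refine ((hf.grow_Zf.mul hI.grow).continuous_heat.mul ?_).continuousOn
      fun_prop
    · intro s hs
      rw [interior_Ici, Set.mem_Ioi] at hs
      have hpos : 0 < Λ * s := mul_pos hΛ hs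
      have h1 : HasDerivAt (fun s => √(Λ * s)) (Λ / (2 * √(Λ * s))) s := by
        have := ((hasDerivAt_id s).const_mul Λ).sqrt hpos.ne'
        simpa using this
      have h2 := (hd s hs).mul ((h1.const_mul 192).neg.exp)
      refine (h2.congr_deriv ?_).hasDerivWithinAt
      have e : Λ / (2 * √(Λ * s)) = √(Λ / s) / 2 := by
        rw [Real.sqrt_mul hΛ.le, Real.sqrt_div hΛ.le]
        have := Real.sqrt_pos.2 hs
        have h3 := Real.sqrt_pos.2 hΛ
        have h4 := Real.sq_sqrt hΛ.le
        field_simp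
        linarith
      simp only [e, Pi.neg_apply]; ring
    · intro s hs
      rw [interior_Ici, Set.mem_Ioi] at hs
      exact mul_nonpos_of_nonpos_of_nonneg (by linarith [hle s hs]) (Real.exp_pos _).le
  have h := hψ (Set.mem_Ici.2 le_rfl) (Set.mem_Ici.2 ht) ht
  simp only [mul_zero, Real.sqrt_zero, neg_zero, Real.exp_zero, mul_one] at h
  rw [Real.exp_neg, ← div_eq_mul_inv, div_le_iff₀ (Real.exp_pos _)] at h
  rwa [show φ 0 = Zf f (0, 0) * ph f Λ (0, 0) from heat_zero _] at h

/-- Guan's bound: the covariance matrices of the tilts stay bounded in Hilbert-Schmidt norm, on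
average. -/
theorem Cpt.heat_tr_sq_le (hLC : LC fun x => ENNReal.ofReal (f x)) {t : ℝ} (ht : 0 < t) :
    heat (fun p => Zf f p * (co f p * co f p).trace) t
      ≤ 2 * Real.exp 192 * (Zf f (0, 0) * (co f (0, 0) * co f (0, 0)).trace) := by
  have hΛ : 0 < 1 / t := by positivity
  obtain ⟨F1, hI⟩ := hf.ig_ph h0 hΛ
  obtain ⟨F2, hT⟩ := hf.ig_tr h0
  have gT : Grow fun p => (co f p * co f p).trace := by
    simpa using (IG.growD hf h0 hT).neg
  have h1 : heat (fun p => Zf f p * (co f p * co f p).trace) t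
      ≤ 2 * heat (fun p => Zf f p * ph f (1 / t) p) t := by
    rw [← heat_const_mul]
    refine heat_mono (hf.grow_Zf.mul gT) ((Grow.const _).mul (hf.grow_Zf.mul hI.grow)) fun θ => ?_
    have h := (hf.tr_sq_le h0 hΛ (t, θ) (hf.co_le h0 hLC (t, θ) ht)).1
    have := mul_le_mul_of_nonneg_left h (hf.Zf_pos h0 (t, θ)).le
    linarith
  have h2 := hf.gronwall h0 hLC hΛ ht.le
  rw [one_div_mul_cancel ht.ne', Real.sqrt_one, mul_one] at h2
  have h3 := mul_le_mul_of_nonneg_left (hf.ph_le h0 (1 / t) hΛ (0, 0)).1 (hf.Zf_pos h0 (0, 0)).le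
  have h4 := mul_le_mul_of_nonneg_right h3 (Real.exp_pos 192).le
  linarith

theorem Cpt.hasDerivAt_heat_tr {t : ℝ} (ht : 0 < t) :
    HasDerivAt (heat fun p => Zf f p * (co f p).trace)
      (-heat (fun p => Zf f p * (co f p * co f p).trace) t) t := by
  obtain ⟨F2, hT⟩ := hf.ig_tr h0
  refine (IG.heat hf h0 hT ht).congr_deriv ?_
  rw [← neg_one_mul, ← heat_const_mul]
  congr 1; funext p; ring

/-- Lower bound for the expected trace of the covariance along the localisation. -/
theorem Cpt.heat_tr_ge (hLC : LC fun x => ENNReal.ofReal (f x)) (h1 : ∫ x, f x = 1)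
    (hA : ∀ v : Fin n → ℝ, ∑ i, ∑ j, v i * v j * co f (0, 0) i j ≤ 2 * ∑ i, v i ^ 2) {t : ℝ}
    (ht : 1 / (8 * Real.exp 192) ≤ t) :
    1 / (8 * Real.exp 192) * (co f (0, 0)).trace / 2
      ≤ t * heat (fun p => Zf f p * (co f p).trace) t := by
  set t0 := 1 / (8 * Real.exp 192) with ht0
  set m := (co f (0, 0)).trace
  set S := heat fun p => Zf f p * (co f p).trace with hS
  have he := Real.exp_pos 192
  have ht0p : 0 < t0 := by positivity
  obtain ⟨F2, hT⟩ := hf.ig_tr h0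
  have hZ0 : Zf f (0, 0) = 1 := by simp [Zf, U, tl, h1]
  have hcS : Continuous S := (hf.grow_Zf.mul hT.grow).continuous_heat
  have hS0 : S 0 = m := by rw [hS, heat_zero, hZ0, one_mul]
  have hB : (co f (0, 0) * co f (0, 0)).trace ≤ 2 * m := (hf.tr_sq_le h0 two_pos (0, 0) hA).2
  have step1 : m / 2 ≤ S t0 := by
    have hmono : MonotoneOn (fun s => S s + 4 * Real.exp 192 * m * s) (Set.Ici 0) := by
      refine monotoneOn_of_hasDerivWithinAt_nonneg (f' := fun s =>
        -heat (fun p => Zf f p * (co f p * co f p).trace) s + 4 * Real.exp 192 * m)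
        (convex_Ici 0) ?_ ?_ ?_
      · exact (hcS.add (by fun_prop)).continuousOn
      · intro s hs
        rw [interior_Ici, Set.mem_Ioi] at hs
        have := (hf.hasDerivAt_heat_tr h0 hs).add ((hasDerivAt_id s).const_mul
          (4 * Real.exp 192 * m))
        rw [mul_one] at this
        exact this.hasDerivWithinAt
      · intro s hs
        rw [interior_Ici, Set.mem_Ioi] at hs
        have := hf.heat_tr_sq_le h0 hLC hs
        rw [hZ0, one_mul] at this
        nlinarith
    have h := hmono (Set.mem_Ici.2 le_rfl) (Set.mem_Ici.2 ht0p.le) ht0p.le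
    simp only [mul_zero, add_zero, hS0] at h
    have e : 4 * Real.exp 192 * m * t0 = m / 2 := by rw [ht0]; field_simp; ring
    linarith
  have gT : Grow fun p => (co f p * co f p).trace := by
    simpa using (IG.growD hf h0 hT).neg
  have step2 : MonotoneOn (fun s => s * S s) (Set.Ici 0) := by
    refine monotoneOn_of_hasDerivWithinAt_nonneg (f' := fun s =>
      1 * S s + s * (-heat (fun p => Zf f p * (co f p * co f p).trace) s))
      (convex_Ici 0) ?_ ?_ ?_
    · exact (continuous_id.mul hcS).continuousOn
    · intro s hs
      rw [interior_Ici, Set.mem_Ioi] at hs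
      exact ((hasDerivAt_id s).mul (hf.hasDerivAt_heat_tr h0 hs)).hasDerivWithinAt
    · intro s hs
      rw [interior_Ici, Set.mem_Ioi] at hs
      have h : s * heat (fun p => Zf f p * (co f p * co f p).trace) s ≤ S s := by
        rw [← heat_const_mul]
        refine heat_mono ((Grow.const _).mul (hf.grow_Zf.mul gT)) (hf.grow_Zf.mul hT.grow)
          fun θ => ?_
        have h := (hf.tr_sq_le h0 (by positivity : 0 < 1 / s) (s, θ)
          (hf.co_le h0 hLC (s, θ) hs)).2
        have h2 := mul_le_mul_of_nonneg_left h (hf.Zf_pos h0 (s, θ)).le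
        have h3 := mul_le_mul_of_nonneg_left h2 hs.le
        refine h3.trans (le_of_eq ?_)
        field_simp
      linarith
  have h := step2 (Set.mem_Ici.2 ht0p.le) (Set.mem_Ici.2 (ht0p.le.trans ht)) ht
  have h2 := mul_le_mul_of_nonneg_left step1 ht0p.le
  simp only at h
  linarith

end Guan
end SmallBall

namespace SmallBall

open scoped ENNReal NNReal Topology

section LogZ
variable {n : ℕ} {f : E n → ℝ} {r : ℝ}

theorem Grow.mono {F G : ℝ × E n → ℝ} (hc : Continuous F) (hG : Grow G)
    (h : ∀ p, |F p| ≤ |G p|) : Grow F := by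
  obtain ⟨-, C, c, hC, hc', hb⟩ := hG
  exact ⟨hc, C, c, hC, hc', fun p => (h p).trans (hb p)⟩

variable (hf : Cpt f r) (h0 : 0 < ∫ x, f x)
include hf h0

theorem Cpt.grow_logZ : Grow fun p => Real.log (Zf f p) := by
  refine Grow.mono (hf.grow_Zf.1.log fun p => (hf.Zf_pos h0 p).ne')
    (hf.grow_Zf.add (hf.grow_inv h0)) fun p => ?_
  have hp := hf.Zf_pos h0 p
  have hi := inv_pos.2 hp
  rw [abs_of_pos (add_pos hp hi), abs_le]
  have h1 := Real.log_le_self hp.le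
  have h2 := Real.log_le_self hi.le
  rw [Real.log_inv] at h2
  constructor <;> linarith

theorem Cpt.ig_logZ :
    ∃ F1, IG f (fun p => Real.log (Zf f p)) F1 fun p => 1 / 2 * ∑ k, mn f k p ^ 2 := by
  have hm : ∀ k : Fin n, IG f (mn f k) _ _ := fun k =>
    hf.ig_Ev h0 (q := fun x : E n => x k) (by fun_prop)
  choose Gt G2 hG _ using hm
  have hlog : Ito (fun p => Real.log (Zf f p)) (Ev f fun x => -(1 / 2) * ‖x‖ ^ 2) (mn f)
      fun k p => Ev f (fun x => x k * x k) p - mn f k p * mn f k p := by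
    refine ⟨hf.grow_logZ h0, (hf.ig_Ev h0 (by fun_prop)).grow, fun k => hf.grow_mn h0 k,
      fun k => ?_, fun γ γ' s hγ => ?_, fun k p => ?_⟩
    · exact ((hf.ig_Ev h0 (q := fun x : E n => x k * x k) (by fun_prop)).grow).sub
        ((hf.grow_mn h0 k).mul (hf.grow_mn h0 k))
    · have h := (hf.hasDerivAt_U (q := fun _ => 1) continuous_const _ _ s hγ).log
        (hf.Zf_pos h0 _).ne'
      refine h.congr_deriv ?_
      simp only [mul_one, smul_eq_mul, mn, Ev, Zf, add_div, Finset.sum_div]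
      congr 1
      · ring
      · exact Finset.sum_congr rfl fun k _ => by ring
    · exact (hG k).axis k p
  refine ⟨mn f, _, _, hlog, fun p => ?_⟩
  have e1 : ∑ k, Ev f (fun x => x k * x k) p = Ev f (fun x => ‖x‖ ^ 2) p := by
    rw [← hf.Ev_sum _ fun k _ => by fun_prop]
    congr 1; funext x; exact (norm_sq_coord x).symm
  rw [Ev_const_mul, Finset.sum_sub_distrib, e1]
  simp only [smul_eq_mul, pow_two]
  ring

theorem Cpt.tr_co (p : ℝ × E n) :
    (co f p).trace = Ev f (fun x => ‖x‖ ^ 2) p - ∑ k, mn f k p ^ 2 := by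
  simp only [Matrix.trace, Matrix.diag_apply, co, Matrix.of_apply, Finset.sum_sub_distrib, pow_two]
  rw [← hf.Ev_sum _ fun k _ => by fun_prop]
  congr 2; funext x; rw [← pow_two, norm_sq_coord]

theorem Cpt.hasDerivAt_entropy {t : ℝ} (ht : 0 < t) :
    HasDerivAt (fun t => heat (fun p => Zf f p * Real.log (Zf f p)) t
        - t / 2 * U f (fun x => ‖x‖ ^ 2) (0, 0))
      (-(1 / 2) * heat (fun p => Zf f p * (co f p).trace) t) t := by
  obtain ⟨F1, hI⟩ := hf.ig_logZ h0
  obtain ⟨F2, hT⟩ := hf.ig_tr h0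
  have h1 := IG.heat hf h0 hI ht
  have h2 : HasDerivAt (fun t : ℝ => t / 2 * U f (fun x => ‖x‖ ^ 2) (0, 0))
      (1 / 2 * U f (fun x => ‖x‖ ^ 2) (0, 0)) t :=
    ((hasDerivAt_id t).div_const 2).mul_const _
  refine (h1.sub h2).congr_deriv ?_
  have e : (fun p => Zf f p * (1 / 2 * ∑ k, mn f k p ^ 2)) = fun p =>
      1 / 2 * U f (fun x => ‖x‖ ^ 2) p + -(1 / 2) * (Zf f p * (co f p).trace) := by
    funext p
    rw [hf.tr_co h0, ← hf.Zf_mul_Ev h0]; ring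
  rw [e, heat_add ((Grow.const _).mul (hf.grow_U (by fun_prop)))
    ((Grow.const _).mul (hf.grow_Zf.mul hT.grow)), heat_const_mul, heat_const_mul,
    hf.heat_U_eq (by fun_prop) ht.le]
  ring

omit h0 in
theorem Cpt.heat_coord_mul {F F' : ℝ × E n → ℝ} (hF : Grow F) (hF' : Grow F') (k : Fin n)
    (hd : ∀ p, HasDerivAt (fun s : ℝ => F (p + s • (0, EuclideanSpace.single k 1))) (F' p) 0)
    {t : ℝ} (ht : 0 ≤ t) : heat (fun p => p.2 k * F p) t = t * heat F' t := by
  have h := heat_ibp hF hF' k hd t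
  have e : ∫ g : E n, (√t • g) k * F (t, √t • g) * gw g
      = √t * ∫ g : E n, g k * F (t, √t • g) * gw g := by
    rw [← integral_const_mul]
    congr 1; funext g; simp only [PiLp.smul_apply, smul_eq_mul]; ring
  simp only [heat]
  rw [e, h, ← mul_assoc, Real.mul_self_sqrt ht, mul_div_assoc]

omit h0 in
theorem grow_coord (k : Fin n) : Grow fun p : ℝ × E n => p.2 k := by
  refine ⟨by fun_prop, 1, 1, zero_le_one, zero_le_one, fun p => ?_⟩
  have h1 : ‖p.2 k‖ ≤ ‖p.2‖ := PiLp.norm_apply_le _ _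
  have h2 := norm_snd_le p
  have h3 := Real.add_one_le_exp ‖p‖
  rw [one_mul, one_mul]
  linarith

/-- The value of the partition function at the origin is controlled by the entropy along the
flow. -/
theorem Cpt.log_Z_le (hLC : LC fun x => ENNReal.ofReal (f x)) (h1 : ∫ x, f x = 1) {t : ℝ}
    (ht : 0 < t) :
    Real.log (Zf f (t, 0)) ≤ n / 2 + (heat (fun p => Zf f p * Real.log (Zf f p)) t
        - t / 2 * U f (fun x => ‖x‖ ^ 2) (0, 0)) := by
  have gU : ∀ k : Fin n, Grow (U f fun x => x k) := fun k => hf.grow_U (by fun_prop)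
  have gc := grow_coord hf
  have hZ : heat (Zf f) t = 1 := by
    rw [show Zf f = U f fun _ => 1 from rfl, hf.heat_U_eq continuous_const ht.le]
    simp [U, tl, h1]
  have a1 : ∀ k, heat (fun p => p.2 k * U f (fun x => x k) p) t
      = t * U f (fun x => x k * x k) (0, 0) := fun k => by
    rw [hf.heat_coord_mul (gU k) (hf.grow_U (by fun_prop)) k
      (fun p => (hf.ito_U (q := fun x : E n => x k) (by fun_prop)).axis k p) ht.le,
      hf.heat_U_eq (by fun_prop) ht.le]
  have a2 : ∀ k, heat (fun p => p.2 k * (p.2 k * Zf f p)) t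
      = t * (1 + t * U f (fun x => x k * x k) (0, 0)) := fun k => by
    rw [hf.heat_coord_mul (F' := fun p => Zf f p + p.2 k * U f (fun x => x k) p)
      ((gc k).mul hf.grow_Zf) (hf.grow_Zf.add ((gc k).mul (gU k))) k (fun p => ?_) ht.le,
      heat_add hf.grow_Zf ((gc k).mul (gU k)), hZ, a1]
    have hz := (hf.ito_U (q := fun _ => 1) continuous_const).axis k p
    have hl : HasDerivAt (fun s : ℝ => (p + s • ((0, EuclideanSpace.single k 1) : ℝ × E n)).2 k)
        1 0 := by
      have : HasDerivAt (fun s : ℝ => p.2 k + s) 1 0 := (hasDerivAt_id (0 : ℝ)).const_add _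
      refine this.congr_of_eventuallyEq (Filter.Eventually.of_forall fun s => ?_)
      simp
    refine (hl.mul hz).congr_deriv ?_
    simp [Zf]
  have hsum : ∑ k, U f (fun x => x k * x k) (0, 0) = U f (fun x => ‖x‖ ^ 2) (0, 0) := by
    rw [← hf.U_sum _ fun k _ => by fun_prop]
    congr 1; funext x; exact (norm_sq_coord x).symm
  set A : ℝ × E n → ℝ := fun p => Zf f p * Real.log (Zf f p) with hA
  set B : ℝ × E n → ℝ := fun p => ∑ k, p.2 k * (p.2 k * Zf f p) with hB
  set C : ℝ × E n → ℝ := fun p => ∑ k, p.2 k * U f (fun x => x k) p with hC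
  have gA : Grow A := hf.grow_Zf.mul (hf.grow_logZ h0)
  have gB : Grow B := Grow.sum _ fun k _ => (gc k).mul ((gc k).mul hf.grow_Zf)
  have gC : Grow C := Grow.sum _ fun k _ => (gc k).mul (gU k)
  have hBv : heat B t = t * n + t ^ 2 * U f (fun x => ‖x‖ ^ 2) (0, 0) := by
    rw [hB, heat_sum _ fun k _ => (gc k).mul ((gc k).mul hf.grow_Zf)]
    simp only [a2, ← Finset.mul_sum, Finset.sum_add_distrib, hsum]
    simp; ring
  have hCv : heat C t = t * U f (fun x => ‖x‖ ^ 2) (0, 0) := by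
    rw [hC, heat_sum _ fun k _ => (gc k).mul (gU k)]
    simp only [a1, ← Finset.mul_sum, hsum]
  have key : heat (fun p => Real.log (Zf f (t, 0)) * Zf f p) t
      ≤ heat (fun p => A p + (1 / (2 * t) * B p + (-1) * C p)) t := by
    refine heat_mono ((Grow.const _).mul hf.grow_Zf)
      (gA.add (((Grow.const _).mul gB).add ((Grow.const _).mul gC))) fun θ => ?_
    have h := mul_le_mul_of_nonneg_left (hf.logZ_tangent h0 hLC ht θ) (hf.Zf_pos h0 (t, θ)).le
    have e1 : B (t, θ) = Zf f (t, θ) * ‖θ‖ ^ 2 := by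
      simp only [hB]
      rw [norm_sq_coord, Finset.mul_sum]
      exact Finset.sum_congr rfl fun k _ => by ring
    have e2 : C (t, θ) = Zf f (t, θ) * ∑ k, θ k * mn f k (t, θ) := by
      simp only [hC]
      rw [Finset.mul_sum]
      refine Finset.sum_congr rfl fun k _ => ?_
      rw [← hf.Zf_mul_Ev h0]; simp only [mn]; ring
    rw [e1, e2]
    refine (le_of_eq (mul_comm _ _)).trans (h.trans (le_of_eq ?_))
    simp only [hA]; ring
  rw [heat_const_mul, hZ, heat_add gA (((Grow.const _).mul gB).add ((Grow.const _).mul gC)),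
    heat_add ((Grow.const _).mul gB) ((Grow.const _).mul gC), heat_const_mul, heat_const_mul, hBv,
    hCv, mul_one] at key
  refine key.trans (le_of_eq ?_)
  field_simp
  ring

/-- Small ball estimate for compactly supported log-concave densities. -/
theorem Cpt.Z_le (hLC : LC fun x => ENNReal.ofReal (f x)) (h1 : ∫ x, f x = 1)
    (hA : ∀ v : Fin n → ℝ, ∑ i, ∑ j, v i * v j * co f (0, 0) i j ≤ 2 * ∑ i, v i ^ 2)
    (htr : (n : ℝ) / 2 ≤ (co f (0, 0)).trace) {T : ℝ} (hT : 1 ≤ T) :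
    Zf f (T, 0) ≤ (Real.exp (1 / 2) * T ^ (-(1 / (64 * Real.exp 192)))) ^ n := by
  set t0 := 1 / (8 * Real.exp 192) with ht0
  have he := Real.exp_pos 192
  have ht0p : 0 < t0 := by positivity
  have ht01 : t0 ≤ 1 := by
    rw [ht0, div_le_one (by positivity)]
    linarith [Real.one_le_exp (by norm_num : (0 : ℝ) ≤ 192)]
  have hTp : 0 < T := by linarith
  obtain ⟨F2, hTr⟩ := hf.ig_tr h0
  set S := heat fun p => Zf f p * (co f p).trace with hS
  set Q := fun t => heat (fun p => Zf f p * Real.log (Zf f p)) t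
        - t / 2 * U f (fun x => ‖x‖ ^ 2) (0, 0) with hQ
  have hd : ∀ t, 0 < t → HasDerivAt Q (-(1 / 2) * S t) t := fun t ht =>
    hf.hasDerivAt_entropy h0 ht
  have hcQ : Continuous Q :=
    ((hf.grow_Zf.mul (hf.grow_logZ h0)).continuous_heat).sub (by fun_prop)
  have hQ0 : Q 0 = 0 := by
    simp only [hQ, heat_zero]
    have : Zf f (0, 0) = 1 := by simp [Zf, U, tl, h1]
    rw [this]; simp
  have hS0 : ∀ t, 0 ≤ S t := fun t => by
    rw [← heat_const (n := n) 0 t]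
    refine heat_mono (Grow.const _) (hf.grow_Zf.mul hTr.grow) fun θ => ?_
    refine mul_nonneg (hf.Zf_pos h0 _).le ?_
    refine Finset.sum_nonneg fun i _ => ?_
    have := hf.co_nonneg h0 (t, θ) (Pi.single i 1)
    simpa [Pi.single_apply] using this
  have s1 : Q t0 ≤ 0 := by
    have hanti : AntitoneOn Q (Set.Ici 0) := by
      refine antitoneOn_of_hasDerivWithinAt_nonpos (f' := fun s => -(1 / 2) * S s)
        (convex_Ici 0) hcQ.continuousOn ?_ ?_
      · intro s hs
        rw [interior_Ici, Set.mem_Ioi] at hs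
        exact (hd s hs).hasDerivWithinAt
      · intro s _
        linarith [hS0 s]
    rw [← hQ0]
    exact hanti (Set.mem_Ici.2 le_rfl) (Set.mem_Ici.2 ht0p.le) ht0p.le
  have s2 : Q T ≤ -(t0 * n / 8) * Real.log T := by
    have hanti : AntitoneOn (fun s => Q s + t0 * n / 8 * Real.log s) (Set.Ici t0) := by
      refine antitoneOn_of_hasDerivWithinAt_nonpos
        (f' := fun s => -(1 / 2) * S s + t0 * n / 8 * s⁻¹) (convex_Ici t0) ?_ ?_ ?_
      · refine hcQ.continuousOn.add (continuousOn_const.mul ?_)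
        exact Real.continuousOn_log.mono fun s hs => ne_of_gt (ht0p.trans_le hs)
      · intro s hs
        rw [interior_Ici, Set.mem_Ioi] at hs
        have hs0 := ht0p.trans hs
        exact ((hd s hs0).add ((Real.hasDerivAt_log hs0.ne').const_mul _)).hasDerivWithinAt
      · intro s hs
        rw [interior_Ici, Set.mem_Ioi] at hs
        have hs0 := ht0p.trans hs
        have h := hf.heat_tr_ge h0 hLC h1 hA hs.le
        have h2 : t0 * n / 8 ≤ s * S s / 2 := by
          have := mul_le_mul_of_nonneg_left htr ht0p.le
          linarith
        have h3 : t0 * n / 8 * s⁻¹ ≤ s * S s / 2 * s⁻¹ := by gcongr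
        have h4 : s * S s / 2 * s⁻¹ = S s / 2 := by field_simp
        linarith
    have h := hanti (Set.mem_Ici.2 le_rfl) (Set.mem_Ici.2 (ht01.trans hT)) (ht01.trans hT)
    simp only at h
    have h5 : t0 * n / 8 * Real.log t0 ≤ 0 :=
      mul_nonpos_of_nonneg_of_nonpos (by positivity) (Real.log_nonpos ht0p.le ht01)
    linarith
  have hl := hf.log_Z_le h0 hLC h1 hTp
  have hfin : Real.log (Zf f (T, 0)) ≤ n * (1 / 2 + Real.log T * (-(1 / (64 * Real.exp 192)))) := by
    refine hl.trans ((add_le_add_right s2 _).trans (le_of_eq ?_))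
    rw [ht0]; field_simp; ring
  rw [Real.rpow_def_of_pos hTp, ← Real.exp_add, ← Real.exp_nat_mul,
    ← Real.log_le_iff_le_exp (hf.Zf_pos h0 _)]
  exact hfin

end LogZ
end SmallBall

namespace SmallBall

open scoped ENNReal NNReal Topology

/-- Isotropic log-concave probability measures, in a rotation-friendly form. -/
structure IsoLC {n : ℕ} (μ : Measure (E n)) : Prop where
  prob : IsProbabilityMeasure μ
  dens : ∃ f : E n → ℝ≥0∞, LC f ∧ μ = volume.withDensity f
  mean : ∀ v : E n, ∫ x, inner ℝ v x ∂μ = 0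
  var : ∀ v : E n, ∫ x, inner ℝ v x ^ 2 ∂μ = ‖v‖ ^ 2

variable {n : ℕ}

theorem lintegral_comp_midpoint {f : E n → ℝ≥0∞} (hf : AEMeasurable f) (x₀ : E n) :
    ∫⁻ x, f ((1 / 2 : ℝ) • x + (1 / 2 : ℝ) • x₀) = 2 ^ n * ∫⁻ x, f x := by
  have h1 : ∫⁻ x, f ((1 / 2 : ℝ) • x + (1 / 2 : ℝ) • x₀) = ∫⁻ x, f ((1 / 2 : ℝ) • x) := by
    have := lintegral_add_right_eq_self (μ := (volume : Measure (E n)))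
      (fun x => f ((1 / 2 : ℝ) • x)) x₀
    simpa only [smul_add] using this
  rw [h1]
  have h2 := Measure.map_addHaar_smul (volume : Measure (E n)) (r := 1 / 2) (by norm_num)
  have h3 : ∫⁻ x, f x ∂(Measure.map (fun x : E n => (1 / 2 : ℝ) • x) volume)
      = ∫⁻ x, f ((1 / 2 : ℝ) • x) := by
    refine lintegral_map' ?_ (by fun_prop)
    have h4 := h2
    change Measure.map (fun x : E n => (1 / 2 : ℝ) • x) volume = _ at h4
    rw [h4]
    exact hf.smul_measure _
  rw [← h3]
  change Measure.map (fun x : E n => (1 / 2 : ℝ) • x) volume = _ at h2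
  rw [h2, lintegral_smul_measure]
  simp [E, abs_of_pos, ENNReal.ofReal_pow]

/-- The square root of a log-concave probability density against its value at a point. -/
theorem LC.sqrt_le {f : E n → ℝ≥0∞} (hf : LC f) (h1 : ∫⁻ x, f x = 1) (x₀ : E n) :
    (∫⁻ x, f x ^ (1 / 2 : ℝ)) * f x₀ ^ (1 / 2 : ℝ) ≤ 2 ^ n := by
  have hm := hf.aemeasurable volume
  calc (∫⁻ x, f x ^ (1 / 2 : ℝ)) * f x₀ ^ (1 / 2 : ℝ)
      = ∫⁻ x, f x ^ (1 / 2 : ℝ) * f x₀ ^ (1 / 2 : ℝ) :=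
        (lintegral_mul_const'' _ (hm.pow_const _)).symm
    _ ≤ ∫⁻ x, f ((1 / 2 : ℝ) • x + (1 / 2 : ℝ) • x₀) :=
        lintegral_mono fun x => hf x x₀ _ _ (by norm_num) (by norm_num) (by norm_num)
    _ = 2 ^ n := by rw [lintegral_comp_midpoint hm, h1, mul_one]

theorem LC.ne_top {f : E n → ℝ≥0∞} (hf : LC f) (h1 : ∫⁻ x, f x = 1) (x₀ : E n) :
    f x₀ ≠ ∞ := by
  intro h
  have h2 := hf.sqrt_le h1 x₀
  have hm := hf.aemeasurable volume
  have h3 : ∫⁻ x, f x ^ (1 / 2 : ℝ) ≠ 0 := by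
    intro h3
    rw [lintegral_eq_zero_iff' (hm.pow_const _)] at h3
    have : ∫⁻ x, f x = 0 := by
      rw [lintegral_eq_zero_iff' hm]
      filter_upwards [h3] with x hx
      rcases ENNReal.rpow_eq_zero_iff.1 hx with h | h
      · exact h.1
      · norm_num at h
    simp [this] at h1
  rw [h, ENNReal.top_rpow_of_pos (by norm_num), ENNReal.mul_top h3] at h2
  exact absurd h2 (by simp)

section Trunc
variable {μ : Measure (E n)} {f : E n → ℝ≥0∞} {K : Set (E n)} {y : E n}

/-- The normalised density of `μ` restricted to `K`, recentred at `y`. -/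
def td (μ : Measure (E n)) (f : E n → ℝ≥0∞) (K : Set (E n)) (y : E n) (x : E n) : ℝ :=
  (μ.real K)⁻¹ * (K.indicator f (x + y)).toReal

theorem integral_mul_td (hf : LC f) (h1 : ∫⁻ x, f x = 1) (hμ : μ = volume.withDensity f)
    (hK : MeasurableSet K) (q : E n → ℝ) :
    ∫ x, q x * td μ f K y x = (μ.real K)⁻¹ * ∫ z in K, q (z - y) ∂μ := by
  have hm := hf.aemeasurable volume
  have ha := integral_add_right_eq_self (μ := (volume : Measure (E n)))
    (fun z => q (z - y) * ((μ.real K)⁻¹ * (K.indicator f z).toReal)) y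
  simp only [add_sub_cancel_right] at ha
  unfold td
  rw [ha, ← integral_indicator hK]
  conv_rhs => rw [hμ]
  rw [integral_withDensity_eq_integral_toReal_smul₀ hm
    (Filter.Eventually.of_forall fun x => (hf.ne_top h1 x).lt_top), ← integral_const_mul]
  refine integral_congr_ae (Filter.Eventually.of_forall fun x => ?_)
  by_cases hx : x ∈ K
  · simp only [Set.indicator_of_mem hx, smul_eq_mul, ← hμ]; ring
  · simp [Set.indicator_of_notMem hx]

theorem cpt_td (hf : LC f) (h1 : ∫⁻ x, f x = 1) (hK : MeasurableSet K) {R : ℝ} (hR : 0 ≤ R)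
    (hKR : K ⊆ Metric.closedBall 0 R) : Cpt (td μ f K y) (R + ‖y‖) where
  nonneg x := by unfold td; positivity
  int := by
    have hm := hf.aemeasurable volume
    have : Integrable fun x => (K.indicator f x).toReal := by
      refine integrable_toReal_of_lintegral_ne_top (hm.indicator hK) ?_
      refine ne_top_of_le_ne_top (b := 1) (by simp) ?_
      rw [← h1]
      exact lintegral_mono fun x => Set.indicator_le_self _ _ _
    exact (this.comp_add_right y).const_mul _
  supp x hx := by
    have : x + y ∉ K := fun h => by
      have h2 := hKR h
      rw [mem_closedBall_zero_iff] at h2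
      have h3 : ‖x‖ ≤ ‖x + y‖ + ‖y‖ := by
        have := norm_sub_le (x + y) y
        simpa using this
      linarith
    simp [td, this]
  r0 := by positivity

theorem lc_td (hf : LC f) (h1 : ∫⁻ x, f x = 1) (hK : Convex ℝ K) :
    LC fun x => ENNReal.ofReal (td μ f K y x) := by
  have h2 : LC fun x => K.indicator (fun _ => (1 : ℝ≥0∞)) x * f x := (LC.indicator hK).mul hf
  have h3 := (h2.comp_affine (fun x : E n => x + y) ?_).const_mul
    (ENNReal.ofReal (μ.real K)⁻¹)
  · convert! h3 using 2 with x
    rw [td, ENNReal.ofReal_mul (by positivity), ENNReal.ofReal_toReal]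
    · by_cases hx : x + y ∈ K <;> simp [hx]
    · by_cases hx : x + y ∈ K <;> simp [hx, hf.ne_top h1]
  · intro x z a b hab
    have : y = a • y + b • y := by rw [← add_smul, hab, one_smul]
    calc a • x + b • z + y = a • x + b • z + (a • y + b • y) := by rw [← this]
      _ = _ := by simp only [smul_add]; abel

theorem integral_td (hf : LC f) (h1 : ∫⁻ x, f x = 1) (hμ : μ = volume.withDensity f)
    (hK : MeasurableSet K) (h0 : μ.real K ≠ 0) : ∫ x, td μ f K y x = 1 := by
  have h := integral_mul_td (y := y) hf h1 hμ hK (fun _ => 1)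
  simp only [one_mul] at h
  rw [h]
  simp [h0]

theorem ev_td (hf : LC f) (h1 : ∫⁻ x, f x = 1) (hμ : μ = volume.withDensity f)
    (hK : MeasurableSet K) (h0 : μ.real K ≠ 0) (q : E n → ℝ) :
    Ev (td μ f K y) q (0, 0) = (μ.real K)⁻¹ * ∫ z in K, q (z - y) ∂μ := by
  unfold Ev Zf U
  simp only [tl, inner_zero_left, zero_div, zero_mul, sub_zero, Real.exp_zero, mul_one, one_mul]
  rw [integral_mul_td hf h1 hμ hK q]
  have h := integral_td (y := y) hf h1 hμ hK h0
  simp [h]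

end Trunc

end SmallBall

namespace SmallBall

open scoped ENNReal NNReal Topology

variable {n : ℕ} {μ : Measure (E n)}

theorem inner_single_coord (i : Fin n) (x : E n) :
    inner ℝ (EuclideanSpace.single i (1 : ℝ)) x = x i := by
  have := EuclideanSpace.inner_single_left (𝕜 := ℝ) i 1 x
  simpa using this

theorem norm_sq_eq_sum (x : E n) : ‖x‖ ^ 2 = ∑ i, x i ^ 2 := by
  rw [norm_sq_coord]; simp only [pow_two]

theorem IsoLC.integrable_sq (h : IsoLC μ) (v : E n) :
    Integrable (fun x => inner ℝ v x ^ 2) μ := by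
  by_cases hv : v = 0
  · have := h.prob
    simp [hv]
  · by_contra hc
    have := h.var v
    rw [integral_undef hc] at this
    exact hv (norm_eq_zero.1 (pow_eq_zero_iff (two_ne_zero) |>.1 this.symm))

theorem IsoLC.integrable_inner (h : IsoLC μ) (v : E n) :
    Integrable (fun x => inner ℝ v x) μ := by
  have := h.prob
  refine ((integrable_const (1 : ℝ)).add (h.integrable_sq v)).mono'
    (by fun_prop) (Filter.Eventually.of_forall fun x => ?_)
  simp only [Pi.add_apply, Real.norm_eq_abs]
  rw [← sq_abs]
  nlinarith [sq_nonneg (|inner ℝ v x| - 1), abs_nonneg (inner ℝ v x)]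

theorem IsoLC.integral_coord (h : IsoLC μ) (i : Fin n) : ∫ x, x i ∂μ = 0 := by
  simpa only [inner_single_coord] using h.mean (EuclideanSpace.single i 1)

theorem IsoLC.integrable_coord (h : IsoLC μ) (i : Fin n) : Integrable (fun x => x i) μ := by
  simpa only [inner_single_coord] using h.integrable_inner (EuclideanSpace.single i 1)

theorem IsoLC.integral_coord_sq (h : IsoLC μ) (i : Fin n) : ∫ x, x i ^ 2 ∂μ = 1 := by
  have := h.var (EuclideanSpace.single i 1)
  simp only [inner_single_coord] at this
  simpa using this

theorem IsoLC.integrable_coord_sq (h : IsoLC μ) (i : Fin n) :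
    Integrable (fun x => x i ^ 2) μ := by
  simpa only [inner_single_coord] using h.integrable_sq (EuclideanSpace.single i 1)

theorem IsoLC.integrable_sub_sq (h : IsoLC μ) (y : E n) (i : Fin n) :
    Integrable (fun x => (x i - y i) ^ 2) μ := by
  have := h.prob
  have h1 := ((h.integrable_coord_sq i).sub ((h.integrable_coord i).const_mul (2 * y i))).add
    (integrable_const (y i ^ 2))
  refine h1.congr (Filter.Eventually.of_forall fun x => ?_)
  simp only [Pi.add_apply, Pi.sub_apply]; ring

theorem IsoLC.integral_sub_sq (h : IsoLC μ) (y : E n) (i : Fin n) :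
    ∫ x, (x i - y i) ^ 2 ∂μ = 1 + y i ^ 2 := by
  have := h.prob
  have h1 : ∀ x : E n, (x i - y i) ^ 2 = x i ^ 2 - 2 * y i * x i + y i ^ 2 := fun x => by ring
  simp only [h1]
  have h2 : Integrable (fun x => x i ^ 2 - 2 * y i * x i) μ :=
    (h.integrable_coord_sq i).sub ((h.integrable_coord i).const_mul (2 * y i))
  rw [integral_add h2 (integrable_const _), integral_sub (h.integrable_coord_sq i)
    ((h.integrable_coord i).const_mul (2 * y i)), integral_const_mul, h.integral_coord,
    h.integral_coord_sq]
  simp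

theorem IsoLC.integral_norm_sq (h : IsoLC μ) : ∫ x, ‖x‖ ^ 2 ∂μ = n := by
  simp only [norm_sq_eq_sum]
  rw [integral_finsetSum _ fun i _ => h.integrable_coord_sq i]
  simp [h.integral_coord_sq]

theorem IsoLC.integrable_norm_sq (h : IsoLC μ) : Integrable (fun x => ‖x‖ ^ 2) μ := by
  simp only [norm_sq_eq_sum]
  exact integrable_finsetSum _ fun i _ => h.integrable_coord_sq i

theorem Cpt.cov_le {f : E n → ℝ} {r : ℝ} (hf : Cpt f r) (h0 : 0 < ∫ x, f x) (p : ℝ × E n)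
    (v : Fin n → ℝ) (c : ℝ) :
    ∑ i, ∑ j, v i * v j * co f p i j ≤ Ev f (fun x => ((∑ i, v i * x i) - c) ^ 2) p := by
  rw [hf.co_form h0]
  set m := ∑ i, v i * mn f i p with hm
  have hlin : Ev f (fun x => ∑ i, v i * x i) p = m := by
    rw [hf.Ev_sum _ (fun i _ => by fun_prop)]
    exact Finset.sum_congr rfl fun i _ => Ev_const_mul _ _ _
  have hs : Ev f (fun x => (∑ i, v i * x i) - m) p = 0 := by
    rw [hf.Ev_sub (by fun_prop) (by fun_prop), hlin, hf.Ev_const h0, sub_self]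
  have e1 : ∀ x : E n, ((∑ i, v i * x i) - c) ^ 2
      = (((∑ i, v i * x i) - m) ^ 2 + (2 * (m - c)) * ((∑ i, v i * x i) - m)) + (m - c) ^ 2 :=
    fun x => by ring
  simp only [e1]
  rw [hf.Ev_add (by fun_prop) (by fun_prop), hf.Ev_add (by fun_prop) (by fun_prop),
    Ev_const_mul, hs, hf.Ev_const h0]
  have e2 : ∀ x : E n, (∑ i, v i * (x i - mn f i p)) * ∑ i, v i * (x i - mn f i p)
      = ((∑ i, v i * x i) - m) ^ 2 := fun x => by
    simp only [mul_sub, Finset.sum_sub_distrib, hm]; ring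
  simp only [e2]
  nlinarith [sq_nonneg (m - c)]

theorem inner_eq_sum (v x : E n) : inner ℝ v x = ∑ i, v i * x i := by
  simp [PiLp.inner_apply, mul_comm]

/-- Negative exponential moments of an isotropic log-concave measure around any point. -/
theorem IsoLC.small_ball_exp (h : IsoLC μ) (y : E n) {T : ℝ} (hT : 1 ≤ T) :
    ∫ x, Real.exp (-(T / 2 * ‖x - y‖ ^ 2)) ∂μ
      ≤ (Real.exp (1 / 2) * T ^ (-(1 / (64 * Real.exp 192)))) ^ n := by
  have hp := h.prob
  obtain ⟨f, hf, hμ⟩ := h.dens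
  have h1 : ∫⁻ x, f x = 1 := by
    have := measure_univ (μ := μ)
    rwa [hμ, withDensity_apply _ MeasurableSet.univ, setLIntegral_univ] at this
  set B : ℕ → Set (E n) := fun k => Metric.closedBall 0 (k : ℝ) with hB
  have hBm : ∀ k, MeasurableSet (B k) := fun k => Metric.isClosed_closedBall.measurableSet
  have hcov : AECover μ Filter.atTop B := aecover_closedBall tendsto_natCast_atTop_atTop
  have hlim : ∀ q : E n → ℝ, Integrable q μ →
      Filter.Tendsto (fun k => ∫ x in B k, q x ∂μ) Filter.atTop (𝓝 (∫ x, q x ∂μ)) :=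
    fun q hq => hcov.integral_tendsto_of_countably_generated hq
  have hm : Filter.Tendsto (fun k => μ.real (B k)) Filter.atTop (𝓝 1) := by
    have := hlim (fun _ => 1) (integrable_const _)
    simpa using this
  have hmi : Filter.Tendsto (fun k => (μ.real (B k))⁻¹) Filter.atTop (𝓝 1) := by
    have := hm.inv₀ one_ne_zero
    simpa using this
  have hhalf : ∀ᶠ k in Filter.atTop, 1 / 2 < μ.real (B k) :=
    hm.eventually (lt_mem_nhds (by norm_num))
  -- limits of the first two moments of the truncations
  have hmean : ∀ i : Fin n, Filter.Tendsto
      (fun k => (μ.real (B k))⁻¹ * ∫ z in B k, (z - y) i ∂μ) Filter.atTop (𝓝 (-y i)) := by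
    intro i
    have h2 := hmi.mul (hlim (fun z => (z - y) i) ?_)
    · convert! h2 using 2
      simp only [PiLp.sub_apply]
      rw [integral_sub (h.integrable_coord i) (integrable_const _), h.integral_coord]
      simp
    · simp only [PiLp.sub_apply]
      exact (h.integrable_coord i).sub (integrable_const _)
  have hsq : Filter.Tendsto
      (fun k => (μ.real (B k))⁻¹ * ∫ z in B k, ‖z - y‖ ^ 2 ∂μ) Filter.atTop
      (𝓝 (n + ∑ i, y i ^ 2)) := by
    have e : ∀ z : E n, ‖z - y‖ ^ 2 = ∑ i, (z i - y i) ^ 2 := fun z => by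
      rw [norm_sq_eq_sum]; simp only [PiLp.sub_apply]
    simp only [e]
    have h2 := hmi.mul (hlim (fun z => ∑ i, (z i - y i) ^ 2)
      (integrable_finsetSum _ fun i _ => h.integrable_sub_sq y i))
    convert! h2 using 2
    rw [integral_finsetSum _ fun i _ => h.integrable_sub_sq y i]
    simp [h.integral_sub_sq, Finset.sum_add_distrib]
  have htr : ∀ᶠ k in Filter.atTop, (n : ℝ) / 2 ≤ (μ.real (B k))⁻¹ * ∫ z in B k, ‖z - y‖ ^ 2 ∂μ
      - ∑ i, ((μ.real (B k))⁻¹ * ∫ z in B k, (z - y) i ∂μ) ^ 2 := by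
    rcases Nat.eq_zero_or_pos n with rfl | hn
    · refine Filter.Eventually.of_forall fun k => ?_
      simp only [Finset.univ_eq_empty, Finset.sum_empty, Nat.cast_zero, zero_div, sub_zero]
      exact mul_nonneg (by positivity) (integral_nonneg fun _ => by positivity)
    · have h2 := hsq.sub (tendsto_finsetSum Finset.univ fun i _ => (hmean i).pow 2)
      have hn' : (0 : ℝ) < n := by exact_mod_cast hn
      have h3 := h2.eventually (lt_mem_nhds (a := (n : ℝ) / 2) ?_)
      · exact h3.mono fun k hk => hk.le
      · simp only [neg_sq]; linarith
  have hInt : Integrable (fun x => Real.exp (-(T / 2 * ‖x - y‖ ^ 2))) μ := by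
    refine (integrable_const (1 : ℝ)).mono' (by fun_prop) (Filter.Eventually.of_forall fun x => ?_)
    rw [Real.norm_eq_abs, abs_of_pos (Real.exp_pos _), Real.exp_le_one_iff]
    have : 0 ≤ T / 2 * ‖x - y‖ ^ 2 := by positivity
    linarith
  have hfin := hmi.mul (hlim _ hInt)
  rw [one_mul] at hfin
  refine le_of_tendsto hfin ?_
  filter_upwards [hhalf, htr] with k hk hk2
  have hk0 : μ.real (B k) ≠ 0 := by linarith
  have hcpt : Cpt (td μ f (B k) y) (k + ‖y‖) :=
    cpt_td hf h1 (hBm k) (Nat.cast_nonneg k) subset_rfl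
  have hg1 := integral_td (y := y) hf h1 hμ (hBm k) hk0
  have hg0 : 0 < ∫ x, td μ f (B k) y x := by rw [hg1]; norm_num
  have hev := fun q => ev_td (y := y) hf h1 hμ (hBm k) hk0 q
  have hZ := hcpt.Z_le hg0 (lc_td hf h1 (convex_closedBall 0 _)) hg1 ?_ ?_ hT
  · convert! hZ using 1
    unfold Zf U
    rw [← integral_mul_td (y := y) hf h1 hμ (hBm k)
      (fun x => Real.exp (-(T / 2 * ‖x‖ ^ 2)))]
    refine integral_congr_ae (Filter.Eventually.of_forall fun x => ?_)
    simp only [tl, inner_zero_left, zero_sub]; ring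
  · intro v
    refine (hcpt.cov_le hg0 _ v (-∑ i, v i * y i)).trans ?_
    rw [hev]
    have e : ∀ z : E n, ((∑ i, v i * (z - y) i) - -∑ i, v i * y i) ^ 2
        = inner ℝ (WithLp.toLp 2 v) z ^ 2 := fun z => by
      rw [inner_eq_sum]
      simp only [PiLp.sub_apply, mul_sub, Finset.sum_sub_distrib]
      congr 1; ring
    simp only [e]
    have h3 : ∫ z in B k, inner ℝ (WithLp.toLp 2 v) z ^ 2 ∂μ ≤ ∑ i, v i ^ 2 := by
      refine (setIntegral_le_integral (h.integrable_sq _)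
        (Filter.Eventually.of_forall fun x => sq_nonneg _)).trans_eq ?_
      rw [h.var, norm_sq_eq_sum]
    have h4 : (μ.real (B k))⁻¹ ≤ 2 := by
      rw [inv_le_comm₀ (by linarith) (by norm_num)]; linarith
    exact mul_le_mul h4 h3 (integral_nonneg fun _ => sq_nonneg _) (by norm_num)
  · rw [hcpt.tr_co hg0, hev]
    simpa only [mn, hev] using hk2

end SmallBall

namespace SmallBall

open scoped ENNReal NNReal Topology

variable {n : ℕ}

theorem volume_hyperplane {v : E n} (hv : v ≠ 0) (c : ℝ) :
    volume {x : E n | inner ℝ v x = c} = 0 := by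
  rcases Set.eq_empty_or_nonempty {x : E n | inner ℝ v x = c} with h | ⟨x₀, hx₀⟩
  · rw [h, measure_empty]
  · have e : {x : E n | inner ℝ v x = c}
        = (fun x => x + -x₀) ⁻¹' ((LinearMap.ker (innerSL ℝ v).toLinearMap : Submodule ℝ (E n))
          : Set (E n)) := by
      ext x
      have h0 : inner ℝ v x₀ = c := hx₀
      simp [inner_add_right, inner_neg_right, h0, add_neg_eq_zero]
    rw [e, measure_preimage_add_right]
    refine Measure.addHaar_submodule _ _ fun h => hv ?_
    have h2 : v ∈ LinearMap.ker (innerSL ℝ v).toLinearMap := by rw [h]; trivial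
    simpa using h2

section Tilt
variable {f : E n → ℝ} {r : ℝ} (hf : Cpt f r) (h0 : 0 < ∫ x, f x)
include hf h0

theorem Cpt.co_pos (p : ℝ × E n) {v : Fin n → ℝ} (hv : v ≠ 0) :
    0 < ∑ i, ∑ j, v i * v j * co f p i j := by
  refine lt_of_le_of_ne (hf.co_nonneg h0 p v) fun h => ?_
  set c := ∑ i, v i * mn f i p with hc
  have e : ∀ x : E n, (∑ i, v i * (x i - mn f i p)) = inner ℝ (WithLp.toLp 2 v) x - c := fun x => by
    rw [inner_eq_sum]; simp only [mul_sub, Finset.sum_sub_distrib, hc]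
  rw [hf.co_form h0] at h
  simp only [e] at h
  set q : E n → ℝ := fun x => inner ℝ (WithLp.toLp 2 v) x - c with hq
  have hqc : Continuous fun x => q x * q x := by fun_prop
  have hU : U f (fun x => q x * q x) p = 0 := by
    rw [← hf.Zf_mul_Ev h0 (fun x => q x * q x) p, ← h, mul_zero]
  have hnn : ∀ x, 0 ≤ q x * q x * (f x * Real.exp (tl p x)) := fun x =>
    mul_nonneg (mul_self_nonneg _) (mul_nonneg (hf.nonneg x) (Real.exp_pos _).le)
  rw [U, integral_eq_zero_iff_of_nonneg hnn (hf.integrable_U hqc p)] at hU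
  have hne : ∀ᵐ x, q x ≠ 0 := by
    have hv' : WithLp.toLp 2 v ≠ 0 := fun h => hv (by simpa using h)
    have := volume_hyperplane hv' c
    rw [measure_eq_zero_iff_ae_notMem] at this
    filter_upwards [this] with x hx h
    exact hx (sub_eq_zero.1 h)
  have hz : f =ᵐ[volume] 0 := by
    filter_upwards [hU, hne] with x h1 h2
    simp only [Pi.zero_apply, mul_eq_zero, h2, (Real.exp_pos _).ne', or_false, false_or] at h1
    exact h1
  rw [integral_congr_ae hz] at h0
  simp at h0

omit hf h0 in
/-- The barycentre map of the tilts `f e^{⟨θ, ·⟩}`. -/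
def bary (f : E n → ℝ) (θ : E n) : E n := WithLp.toLp 2 fun k => mn f k (0, θ)

theorem Cpt.differentiableAt_mn (p : ℝ × E n) (k : Fin n) : DifferentiableAt ℝ (mn f k) p := by
  have h1 := (hf.hasFDerivAt_U (q := fun x : E n => x k) (by fun_prop) p).differentiableAt
  have h2 := (hf.hasFDerivAt_U (q := fun _ => 1) (by fun_prop) p).differentiableAt
  exact h1.mul (h2.inv (hf.Zf_pos h0 p).ne')

theorem Cpt.hasFDerivAt_bary (θ : E n) :
    HasFDerivAt (bary f)
      (LinearMap.toContinuousLinearMap (Matrix.toEuclideanLin (co f (0, θ)))) θ := by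
  have hd : DifferentiableAt ℝ (bary f) θ := by
    rw [differentiableAt_piLp]
    intro k
    exact (hf.differentiableAt_mn h0 (0, θ) k).comp θ (by fun_prop)
  convert! hd.hasFDerivAt using 1
  ext v k
  have hγ : HasDerivAt (fun s : ℝ => θ + s • v) v 0 := by
    simpa using ((hasDerivAt_id (0 : ℝ)).smul_const v).const_add θ
  have h1 : HasFDerivAt (bary f) (fderiv ℝ (bary f) θ) (θ + (0 : ℝ) • v) := by
    simpa using hd.hasFDerivAt
  have h2 := h1.comp_hasDerivAt (0 : ℝ) hγ
  have h3 : HasDerivAt (fun s : ℝ => mn f k (0, θ + s • v)) (fderiv ℝ (bary f) θ v k) 0 :=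
    (EuclideanSpace.proj (𝕜 := ℝ) k).hasFDerivAt.comp_hasDerivAt (0 : ℝ) h2
  rw [h3.unique (hf.hasDerivAt_mn h0 0 θ v k)]
  simp only [LinearMap.coe_toContinuousLinearMap', Matrix.toLpLin_apply, Matrix.mulVec, dotProduct]
  exact Finset.sum_congr rfl fun j _ => by rw [co_symm, mul_comm]

theorem Cpt.bary_injective : Function.Injective (bary f) := by
  intro θ θ' h
  by_contra hne
  set v := θ' - θ with hv
  have hv0 : v ≠ 0 := sub_ne_zero.2 (Ne.symm hne)
  have hv1 : (fun i => v i) ≠ 0 := fun h => hv0 (by ext i; exact congrFun h i)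
  have hd : ∀ s : ℝ, HasDerivAt (fun s : ℝ => ∑ k, v k * mn f k (0, θ + s • v))
      (∑ k, ∑ j, v k * v j * co f (0, θ + s • v) k j) s := by
    intro s
    refine HasDerivAt.fun_sum fun k _ => ?_
    have h2 := hf.hasDerivAt_mn h0 0 (θ + s • v) v k
    have h3 : HasDerivAt (fun u : ℝ => mn f k (0, θ + u • v))
        (∑ j, v j * co f (0, θ + s • v) j k) s := by
      have h4 : HasDerivAt (fun u : ℝ => u - s) 1 s := (hasDerivAt_id s).sub_const s
      have h5 := HasDerivAt.comp (h₂ := fun u : ℝ => mn f k (0, θ + s • v + u • v))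
        (h := fun u => u - s) s (by simpa using h2) h4
      refine (h5.congr_deriv (by simp)).congr_of_eventuallyEq (Filter.Eventually.of_forall ?_)
      intro u
      simp only [Function.comp, sub_smul]
      congr 2; abel
    refine (h3.const_mul (v k)).congr_deriv ?_
    rw [Finset.mul_sum]
    exact Finset.sum_congr rfl fun j _ => by rw [co_symm]; ring
  have hm : StrictMono fun s : ℝ => ∑ k, v k * mn f k (0, θ + s • v) :=
    strictMono_of_deriv_pos fun s => by rw [(hd s).deriv]; exact hf.co_pos h0 _ hv1
  have h01 := hm zero_lt_one
  simp only [zero_smul, add_zero, one_smul, hv, add_sub_cancel] at h01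
  have e : ∀ k, mn f k (0, θ) = mn f k (0, θ') := fun k => congrArg (fun x : E n => x k) h
  simp only [e, lt_self_iff_false] at h01

theorem Cpt.bary_mem {K : Set (E n)} (hK : Convex ℝ K) (hfK : ∀ x, x ∉ K → f x = 0) (θ : E n) :
    bary f θ ∈ closure K := by
  by_contra hc
  obtain ⟨φ, u, h1, h2⟩ := geometric_hahn_banach_closed_point hK.closure isClosed_closure hc
  have hlin : ∀ x : E n, φ x = ∑ i, φ (EuclideanSpace.single i 1) * x i := by
    intro x
    conv_lhs => rw [← (EuclideanSpace.basisFun (Fin n) ℝ).sum_repr x, map_sum]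
    exact Finset.sum_congr rfl fun i _ => by
      simp [mul_comm]
  have hb : φ (bary f θ) = Ev f (fun x => φ x) (0, θ) := by
    rw [hlin]
    have e : (fun x => φ x) = fun x : E n => ∑ i, φ (EuclideanSpace.single i 1) * x i :=
      funext hlin
    rw [e, hf.Ev_sum _ (fun i _ => by fun_prop)]
    exact Finset.sum_congr rfl fun i _ => (Ev_const_mul _ _ _).symm
  have hle : Ev f (fun x => φ x) (0, θ) ≤ Ev f (fun _ => u) (0, θ) := by
    unfold Ev U
    refine mul_le_mul_of_nonneg_right (integral_mono (hf.integrable_U φ.continuous _)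
      (hf.integrable_U continuous_const _) fun x => ?_) (inv_nonneg.2 (hf.Zf_pos h0 _).le)
    by_cases hx : x ∈ K
    · exact mul_le_mul_of_nonneg_right (h1 x (subset_closure hx)).le
        (mul_nonneg (hf.nonneg x) (Real.exp_pos _).le)
    · simp [hfK x hx]
  rw [hf.Ev_const h0, ← hb] at hle
  linarith

/-- Some tilt in the unit cube has a covariance of small determinant. -/
theorem Cpt.exists_tilt_det_le {K : Set (E n)} (hK : Convex ℝ K) (hfK : ∀ x, x ∉ K → f x = 0) :
    ∃ θ : E n, (∀ i, |θ i| ≤ 1) ∧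
      ENNReal.ofReal |(co f (0, θ)).det| * 2 ^ n ≤ volume K := by
  set Q : Set (E n) := {θ | ∀ i, |θ i| ≤ 1} with hQ
  have hQe : Q = (@WithLp.ofLp 2 (Fin n → ℝ)) ⁻¹'
      (Set.Icc (fun _ => -1) fun _ => 1) := by
    ext θ
    simp only [hQ, Set.mem_ofPred_eq, Set.mem_preimage, Set.mem_Icc, Pi.le_def, abs_le]
    exact forall_and
  have hQm : MeasurableSet Q := by
    rw [hQe]; exact (PiLp.volume_preserving_ofLp (Fin n)).measurable measurableSet_Icc
  have hQv : volume Q = 2 ^ n := by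
    rw [hQe, (PiLp.volume_preserving_ofLp (Fin n)).measure_preimage
      measurableSet_Icc.nullMeasurableSet, Real.volume_Icc_pi]
    norm_num
  have hdet : ∀ θ, (LinearMap.toContinuousLinearMap (Matrix.toEuclideanLin (co f (0, θ)))).det
      = (co f (0, θ)).det := fun θ => by
    rw [LinearMap.det_toContinuousLinearMap]
    have := LinearMap.det_toLin (EuclideanSpace.basisFun (Fin n) ℝ).toBasis (co f (0, θ))
    rw [← this]
    congr 1
  have hcv := lintegral_abs_det_fderiv_eq_addHaar_image volume hQm
    (fun θ _ => (hf.hasFDerivAt_bary h0 θ).hasFDerivWithinAt) (hf.bary_injective h0).injOn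
  have hvol : volume (bary f '' Q) ≤ volume K := by
    have h1 : bary f '' Q ⊆ closure K := by
      rintro _ ⟨θ, -, rfl⟩; exact hf.bary_mem h0 hK hfK θ
    refine (measure_mono h1).trans ?_
    calc volume (closure K) ≤ volume (interior K ∪ frontier K) := by
          rw [← closure_eq_interior_union_frontier]
      _ ≤ volume (interior K) + volume (frontier K) := measure_union_le _ _
      _ ≤ volume K := by
        rw [hK.addHaar_frontier volume, add_zero]; exact measure_mono interior_subset
  simp only [hdet] at hcv
  have hcont : Continuous fun θ : E n => (co f (0, θ)).det :=
    Continuous.matrix_det (continuous_matrix fun i j =>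
      (hf.ig_co_apply h0 i j).grow.1.comp (by fun_prop))
  obtain ⟨θ, hθ, hle⟩ := exists_le_setLAverage (μ := volume) (s := Q)
    (f := fun θ => ENNReal.ofReal |(co f (0, θ)).det|) (by rw [hQv]; positivity)
    (by rw [hQv]; simp) hcont.abs.measurable.ennreal_ofReal.aemeasurable
  refine ⟨θ, hθ, ?_⟩
  rw [setLAverage_eq, hcv, hQv, ENNReal.le_div_iff_mul_le (by simp) (by simp)] at hle
  exact hle.trans hvol

end Tilt

end SmallBall

namespace SmallBall

open scoped ENNReal NNReal Topology

variable {n k : ℕ}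

theorem exists_split {P : E n →L[ℝ] E k} (hP : Function.Surjective P) :
    ∃ Φ : (E k × LinearMap.ker P.toLinearMap) ≃L[ℝ] E n, ∀ z, P (Φ z) = z.1 := by
  obtain ⟨S, hS⟩ := P.toLinearMap.exists_rightInverse_of_surjective (LinearMap.range_eq_top.2 hP)
  have hS' : ∀ y, P (S y) = y := fun y => LinearMap.congr_fun hS y
  let Φ : (E k × LinearMap.ker P.toLinearMap) ≃ₗ[ℝ] E n :=
    { toFun := fun z => S z.1 + z.2
      map_add' := fun z w => by simp only [Prod.fst_add, Prod.snd_add, map_add, Submodule.coe_add]; abel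
      map_smul' := fun c z => by simp [smul_add]
      invFun := fun x => (P x, ⟨x - S (P x), by simp [hS']⟩)
      left_inv := fun z => by
        have hz : P (z.2 : E n) = 0 := z.2.2
        ext1
        · simp [hS', hz]
        · ext1; simp [hS', hz]
      right_inv := fun x => by simp }
  refine ⟨Φ.toContinuousLinearEquiv, fun z => ?_⟩
  have hz : P (z.2 : E n) = 0 := z.2.2
  change P (S z.1 + z.2) = z.1
  rw [map_add, hS', hz, add_zero]

/-- Linear images of measures with log-concave densities have log-concave densities. -/
theorem exists_density_map {f : E n → ℝ≥0∞} (hf : LC f) {P : E n →L[ℝ] E k}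
    (hP : Function.Surjective P) :
    ∃ g : E k → ℝ≥0∞, LC g ∧ (volume.withDensity f).map P = volume.withDensity g := by
  obtain ⟨Φ, hΦ⟩ := exists_split hP
  set ν : Measure (E k × LinearMap.ker P.toLinearMap) := volume.prod volume with hν
  obtain ⟨c, hc⟩ : ∃ c : ℝ≥0∞, (volume : Measure (E n)) = c • ν.map Φ := by
    have : (ν.map Φ).IsAddHaarMeasure := Φ.isAddHaarMeasure_map ν
    have h := Measure.isAddLeftInvariant_eq_smul (volume : Measure (E n)) (ν.map Φ)
    exact ⟨_, h⟩
  have hF : LC fun z => f (Φ z) := hf.comp_linear Φ.toLinearEquiv.toLinearMap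
  refine ⟨fun y => c * ∫⁻ w, f (Φ (y, w)), (hF.marginal volume).const_mul c, ?_⟩
  ext A hA
  have hPm : Measurable P := P.continuous.measurable
  rw [Measure.map_apply hPm hA, withDensity_apply _ (hPm hA), withDensity_apply _ hA,
    ← lintegral_indicator (hPm hA), ← lintegral_indicator hA]
  have hΦm : MeasurableEmbedding Φ := Φ.toHomeomorph.measurableEmbedding
  have hmeas : AEMeasurable (fun z => (P ⁻¹' A).indicator f (Φ z)) (volume.prod volume) :=
    (hF.aemeasurable (volume.prod volume)).indicator (s := Φ ⁻¹' (P ⁻¹' A))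
      (Φ.continuous.measurable (hPm hA))
  conv_lhs => rw [hc]
  rw [lintegral_smul_measure, hΦm.lintegral_map, hν, lintegral_prod]
  · rw [smul_eq_mul, ← lintegral_const_mul'']
    · refine lintegral_congr fun y => ?_
      by_cases hy : y ∈ A
      · rw [Set.indicator_of_mem hy]
        congr 1
        refine lintegral_congr fun w => ?_
        rw [Set.indicator_of_mem]
        rw [Set.mem_preimage, hΦ]; exact hy
      · rw [Set.indicator_of_notMem hy]
        have : ∀ w, (P ⁻¹' A).indicator f (Φ (y, w)) = 0 := fun w =>
          Set.indicator_of_notMem (by rw [Set.mem_preimage, hΦ]; exact hy) _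
        simp [this]
    · exact AEMeasurable.lintegral_prod_right'
        (f := fun z => (P ⁻¹' A).indicator f (Φ z)) hmeas
  · exact hmeas

theorem IsoLC.map {μ : Measure (E n)} (h : IsoLC μ) {P : E n →L[ℝ] E k}
    (hP : ∀ v : E k, ∃ w : E n, ‖w‖ = ‖v‖ ∧ ∀ x, inner ℝ v (P x) = inner ℝ w x)
    (hPs : Function.Surjective P) : IsoLC (μ.map P) := by
  have := h.prob
  have hPm : AEMeasurable P μ := P.continuous.measurable.aemeasurable
  refine ⟨Measure.isProbabilityMeasure_map hPm, ?_, fun v => ?_, fun v => ?_⟩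
  · obtain ⟨f, hf, hμ⟩ := h.dens
    rw [hμ]; exact exists_density_map hf hPs
  · obtain ⟨w, -, hw⟩ := hP v
    rw [integral_map hPm (by fun_prop)]
    simp only [hw, h.mean]
  · obtain ⟨w, hn, hw⟩ := hP v
    rw [integral_map hPm (by fun_prop)]
    simp only [hw, h.var, hn]

/-- Coordinates along a subfamily of an orthonormal family. -/
def coords (b : Fin n → E n) (σ : Fin k → Fin n) : E n →L[ℝ] E k :=
  LinearMap.toContinuousLinearMap
    { toFun := fun x => WithLp.toLp 2 fun i => inner ℝ (b (σ i)) x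
      map_add' := fun x y => by ext i; simp [inner_add_right]
      map_smul' := fun c x => by ext i; simp [inner_smul_right] }

theorem coords_apply (b : Fin n → E n) (σ : Fin k → Fin n) (x : E n) (i : Fin k) :
    coords b σ x i = inner ℝ (b (σ i)) x := rfl

theorem IsoLC.map_coords {μ : Measure (E n)} (h : IsoLC μ) {b : Fin n → E n}
    (hb : Orthonormal ℝ b) {σ : Fin k → Fin n} (hσ : Function.Injective σ) :
    IsoLC (μ.map (coords b σ)) := by
  have hbo : Orthonormal ℝ fun i => b (σ i) := hb.comp σ hσ
  refine h.map (fun v => ⟨∑ i, v i • b (σ i), ?_, fun x => ?_⟩) fun v => ⟨∑ i, v i • b (σ i), ?_⟩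
  · have h1 : ‖∑ i, v i • b (σ i)‖ ^ 2 = ‖v‖ ^ 2 := by
      rw [← real_inner_self_eq_norm_sq, hbo.inner_sum, norm_sq_eq_sum]
      simp [pow_two]
    exact (sq_eq_sq₀ (norm_nonneg _) (norm_nonneg _)).1 h1
  · rw [inner_eq_sum, sum_inner]
    simp only [coords_apply, inner_smul_left, RCLike.conj_to_real]
  · ext i
    rw [coords_apply, inner_sum]
    simp only [inner_smul_right]
    rw [Finset.sum_eq_single i]
    · simp [hbo.1 i]
    · intro j _ hj
      rw [hbo.2 (Ne.symm hj), mul_zero]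
    · simp

end SmallBall

namespace SmallBall

open scoped ENNReal NNReal Topology

variable {n : ℕ} {μ : Measure (E n)} {f : E n → ℝ≥0∞}

theorem IsoLC.lintegral_eq_one (h : IsoLC μ) (hμ : μ = volume.withDensity f) :
    ∫⁻ x, f x = 1 := by
  have := h.prob
  have h1 := measure_univ (μ := μ)
  rwa [hμ, withDensity_apply _ MeasurableSet.univ, setLIntegral_univ] at h1

theorem IsoLC.measure_norm_gt (h : IsoLC μ) (hn : 1 ≤ n) :
    μ (Metric.closedBall 0 (2 * √n))ᶜ ≤ 1 / 4 := by
  have := h.prob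
  have hn' : (0 : ℝ) < n := by exact_mod_cast hn
  have hm := mul_meas_ge_le_integral_of_nonneg (μ := μ) (f := fun x : E n => ‖x‖ ^ 2)
    (Filter.Eventually.of_forall fun x => sq_nonneg _) h.integrable_norm_sq (4 * n)
  rw [h.integral_norm_sq] at hm
  have h1 : μ.real {x : E n | 4 * (n : ℝ) ≤ ‖x‖ ^ 2} ≤ 1 / 4 := by
    change 4 * (n : ℝ) * μ.real _ ≤ n at hm
    nlinarith
  have h2 : (Metric.closedBall 0 (2 * √n))ᶜ ⊆ {x : E n | 4 * (n : ℝ) ≤ ‖x‖ ^ 2} := by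
    intro x hx
    rw [Set.mem_compl_iff, mem_closedBall_zero_iff, not_le] at hx
    have := Real.sq_sqrt hn'.le
    have := Real.sqrt_nonneg (n : ℝ)
    simp only [Set.mem_ofPred_eq]
    nlinarith
  refine (measure_mono h2).trans ?_
  rw [← ENNReal.ofReal_toReal (measure_ne_top μ _)]
  calc _ ≤ ENNReal.ofReal (1 / 4) := ENNReal.ofReal_le_ofReal h1
    _ = 1 / 4 := by rw [ENNReal.ofReal_div_of_pos (by norm_num)]; simp

theorem measure_sublevel_le (hf : LC f) (h1 : ∫⁻ x, f x = 1) (hμ : μ = volume.withDensity f)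
    {M : ℝ} (hM : 0 < M) {x₀ : E n} (hx₀ : ENNReal.ofReal M ≤ f x₀) :
    μ {x | f x < ENNReal.ofReal (M / 16 ^ n)} ≤ ENNReal.ofReal ((1 / 2) ^ n) := by
  have hm := hf.aemeasurable volume
  have hns : NullMeasurableSet {x | f x < ENNReal.ofReal (M / 16 ^ n)} :=
    nullMeasurableSet_lt hm aemeasurable_const
  have h2 : (∫⁻ x, f x ^ (1 / 2 : ℝ)) * ENNReal.ofReal (√M) ≤ 2 ^ n := by
    refine le_trans (mul_le_mul_right ?_ _) (hf.sqrt_le h1 x₀)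
    rw [Real.sqrt_eq_rpow, ← ENNReal.ofReal_rpow_of_pos hM]
    exact ENNReal.rpow_le_rpow hx₀ (by norm_num)
  have hsq : √(M / 16 ^ n) = √M / 4 ^ n := by
    rw [Real.sqrt_div hM.le, show (16 : ℝ) ^ n = (4 ^ n) ^ 2 by rw [← pow_mul, mul_comm, pow_mul]; norm_num,
      Real.sqrt_sq (by positivity)]
  have h3 : μ {x | f x < ENNReal.ofReal (M / 16 ^ n)}
      ≤ (∫⁻ x, f x ^ (1 / 2 : ℝ)) * ENNReal.ofReal (√M / 4 ^ n) := by
    rw [hμ, withDensity_apply₀ _ hns, ← lintegral_mul_const'' _ (hm.pow_const _)]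
    refine le_trans ?_ (setLIntegral_le_lintegral {x | f x < ENNReal.ofReal (M / 16 ^ n)} _)
    refine lintegral_mono_ae ?_
    filter_upwards [ae_restrict_mem₀ hns] with x hx
    have hx' : f x < ENNReal.ofReal (M / 16 ^ n) := hx
    calc f x = f x ^ (1 / 2 : ℝ) * f x ^ (1 / 2 : ℝ) := by
          rw [← ENNReal.rpow_add_of_nonneg _ _ (by norm_num) (by norm_num)]; norm_num
      _ ≤ _ := by
        gcongr
        rw [← hsq, Real.sqrt_eq_rpow, ← ENNReal.ofReal_rpow_of_pos (by positivity)]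
        exact ENNReal.rpow_le_rpow hx'.le (by norm_num)
  refine h3.trans ?_
  have e : √M / 4 ^ n = √M * (1 / 4) ^ n := by rw [one_div_pow]; ring
  rw [e, ENNReal.ofReal_mul (Real.sqrt_nonneg _), ← mul_assoc]
  calc _ ≤ 2 ^ n * ENNReal.ofReal ((1 / 4) ^ n) := by gcongr
    _ = ENNReal.ofReal (2 ^ n) * ENNReal.ofReal ((1 / 4) ^ n) := by
      rw [ENNReal.ofReal_pow (by norm_num)]; simp
    _ = _ := by rw [← ENNReal.ofReal_mul (by positivity), ← mul_pow]; norm_num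

/-- A convex core of small volume carrying a quarter of the mass. -/
theorem IsoLC.exists_core (h : IsoLC μ) (hf : LC f) (hμ : μ = volume.withDensity f) (hn : 1 ≤ n)
    {M : ℝ} (hM : 0 < M) {x₀ : E n} (hx₀ : ENNReal.ofReal M ≤ f x₀) :
    ∃ K : Set (E n), MeasurableSet K ∧ Convex ℝ K ∧ K ⊆ Metric.closedBall 0 (2 * √n) ∧
      1 / 4 ≤ μ.real K ∧ ENNReal.ofReal M * volume K ≤ 16 ^ n := by
  have := h.prob
  have h1 := h.lintegral_eq_one hμ
  set c := ENNReal.ofReal (M / 16 ^ n) with hc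
  set K₀ : Set (E n) := {x | c ≤ f x} ∩ Metric.closedBall 0 (2 * √n) with hK₀
  have hconv : Convex ℝ K₀ := (hf.convex_level_le c).inter (convex_closedBall _ _)
  have hKm : MeasurableSet (interior K₀) := isOpen_interior.measurableSet
  refine ⟨interior K₀, hKm, hconv.interior, interior_subset.trans Set.inter_subset_right, ?_, ?_⟩
  · have hfr : μ (frontier K₀) = 0 := by
      rw [hμ]
      exact withDensity_absolutelyContinuous _ _ (hconv.addHaar_frontier volume)
    have hsub : (interior K₀)ᶜ ⊆
        ({x | f x < c} ∪ (Metric.closedBall 0 (2 * √n))ᶜ) ∪ frontier K₀ := by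
      intro x hx
      by_cases hxK : x ∈ K₀
      · exact Or.inr ⟨subset_closure hxK, hx⟩
      · left
        by_contra hcon
        rw [Set.mem_union, not_or] at hcon
        have ha : ¬ f x < c := hcon.1
        have hb : c ≤ f x := not_lt.1 ha
        exact hxK ⟨hb, not_not.1 hcon.2⟩
    have h2 : μ (interior K₀)ᶜ ≤ ENNReal.ofReal (3 / 4) := by
      refine (measure_mono hsub).trans ((measure_union_le _ _).trans ?_)
      rw [hfr, add_zero]
      refine (measure_union_le _ _).trans ?_
      refine (add_le_add (measure_sublevel_le hf h1 hμ hM hx₀) (h.measure_norm_gt hn)).trans ?_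
      have e : (1 / 4 : ℝ≥0∞) = ENNReal.ofReal (1 / 4) := by
        rw [ENNReal.ofReal_div_of_pos (by norm_num)]; simp
      rw [e, ← ENNReal.ofReal_add (by positivity) (by norm_num)]
      refine ENNReal.ofReal_le_ofReal ?_
      have : (1 / 2 : ℝ) ^ n ≤ (1 / 2) ^ 1 := pow_le_pow_of_le_one (by norm_num) (by norm_num) hn
      linarith
    have h3 : μ.real (interior K₀)ᶜ ≤ 3 / 4 := ENNReal.toReal_le_of_le_ofReal (by norm_num) h2
    rw [probReal_compl_eq_one_sub hKm] at h3
    linarith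
  · have h2 : c * volume (interior K₀) ≤ 1 := by
      rw [← h1, ← setLIntegral_const]
      refine le_trans ?_ (setLIntegral_le_lintegral (interior K₀) _)
      exact setLIntegral_mono' hKm fun x hx => (interior_subset hx).1
    have e : ENNReal.ofReal M = 16 ^ n * c := by
      rw [hc, show (16 : ℝ≥0∞) ^ n = ENNReal.ofReal (16 ^ n) by
        rw [ENNReal.ofReal_pow (by norm_num)]; simp, ← ENNReal.ofReal_mul (by positivity)]
      congr 1; field_simp
    rw [e, mul_assoc]
    exact mul_le_of_le_one_right' h2

end SmallBall

namespace SmallBall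

open scoped ENNReal NNReal Topology Matrix

variable {n : ℕ}

theorem orthonormal_columns {P : Matrix (Fin n) (Fin n) ℝ} (hP : Pᵀ * P = 1) :
    Orthonormal ℝ fun i : Fin n => (WithLp.toLp 2 fun a => P a i : E n) := by
  rw [orthonormal_iff_ite]
  intro i j
  rw [inner_eq_sum]
  have := congrFun (congrFun hP i) j
  rw [Matrix.mul_apply, Matrix.one_apply] at this
  exact this

theorem det_of_spectral {A P : Matrix (Fin n) (Fin n) ℝ} {lam : Fin n → ℝ} (hP : Pᵀ * P = 1)
    (hA : A = P * Matrix.diagonal lam * Pᵀ) : A.det = ∏ i, lam i := by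
  have h := congrArg Matrix.det hP
  rw [Matrix.det_mul, Matrix.det_one] at h
  rw [hA, Matrix.det_mul, Matrix.det_mul, Matrix.det_diagonal]
  linear_combination (∏ i, lam i) * h

theorem Cpt.mass_ge_half {f : E n → ℝ} {r : ℝ} (hf : Cpt f r) (h0 : 0 < ∫ x, f x)
    (p : ℝ × E n) {q : E n → ℝ} (hq : Continuous q) (hq0 : ∀ x, 0 ≤ q x) {m : ℝ} (hm : 0 < m)
    (he : Ev f q p = m) :
    Zf f p / 2 ≤ ∫ x in {x | q x ≤ 2 * m}, f x * Real.exp (tl p x) := by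
  have hA : MeasurableSet {x | q x ≤ 2 * m} := measurableSet_le hq.measurable measurable_const
  have hw : Integrable fun x => f x * Real.exp (tl p x) := by
    simpa using hf.integrable_U (q := fun _ => 1) continuous_const p
  have hw0 : ∀ x, 0 ≤ f x * Real.exp (tl p x) := fun x =>
    mul_nonneg (hf.nonneg x) (Real.exp_pos _).le
  have hZ : Zf f p = ∫ x, f x * Real.exp (tl p x) := by simp [Zf, U]
  have h1 : U f q p = m * Zf f p := by
    rw [← he, Ev, mul_assoc, inv_mul_cancel₀ (hf.Zf_pos h0 p).ne', mul_one]
  have h2 : ∫ x in {x | q x ≤ 2 * m}ᶜ, f x * Real.exp (tl p x) ≤ (2 * m)⁻¹ * U f q p := by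
    rw [← integral_indicator hA.compl, U, ← integral_const_mul]
    refine integral_mono (hw.indicator hA.compl) ((hf.integrable_U hq p).const_mul _) fun x => ?_
    by_cases hx : x ∈ {x | q x ≤ 2 * m}ᶜ
    · rw [Set.indicator_of_mem hx]
      have hx' : ¬ q x ≤ 2 * m := hx
      rw [← mul_assoc]
      refine le_mul_of_one_le_left (hw0 x) ?_
      rw [inv_mul_eq_div, one_le_div (by positivity)]
      exact (not_le.1 hx').le
    · rw [Set.indicator_of_notMem hx]
      have := hw0 x
      have := hq0 x
      positivity
  have h3 := integral_add_compl hA hw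
  have e : (2 * m)⁻¹ * (m * Zf f p) = Zf f p / 2 := by field_simp
  rw [h1, e] at h2
  linarith

/-- A large density forces a thin ellipsoid of not too small mass. -/
theorem IsoLC.exists_ellipsoid {μ : Measure (E n)} {f : E n → ℝ≥0∞} (h : IsoLC μ) (hf : LC f)
    (hμ : μ = volume.withDensity f) (hn : 1 ≤ n) {C : ℝ} (hC : 0 < C) {x₀ : E n}
    (hx₀ : ENNReal.ofReal (C ^ n) ≤ f x₀) :
    ∃ (b : Fin n → E n) (lam a : Fin n → ℝ), Orthonormal ℝ b ∧ (∀ i, 0 < lam i) ∧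
      ∏ i, lam i ≤ (8 / C) ^ n ∧
      Real.exp (-(4 * n)) / 8 ≤
        μ.real {x | ∑ i, (inner ℝ (b i) x - a i) ^ 2 / lam i ≤ 2 * n} := by
  have := h.prob
  have h1 := h.lintegral_eq_one hμ
  have hn0 : (0 : ℝ) < n := by exact_mod_cast hn
  obtain ⟨K, hKm, hKc, hKb, hKμ, hKv⟩ := h.exists_core hf hμ hn (pow_pos hC n) hx₀
  have hK0 : μ.real K ≠ 0 := by linarith
  set g := td μ f K 0 with hg
  have hcpt : Cpt g (2 * √n + ‖(0 : E n)‖) := cpt_td hf h1 hKm (by positivity) hKb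
  have hI : ∫ x, g x = 1 := integral_td hf h1 hμ hKm hK0
  have h0 : 0 < ∫ x, g x := by rw [hI]; norm_num
  have hgK : ∀ x, x ∉ K → g x = 0 := fun x hx => by
    simp [hg, td, hx]
  obtain ⟨θ, hθ, hdet⟩ := hcpt.exists_tilt_det_le h0 hKc hgK
  obtain ⟨P, lam, hP1, hP2, hPA, hlam, hcov⟩ := hcpt.co_spectral h0 (0, θ)
  have hb := orthonormal_columns hP2
  set b : Fin n → E n := fun i => WithLp.toLp 2 fun a => P a i with hbdef
  set a : Fin n → ℝ := fun i => ∑ k, P k i * mn g k (0, θ) with ha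
  have hxi : ∀ i x, xi g P (0, θ) i x = inner ℝ (b i) x - a i := fun i x => by
    rw [inner_eq_sum]
    simp only [xi, mul_sub, Finset.sum_sub_distrib, ha, hbdef]
  have hlam' : ∀ i, 0 < lam i := fun i => by
    have e := diag_of_spectral hP2 hPA i i
    rw [if_pos rfl] at e
    rw [← e]
    refine hcpt.co_pos h0 (0, θ) (v := fun k => P k i) fun hv => ?_
    have hb1 := hb.1 i
    have : b i = 0 := by
      ext k; exact congrFun hv k
    rw [this, norm_zero] at hb1
    norm_num at hb1
  refine ⟨b, lam, a, hb, hlam', ?_, ?_⟩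
  · rw [det_of_spectral hP2 hPA, abs_of_pos (Finset.prod_pos fun i _ => hlam' i)] at hdet
    have h2 : ENNReal.ofReal (C ^ n * ((∏ i, lam i) * 2 ^ n)) ≤ ENNReal.ofReal (16 ^ n) := by
      rw [ENNReal.ofReal_mul (by positivity), ENNReal.ofReal_mul
        (Finset.prod_nonneg fun i _ => hlam i), ENNReal.ofReal_pow (p := 2) (by norm_num),
        ENNReal.ofReal_pow (p := 16) (by norm_num)]
      simp only [ENNReal.ofReal_ofNat]
      exact (mul_le_mul_right hdet _).trans hKv
    rw [ENNReal.ofReal_le_ofReal_iff (by positivity)] at h2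
    rw [div_pow, le_div_iff₀ (by positivity)]
    have e : (16 : ℝ) ^ n = 8 ^ n * 2 ^ n := by rw [← mul_pow]; norm_num
    rw [e] at h2
    refine le_of_mul_le_mul_right ?_ (show (0 : ℝ) < 2 ^ n by positivity)
    linarith
  · set q : E n → ℝ := fun x => ∑ i, (inner ℝ (b i) x - a i) ^ 2 / lam i with hq
    have hqc : Continuous q := by
      simp only [hq]; fun_prop
    have hq0 : ∀ x, 0 ≤ q x := fun x =>
      Finset.sum_nonneg fun i _ => div_nonneg (sq_nonneg _) (hlam i)
    have hEv : Ev g q (0, θ) = n := by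
      have e : q = fun x => ∑ i, (lam i)⁻¹ * (xi g P (0, θ) i x * xi g P (0, θ) i x) := by
        funext x
        simp only [hq, hxi]
        exact Finset.sum_congr rfl fun i _ => by ring
      have hx := fun i => continuous_xi (f := g) P (0, θ) i
      rw [e, hcpt.Ev_sum _ fun i _ => by have := hx i; fun_prop]
      simp only [Ev_const_mul, hcov, if_true]
      simp [(hlam' _).ne']
    have hhalf := hcpt.mass_ge_half h0 (0, θ) hqc hq0 hn0 hEv
    set A : Set (E n) := {x | q x ≤ 2 * n} with hA
    have hAm : MeasurableSet A := measurableSet_le hqc.measurable measurable_const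
    have htl : ∀ x ∈ K, |tl (0, θ) x| ≤ 2 * n := fun x hx => by
      have hθn : ‖θ‖ ≤ √n := by
        rw [← Real.sqrt_sq (norm_nonneg θ), norm_sq_eq_sum]
        refine Real.sqrt_le_sqrt ?_
        calc ∑ i, θ i ^ 2 ≤ ∑ _i : Fin n, (1 : ℝ) :=
              Finset.sum_le_sum fun i _ => (sq_le_one_iff_abs_le_one _).2 (hθ i)
          _ = n := by simp
      have hxn : ‖x‖ ≤ 2 * √n := by simpa using hKb hx
      simp only [tl, zero_div, zero_mul, sub_zero]
      calc |inner ℝ θ x| ≤ ‖θ‖ * ‖x‖ := abs_real_inner_le_norm _ _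
        _ ≤ √n * (2 * √n) := by gcongr
        _ = 2 * n := by
          have := Real.mul_self_sqrt hn0.le
          linear_combination 2 * this
    have hw : Integrable fun x => g x * Real.exp (tl (0, θ) x) := by
      simpa using hcpt.integrable_U (q := fun _ => 1) continuous_const (0, θ)
    have hZ : Real.exp (-(2 * n)) ≤ Zf g (0, θ) := by
      have e : Real.exp (-(2 * n)) = ∫ x, g x * Real.exp (-(2 * n)) := by
        rw [integral_mul_const, hI, one_mul]
      rw [e]
      simp only [Zf, U, one_mul]
      refine integral_mono (hcpt.int.mul_const _) hw fun x => ?_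
      by_cases hx : x ∈ K
      · exact mul_le_mul_of_nonneg_left (Real.exp_le_exp.2 (abs_le.1 (htl x hx)).1) (hcpt.nonneg x)
      · simp [hgK x hx]
    have hup : ∫ x in A, g x * Real.exp (tl (0, θ) x) ≤ Real.exp (2 * n) * (4 * μ.real A) := by
      have e1 : ∫ x in A, g x * Real.exp (tl (0, θ) x) ≤ ∫ x in A, Real.exp (2 * n) * g x := by
        refine integral_mono hw.integrableOn (hcpt.int.const_mul _).integrableOn fun x => ?_
        by_cases hx : x ∈ K
        · show g x * _ ≤ _ * g x
          rw [mul_comm]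
          exact mul_le_mul_of_nonneg_right (Real.exp_le_exp.2 (abs_le.1 (htl x hx)).2)
            (hcpt.nonneg x)
        · simp [hgK x hx]
      refine e1.trans ?_
      rw [integral_const_mul]
      refine mul_le_mul_of_nonneg_left ?_ (Real.exp_pos _).le
      have e2 := integral_mul_td (y := 0) hf h1 hμ hKm (A.indicator 1)
      have e3 : ∫ x in A, g x = ∫ x, A.indicator 1 x * td μ f K 0 x := by
        rw [← integral_indicator hAm]
        refine integral_congr_ae (Filter.Eventually.of_forall fun x => ?_)
        by_cases hx : x ∈ A <;> simp [hx, hg]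
      rw [e3, e2]
      simp only [sub_zero]
      rw [integral_indicator_one hAm, measureReal_restrict_apply hAm]
      have e4 : (μ.real K)⁻¹ ≤ 4 := by
        rw [inv_le_comm₀ (by linarith) (by norm_num)]; linarith
      have e5 : μ.real (A ∩ K) ≤ μ.real A := measureReal_mono Set.inter_subset_left
      gcongr
    have hfin : Real.exp (-(2 * n)) / 2 ≤ Real.exp (2 * n) * (4 * μ.real A) := by linarith
    have e6 : Real.exp (-(4 * n)) = Real.exp (-(2 * n)) * Real.exp (-(2 * n)) := by
      rw [← Real.exp_add]; ring_nf
    have e7 : Real.exp (-(2 * n)) * Real.exp (2 * n) = 1 := by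
      rw [← Real.exp_add]; simp
    have := mul_le_mul_of_nonneg_left hfin (Real.exp_pos (-(2 * n : ℝ))).le
    rw [← mul_assoc, e7] at this
    rw [e6]
    linarith

end SmallBall

namespace SmallBall

open scoped ENNReal NNReal Topology

variable {n : ℕ}

theorem volume_ellipsoid_le {lam : Fin n → ℝ} (hlam : ∀ i, 0 < lam i) (a : Fin n → ℝ) (m : ℝ) :
    volume {z : E n | ∑ i, (z i - a i) ^ 2 / lam i ≤ 2 * m} ≤
      ENNReal.ofReal (Real.exp m * ∏ i, √(2 * Real.pi * lam i)) := by
  set A : Set (E n) := {z : E n | ∑ i, (z i - a i) ^ 2 / lam i ≤ 2 * m} with hA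
  have hAm : MeasurableSet A := measurableSet_le (by fun_prop) measurable_const
  set G : Fin n → ℝ → ℝ := fun i x => Real.exp (-(1 / (2 * lam i)) * (x - a i) ^ 2) with hG
  have hGi : ∀ i, Integrable (G i) := fun i =>
    (integrable_exp_neg_mul_sq (b := 1 / (2 * lam i))
      (by have := hlam i; positivity)).comp_sub_right (a i)
  have hGv : ∀ i, ∫ x, G i x = √(2 * Real.pi * lam i) := fun i => by
    have e := integral_sub_right_eq_self (μ := volume)
      (fun x : ℝ => Real.exp (-(1 / (2 * lam i)) * x ^ 2)) (a i)
    simp only [hG]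
    rw [e, integral_gaussian]
    congr 1
    have := hlam i
    field_simp
  have hpi : Integrable (fun x : Fin n → ℝ => ∏ i, G i (x i)) := Integrable.fintype_prod hGi
  have hE : Integrable (fun z : E n => ∏ i, G i (z i)) :=
    (PiLp.volume_preserving_ofLp (Fin n)).integrable_comp_of_integrable hpi
  have hEv : ∫ z : E n, ∏ i, G i (z i) = ∏ i, √(2 * Real.pi * lam i) := by
    have e := (PiLp.volume_preserving_ofLp (Fin n)).integral_comp
      (MeasurableEquiv.toLp 2 (Fin n → ℝ)).symm.measurableEmbedding
      (fun x : Fin n → ℝ => ∏ i, G i (x i))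
    refine e.trans ?_
    rw [integral_fintype_prod_volume_eq_prod]
    simp only [hGv]
  have hG0 : ∀ z : E n, 0 ≤ ∏ i, G i (z i) := fun z =>
    Finset.prod_nonneg fun i _ => (Real.exp_pos _).le
  have hGe : ∀ z : E n, ∏ i, G i (z i) = Real.exp (-(1 / 2) * ∑ i, (z i - a i) ^ 2 / lam i) :=
    fun z => by
      simp only [hG]
      rw [← Real.exp_sum, Finset.mul_sum]
      congr 1
      refine Finset.sum_congr rfl fun i _ => ?_
      have := (hlam i).ne'
      field_simp
  rw [← setLIntegral_one, ← hEv, ← integral_const_mul,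
    ofReal_integral_eq_lintegral_ofReal (hE.const_mul _)
      (Filter.Eventually.of_forall fun z => mul_nonneg (Real.exp_pos _).le (hG0 z))]
  refine (setLIntegral_mono' hAm fun z hz => ?_).trans (setLIntegral_le_lintegral A _)
  have hz' : ∑ i, (z i - a i) ^ 2 / lam i ≤ 2 * m := hz
  rw [hGe, ← Real.exp_add, ← ENNReal.ofReal_one]
  exact ENNReal.ofReal_le_ofReal (Real.one_le_exp (by linarith))

theorem exists_enum (S : Finset (Fin n)) :
    ∃ σ : Fin S.card → Fin n, Function.Injective σ ∧ (∀ j, σ j ∈ S) ∧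
      ∀ φ : Fin n → ℝ, ∏ j, φ (σ j) = ∏ i ∈ S, φ i := by
  refine ⟨fun j => (S.equivFin.symm j : Fin n),
    Subtype.val_injective.comp S.equivFin.symm.injective, fun j => (S.equivFin.symm j).2,
    fun φ => ?_⟩
  rw [← Finset.prod_coe_sort S]
  exact Equiv.prod_comp S.equivFin.symm fun i : S => φ i

/-- Projecting an ellipsoid on a subset of its axes. -/
theorem IsoLC.ellipsoid_le_map {μ : Measure (E n)} (h : IsoLC μ) {b : Fin n → E n}
    {lam : Fin n → ℝ} (hlam : ∀ i, 0 < lam i) (a : Fin n → ℝ) {k : ℕ} {σ : Fin k → Fin n}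
    (hσ : Function.Injective σ) (m : ℝ) :
    μ.real {x | ∑ i, (inner ℝ (b i) x - a i) ^ 2 / lam i ≤ m} ≤
      (μ.map (coords b σ)).real {z : E k | ∑ j, (z j - a (σ j)) ^ 2 / lam (σ j) ≤ m} := by
  have := h.prob
  have hm : MeasurableSet {z : E k | ∑ j, (z j - a (σ j)) ^ 2 / lam (σ j) ≤ m} :=
    measurableSet_le (by fun_prop) measurable_const
  rw [map_measureReal_apply (coords b σ).continuous.measurable hm]
  refine measureReal_mono fun x hx => ?_
  have hx' : ∑ i, (inner ℝ (b i) x - a i) ^ 2 / lam i ≤ m := hx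
  show ∑ j, (coords b σ x j - a (σ j)) ^ 2 / lam (σ j) ≤ m
  simp only [coords_apply]
  refine le_trans ?_ hx'
  rw [← Finset.sum_image (f := fun i => (inner ℝ (b i) x - a i) ^ 2 / lam i)
    (fun i _ j _ hij => hσ hij)]
  exact Finset.sum_le_sum_of_subset_of_nonneg (Finset.subset_univ _)
    fun i _ _ => div_nonneg (sq_nonneg _) (hlam i).le

theorem pow_le_exp_div (hn : 1 ≤ n) :
    (Real.exp (-5) / 8) ^ n ≤ Real.exp (-(4 * n)) / 8 * Real.exp (-n) := by
  have e : Real.exp (-(4 * n)) / 8 * Real.exp (-n) = Real.exp (-5) ^ n / 8 := by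
    rw [← Real.exp_nat_mul, div_mul_eq_mul_div, ← Real.exp_add]; ring_nf
  rw [e, div_pow]
  have : (8 : ℝ) ^ 1 ≤ 8 ^ n := pow_le_pow_right₀ (by norm_num) hn
  gcongr
  linarith

/-- Few axes of an ellipsoid of not too small mass are short. -/
theorem exists_short_axis_bound : ∃ s : ℝ, 0 < s ∧ s ≤ 1 ∧ ∀ {n : ℕ} {μ : Measure (E n)}
    {b : Fin n → E n} {lam a : Fin n → ℝ}, 1 ≤ n → IsoLC μ → Orthonormal ℝ b →
    (∀ i, 0 < lam i) →
    Real.exp (-(4 * n)) / 8 ≤ μ.real {x | ∑ i, (inner ℝ (b i) x - a i) ^ 2 / lam i ≤ 2 * n} →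
    ∀ S : Finset (Fin n), (∀ i ∈ S, lam i ≤ s) → 4 * S.card < n := by
  set c : ℝ := 1 / (64 * Real.exp 192) with hc
  have hc0 : 0 < c := by positivity
  set κ : ℝ := Real.exp (-5) / 8 with hκ
  have hκ0 : 0 < κ := by positivity
  have hκ1 : κ ≤ 1 := by
    have : Real.exp (-5) ≤ 1 := Real.exp_le_one_iff.2 (by norm_num)
    rw [hκ]; linarith
  set β : ℝ := κ ^ 4 * Real.exp (-(1 / 2)) / 2 with hβ
  have hβ0 : 0 < β := by positivity
  have hβ1 : β ≤ 1 := by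
    have h1 : Real.exp (-(1 / 2)) ≤ 1 := Real.exp_le_one_iff.2 (by norm_num)
    have h2 : κ ^ 4 ≤ 1 := pow_le_one₀ hκ0.le hκ1
    have := mul_le_one₀ h2 (Real.exp_pos _).le h1
    rw [hβ]; linarith
  set s : ℝ := β ^ (1 / c) with hs
  have hs0 : 0 < s := Real.rpow_pos_of_pos hβ0 _
  have hs1 : s ≤ 1 := Real.rpow_le_one hβ0.le hβ1 (by positivity)
  have hsc : s⁻¹ ^ (-c) = β := by
    rw [Real.rpow_neg (by positivity), Real.inv_rpow hs0.le, inv_inv, hs, ← Real.rpow_mul hβ0.le,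
      one_div_mul_cancel hc0.ne', Real.rpow_one]
  have hρ : Real.exp (1 / 2) * s⁻¹ ^ (-c) = κ ^ 4 / 2 := by
    rw [hsc, hβ, mul_div_assoc', mul_comm (κ ^ 4), ← mul_assoc, ← Real.exp_add]; simp
  refine ⟨s, hs0, hs1, ?_⟩
  intro n μ b lam a hn h hb hlam hmass S hS
  obtain ⟨σ, hσ, hσS, -⟩ := exists_enum S
  by_contra hcon
  push Not at hcon
  have hν := h.map_coords hb hσ
  set ν := μ.map (coords b σ) with hνdef
  have hνp := hν.prob
  set y : E S.card := WithLp.toLp 2 fun j => a (σ j) with hy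
  have h1 := hν.small_ball_exp y (T := s⁻¹) ((one_le_inv₀ hs0).2 hs1)
  rw [← hc, hρ] at h1
  have h2 := hmass.trans (h.ellipsoid_le_map (b := b) hlam a hσ (2 * n))
  set A : Set (E S.card) := {z : E S.card | ∑ j, (z j - a (σ j)) ^ 2 / lam (σ j) ≤ 2 * n} with hA
  have hAm : MeasurableSet A := measurableSet_le (by fun_prop) measurable_const
  have hInt : Integrable (fun z => Real.exp (-(s⁻¹ / 2 * ‖z - y‖ ^ 2))) ν := by
    refine (integrable_const (1 : ℝ)).mono' (by fun_prop) (Filter.Eventually.of_forall fun z => ?_)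
    rw [Real.norm_of_nonneg (Real.exp_pos _).le]
    refine Real.exp_le_one_iff.2 ?_
    have : 0 ≤ s⁻¹ / 2 * ‖z - y‖ ^ 2 := by positivity
    linarith
  have h3 : ν.real A ≤ Real.exp n * ∫ z, Real.exp (-(s⁻¹ / 2 * ‖z - y‖ ^ 2)) ∂ν := by
    rw [← integral_indicator_one hAm, ← integral_const_mul]
    refine integral_mono ((integrable_const (1 : ℝ)).indicator hAm) (hInt.const_mul _) fun z => ?_
    by_cases hz : z ∈ A
    · simp only [Set.indicator_of_mem hz, Pi.one_apply]
      have hz' : ∑ j, (z j - a (σ j)) ^ 2 / lam (σ j) ≤ 2 * n := hz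
      have h4 : s⁻¹ * ‖z - y‖ ^ 2 ≤ 2 * n := by
        refine le_trans ?_ hz'
        rw [norm_sq_eq_sum, Finset.mul_sum]
        refine Finset.sum_le_sum fun j _ => ?_
        show s⁻¹ * (z j - a (σ j)) ^ 2 ≤ _
        rw [inv_mul_eq_div]
        exact div_le_div_of_nonneg_left (sq_nonneg _) (hlam _) (hS _ (hσS j))
      rw [← Real.exp_add]
      exact Real.one_le_exp (by linarith)
    · simp only [Set.indicator_of_notMem hz]; positivity
  have h5 : Real.exp (-(4 * n)) / 8 ≤ Real.exp n * (κ ^ 4 / 2) ^ S.card :=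
    (h2.trans h3).trans (mul_le_mul_of_nonneg_left h1 (Real.exp_pos _).le)
  have h6 : κ ^ n ≤ (κ ^ 4 / 2) ^ S.card := by
    refine (pow_le_exp_div hn).trans ?_
    have := mul_le_mul_of_nonneg_right h5 (Real.exp_pos (-(n : ℝ))).le
    refine this.trans_eq ?_
    rw [mul_right_comm, ← Real.exp_add, add_neg_cancel, Real.exp_zero, one_mul]
  have hk0 : S.card ≠ 0 := by omega
  have h7 : (κ ^ 4 / 2) ^ S.card < (κ ^ 4) ^ S.card :=
    pow_lt_pow_left₀ (by linarith [pow_pos hκ0 4]) (by positivity) hk0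
  have h8 : (κ ^ 4) ^ S.card ≤ κ ^ n := by
    rw [← pow_mul]; exact pow_le_pow_of_le_one hκ0.le hκ1 hcon
  linarith

/-- A density bound for marginals bounds the axes of an ellipsoid from below. -/
theorem IsoLC.le_prod_axes {μ : Measure (E n)} (h : IsoLC μ) (hn : 1 ≤ n) {b : Fin n → E n}
    (hb : Orthonormal ℝ b) {lam a : Fin n → ℝ} (hlam : ∀ i, 0 < lam i)
    (hmass : Real.exp (-(4 * n)) / 8 ≤
      μ.real {x | ∑ i, (inner ℝ (b i) x - a i) ^ 2 / lam i ≤ 2 * n})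
    {C : ℝ} (hC : 0 ≤ C) (S : Finset (Fin n))
    (hS : ∀ (ν : Measure (E S.card)) (g : E S.card → ℝ≥0∞), IsoLC ν → LC g →
      ν = volume.withDensity g → ∀ x, g x ≤ ENNReal.ofReal (C ^ S.card)) :
    (Real.exp (-5) / 8) ^ n ≤ ∏ i ∈ S, (C * √(2 * Real.pi * lam i)) := by
  obtain ⟨σ, hσ, -, hσp⟩ := exists_enum S
  have hν := h.map_coords hb hσ
  obtain ⟨g, hg, hνg⟩ := hν.dens
  have hgb := hS _ g hν hg hνg
  have h2 := hmass.trans (h.ellipsoid_le_map (b := b) hlam a hσ (2 * n))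
  rw [hνg] at h2
  have hvol := volume_ellipsoid_le (fun j => hlam (σ j)) (fun j => a (σ j)) n
  set A : Set (E S.card) := {z | ∑ j, (z j - a (σ j)) ^ 2 / lam (σ j) ≤ 2 * n} with hA
  have hAm : MeasurableSet A := measurableSet_le (by fun_prop) measurable_const
  have h3 : (volume.withDensity g) A ≤
      ENNReal.ofReal (C ^ S.card * (Real.exp n * ∏ j, √(2 * Real.pi * lam (σ j)))) := by
    rw [withDensity_apply _ hAm, ENNReal.ofReal_mul (by positivity)]
    refine (setLIntegral_mono' hAm fun z _ => hgb z).trans ?_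
    rw [setLIntegral_const]
    gcongr
  have h4 := h2.trans (ENNReal.toReal_le_of_le_ofReal (by positivity) h3)
  rw [hσp fun i => √(2 * Real.pi * lam i)] at h4
  refine (pow_le_exp_div hn).trans ?_
  refine (mul_le_mul_of_nonneg_right h4 (Real.exp_pos (-(n : ℝ))).le).trans_eq ?_
  have e : Real.exp n * Real.exp (-(n : ℝ)) = 1 := by rw [← Real.exp_add]; simp
  rw [Finset.prod_mul_distrib, Finset.prod_const]
  linear_combination (C ^ S.card * ∏ i ∈ S, √(2 * Real.pi * lam i)) * e

end SmallBall

namespace SmallBall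

open scoped ENNReal NNReal Topology

/-- The maximal density of isotropic log-concave measures is at most exponential in the
dimension. -/
theorem exists_density_bound : ∃ C : ℝ, 1 ≤ C ∧ ∀ (n : ℕ) (μ : Measure (E n)) (f : E n → ℝ≥0∞),
    1 ≤ n → IsoLC μ → LC f → μ = volume.withDensity f →
    ∀ x, f x ≤ ENNReal.ofReal (C ^ n) := by
  obtain ⟨s, hs0, hs1, hshort⟩ := exists_short_axis_bound
  set κ : ℝ := Real.exp (-5) / 8 with hκ
  have hκ0 : 0 < κ := by positivity
  have hκ1 : κ ≤ 1 := by
    have : Real.exp (-5) ≤ 1 := Real.exp_le_one_iff.2 (by norm_num)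
    rw [hκ]; linarith
  have hπ : 1 ≤ 2 * Real.pi := by linarith [Real.pi_gt_three]
  set d : ℝ := κ ^ 2 / (2 * Real.pi) with hd
  have hd0 : 0 < d := by positivity
  have hd1 : d ≤ 1 := by
    rw [hd, div_le_one (by positivity)]
    exact (pow_le_one₀ hκ0.le hκ1).trans hπ
  set C : ℝ := 1 + 8 ^ 4 / (d ^ 4 * s ^ 3) with hC
  have hC1 : 1 ≤ C := by rw [hC]; have : 0 ≤ 8 ^ 4 / (d ^ 4 * s ^ 3) := by positivity
                         linarith
  have hC0 : 0 < C := by linarith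
  have hCC : C ≤ C ^ 2 := le_self_pow₀ hC1 (by norm_num)
  have hCs : 1 ≤ C ^ 2 * s := by
    have h1 : 1 / s ≤ 8 ^ 4 / (d ^ 4 * s ^ 3) := by
      rw [div_le_div_iff₀ hs0 (by positivity)]
      have h2 : d ^ 4 ≤ 1 := pow_le_one₀ hd0.le hd1
      have h3 : s ^ 3 ≤ s := pow_le_of_le_one hs0.le hs1 (by norm_num)
      have := mul_le_mul h2 h3 (by positivity) zero_le_one
      linarith
    have h2 : 1 / s ≤ C ^ 2 := by linarith
    rwa [div_le_iff₀ hs0] at h2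
  refine ⟨C, hC1, fun n => ?_⟩
  induction n using Nat.strong_induction_on with
  | _ n ih =>
  intro μ f hn h hf hμ x
  by_contra hcon
  obtain ⟨b, lam, a, hb, hlam, hprod, hmass⟩ :=
    h.exists_ellipsoid hf hμ hn hC0 (not_le.1 hcon).le
  set L : Fin n → ℝ := fun i => C ^ 2 * lam i with hL
  have hL0 : ∀ i, 0 < L i := fun i => by have := hlam i; positivity
  have hLprod : ∏ i, L i ≤ (8 * C) ^ n := by
    simp only [hL, Finset.prod_mul_distrib, Finset.prod_const, Finset.card_univ, Fintype.card_fin]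
    refine (mul_le_mul_of_nonneg_left hprod (by positivity)).trans_eq ?_
    rw [← mul_pow]; congr 1; field_simp
  set S : Finset (Fin n) := Finset.univ.filter fun i => L i < 1 with hS
  have hSm : ∀ i, i ∈ S ↔ L i < 1 := fun i => by simp [hS]
  have hSn : S.card < n := by
    by_contra hfull
    have hSu : S = Finset.univ := by
      rw [← Finset.card_eq_iff_eq_univ, Fintype.card_fin]
      have := Finset.card_le_univ S
      rw [Fintype.card_fin] at this
      omega
    have := hshort hn h hb hlam hmass S fun i hi => by
      have h1 : C ^ 2 * lam i < C ^ 2 * s := ((hSm i).1 hi).trans_le hCs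
      exact (lt_of_mul_lt_mul_left h1 (by positivity)).le
    omega
  have hSd : d ^ n ≤ ∏ i ∈ S, L i := by
    rcases Nat.eq_zero_or_pos S.card with h0 | h0
    · rw [Finset.card_eq_zero.1 h0, Finset.prod_empty]
      exact pow_le_one₀ hd0.le hd1
    · have h1 := h.le_prod_axes hn hb hlam hmass hC0.le S
        fun ν g hν hg hνg => ih S.card hSn ν g h0 hν hg hνg
      have h2 := pow_le_pow_left₀ (by positivity) h1 2
      rw [← Finset.prod_pow] at h2
      have e : ∀ i, (C * √(2 * Real.pi * lam i)) ^ 2 = 2 * Real.pi * L i := fun i => by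
        have := hlam i
        rw [mul_pow, Real.sq_sqrt (by positivity)]; simp only [hL]; ring
      simp only [e] at h2
      rw [Finset.prod_mul_distrib, Finset.prod_const] at h2
      have h3 : (2 * Real.pi) ^ S.card ≤ (2 * Real.pi) ^ n := pow_le_pow_right₀ hπ hSn.le
      have h4 : 0 ≤ ∏ i ∈ S, L i := Finset.prod_nonneg fun i _ => (hL0 i).le
      have h5 := h2.trans (mul_le_mul_of_nonneg_right h3 h4)
      rw [hd, div_pow, div_le_iff₀ (by positivity), ← pow_mul, mul_comm 2 n, pow_mul]
      linarith
  have hSc : ∏ i ∈ Sᶜ, L i ≤ (8 * C / d) ^ n := by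
    rw [div_pow, le_div_iff₀ (by positivity)]
    have h1 := Finset.prod_mul_prod_compl S L
    have h4 : 0 ≤ ∏ i ∈ Sᶜ, L i := Finset.prod_nonneg fun i _ => (hL0 i).le
    have := mul_le_mul_of_nonneg_left hSd h4
    linarith
  set B : Finset (Fin n) := Finset.univ.filter fun i => s < lam i with hB
  have hBm : ∀ i, i ∈ B ↔ s < lam i := fun i => by simp [hB]
  have hBS : B ⊆ Sᶜ := fun i hi => by
    rw [Finset.mem_compl, hSm, not_lt]
    refine hCs.trans ?_
    exact mul_le_mul_of_nonneg_left ((hBm i).1 hi).le (by positivity)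
  have hBc : 3 * n ≤ 4 * B.card := by
    have h1 := hshort hn h hb hlam hmass Bᶜ fun i hi => by
      rw [Finset.mem_compl, hBm, not_lt] at hi; exact hi
    have h2 := Finset.card_add_card_compl B
    rw [Fintype.card_fin] at h2
    omega
  have h1 : (C ^ 2 * s) ^ B.card ≤ ∏ i ∈ Sᶜ, L i := by
    rw [← Finset.prod_const]
    calc ∏ _i ∈ B, C ^ 2 * s ≤ ∏ i ∈ B, L i :=
          Finset.prod_le_prod (fun i _ => by positivity) fun i hi =>
            mul_le_mul_of_nonneg_left ((hBm i).1 hi).le (by positivity)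
      _ ≤ ∏ i ∈ Sᶜ, L i :=
by
          rw [← Finset.prod_sdiff hBS]
          refine le_mul_of_one_le_left (Finset.prod_nonneg fun i _ => (hL0 i).le) ?_
          have h0 : ∏ _i ∈ Sᶜ \ B, (1 : ℝ) ≤ ∏ i ∈ Sᶜ \ B, L i := by
            refine Finset.prod_le_prod (fun _ _ => zero_le_one) fun i hi => ?_
            have hi' := (Finset.mem_sdiff.1 hi).1
            rwa [Finset.mem_compl, hSm, not_lt] at hi'
          rwa [Finset.prod_const_one] at h0
  have h2 : ((C ^ 2 * s) ^ 3) ^ n ≤ ((8 * C / d) ^ 4) ^ n := by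
    calc ((C ^ 2 * s) ^ 3) ^ n = (C ^ 2 * s) ^ (3 * n) := by rw [pow_mul]
      _ ≤ (C ^ 2 * s) ^ (4 * B.card) := pow_le_pow_right₀ hCs hBc
      _ = ((C ^ 2 * s) ^ B.card) ^ 4 := by rw [mul_comm 4, pow_mul]
      _ ≤ ((8 * C / d) ^ n) ^ 4 := pow_le_pow_left₀ (by positivity) (h1.trans hSc) 4
      _ = _ := by rw [← pow_mul, ← pow_mul, mul_comm n]
  have h3 := (pow_le_pow_iff_left₀ (by positivity) (by positivity) (by omega)).1 h2
  rw [div_pow, le_div_iff₀ (by positivity)] at h3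
  have h4 : C ^ 2 * (d ^ 4 * s ^ 3) ≤ 8 ^ 4 := by
    refine le_of_mul_le_mul_left ?_ (show 0 < C ^ 4 by positivity)
    nlinarith [h3]
  have h5 : C * (d ^ 4 * s ^ 3) = d ^ 4 * s ^ 3 + 8 ^ 4 := by
    rw [hC]; field_simp
  have h6 : C * (d ^ 4 * s ^ 3) ≤ C ^ 2 * (d ^ 4 * s ^ 3) :=
    mul_le_mul_of_nonneg_right hCC (by positivity)
  have h7 : 0 < d ^ 4 * s ^ 3 := by positivity
  linarith

theorem isoLC_of_coord {n : ℕ} {μ : Measure (E n)} [IsProbabilityMeasure μ] {f : E n → ℝ}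
    (hf0 : ∀ x, 0 ≤ f x)
    (hf : ∀ x y : E n, ∀ t : ℝ, 0 ≤ t → t ≤ 1 → f x ^ t * f y ^ (1 - t) ≤ f (t • x + (1 - t) • y))
    (hμ : μ = volume.withDensity fun x => ENNReal.ofReal (f x))
    (hmean : ∀ i, ∫ x, x i ∂μ = 0)
    (hcov : ∀ i j, ∫ x, x i * x j ∂μ = if i = j then 1 else 0) :
    IsoLC μ ∧ LC fun x => ENNReal.ofReal (f x) := by
  have hLC : LC fun x => ENNReal.ofReal (f x) := by
    intro x y a b ha hb hab
    have e : b = 1 - a := by linarith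
    rw [ENNReal.ofReal_rpow_of_nonneg (hf0 x) ha.le, ENNReal.ofReal_rpow_of_nonneg (hf0 y) hb.le,
      ← ENNReal.ofReal_mul (Real.rpow_nonneg (hf0 x) _), e]
    exact ENNReal.ofReal_le_ofReal (hf x y a ha.le (by linarith))
  have hsq : ∀ i, Integrable (fun x : E n => x i ^ 2) μ := fun i => by
    by_contra hni
    have h1 := hcov i i
    simp only [← pow_two, if_true] at h1
    rw [integral_undef hni] at h1
    norm_num at h1
  have hL2 : ∀ i, MemLp (fun x : E n => x i) 2 μ := fun i =>
    (memLp_two_iff_integrable_sq (by fun_prop)).2 (hsq i)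
  have hInt : ∀ i, Integrable (fun x : E n => x i) μ := fun i => (hL2 i).integrable (by norm_num)
  have hmul : ∀ i j, Integrable (fun x : E n => x i * x j) μ := fun i j =>
    (hL2 i).integrable_mul (hL2 j)
  refine ⟨⟨inferInstance, ⟨_, hLC, hμ⟩, fun v => ?_, fun v => ?_⟩, hLC⟩
  · simp only [inner_eq_sum]
    rw [integral_finsetSum _ fun i _ => (hInt i).const_mul _]
    simp only [integral_const_mul, hmean, mul_zero, Finset.sum_const_zero]
  · have e : ∀ x : E n, inner ℝ v x ^ 2 = ∑ i, ∑ j, v i * v j * (x i * x j) := fun x => by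
      rw [inner_eq_sum, sq, Finset.sum_mul_sum]
      exact Finset.sum_congr rfl fun i _ => Finset.sum_congr rfl fun j _ => by ring
    simp only [e]
    rw [integral_finsetSum _ fun i _ => integrable_finsetSum _ fun j _ => (hmul i j).const_mul _]
    rw [norm_sq_eq_sum]
    refine Finset.sum_congr rfl fun i _ => ?_
    rw [integral_finsetSum _ fun j _ => (hmul i j).const_mul _]
    simp only [integral_const_mul, hcov, mul_ite, mul_one, mul_zero, Finset.sum_ite_eq,
      Finset.mem_univ, if_true]
    ring

/-- Small ball bound from the density bound. -/
theorem measure_ball_le {n : ℕ} {μ : Measure (E n)} {f : E n → ℝ≥0∞}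
    (hμ : μ = volume.withDensity f) {C : ℝ} (hC : 0 ≤ C)
    (hf : ∀ x, f x ≤ ENNReal.ofReal (C ^ n)) {ε : ℝ} (hε : 0 < ε) (y : E n) :
    μ {x | ‖x - y‖ ^ 2 ≤ ε ^ 2 * n} ≤
      ENNReal.ofReal ((C * (Real.exp 1 * √(2 * Real.pi)) * ε) ^ n) := by
  have hm : MeasurableSet {x : E n | ‖x - y‖ ^ 2 ≤ ε ^ 2 * n} :=
    measurableSet_le (by fun_prop) measurable_const
  have hsub : {x : E n | ‖x - y‖ ^ 2 ≤ ε ^ 2 * n} ⊆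
      {z : E n | ∑ i, (z i - y i) ^ 2 / ε ^ 2 ≤ 2 * n} := by
    intro x hx
    have hx' : ‖x - y‖ ^ 2 ≤ ε ^ 2 * n := hx
    show ∑ i, (x i - y i) ^ 2 / ε ^ 2 ≤ 2 * n
    rw [← Finset.sum_div, div_le_iff₀ (by positivity)]
    have e : ‖x - y‖ ^ 2 = ∑ i, (x i - y i) ^ 2 := norm_sq_eq_sum (x - y)
    rw [← e]
    nlinarith [show (0 : ℝ) ≤ ε ^ 2 * n by positivity]
  have hvol := (measure_mono hsub).trans
    (volume_ellipsoid_le (fun _ => show 0 < ε ^ 2 by positivity) (fun i => y i) (n : ℝ))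
  rw [hμ, withDensity_apply _ hm]
  refine (setLIntegral_mono' hm fun z _ => hf z).trans ?_
  rw [setLIntegral_const]
  refine (mul_le_mul_right hvol _).trans_eq ?_
  rw [← ENNReal.ofReal_mul (by positivity)]
  congr 1
  rw [Finset.prod_const, Finset.card_univ, Fintype.card_fin, Real.sqrt_mul (by positivity),
    Real.sqrt_sq hε.le, ← mul_one (n : ℝ), Real.exp_nat_mul, ← mul_pow, ← mul_pow]
  ring_nf

end SmallBall

/-- There exists a universal constant `C'' > 0` such that for every `n ≥ 1`, every
isotropic log-concave random vector `X` in `ℝⁿ` (identified with its law `μ`),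
every `ε > 0` and every `y ∈ ℝⁿ`, one has
`ℙ(‖X - y‖₂² ≤ ε² n) ≤ (C'' ε)ⁿ`. -/
theorem small_ball_isotropic_logconcave_linear :
    ∃ C'' : ℝ, 0 < C'' ∧
      ∀ n : ℕ, 1 ≤ n →
      ∀ μ : Measure (EuclideanSpace ℝ (Fin n)), IsProbabilityMeasure μ →
        IsLogConcaveMeasure μ → IsIsotropicMeasure μ →
        ∀ ε : ℝ, 0 < ε →
        ∀ y : EuclideanSpace ℝ (Fin n),
          μ {x | ‖x - y‖ ^ 2 ≤ ε ^ 2 * n} ≤ ENNReal.ofReal ((C'' * ε) ^ n) := by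
  obtain ⟨C, hC1, hC⟩ := SmallBall.exists_density_bound
  have hC0 : 0 < C := by linarith
  refine ⟨C * (Real.exp 1 * √(2 * Real.pi)), by positivity, ?_⟩
  intro n hn μ hp hlc hiso ε hε y
  obtain ⟨f, ⟨hf0, hf⟩, hμ⟩ := hlc
  obtain ⟨h, hLC⟩ := SmallBall.isoLC_of_coord hf0 hf hμ hiso.1 hiso.2
  exact SmallBall.measure_ball_le hμ hC0.le (hC n μ _ hn h hLC hμ) hε y

end
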